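/- Let d ∈ {3, 11, 19, 43, 67}, let O_K be the ring of integers of K = Q(√−d), and let N = 16·O_K = (2O_K)⁴. Let Γ₀(N) be the subgroup of GL₂(O_K) consisting of those matrices whose lower-left entry lies in N. Then for every prime l ≥ 5, the abelianization Γ₀(N)^{ab} has no element of order l. -/

import Mathlib

open NumberField Matrix

/-- The congruence subgroup `Γ₀(N)` of `GL₂(R)`: invertible matrices whose lower-left entry
lies in the ideal `N`. -/
def Gamma0 {R : Type*} [CommRing R] (N : Ideal R) : Subgroup (GL (Fin 2) R) where
  carrier := {A | (A : Matrix (Fin 2) (Fin 2) R) 1 0 ∈ N}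
  one_mem' := by
    simp [Matrix.one_apply]
  mul_mem' := by
    intro A B ha hb
    simp only [Set.mem_setOf_eq, Units.val_mul, Matrix.mul_apply, Fin.sum_univ_two] at *
    exact N.add_mem (Ideal.mul_mem_right _ N ha) (Ideal.mul_mem_left N _ hb)
  inv_mem' := by
    intro A ha
    simp only [Set.mem_setOf_eq] at *
    rw [Matrix.coe_units_inv, Matrix.inv_def, Matrix.smul_apply, Matrix.adjugate_fin_two,
      smul_eq_mul]
    exact Ideal.mul_mem_left N _ (by simpa using N.neg_mem ha)

set_option linter.unusedSimpArgs false

namespace Bianchi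

/-- The ring `ℤ[1/6]`, as a subring of `ℚ`. -/
def Z6 : Subring ℚ where
  carrier := {q | ∃ n : ℕ, ∃ z : ℤ, 6 ^ n * q = z}
  mul_mem' := by
    rintro a b ⟨n, z, h⟩ ⟨n', z', h'⟩
    exact ⟨n + n', z * z', by push_cast; rw [← h, ← h']; ring⟩
  one_mem' := ⟨0, 1, by simp⟩
  add_mem' := by
    rintro a b ⟨n, z, h⟩ ⟨n', z', h'⟩
    exact ⟨n + n', 6 ^ n' * z + 6 ^ n * z', by push_cast; rw [← h, ← h']; ring⟩
  zero_mem' := ⟨0, 0, by simp⟩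
  neg_mem' := by
    rintro a ⟨n, z, h⟩
    exact ⟨n, -z, by push_cast; rw [← h]; ring⟩

/-- The `ℤ[1/6]`-submodule `ℤ[1/6]` of `ℚ`. -/
abbrev Z6sub : Submodule Z6 ℚ := LinearMap.range (Algebra.linearMap Z6 ℚ)

/-- The quotient `ℚ / ℤ[1/6]`. -/
abbrev Qmod : Type := ℚ ⧸ Z6sub

/-- The projection `ℚ → ℚ / ℤ[1/6]`. -/
abbrev toQmod : ℚ →ₗ[Z6] Qmod := Z6sub.mkQ

lemma toQmod_eq_zero {q : ℚ} : toQmod q = 0 ↔ q ∈ Z6 := by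
  rw [Submodule.mkQ_apply, Submodule.Quotient.mk_eq_zero]
  constructor
  · rintro ⟨x, rfl⟩; exact x.2
  · intro h; exact ⟨⟨q, h⟩, rfl⟩

/-- The inverse of `6` in `ℤ[1/6]`. -/
def inv6 : Z6 := ⟨1 / 6, 1, 1, by norm_num⟩

lemma six_mul_inv6 : (6 : Z6) * inv6 = 1 := by
  apply Subtype.ext
  show (6 : ℚ) * (1 / 6) = 1
  norm_num

section Module
variable {M : Type*} [AddCommGroup M] [Module Z6 M]

lemma eq_zero_of_dvd_six_pow {n : ℤ} {k : ℕ} (hn : n ∣ 6 ^ k) {x : M} (h : n • x = 0) : x = 0 := by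
  obtain ⟨w, hw⟩ := hn
  have h1 : (6 ^ k : ℤ) • x = 0 := by rw [hw, mul_comm, mul_smul, h, smul_zero]
  have h2 : (inv6 ^ k) • ((6 ^ k : ℤ) • x) = x := by
    rw [← Int.cast_smul_eq_zsmul Z6, smul_smul]
    push_cast
    rw [← mul_pow, mul_comm inv6, six_mul_inv6, one_pow, one_smul]
  rw [← h2, h1, smul_zero]

lemma exists_zsmul_eq {n : ℤ} {k : ℕ} (hn : n ∣ 6 ^ k) : ∃ r : Z6, ∀ (x : M), n • (r • x) = x := by
  obtain ⟨w, hw⟩ := hn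
  refine ⟨w * inv6 ^ k, fun x => ?_⟩
  rw [← Int.cast_smul_eq_zsmul Z6, smul_smul]
  have : ((n : Z6) * (w * inv6 ^ k)) = 1 := by
    rw [← mul_assoc, ← Int.cast_mul, ← hw]
    push_cast
    rw [← mul_pow, six_mul_inv6, one_pow]
  rw [this, one_smul]

lemma exists_scalar {n : ℤ} {k : ℕ} (hn : n ∣ 6 ^ k) : ∃ r : Z6, (n : Z6) * r = 1 := by
  obtain ⟨w, hw⟩ := hn
  refine ⟨w * inv6 ^ k, ?_⟩
  rw [← mul_assoc, ← Int.cast_mul, ← hw]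
  push_cast
  rw [← mul_pow, six_mul_inv6, one_pow]

end Module

section Crossed
variable {G' : Type*} [Group G'] {G : Type*} [Group G]

/-- `c` restricts to a crossed homomorphism on `Γ`, for the action through the sign `ρ`. -/
def IsCrossed {M : Type*} [AddCommGroup M] (Γ : Subgroup G) (ρ : G → ℤˣ) (c : G → M) : Prop :=
  ∀ g ∈ Γ, ∀ h ∈ Γ, c (g * h) = c g + ρ g • c h

/-- `ρ` restricts to a homomorphism on `Γ`. -/
def IsCharOn (Γ : Subgroup G) (ρ : G → ℤˣ) : Prop :=
  ∀ g ∈ Γ, ∀ h ∈ Γ, ρ (g * h) = ρ g * ρ h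

/-- Every crossed homomorphism `Γ → ℚ / ℤ[1/6]` lifts to a crossed homomorphism `Γ → ℚ`. -/
def HasLift (Γ : Subgroup G) (ρ : G → ℤˣ) : Prop :=
  ∀ c : G → Qmod, IsCrossed Γ ρ c →
    ∃ c' : G → ℚ, IsCrossed Γ ρ c' ∧ ∀ g ∈ Γ, toQmod (c' g) = c g

lemma toQmod_units_smul (u : ℤˣ) (x : ℚ) : toQmod (u • x) = u • toQmod x := by
  rcases Int.units_eq_one_or u with rfl | rfl <;> simp

lemma IsCrossed.map_one {M : Type*} [AddCommGroup M] {Γ : Subgroup G} {ρ : G → ℤˣ} {c : G → M}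
    (h : IsCrossed Γ ρ c) (hρ : IsCharOn Γ ρ) : c 1 = 0 := by
  have h1 := h 1 Γ.one_mem 1 Γ.one_mem
  have h2 : ρ 1 = 1 := by
    have := hρ 1 Γ.one_mem 1 Γ.one_mem
    rw [mul_one] at this
    exact (mul_eq_left.mp this.symm)
  rw [mul_one, h2, one_smul] at h1
  exact left_eq_add.mp h1

lemma IsCharOn.map_one {Γ : Subgroup G} {ρ : G → ℤˣ} (hρ : IsCharOn Γ ρ) : ρ 1 = 1 := by
  have := hρ 1 Γ.one_mem 1 Γ.one_mem
  rw [mul_one] at this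
  exact (mul_eq_left.mp this.symm)

lemma IsCharOn.map_inv {Γ : Subgroup G} {ρ : G → ℤˣ} (hρ : IsCharOn Γ ρ) {g : G} (hg : g ∈ Γ) :
    ρ g⁻¹ = ρ g := by
  have := hρ g hg _ (Γ.inv_mem hg)
  rw [mul_inv_cancel, hρ.map_one] at this
  rw [← Int.units_inv_eq_self (ρ g)]
  exact eq_inv_of_mul_eq_one_right this.symm

lemma HasLift.transport {Γ : Subgroup G} {Γ' : Subgroup G'} {ρ : G → ℤˣ} {ρ' : G' → ℤˣ}
    (i : G → G') (j : G' → G) (hi : ∀ g ∈ Γ, i g ∈ Γ') (hj : ∀ g ∈ Γ', j g ∈ Γ)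
    (hji : ∀ g ∈ Γ, j (i g) = g) (hij : ∀ g ∈ Γ', i (j g) = g)
    (hmul : ∀ g ∈ Γ, ∀ h ∈ Γ, i (g * h) = i g * i h) (hρ : ∀ g ∈ Γ, ρ' (i g) = ρ g)
    (H : HasLift Γ' ρ') : HasLift Γ ρ := by
  intro c hc
  obtain ⟨c', h1, h2⟩ := H (fun g => c (j g)) (by
    intro g hg h hh
    have e : j (g * h) = j g * j h := by
      conv_lhs => rw [← hij g hg, ← hij h hh, ← hmul _ (hj g hg) _ (hj h hh)]
      exact hji _ (Γ.mul_mem (hj g hg) (hj h hh))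
    simp only [e]
    rw [hc _ (hj g hg) _ (hj h hh), ← hρ _ (hj g hg), hij g hg])
  refine ⟨fun g => c' (i g), ?_, ?_⟩
  · intro g hg h hh
    simp only
    rw [hmul g hg h hh, h1 _ (hi g hg) _ (hi h hh), hρ g hg]
  · intro g hg
    rw [h2 _ (hi g hg), hji g hg]

lemma HasLift.congr {Γ : Subgroup G} {ρ ρ' : G → ℤˣ} (h : ∀ g ∈ Γ, ρ g = ρ' g)
    (H : HasLift Γ ρ') : HasLift Γ ρ :=
  H.transport id id (fun _ h => h) (fun _ h => h) (fun _ _ => rfl) (fun _ _ => rfl)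
    (fun _ _ _ _ => rfl) (fun g hg => (h g hg).symm)

lemma HasLift.of_ker {Γ N : Subgroup G} {ρ χ : G → ℤˣ} (hρ : IsCharOn Γ ρ) (hχ : IsCharOn Γ χ)
    (hN : ∀ g, g ∈ N ↔ g ∈ Γ ∧ χ g = 1) (H₁ : HasLift Γ ρ)
    (H₂ : HasLift Γ (fun g => ρ g * χ g)) : HasLift N ρ := by
  classical
  by_cases ht : ∃ t ∈ Γ, χ t ≠ 1
  swap
  · push Not at ht
    have : N = Γ := by
      ext g; rw [hN]; exact ⟨fun h => h.1, fun h => ⟨h, ht g h⟩⟩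
    rw [this]; exact H₁
  obtain ⟨t, htΓ, htχ⟩ := ht
  have htχ' : χ t = -1 := (Int.units_eq_one_or _).resolve_left htχ
  intro c hc
  have hNΓ : ∀ {g}, g ∈ N → g ∈ Γ := fun h => ((hN _).1 h).1
  have hχinv : ∀ g ∈ Γ, χ g⁻¹ = χ g := fun g hg => hχ.map_inv hg
  have hc1 : c 1 = 0 := hc.map_one (fun g hg h hh => hρ g (hNΓ hg) h (hNΓ hh))
  let F : G → Qmod := fun g => if χ g = 1 then c g else c (g * t⁻¹)
  have htinv : ∀ g ∈ Γ, χ g = -1 → g * t⁻¹ ∈ N := by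
    intro g hg h
    rw [hN]
    refine ⟨Γ.mul_mem hg (Γ.inv_mem htΓ), ?_⟩
    rw [hχ g hg _ (Γ.inv_mem htΓ), hχinv t htΓ, h, htχ']; rfl
  have hF : ∀ n ∈ N, ∀ g ∈ Γ, F (n * g) = c n + ρ n • F g := by
    intro n hn g hg
    have hχn : χ (n * g) = χ g := by rw [hχ n (hNΓ hn) g hg, ((hN n).1 hn).2, one_mul]
    simp only [F, hχn]
    rcases Int.units_eq_one_or (χ g) with h | h
    · rw [if_pos h, if_pos h, hc n hn g ((hN g).2 ⟨hg, h⟩)]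
    · have h' : χ g ≠ 1 := by rw [h]; decide
      rw [if_neg h', if_neg h', mul_assoc, hc n hn _ (htinv g hg h)]
  let δ : G → G → Qmod := fun h g => ρ g • (F (g * h) - F g)
  have hδN : ∀ h ∈ Γ, ∀ n ∈ N, ∀ g ∈ Γ, δ h (n * g) = δ h g := by
    intro h hh n hn g hg
    simp only [δ]
    rw [mul_assoc, hF n hn _ (Γ.mul_mem hg hh), hF n hn g hg, hρ n (hNΓ hn) g hg,
      add_sub_add_left_eq_sub, ← smul_sub, smul_smul, mul_right_comm, Int.units_mul_self, one_mul]
  have hδ1 : ∀ h ∈ Γ, ∀ g ∈ Γ, χ g = 1 → δ h g = δ h 1 := by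
    intro h hh g hg hg1
    have := hδN h hh g ((hN g).2 ⟨hg, hg1⟩) 1 Γ.one_mem
    rwa [mul_one] at this
  have hδt : ∀ h ∈ Γ, ∀ g ∈ Γ, χ g = -1 → δ h g = δ h t := by
    intro h hh g hg hg1
    have := hδN h hh _ (htinv g hg hg1) t htΓ
    rwa [inv_mul_cancel_right] at this
  have hδmul : ∀ h ∈ Γ, ∀ k ∈ Γ, ∀ g ∈ Γ, δ (h * k) g = δ h g + ρ h • δ k (g * h) := by
    intro h hh k hk g hg
    simp only [δ]
    rw [hρ g hg h hh, smul_smul, mul_left_comm, Int.units_mul_self, mul_one, ← smul_add, mul_assoc]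
    congr 1
    abel
  obtain ⟨D₁, hD₁, hD₁'⟩ := H₁ (fun h => δ h 1 + δ h t) (by
    intro h hh k hk
    simp only
    rw [hδmul h hh k hk 1 Γ.one_mem, hδmul h hh k hk t htΓ, one_mul]
    have key : δ k h + δ k (t * h) = δ k 1 + δ k t := by
      have e : χ (t * h) = - χ h := by rw [hχ t htΓ h hh, htχ']; simp
      rcases Int.units_eq_one_or (χ h) with h1 | h1
      · rw [hδ1 k hk h hh h1, hδt k hk _ (Γ.mul_mem htΓ hh) (by rw [e, h1])]
      · rw [hδt k hk h hh h1, hδ1 k hk _ (Γ.mul_mem htΓ hh) (by rw [e, h1]; rfl), add_comm]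
    rw [← key, smul_add]; abel)
  obtain ⟨D₂, hD₂, hD₂'⟩ := H₂ (fun h => δ h 1 - δ h t) (by
    intro h hh k hk
    simp only
    rw [hδmul h hh k hk 1 Γ.one_mem, hδmul h hh k hk t htΓ, one_mul]
    have key : δ k h - δ k (t * h) = χ h • (δ k 1 - δ k t) := by
      have e : χ (t * h) = - χ h := by rw [hχ t htΓ h hh, htχ']; simp
      rcases Int.units_eq_one_or (χ h) with h1 | h1
      · rw [hδ1 k hk h hh h1, hδt k hk _ (Γ.mul_mem htΓ hh) (by rw [e, h1]), h1, one_smul]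
      · rw [hδt k hk h hh h1, hδ1 k hk _ (Γ.mul_mem htΓ hh) (by rw [e, h1]; rfl), h1]
        simp
    rw [mul_smul, ← key, smul_sub]; abel)
  obtain ⟨r, hr⟩ := exists_scalar (n := 2) (k := 1) (by norm_num)
  refine ⟨fun g => r • (D₁ g + D₂ g), ?_, ?_⟩
  · intro g hg h hh
    simp only
    rw [hD₁ g (hNΓ hg) h (hNΓ hh), hD₂ g (hNΓ hg) h (hNΓ hh)]
    simp only
    rw [((hN g).1 hg).2, mul_one, smul_comm (ρ g), ← smul_add, smul_add (ρ g)]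
    congr 1
    abel
  · intro g hg
    rw [map_smul, map_add, hD₁' g (hNΓ hg), hD₂' g (hNΓ hg)]
    have e : δ g 1 = c g := by
      simp only [δ, F]
      rw [one_mul, hρ.map_one, one_smul, hχ.map_one, if_pos rfl, if_pos ((hN g).1 hg).2, hc1, sub_zero]
    rw [e]
    have : c g + δ g t + (c g - δ g t) = (2 : Z6) • c g := by rw [two_smul]; abel
    rw [this, smul_smul, mul_comm]
    have hr' : (2 : Z6) * r = 1 := by exact_mod_cast hr
    rw [hr', one_smul]

end Crossed

lemma eq_one_of_pow_prime_of_hasLift {G : Type*} [Group G] {N : Subgroup G}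
    (H : HasLift N (fun _ => 1)) {l : ℕ} (hl : l.Prime) (hl5 : 5 ≤ l) (x : Abelianization N)
    (hx : x ^ l = 1) : x = 1 := by
  classical
  by_contra hx1
  obtain ⟨χ, hχ⟩ := CharacterModule.exists_character_apply_ne_zero_of_ne_zero
    (A := Additive (Abelianization N)) (a := Additive.ofMul x) (by simpa using hx1)
  have hZ : AddSubgroup.zmultiples (1 : ℚ) ≤ Z6sub.toAddSubgroup.comap (AddMonoidHom.id ℚ) := by
    rw [AddSubgroup.zmultiples_le]
    exact ⟨1, by simp⟩
  let q : AddCircle (1 : ℚ) →+ Qmod :=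
    QuotientAddGroup.map _ Z6sub.toAddSubgroup (AddMonoidHom.id ℚ) hZ
  have hq : ∀ y : AddCircle (1 : ℚ), l • y = 0 → q y = 0 → y = 0 := by
    intro y
    induction y using QuotientAddGroup.induction_on with
    | H y =>
      intro h1 h2
      have h2' : y ∈ Z6 := toQmod_eq_zero.1 h2
      rw [← QuotientAddGroup.mk_nsmul, QuotientAddGroup.eq_zero_iff,
        AddSubgroup.mem_zmultiples_iff] at h1
      rw [QuotientAddGroup.eq_zero_iff, AddSubgroup.mem_zmultiples_iff]
      obtain ⟨w, hw⟩ := h1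
      obtain ⟨n, z, hz⟩ := h2'
      have hcop : IsCoprime (l : ℤ) ((6 : ℤ) ^ n) := by
        apply IsCoprime.pow_right
        rw [Int.isCoprime_iff_gcd_eq_one]
        show Nat.gcd l 6 = 1
        rw [← Nat.coprime_iff_gcd_eq_one, hl.coprime_iff_not_dvd]
        intro h
        have := Nat.le_of_dvd (by norm_num) h
        interval_cases l <;> revert hl h <;> decide
      obtain ⟨a, b, hab⟩ := hcop
      refine ⟨a * w + b * z, ?_⟩
      have hab' : (a : ℚ) * l + b * 6 ^ n = 1 := by exact_mod_cast hab
      rw [zsmul_eq_mul, nsmul_eq_mul] at *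
      push_cast
      rw [← hz]
      simp only [mul_one] at *
      rw [hw]
      linear_combination y * hab'
  let c₀ : N → Qmod := fun g => q (χ (Additive.ofMul (Abelianization.of g)))
  have hc₀ : ∀ g h, c₀ (g * h) = c₀ g + c₀ h := by
    intro g h
    simp only [c₀, map_mul, ofMul_mul, map_add]
  obtain ⟨c', h1, h2⟩ := H (fun g => if h : g ∈ N then c₀ ⟨g, h⟩ else 0) (by
    intro g hg h hh
    simp only [dif_pos hg, dif_pos hh, dif_pos (N.mul_mem hg hh), one_smul]
    exact hc₀ ⟨g, hg⟩ ⟨h, hh⟩)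
  let f : N →* Multiplicative ℚ :=
    { toFun := fun g => Multiplicative.ofAdd (c' g)
      map_one' := by
        have := h1.map_one (fun _ _ _ _ => by simp)
        simp [this]
      map_mul' := by
        intro g h
        have := h1 g g.2 h h.2
        simp only [one_smul] at this
        simp [this] }
  have hf : ∀ y : Abelianization N, toQmod (Multiplicative.toAdd (Abelianization.lift f y)) =
      q (χ (Additive.ofMul y)) := by
    intro y
    induction y using QuotientGroup.induction_on with
    | H y =>
      have : Abelianization.lift f (Abelianization.of y) = f y := Abelianization.lift_apply_of f y
      change toQmod (Multiplicative.toAdd (Abelianization.lift f (Abelianization.of y))) = _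
      rw [this]
      change toQmod (c' y) = _
      rw [h2 y y.2, dif_pos y.2]
      rfl
  have h0 : Multiplicative.toAdd (Abelianization.lift f x) = 0 := by
    have : (Abelianization.lift f x) ^ l = 1 := by rw [← map_pow, hx, map_one]
    have h' := congrArg Multiplicative.toAdd this
    rw [toAdd_pow, toAdd_one, smul_eq_zero] at h'
    exact h'.resolve_left hl.ne_zero
  have h3 := hf x
  rw [h0, map_zero] at h3
  refine hχ (hq _ ?_ h3.symm)
  rw [← map_nsmul, ← ofMul_pow, hx, ofMul_one, map_zero]

open Subgroup.leftTransversals in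
lemma transfer_comp_subtype {Γ A : Type*} [Group Γ] [CommGroup A] (N : Subgroup Γ)
    [N.FiniteIndex] (f : Γ →* A) (g : Γ) :
    MonoidHom.transfer (f.comp N.subtype) g = f g ^ N.index := by
  classical
  letI := N.fintypeQuotientOfFiniteIndex
  obtain ⟨T⟩ : Nonempty N.LeftTransversal := inferInstance
  rw [MonoidHom.transfer_def _ T, Subgroup.leftTransversals.diff]
  simp only [MonoidHom.coe_comp, Function.comp_apply, Subgroup.coe_subtype, map_mul, map_inv]
  have : ∀ q : Γ ⧸ N, (((g • T).2.leftQuotientEquiv q : Γ)) =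
      g * (T.2.leftQuotientEquiv (g⁻¹ • q) : Γ) := by
    intro q
    rw [Subgroup.smul_apply_eq_smul_apply_inv_smul]; rfl
  simp only [this, map_mul]
  rw [Finset.prod_mul_distrib, Finset.prod_mul_distrib, Finset.prod_const, Finset.card_univ,
    Subgroup.index_eq_card, Nat.card_eq_fintype_card, Finset.prod_inv_distrib]
  rw [Fintype.prod_equiv (MulAction.toPerm g⁻¹) (fun q => f (T.2.leftQuotientEquiv (g⁻¹ • q)))
    (fun q => f (T.2.leftQuotientEquiv q)) (fun _ => rfl)]
  rw [mul_comm, mul_assoc, mul_inv_cancel, mul_one]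

theorem no_order_prime {Γ G : Type*} [Group Γ] [Group G] {N : Subgroup G}
    (H : HasLift N (fun _ => 1)) (i : N →* Γ) (hi : Function.Injective i) {k : ℕ}
    (hidx : i.range.index ∣ 6 ^ k) {l : ℕ} (hl : l.Prime) (hl5 : 5 ≤ l) :
    ¬ ∃ x : Abelianization Γ, orderOf x = l := by
  rintro ⟨x, hx⟩
  haveI : i.range.FiniteIndex := ⟨by rintro h; rw [h] at hidx; simp at hidx⟩
  let e := i.ofInjective hi
  let V : Γ →* Abelianization N :=
    MonoidHom.transfer ((Abelianization.of (G := N)).comp (e.symm : i.range →* N))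
  let j : Abelianization N →* Abelianization Γ := Abelianization.map i
  have hV : ∀ g, j (V g) = (Abelianization.of g) ^ i.range.index := by
    intro g
    rw [← transfer_comp_subtype]
    have e1 : j.comp ((Abelianization.of (G := N)).comp (e.symm : i.range →* N)) =
        (Abelianization.of (G := Γ)).comp i.range.subtype := by
      ext ⟨y, n, rfl⟩
      have : e.symm ⟨i n, n, rfl⟩ = n := by rw [MulEquiv.symm_apply_eq]; rfl
      simp only [MonoidHom.comp_apply, MonoidHom.coe_coe, this, j, Abelianization.map_of,
        Subgroup.coe_subtype]
    rw [← e1]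
    simp only [V]
    rw [MonoidHom.transfer_def _ default, MonoidHom.transfer_def _ default,
      Subgroup.leftTransversals.diff, Subgroup.leftTransversals.diff, map_prod]
    rfl
  have hV' : j (Abelianization.lift V x) = x ^ i.range.index := by
    induction x using QuotientGroup.induction_on with
    | H y =>
      exact (congrArg j (Abelianization.lift_apply_of V y)).trans (hV y)
  have h1 : Abelianization.lift V x = 1 := by
    apply eq_one_of_pow_prime_of_hasLift H hl hl5
    rw [← map_pow, ← hx, pow_orderOf_eq_one, map_one]
  rw [h1, map_one] at hV'
  have h2 : l ∣ i.range.index := by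
    rw [← hx]; exact orderOf_dvd_of_pow_eq_one hV'.symm
  have h3 := hl.dvd_of_dvd_pow (h2.trans hidx)
  have := Nat.le_of_dvd (by norm_num) h3
  interval_cases l <;> revert hl h3 <;> decide

/-- The quadratic ring `ℤ[ω]` with `ω² = ω - m`. -/
abbrev O (m : ℤ) : Type := QuadraticAlgebra ℤ (-m) 1

/-- The group `SL₂(R)`, with named entries. -/
@[ext]
structure SL (R : Type*) [CommRing R] where
  /-- upper left entry -/
  a : R
  /-- upper right entry -/
  b : R
  /-- lower left entry -/
  c : R
  /-- lower right entry -/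
  d : R
  det : a * d - b * c = 1

namespace SL
variable {R : Type*} [CommRing R]

instance : Mul (SL R) where
  mul g h := ⟨g.a * h.a + g.b * h.c, g.a * h.b + g.b * h.d, g.c * h.a + g.d * h.c,
    g.c * h.b + g.d * h.d, by linear_combination h.det + (h.a * h.d - h.b * h.c) * g.det⟩

instance : One (SL R) where
  one := ⟨1, 0, 0, 1, by ring⟩

instance : Inv (SL R) where
  inv g := ⟨g.d, -g.b, -g.c, g.a, by linear_combination g.det⟩

variable (g h : SL R)
@[simp] lemma mul_a : (g * h).a = g.a * h.a + g.b * h.c := rfl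
@[simp] lemma mul_b : (g * h).b = g.a * h.b + g.b * h.d := rfl
@[simp] lemma mul_c : (g * h).c = g.c * h.a + g.d * h.c := rfl
@[simp] lemma mul_d : (g * h).d = g.c * h.b + g.d * h.d := rfl
@[simp] lemma one_a : (1 : SL R).a = 1 := rfl
@[simp] lemma one_b : (1 : SL R).b = 0 := rfl
@[simp] lemma one_c : (1 : SL R).c = 0 := rfl
@[simp] lemma one_d : (1 : SL R).d = 1 := rfl
@[simp] lemma inv_a : (g⁻¹).a = g.d := rfl
@[simp] lemma inv_b : (g⁻¹).b = -g.b := rfl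
@[simp] lemma inv_c : (g⁻¹).c = -g.c := rfl
@[simp] lemma inv_d : (g⁻¹).d = g.a := rfl

instance : Group (SL R) := Group.ofLeftAxioms
  (by intro g h k; ext <;> simp <;> ring)
  (by intro g; ext <;> simp)
  (by
    intro g
    ext <;> simp
    · linear_combination g.det
    · ring
    · ring
    · linear_combination g.det)

end SL

section parity
variable {m : ℤ}

lemma two_dvd_iff {x : O m} : 2 ∣ x ↔ 2 ∣ x.re ∧ 2 ∣ x.im := by
  constructor
  · rintro ⟨y, rfl⟩
    constructor
    · exact ⟨y.re, by simp [two_mul]⟩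
    · exact ⟨y.im, by simp [two_mul]⟩
  · rintro ⟨⟨y, hy⟩, ⟨z, hz⟩⟩
    exact ⟨⟨y, z⟩, by ext <;> simp [hy, hz, two_mul]⟩

/-- Coordinatewise division by an integer. -/
def divn (n : ℤ) (x : O m) : O m := ⟨x.re / n, x.im / n⟩

lemma divn_two_mul (x : O m) : divn 2 (2 * x) = x := by
  ext <;> simp [divn, two_mul] <;> lia

lemma divn_four_mul (x : O m) : divn 4 (4 * x) = x := by
  have : (4 : O m) * x = x + x + x + x := by ring
  ext <;> simp [divn, this] <;> lia

/-- The additive character `x ↦ (-1) ^ (p₀ x₀ + p₁ x₁)`. -/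
def chi (p : ℤ × ℤ) (x : O m) : ℤˣ := (p.1 * x.re + p.2 * x.im).negOnePow

lemma chi_add (p : ℤ × ℤ) (x y : O m) : chi p (x + y) = chi p x * chi p y := by
  simp only [chi, ← Int.negOnePow_add, QuadraticAlgebra.re_add, QuadraticAlgebra.im_add]
  congr 1; ring

lemma chi_two_mul (p : ℤ × ℤ) (x : O m) : chi p (2 * x) = 1 := by
  rw [two_mul, chi_add, Int.units_mul_self]

lemma chi_congr (p : ℤ × ℤ) {x y : O m} (h : 2 ∣ x - y) : chi p x = chi p y := by
  obtain ⟨z, hz⟩ := h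
  rw [show x = 2 * z + y by rw [← hz]; ring, chi_add, chi_two_mul, one_mul]

lemma chi_neg (p : ℤ × ℤ) (x : O m) : chi p (-x) = chi p x :=
  chi_congr p ⟨-x, by ring⟩

lemma chi_mask_add (p q : ℤ × ℤ) (x : O m) : chi (p + q) x = chi p x * chi q x := by
  simp only [chi, ← Int.negOnePow_add, Prod.fst_add, Prod.snd_add]
  congr 1; ring

lemma chi_zero_mask (x : O m) : chi (0, 0) x = 1 := by simp [chi]

lemma chi_eq_one_iff (x : O m) : (chi (1, 0) x = 1 ∧ chi (0, 1) x = 1) ↔ 2 ∣ x := by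
  simp only [chi, Int.negOnePow_eq_one_iff, two_dvd_iff, one_mul, zero_mul, add_zero, zero_add,
    even_iff_two_dvd]

lemma HasLift.of_even {G : Type*} [Group G] {Γ N : Subgroup G} {ρ : G → ℤˣ} (u : G → O m)
    (hρ : IsCharOn Γ ρ) (hu : ∀ g ∈ Γ, ∀ h ∈ Γ, 2 ∣ u (g * h) - (u g + u h))
    (hN : ∀ g, g ∈ N ↔ g ∈ Γ ∧ 2 ∣ u g)
    (H : ∀ p, HasLift Γ (fun g => ρ g * chi p (u g))) : HasLift N ρ := by
  have hχ : ∀ p, IsCharOn Γ (fun g => chi p (u g)) := by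
    intro p g hg h hh
    simp only
    rw [chi_congr p (hu g hg h hh), chi_add]
  let K : Subgroup G :=
    { carrier := {g | g ∈ Γ ∧ chi (1, 0) (u g) = 1}
      one_mem' := ⟨Γ.one_mem, (hχ (1, 0)).map_one⟩
      mul_mem' := fun {g h} hg hh => ⟨Γ.mul_mem hg.1 hh.1, by
        have := hχ (1, 0) g hg.1 h hh.1
        simp only at this
        rw [this, hg.2, hh.2, one_mul]⟩
      inv_mem' := fun {g} hg => ⟨Γ.inv_mem hg.1, by
        have := (hχ (1, 0)).map_inv hg.1
        rw [this, hg.2]⟩ }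
  have hKΓ : ∀ g ∈ K, g ∈ Γ := fun g hg => hg.1
  have mulchar : ∀ {ρ₁ ρ₂ : G → ℤˣ}, IsCharOn Γ ρ₁ → IsCharOn Γ ρ₂ →
      IsCharOn Γ (fun g => ρ₁ g * ρ₂ g) := by
    intro ρ₁ ρ₂ h1 h2 g hg h hh
    simp only
    rw [h1 g hg h hh, h2 g hg h hh, mul_mul_mul_comm]
  refine HasLift.of_ker (Γ := K) (χ := fun g => chi (0, 1) (u g))
    (fun g hg h hh => hρ g hg.1 h hh.1) (fun g hg h hh => hχ _ g hg.1 h hh.1) ?_ ?_ ?_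
  · intro g
    rw [hN, ← chi_eq_one_iff]
    exact and_assoc.symm
  · refine HasLift.of_ker (Γ := Γ) (χ := fun g => chi (1, 0) (u g)) hρ (hχ _) (fun g => Iff.rfl)
      ?_ (H _)
    exact (H (0, 0)).congr (fun g _ => by simp [chi_zero_mask])
  · refine HasLift.of_ker (Γ := Γ) (χ := fun g => chi (1, 0) (u g)) (mulchar hρ (hχ _)) (hχ _)
      (fun g => Iff.rfl) (H _) ?_
    refine (H ((0, 1) + (1, 0))).congr (fun g _ => ?_)
    rw [chi_mask_add, mul_assoc]

end parity

section groups
variable {m : ℤ}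

/-- Matrices in `SL₂(O)` with `a ≡ d ≡ 1 mod 2`, `c ≡ 0 mod n` and `b ≡ 0 mod k`. -/
def Cong (k n : O m) (hk : 2 ∣ k ∨ 2 ∣ n) : Subgroup (SL (O m)) where
  carrier := {g | 2 ∣ g.a - 1 ∧ 2 ∣ g.d - 1 ∧ k ∣ g.b ∧ n ∣ g.c}
  one_mem' := by simp
  mul_mem' := by
    rintro g h ⟨⟨a, ha⟩, ⟨d, hd⟩, ⟨b, hb⟩, ⟨c, hc⟩⟩ ⟨⟨a', ha'⟩, ⟨d', hd'⟩, ⟨b', hb'⟩, ⟨c', hc'⟩⟩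
    rw [sub_eq_iff_eq_add] at ha hd ha' hd'
    refine ⟨?_, ?_, ⟨g.a * b' + b * h.d, ?_⟩, ⟨c * h.a + g.d * c', ?_⟩⟩
    · have : 2 ∣ g.b * h.c := by
        rw [hb, hc']
        rcases hk with hk | hk
        · exact (hk.mul_right _).mul_right _
        · exact (hk.mul_right _).mul_left _
      obtain ⟨w, hw⟩ := this
      exact ⟨2 * a * a' + a + a' + w, by rw [SL.mul_a, hw, ha, ha']; ring⟩
    · have : 2 ∣ g.c * h.b := by
        rw [hb', hc]
        rcases hk with hk | hk
        · exact (hk.mul_right _).mul_left _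
        · exact (hk.mul_right _).mul_right _
      obtain ⟨w, hw⟩ := this
      exact ⟨2 * d * d' + d + d' + w, by rw [SL.mul_d, hw, hd, hd']; ring⟩
    · rw [SL.mul_b, hb, hb']; ring
    · rw [SL.mul_c, hc, hc']; ring
  inv_mem' := by
    rintro g ⟨ha, hd, hb, hc⟩
    exact ⟨hd, ha, by simpa using hb, by simpa using hc⟩

/-- The subgroup of `Γ₀(2)` in `SL₂(O)` with diagonal congruent to one. -/
abbrev GB (m : ℤ) : Subgroup (SL (O m)) := Cong 1 2 (Or.inr dvd_rfl)

/-- The principal congruence subgroup of level two. -/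
abbrev GP (m : ℤ) : Subgroup (SL (O m)) := Cong 2 2 (Or.inr dvd_rfl)

/-- The sign characters of `GB`. -/
def rho (α β : ℤ × ℤ) (g : SL (O m)) : ℤˣ := chi α (divn 2 g.c) * chi β g.b

/-- The sign characters of `GP`. -/
def rhoP (α β : ℤ × ℤ) (g : SL (O m)) : ℤˣ := chi α (divn 2 g.c) * chi β (divn 2 g.b)

lemma half_c_mul {g h : SL (O m)} (hg : 2 ∣ g.d - 1 ∧ 2 ∣ g.c) (hh : 2 ∣ h.a - 1 ∧ 2 ∣ h.c) :
    2 ∣ divn 2 (g * h).c - (divn 2 g.c + divn 2 h.c) := by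
  obtain ⟨⟨d, hd⟩, ⟨c, hc⟩⟩ := hg
  obtain ⟨⟨a, ha⟩, ⟨c', hc'⟩⟩ := hh
  rw [sub_eq_iff_eq_add] at hd ha
  refine ⟨c * a + d * c', ?_⟩
  rw [SL.mul_c, hc, hc', divn_two_mul, divn_two_mul,
    show 2 * c * h.a + g.d * (2 * c') = 2 * (c * h.a + g.d * c') by ring, divn_two_mul, ha, hd]
  ring

lemma half_b_mul {g h : SL (O m)} (hg : 2 ∣ g.a - 1 ∧ 2 ∣ g.b) (hh : 2 ∣ h.d - 1 ∧ 2 ∣ h.b) :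
    2 ∣ divn 2 (g * h).b - (divn 2 g.b + divn 2 h.b) := by
  obtain ⟨⟨d, hd⟩, ⟨c, hc⟩⟩ := hg
  obtain ⟨⟨a, ha⟩, ⟨c', hc'⟩⟩ := hh
  rw [sub_eq_iff_eq_add] at hd ha
  refine ⟨d * c' + c * a, ?_⟩
  rw [SL.mul_b, hc, hc', divn_two_mul, divn_two_mul,
    show g.a * (2 * c') + 2 * c * h.d = 2 * (c * h.d + g.a * c') by ring, divn_two_mul, ha, hd]
  ring

lemma b_mul {g h : SL (O m)} (hg : 2 ∣ g.a - 1) (hh : 2 ∣ h.d - 1) :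
    2 ∣ (g * h).b - (g.b + h.b) := by
  obtain ⟨d, hd⟩ := hg
  obtain ⟨a, ha⟩ := hh
  rw [sub_eq_iff_eq_add] at hd ha
  refine ⟨d * h.b + g.b * a, ?_⟩
  rw [SL.mul_b, ha, hd]
  ring

lemma rho_isCharOn (α β : ℤ × ℤ) : IsCharOn (GB m) (rho α β) := by
  intro g hg h hh
  simp only [rho]
  rw [chi_congr _ (half_c_mul ⟨hg.2.1, hg.2.2.2⟩ ⟨hh.1, hh.2.2.2⟩), chi_congr _ (b_mul hg.1 hh.2.1),
    chi_add, chi_add, mul_mul_mul_comm]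

lemma rhoP_isCharOn (α β : ℤ × ℤ) : IsCharOn (GP m) (rhoP α β) := by
  intro g hg h hh
  simp only [rhoP]
  rw [chi_congr _ (half_c_mul ⟨hg.2.1, hg.2.2.2⟩ ⟨hh.1, hh.2.2.2⟩),
    chi_congr _ (half_b_mul ⟨hg.1, hg.2.2.1⟩ ⟨hh.2.1, hh.2.2.1⟩),
    chi_add, chi_add, mul_mul_mul_comm]

lemma two_dvd_divn_iff {x : O m} (h : 2 ∣ x) : 2 ∣ divn 2 x ↔ 4 ∣ x := by
  obtain ⟨y, rfl⟩ := h
  rw [divn_two_mul]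
  constructor
  · rintro ⟨z, rfl⟩; exact ⟨z, by ring⟩
  · rintro ⟨z, hz⟩
    refine ⟨z, ?_⟩
    have := congrArg (divn 2) hz
    rwa [divn_two_mul, show (4 : O m) * z = 2 * (2 * z) by ring, divn_two_mul] at this

lemma two_dvd_four : (2 : O m) ∣ 4 := ⟨2, by norm_num⟩

lemma hasLift_four (H : ∀ α β, HasLift (GP m) (rhoP α β)) :
    HasLift (Cong (m := m) 4 4 (Or.inr two_dvd_four)) (fun _ => 1) := by
  refine HasLift.of_even (Γ := Cong (m := m) 4 2 (Or.inr dvd_rfl)) (fun g => divn 2 g.c) ?_ ?_ ?_ ?_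
  · intro g hg h hh; simp
  · intro g hg h hh
    exact half_c_mul ⟨hg.2.1, hg.2.2.2⟩ ⟨hh.1, hh.2.2.2⟩
  · intro g
    constructor
    · rintro ⟨h1, h2, h3, h4⟩
      have h5 := two_dvd_four.trans h4
      exact ⟨⟨h1, h2, h3, h5⟩, (two_dvd_divn_iff h5).2 h4⟩
    · rintro ⟨⟨h1, h2, h3, h4⟩, h5⟩
      exact ⟨h1, h2, h3, (two_dvd_divn_iff h4).1 h5⟩
  intro α
  refine HasLift.of_even (Γ := GP m) (fun g => divn 2 g.b) ?_ ?_ ?_ ?_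
  · intro g hg h hh
    have := rhoP_isCharOn (m := m) α (0, 0) g hg h hh
    simpa [rhoP, chi_zero_mask] using this
  · intro g hg h hh
    exact half_b_mul ⟨hg.1, hg.2.2.1⟩ ⟨hh.2.1, hh.2.2.1⟩
  · intro g
    constructor
    · rintro ⟨h1, h2, h3, h4⟩
      have h5 := two_dvd_four.trans h3
      exact ⟨⟨h1, h2, h5, h4⟩, (two_dvd_divn_iff h5).2 h3⟩
    · rintro ⟨⟨h1, h2, h3, h4⟩, h5⟩
      exact ⟨h1, h2, (two_dvd_divn_iff h3).1 h5, h4⟩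
  intro β
  exact (H α β).congr (fun g _ => by simp [rhoP])

lemma hasLift_sixteen (H : ∀ α β, HasLift (GP m) (rhoP α β)) :
    HasLift (Cong (m := m) 1 16 (Or.inr ⟨8, by norm_num⟩)) (fun _ => 1) := by
  classical
  refine HasLift.transport (Γ' := Cong (m := m) 4 4 (Or.inr two_dvd_four))
    (fun g => if h : g.a * g.d - (4 * g.b) * divn 4 g.c = 1 then
      ⟨g.a, 4 * g.b, divn 4 g.c, g.d, h⟩ else 1)
    (fun g => if h : g.a * g.d - divn 4 g.b * (4 * g.c) = 1 then
      ⟨g.a, divn 4 g.b, 4 * g.c, g.d, h⟩ else 1) ?_ ?_ ?_ ?_ ?_ (fun _ _ => rfl) (hasLift_four H)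
  all_goals have e16 : ∀ x : O m, (16 : O m) * x = 4 * (4 * x) := fun x => by ring
  · rintro g ⟨h1, h2, h3, ⟨x, h4⟩⟩
    have hd := g.det
    rw [h4, e16] at hd
    rw [dif_pos (by rw [h4, e16, divn_four_mul, ← hd]; ring)]
    exact ⟨h1, h2, ⟨g.b, rfl⟩, ⟨x, by simp [h4, e16, divn_four_mul]⟩⟩
  · rintro g ⟨h1, h2, ⟨y, h3⟩, ⟨x, h4⟩⟩
    have hd := g.det
    rw [h3] at hd
    rw [dif_pos (by rw [h3, divn_four_mul, ← hd]; ring)]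
    exact ⟨h1, h2, one_dvd _, ⟨x, by simp [h4, e16]⟩⟩
  · rintro g ⟨h1, h2, h3, ⟨x, h4⟩⟩
    have hd := g.det
    rw [h4, e16] at hd
    rw [dif_pos (show g.a * g.d - 4 * g.b * divn 4 g.c = 1 by
      rw [h4, e16, divn_four_mul, ← hd]; ring)]
    simp only [h4, e16, divn_four_mul]
    rw [dif_pos hd]
    ext <;> simp [h4, e16]
  · rintro g ⟨h1, h2, ⟨y, h3⟩, ⟨x, h4⟩⟩
    have hd := g.det
    rw [h3] at hd
    rw [dif_pos (show g.a * g.d - divn 4 g.b * (4 * g.c) = 1 by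
      rw [h3, divn_four_mul, ← hd]; ring)]
    simp only [h3, divn_four_mul]
    rw [dif_pos hd]
    ext <;> simp [h3]
  · have key : ∀ g : SL (O m), (16 ∣ g.c) → g.a * g.d - (4 * g.b) * divn 4 g.c = 1 := by
      rintro g ⟨x, h4⟩
      have hd := g.det
      rw [h4, e16] at hd
      rw [h4, e16, divn_four_mul, ← hd]; ring
    intro g hg h hh
    rw [dif_pos (key g hg.2.2.2), dif_pos (key h hh.2.2.2),
      dif_pos (key _ (mul_mem hg hh).2.2.2)]
    obtain ⟨x, hx⟩ := hg.2.2.2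
    obtain ⟨y, hy⟩ := hh.2.2.2
    have e : (g * h).c = 4 * (4 * (x * h.a + g.d * y)) := by
      rw [SL.mul_c, hx, hy]; ring
    ext1
    · simp only [SL.mul_a, hy, e16, divn_four_mul]; ring
    · simp only [SL.mul_b]; ring
    · simp only [SL.mul_c, hx, hy, e16, divn_four_mul]
      rw [show 4 * (4 * x) * h.a + g.d * (4 * (4 * y)) = 4 * (4 * (x * h.a + g.d * y)) by ring,
        divn_four_mul]; ring
    · simp only [SL.mul_d, hx, e16, divn_four_mul]; ring

end groups

section conj
variable {m : ℤ}

lemma emod_two_eq_iff (x y : ℤ) : x % 2 = y % 2 ↔ (x : ZMod 2) = (y : ZMod 2) :=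
  ((ZMod.intCast_eq_intCast_iff' x y 2)).symm

lemma HasLift.conj {G : Type*} [Group G] {Γ : Subgroup G} {ρ ρ' : G → ℤˣ} (t : G)
    (h : ∀ g ∈ Γ, t * g * t⁻¹ ∈ Γ) (h' : ∀ g ∈ Γ, t⁻¹ * g * t ∈ Γ)
    (hρ : ∀ g ∈ Γ, ρ' (t * g * t⁻¹) = ρ g) (H : HasLift Γ ρ') : HasLift Γ ρ :=
  H.transport (fun g => t * g * t⁻¹) (fun g => t⁻¹ * g * t) h h' (fun g _ => by group)
    (fun g _ => by group) (fun g _ k _ => by group) hρ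

lemma two_mul_cancel {x y : O m} (h : 2 * x = 2 * y) : x = y := by
  rw [← divn_two_mul x, h, divn_two_mul]

lemma chi_mask_congr {p q : ℤ × ℤ} (h1 : p.1 % 2 = q.1 % 2) (h2 : p.2 % 2 = q.2 % 2) (x : O m) :
    chi p x = chi q x := by
  simp only [chi, Int.negOnePow_eq_iff, even_iff_two_dvd]
  rw [← Int.modEq_iff_dvd]
  exact (Int.ModEq.add (Int.ModEq.mul_right _ h1) (Int.ModEq.mul_right _ h2)).symm

/-- The mask `β ∘ y`. -/
def mulmask (m : ℤ) (β : ℤ × ℤ) (y : O m) : ℤ × ℤ :=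
  (β.1 * y.re + β.2 * y.im, β.1 * (-m * y.im) + β.2 * (y.re + y.im))

lemma chi_mulmask (β : ℤ × ℤ) (y x : O m) : chi (mulmask m β y) x = chi β (y * x) := by
  simp only [chi, mulmask, QuadraticAlgebra.re_mul, QuadraticAlgebra.im_mul]
  congr 1; ring

lemma half_b_conj {g : SL (O m)} (hg : g ∈ GP m) (t : O m) :
    ∃ y, g.b + t * (g.d - g.a) - t ^ 2 * g.c =
      2 * (divn 2 g.b + t ^ 2 * divn 2 g.c + 2 * y) := by
  obtain ⟨⟨a, ha⟩, ⟨d, hd⟩, ⟨b, hb⟩, ⟨c, hc⟩⟩ := hg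
  rw [sub_eq_iff_eq_add] at ha hd
  have h : d - a = 2 * (b * c - a * d - a) := by
    apply two_mul_cancel
    have := g.det
    rw [ha, hd, hb, hc] at this
    linear_combination this
  refine ⟨t * (b * c - a * d - a) - t ^ 2 * c, ?_⟩
  rw [hb, hc, divn_two_mul, divn_two_mul, ha, hd]
  linear_combination 2 * t * h

/-- The upper triangular unipotent matrix with entry `t`. -/
def trans {R : Type*} [CommRing R] (t : R) : SL R := ⟨1, t, 0, 1, by ring⟩

lemma conj_trans_mem {g : SL (O m)} (hg : g ∈ GP m) (t : O m) :
    trans t * g * (trans t)⁻¹ ∈ GP m := by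
  obtain ⟨y, hy⟩ := half_b_conj hg t
  obtain ⟨⟨a, ha⟩, ⟨d, hd⟩, -, ⟨c, hc⟩⟩ := hg
  refine ⟨⟨a + t * c, ?_⟩, ⟨d - t * c, ?_⟩,
    ⟨divn 2 g.b + t ^ 2 * divn 2 g.c + 2 * y, ?_⟩, ⟨c, ?_⟩⟩
  · simp [trans]; linear_combination ha + t * hc
  · simp [trans]; linear_combination hd - t * hc
  · rw [← hy]; simp [trans]; ring
  · simp [trans, hc]

lemma rhoP_conj_trans {g : SL (O m)} (hg : g ∈ GP m) (t : O m) (α β : ℤ × ℤ) :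
    rhoP α β (trans t * g * (trans t)⁻¹) = rhoP (α + mulmask m β (t ^ 2)) β g := by
  obtain ⟨y, hy⟩ := half_b_conj hg t
  have e : (trans t * g * (trans t)⁻¹).b = g.b + t * (g.d - g.a) - t ^ 2 * g.c := by
    simp [trans]; ring
  have e' : (trans t * g * (trans t)⁻¹).c = g.c := by simp [trans]
  rw [rhoP, rhoP, e, e', hy, divn_two_mul, chi_mask_add, chi_mulmask, chi_add, chi_add,
    chi_two_mul, mul_one]
  ac_rfl

lemma trans_inv {R : Type*} [CommRing R] (t : R) : (trans t)⁻¹ = trans (-t) := by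
  ext <;> simp [trans]

lemma HasLift.of_trans (t : O m) {α β : ℤ × ℤ} (H : HasLift (GP m) (rhoP α β)) :
    HasLift (GP m) (rhoP (α + mulmask m β (t ^ 2)) β) := by
  refine H.conj (trans t) (fun g hg => conj_trans_mem hg t) (fun g hg => ?_)
    (fun g hg => rhoP_conj_trans hg t α β)
  have := conj_trans_mem hg (-t)
  rwa [← trans_inv, inv_inv] at this

/-- The inversion `(0, 1; -1, 0)`. -/
def weyl {R : Type*} [CommRing R] : SL R := ⟨0, 1, -1, 0, by ring⟩

lemma HasLift.weyl {α β : ℤ × ℤ} (H : HasLift (GP m) (rhoP α β)) :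
    HasLift (GP m) (rhoP β α) := by
  have hb : ∀ {x : O m}, 2 ∣ x → chi α (divn 2 (-x)) = chi α (divn 2 x) ∧
      chi β (divn 2 (-x)) = chi β (divn 2 x) := by
    rintro x ⟨y, rfl⟩
    rw [← mul_neg, divn_two_mul, divn_two_mul, chi_neg, chi_neg]
    exact ⟨rfl, rfl⟩
  refine H.conj Bianchi.weyl ?_ ?_ ?_
  · rintro g ⟨h1, h2, h3, h4⟩
    exact ⟨by simpa [Bianchi.weyl] using h2, by simpa [Bianchi.weyl] using h1,
      by simpa [Bianchi.weyl] using h4, by simpa [Bianchi.weyl] using h3⟩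
  · rintro g ⟨h1, h2, h3, h4⟩
    exact ⟨by simpa [Bianchi.weyl] using h2, by simpa [Bianchi.weyl] using h1,
      by simpa [Bianchi.weyl] using h4, by simpa [Bianchi.weyl] using h3⟩
  · rintro g ⟨h1, h2, h3, h4⟩
    simp [Bianchi.weyl, rhoP, (hb h3).1, (hb h4).2, mul_comm]

lemma rhoP_congr {α α' β β' : ℤ × ℤ} (h1 : α.1 % 2 = α'.1 % 2) (h2 : α.2 % 2 = α'.2 % 2)
    (h3 : β.1 % 2 = β'.1 % 2) (h4 : β.2 % 2 = β'.2 % 2) :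
    rhoP (m := m) α β = rhoP α' β' := by
  ext1 g
  rw [rhoP, rhoP, chi_mask_congr h1 h2, chi_mask_congr h3 h4]

lemma rho_congr {α α' β β' : ℤ × ℤ} (h1 : α.1 % 2 = α'.1 % 2) (h2 : α.2 % 2 = α'.2 % 2)
    (h3 : β.1 % 2 = β'.1 % 2) (h4 : β.2 % 2 = β'.2 % 2) :
    rho (m := m) α β = rho α' β' := by
  ext1 g
  rw [rho, rho, chi_mask_congr h1 h2, chi_mask_congr h3 h4]

lemma hasLift_rhoP (hm : m % 2 = 1) (H : ∀ α β, HasLift (GB m) (rho α β)) (α β : ℤ × ℤ) :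
    HasLift (GP m) (rhoP α β) := by
  have h0 : ∀ α, HasLift (GP m) (rhoP α (0, 0)) := by
    intro α
    refine HasLift.of_even (Γ := GB m) (fun g => g.b) ?_ ?_ ?_ ?_
    · intro g hg h hh
      have := rho_isCharOn (m := m) α (0, 0) g hg h hh
      simpa [rho, rhoP, chi_zero_mask] using this
    · intro g hg h hh
      exact b_mul hg.1 hh.2.1
    · intro g
      constructor
      · rintro ⟨h1, h2, h3, h4⟩
        exact ⟨⟨h1, h2, one_dvd _, h4⟩, h3⟩
      · rintro ⟨⟨h1, h2, -, h4⟩, h3⟩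
        exact ⟨h1, h2, h3, h4⟩
    intro β
    exact (H α β).congr (fun g _ => by simp [rho, rhoP, chi_zero_mask])
  have key : ∀ t : O m, HasLift (GP m) (rhoP (mulmask m β (t ^ 2)) β) := by
    intro t
    have := (h0 β).weyl.of_trans t
    rwa [show ((0, 0) : ℤ × ℤ) + mulmask m β (t ^ 2) = mulmask m β (t ^ 2) from zero_add _] at this
  have k0 := key 0
  have k1 := key 1
  have k2 := key ⟨0, 1⟩
  have k3 := key ⟨1, 1⟩
  obtain ⟨α0, α1⟩ := α
  obtain ⟨β0, β1⟩ := β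
  have hm' : (m : ZMod 2) = 1 := by exact_mod_cast (emod_two_eq_iff m 1).1 hm
  have cases2 : ∀ x : ZMod 2, x = 0 ∨ x = 1 := by decide
  rcases cases2 β0 with h2 | h2 <;> rcases cases2 β1 with h3 | h3
  · rw [rhoP_congr (α' := (α0, α1)) (β' := (0, 0)) rfl rfl ((emod_two_eq_iff _ _).2 (by simpa using h2))
      ((emod_two_eq_iff _ _).2 (by simpa using h3))]
    exact h0 _
  all_goals
    rcases cases2 α0 with h0 | h0 <;> rcases cases2 α1 with h1 | h1 <;>
    first
    | (rw [rhoP_congr (α' := _) (β' := (β0, β1)) ?_ ?_ rfl rfl]; exact k0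
       all_goals
         rw [emod_two_eq_iff]
         simp only [mulmask, pow_two, QuadraticAlgebra.re_mul, QuadraticAlgebra.im_mul,
           QuadraticAlgebra.re_zero, QuadraticAlgebra.im_zero, QuadraticAlgebra.re_one,
           QuadraticAlgebra.im_one]
         push_cast
         simp only [hm', h0, h1, h2, h3]
         decide)
    | (rw [rhoP_congr (α' := _) (β' := (β0, β1)) ?_ ?_ rfl rfl]; exact k1
       all_goals
         rw [emod_two_eq_iff]
         simp only [mulmask, pow_two, QuadraticAlgebra.re_mul, QuadraticAlgebra.im_mul,
           QuadraticAlgebra.re_zero, QuadraticAlgebra.im_zero, QuadraticAlgebra.re_one,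
           QuadraticAlgebra.im_one]
         push_cast
         simp only [hm', h0, h1, h2, h3]
         decide)
    | (rw [rhoP_congr (α' := _) (β' := (β0, β1)) ?_ ?_ rfl rfl]; exact k2
       all_goals
         rw [emod_two_eq_iff]
         simp only [mulmask, pow_two, QuadraticAlgebra.re_mul, QuadraticAlgebra.im_mul,
           QuadraticAlgebra.re_zero, QuadraticAlgebra.im_zero, QuadraticAlgebra.re_one,
           QuadraticAlgebra.im_one]
         push_cast
         simp only [hm', h0, h1, h2, h3]
         decide)
    | (rw [rhoP_congr (α' := _) (β' := (β0, β1)) ?_ ?_ rfl rfl]; exact k3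
       all_goals
         rw [emod_two_eq_iff]
         simp only [mulmask, pow_two, QuadraticAlgebra.re_mul, QuadraticAlgebra.im_mul,
           QuadraticAlgebra.re_zero, QuadraticAlgebra.im_zero, QuadraticAlgebra.re_one,
           QuadraticAlgebra.im_one]
         push_cast
         simp only [hm', h0, h1, h2, h3]
         decide)

lemma conj_mem_GB {t g : SL (O m)} (h1 : 2 ∣ t.b) (h2 : 4 ∣ t.c) (hg : g ∈ GB m) :
    t * g * t⁻¹ ∈ GB m ∧ 2 ∣ (t * g * t⁻¹).b - t.a ^ 2 * g.b ∧
      2 ∣ divn 2 (t * g * t⁻¹).c - t.d ^ 2 * divn 2 g.c := by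
  obtain ⟨q, hq⟩ := h1
  obtain ⟨e, he⟩ := h2
  obtain ⟨⟨a, ha⟩, ⟨d, hd⟩, -, ⟨c, hc⟩⟩ := hg
  rw [sub_eq_iff_eq_add] at ha hd
  have ht := t.det
  rw [hq, he] at ht
  have hcc : (t * g * t⁻¹).c = 2 * (t.d ^ 2 * c + 2 * (e * t.d * (g.a - g.d) - 4 * e ^ 2 * g.b)) := by
    simp [hq, he, hc]; ring
  refine ⟨⟨⟨t.a * t.d * a + 4 * q * e * 1 + 2 * q * c * t.d - t.a * g.b * 2 * e - 4 * q * e * g.d, ?_⟩,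
    ⟨t.a * t.d * d + 4 * q * e * 1 - 4 * e * q * g.a - 2 * c * t.d * q + 2 * t.a * e * g.b, ?_⟩,
    one_dvd _, ⟨_, hcc⟩⟩, ⟨-q * t.a * g.a - 2 * q ^ 2 * g.c + t.a * q * g.d, ?_⟩, ?_⟩
  · simp [hq, he, hc, ha]; linear_combination ht
  · simp [hq, he, hc, hd]; linear_combination ht
  · simp [hq, he, hc, hd]; ring
  · rw [hcc, divn_two_mul, hc, divn_two_mul]
    exact ⟨_, add_sub_cancel_left _ _⟩

/-- A matrix congruent to a non-scalar diagonal matrix modulo two. -/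
def scal (e : ℤ) (he : m ^ 2 = 8 * e + 1) : SL (O m) :=
  ⟨⟨0, 1⟩, 2, 4 * ⟨e, 0⟩, ⟨m, -m⟩, by
    have h2 : (2 : O m) = ⟨2, 0⟩ := rfl
    have h4 : (4 : O m) = ⟨4, 0⟩ := rfl
    rw [h2, h4]
    ext
    · simp [QuadraticAlgebra.re_one]; linarith
    · simp [QuadraticAlgebra.im_one]⟩

lemma exists_eight (hm : m % 2 = 1) : ∃ e, m ^ 2 = 8 * e + 1 := by
  have : m ^ 2 % 8 = 1 := by
    have h : m % 8 = 1 ∨ m % 8 = 3 ∨ m % 8 = 5 ∨ m % 8 = 7 := by omega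
    rcases h with h | h | h | h <;> simp [pow_two, Int.mul_emod, h]
  exact ⟨m ^ 2 / 8, by omega⟩

lemma HasLift.scale (hm : m % 2 = 1) {α β : ℤ × ℤ} (H : HasLift (GB m) (rho α β)) :
    HasLift (GB m) (rho (α.2, α.1 + α.2) (β.1 + β.2, β.1)) := by
  obtain ⟨e, he⟩ := exists_eight hm
  have h1 : 2 ∣ (scal e he).b := dvd_rfl
  have h2 : 4 ∣ (scal e he).c := ⟨_, rfl⟩
  refine H.conj (scal e he) (fun g hg => (conj_mem_GB h1 h2 hg).1) (fun g hg => ?_)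
    (fun g hg => ?_)
  · have := (conj_mem_GB (t := (scal e he)⁻¹) (by simpa using h1) (by simpa using h2) hg).1
    rwa [inv_inv] at this
  · obtain ⟨-, h3, h4⟩ := conj_mem_GB h1 h2 hg
    rw [rho, rho, chi_congr _ h3, chi_congr _ h4, ← chi_mulmask, ← chi_mulmask]
    have hm' : (m : ZMod 2) = 1 := by exact_mod_cast (emod_two_eq_iff m 1).1 hm
    congr 1
    all_goals
      refine chi_mask_congr ?_ ?_ _
      all_goals
        simp only [mulmask, scal, pow_two, QuadraticAlgebra.re_mul, QuadraticAlgebra.im_mul]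
        rw [emod_two_eq_iff]
        push_cast
        rw [hm']
        generalize (α.1 : ZMod 2) = x
        generalize (α.2 : ZMod 2) = y
        generalize (β.1 : ZMod 2) = z
        generalize (β.2 : ZMod 2) = w
        revert x y z w
        decide

/-- Complex conjugation on `SL₂(O)`. -/
def conjSL (g : SL (O m)) : SL (O m) :=
  ⟨star g.a, star g.b, star g.c, star g.d, by
    rw [← star_mul', ← star_mul', ← star_sub, g.det, star_one]⟩

lemma dvd_star {n : ℤ} {x : O m} (h : (n : O m) ∣ x) : (n : O m) ∣ star x := by
  obtain ⟨y, rfl⟩ := h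
  exact ⟨star y, by rw [star_mul, star_intCast, mul_comm]⟩

lemma chi_star (p : ℤ × ℤ) (x : O m) : chi p (star x) = chi (p.1, p.1 + p.2) x := by
  simp only [chi, QuadraticAlgebra.re_star, QuadraticAlgebra.im_star, Int.negOnePow_eq_iff]
  exact ⟨-p.2 * x.im, by ring⟩

lemma HasLift.star {α β : ℤ × ℤ} (H : HasLift (GB m) (rho α β)) :
    HasLift (GB m) (rho (α.1, α.1 + α.2) (β.1, β.1 + β.2)) := by
  have h1 : ∀ g ∈ GB m, conjSL g ∈ GB m := by
    rintro g ⟨h1, h2, h3, h4⟩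
    refine ⟨?_, ?_, one_dvd _, dvd_star (n := 2) h4⟩
    · have := dvd_star (n := 2) h1
      rwa [star_sub, star_one] at this
    · have := dvd_star (n := 2) h2
      rwa [star_sub, star_one] at this
  refine H.transport conjSL conjSL h1 h1 ?_ ?_ ?_ ?_
  · intro g _; ext1 <;> exact star_star _
  · intro g _; ext1 <;> exact star_star _
  · intro g _ h _
    ext1 <;> simp only [conjSL, SL.mul_a, SL.mul_b, SL.mul_c, SL.mul_d, star_add, star_mul,
      mul_comm]
  · rintro g ⟨h1, h2, h3, ⟨c, hc⟩⟩
    have : divn 2 (conjSL g).c = Star.star (divn 2 g.c) := by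
      have e : (conjSL g).c = 2 * Star.star c := by
        show Star.star g.c = _
        rw [hc, star_mul, mul_comm, show (Star.star (2 : O m)) = 2 from star_ofNat 2]
      rw [e, hc, divn_two_mul, divn_two_mul]
    rw [rho, rho, this, ← chi_star, ← chi_star]
    rfl

lemma HasLift.fricke {α β : ℤ × ℤ} (H : HasLift (GB m) (rho α β)) :
    HasLift (GB m) (rho β α) := by
  classical
  let i : SL (O m) → SL (O m) := fun g => if h : g.d * g.a - (-divn 2 g.c) * (-2 * g.b) = 1 then
      ⟨g.d, -divn 2 g.c, -2 * g.b, g.a, h⟩ else 1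
  have hi : ∀ g ∈ GB m, ∃ c, g.c = 2 * c ∧ (i g).a = g.d ∧ (i g).b = -c ∧ (i g).c = 2 * (-g.b) ∧
      (i g).d = g.a := by
    rintro g ⟨h1, h2, h3, ⟨c, hc⟩⟩
    have hd := g.det
    rw [hc] at hd
    refine ⟨c, hc, ?_⟩
    simp only [i]
    rw [dif_pos (by rw [hc, divn_two_mul]; linear_combination hd)]
    refine ⟨rfl, ?_, ?_, rfl⟩
    · simp [hc, divn_two_mul]
    · simp
  have hmem : ∀ g ∈ GB m, i g ∈ GB m := by
    intro g hg
    obtain ⟨c, hc, ha, hb, hc', hd⟩ := hi g hg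
    exact ⟨by rw [ha]; exact hg.2.1, by rw [hd]; exact hg.1, one_dvd _, _, hc'⟩
  have hinv : ∀ g ∈ GB m, i (i g) = g := by
    intro g hg
    obtain ⟨c, hc, ha, hb, hc', hd⟩ := hi g hg
    obtain ⟨c2, hc2, ha2, hb2, hc2', hd2⟩ := hi _ (hmem g hg)
    have : c2 = -g.b := two_mul_cancel (by rw [← hc2, hc'])
    ext1
    · rw [ha2, hd]
    · rw [hb2, this, neg_neg]
    · rw [hc2', hb, hc, neg_neg]
    · rw [hd2, ha]
  refine H.transport i i hmem hmem hinv hinv ?_ ?_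
  · intro g hg h hh
    obtain ⟨c, hc, ha, hb, hc', hd⟩ := hi g hg
    obtain ⟨c2, hc2, ha2, hb2, hc2', hd2⟩ := hi h hh
    obtain ⟨c3, hc3, ha3, hb3, hc3', hd3⟩ := hi _ (mul_mem hg hh)
    have : c3 = c * h.a + g.d * c2 := two_mul_cancel (by
      rw [← hc3, SL.mul_c, hc, hc2]; ring)
    ext1
    · rw [ha3, SL.mul_a, SL.mul_d, ha, ha2, hb, hc2', hc]; ring
    · rw [hb3, SL.mul_b, this, ha, hb2, hb, hd2]; ring
    · rw [hc3', SL.mul_b, SL.mul_c, hc', ha2, hd, hc2']; ring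
    · rw [hd3, SL.mul_a, SL.mul_d, hc', hb2, hd, hd2, hc2]; ring
  · intro g hg
    obtain ⟨c, hc, ha, hb, hc', hd⟩ := hi g hg
    rw [rho, rho, hc', hb, hc, divn_two_mul, divn_two_mul, chi_neg, chi_neg, mul_comm]

lemma hasLift_rho_of_four (hm : m % 2 = 1) (H0 : HasLift (GB m) (rho (0, 0) (0, 0)))
    (H1 : HasLift (GB m) (rho (0, 1) (0, 0))) (H2 : HasLift (GB m) (rho (0, 1) (0, 1)))
    (H3 : HasLift (GB m) (rho (0, 1) (1, 0))) (α β : ℤ × ℤ) : HasLift (GB m) (rho α β) := by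
  let P : ZMod 2 → ZMod 2 → ZMod 2 → ZMod 2 → Prop := fun x y z w =>
    ∀ a b c d : ℤ, (a : ZMod 2) = x → (b : ZMod 2) = y → (c : ZMod 2) = z → (d : ZMod 2) = w →
      HasLift (GB m) (rho (a, b) (c, d))
  have mk : ∀ a b c d : ℤ, HasLift (GB m) (rho (a, b) (c, d)) → P a b c d := by
    intro a b c d h a' b' c' d' ha hb hc hd
    rw [← emod_two_eq_iff] at ha hb hc hd
    rwa [rho_congr (α := (a', b')) (α' := (a, b)) (β := (c', d')) (β' := (c, d)) ha hb hc hd]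
  have p0 : P 0 0 0 0 := by exact_mod_cast mk _ _ _ _ H0
  have p1 : P 0 1 0 0 := by exact_mod_cast mk _ _ _ _ H1
  have p2 : P 0 1 0 1 := by exact_mod_cast mk _ _ _ _ H2
  have p3 : P 0 1 1 0 := by exact_mod_cast mk _ _ _ _ H3
  have lift : ∀ x : ZMod 2, ∃ a : ℤ, (a : ZMod 2) = x := fun x => ⟨x.val, by simp⟩
  have sc : ∀ x y z w, P x y z w → P y (x + y) (z + w) z := by
    intro x y z w h
    obtain ⟨a, rfl⟩ := lift x
    obtain ⟨b, rfl⟩ := lift y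
    obtain ⟨c, rfl⟩ := lift z
    obtain ⟨d, rfl⟩ := lift w
    exact_mod_cast mk _ _ _ _ (HasLift.scale hm (h a b c d rfl rfl rfl rfl))
  have sw : ∀ x y z w, P x y z w → P z w x y := by
    intro x y z w h a b c d ha hb hc hd
    exact (h c d a b hc hd ha hb).fricke
  have st : ∀ x y z w, P x y z w → P x (x + y) z (z + w) := by
    intro x y z w h
    obtain ⟨a, rfl⟩ := lift x
    obtain ⟨b, rfl⟩ := lift y
    obtain ⟨c, rfl⟩ := lift z
    obtain ⟨d, rfl⟩ := lift w
    exact_mod_cast mk _ _ _ _ (HasLift.star (h a b c d rfl rfl rfl rfl))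
  have p1' := sc _ _ _ _ p1
  have p1'' := sc _ _ _ _ p1'
  have p2' := sc _ _ _ _ p2
  have p2'' := sc _ _ _ _ p2'
  have p3' := sc _ _ _ _ p3
  have p3'' := sc _ _ _ _ p3'
  have p4 := st _ _ _ _ p3
  have p4' := sc _ _ _ _ p4
  have p4'' := sc _ _ _ _ p4'
  have q1 := sw _ _ _ _ p1
  have q1' := sw _ _ _ _ p1'
  have q1'' := sw _ _ _ _ p1''
  have e : (1 + 1 : ZMod 2) = 0 := rfl
  simp only [zero_add, add_zero, e] at *
  have all : ∀ x y z w, P x y z w := by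
    have cases2 : ∀ x : ZMod 2, x = 0 ∨ x = 1 := by decide
    intro x y z w
    rcases cases2 x with rfl | rfl <;> rcases cases2 y with rfl | rfl <;>
      rcases cases2 z with rfl | rfl <;> rcases cases2 w with rfl | rfl <;> assumption
  exact all _ _ _ _ _ _ _ _ rfl rfl rfl rfl

end conj

section ringOfIntegers

lemma exists_int_of_isIntegral_of_sq {K : Type*} [Field K] [NumberField K] {z : K}
    (hz : IsIntegral ℤ z) (hq : z ∉ (algebraMap ℚ K).range) {s n : ℚ}
    (h : z ^ 2 - (s : K) * z + (n : K) = 0) : (∃ a : ℤ, s = a) ∧ ∃ b : ℤ, n = b := by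
  let Q : Polynomial ℚ := Polynomial.X ^ 2 + (Polynomial.C (-s) * Polynomial.X + Polynomial.C n)
  have hQd : Q.natDegree = 2 := by simp only [Q]; compute_degree!
  have hQm : Q.Monic := by simp only [Q]; monicity!
  have h1 : minpoly ℚ z ∣ Q := by
    refine minpoly.dvd _ _ ?_
    simp only [Q, map_add, map_mul, map_pow, Polynomial.aeval_X, Polynomial.aeval_C, map_neg,
      eq_ratCast]
    rw [← h]; ring
  have hzq : IsIntegral ℚ z := hz.tower_top
  have h2 : Q.natDegree ≤ (minpoly ℚ z).natDegree := by
    rw [hQd]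
    have h3 := minpoly.natDegree_pos hzq
    have h4 : (minpoly ℚ z).natDegree ≠ 1 := fun e => hq (minpoly.natDegree_eq_one_iff.1 e)
    omega
  have h3 : Q = minpoly ℚ z :=
    Polynomial.eq_of_monic_of_dvd_of_natDegree_le (minpoly.monic hzq) hQm h1 h2
  rw [minpoly.isIntegrallyClosed_eq_field_fractions' ℚ hz] at h3
  constructor
  · refine ⟨-(minpoly ℤ z).coeff 1, ?_⟩
    have := congrArg (fun p => Polynomial.coeff p 1) h3
    simp [Q, Polynomial.coeff_X, Polynomial.coeff_C] at this
    push_cast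
    linarith
  · refine ⟨(minpoly ℤ z).coeff 0, ?_⟩
    have := congrArg (fun p => Polynomial.coeff p 0) h3
    simpa [Q, Polynomial.coeff_X, Polynomial.coeff_C] using this

lemma Rat.exists_int_of_prime_mul_sq {p : ℕ} (hp : p.Prime) {q : ℚ} {n : ℤ} (h : p * q ^ 2 = n) :
    ∃ a : ℤ, q = a := by
  have h1 : ((p * q : ℚ)) ^ 2 = ((p * n : ℤ) : ℚ) := by push_cast; rw [← h]; ring
  have h2 : ∃ b : ℤ, (b : ℚ) = p * q := by
    have := IsIntegrallyClosed.isIntegral_iff (R := ℤ) (x := (p * q : ℚ))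
    have h3 : IsIntegral ℤ ((p * q : ℚ)) := by
      refine IsIntegral.of_pow (n := 2) (by norm_num) ?_
      rw [h1]; exact isIntegral_algebraMap (R := ℤ) (x := (p * n : ℤ))
    obtain ⟨b, hb⟩ := this.1 h3
    exact ⟨b, by simpa using hb⟩
  obtain ⟨b, hb⟩ := h2
  have hp0 : (p : ℚ) ≠ 0 := by exact_mod_cast hp.ne_zero
  have h4 : b ^ 2 = p * n := by
    have : ((b ^ 2 : ℤ) : ℚ) = ((p * n : ℤ) : ℚ) := by rw [← h1, ← hb]; push_cast; ring
    exact_mod_cast this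
  obtain ⟨c, hc⟩ := (Nat.prime_iff_prime_int.1 hp).dvd_of_dvd_pow ⟨n, h4⟩
  refine ⟨c, ?_⟩
  rw [hc] at hb
  push_cast at hb
  exact (mul_left_cancel₀ hp0 hb).symm

theorem exists_ringEquiv {d : ℕ} (hd : d.Prime) {m : ℤ} (hm : (d : ℤ) = 4 * m - 1)
    (K : Type*) [Field K] [NumberField K] (hdeg : Module.finrank ℚ K = 2) (sqd : K)
    (hsqd : sqd ^ 2 = -(d : K)) : Nonempty (O m ≃+* 𝓞 K) := by
  have hdK : (d : K) = 4 * (m : K) - 1 := by exact_mod_cast congrArg (Int.cast : ℤ → K) hm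
  let w : K := (1 + sqd) / 2
  have hw : w * w = -(m : K) + w := by
    simp only [w]
    linear_combination (1 / 4 : K) * hsqd - (1 / 4 : K) * hdK
  have hwi : IsIntegral ℤ w := by
    refine ⟨Polynomial.X ^ 2 + (Polynomial.C (-1) * Polynomial.X + Polynomial.C m), by monicity!, ?_⟩
    simp only [Polynomial.eval₂_add, Polynomial.eval₂_mul, Polynomial.eval₂_pow,
      Polynomial.eval₂_X, Polynomial.eval₂_C]
    rw [pow_two, hw]
    simp
  have hdq : (0 : ℚ) < d := by exact_mod_cast hd.pos
  have hindep : ∀ p q : ℚ, (p : K) + q * w = 0 → p = 0 ∧ q = 0 := by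
    intro p q h
    have h1 : ((2 * p + q : ℚ) : K) = -(q : K) * sqd := by
      push_cast
      simp only [w] at h
      linear_combination 2 * h
    have h2 : (((2 * p + q) ^ 2 + d * q ^ 2 : ℚ) : K) = 0 := by
      rw [Rat.cast_add, Rat.cast_pow, h1]
      push_cast
      linear_combination (q : K) ^ 2 * hsqd
    have h3 : (2 * p + q) ^ 2 + d * q ^ 2 = 0 := by exact_mod_cast h2
    have h4 : q ^ 2 = 0 := by
      have := sq_nonneg (2 * p + q)
      have h5 := mul_nonneg hdq.le (sq_nonneg q)
      have : d * q ^ 2 = 0 := by linarith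
      exact (mul_eq_zero.1 this).resolve_left hdq.ne'
    have h5 : q = 0 := by simpa using h4
    rw [h5] at h3
    exact ⟨by simpa using h3, h5⟩
  have hspan : ∀ z : K, ∃ p q : ℚ, z = p + q * w := by
    have hli : LinearIndependent ℚ ![(1 : K), w] := by
      rw [LinearIndependent.pair_iff]
      intro s t h
      refine hindep s t ?_
      rw [← h, Rat.smul_def, Rat.smul_def, mul_one]
    have htop := hli.span_eq_top_of_card_eq_finrank' (by simp [hdeg])
    intro z
    have hz : z ∈ Submodule.span ℚ (Set.range ![(1 : K), w]) := by rw [htop]; trivial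
    rw [Matrix.range_cons, Matrix.range_cons, Matrix.range_empty, Set.union_empty,
      Set.singleton_union, Submodule.mem_span_pair] at hz
    obtain ⟨p, q, h⟩ := hz
    exact ⟨p, q, by rw [← h, Rat.smul_def, Rat.smul_def, mul_one]⟩
  let W : 𝓞 K := ⟨w, hwi⟩
  have hW : W * W = (-m) • (1 : 𝓞 K) + (1 : ℤ) • W := by
    apply RingOfIntegers.ext
    show w * w = ((-m) • (1 : 𝓞 K) + (1 : ℤ) • W : 𝓞 K)
    rw [hw, one_smul, zsmul_one]
    push_cast
    rfl
  let φ : O m →ₐ[ℤ] 𝓞 K := QuadraticAlgebra.lift ⟨W, hW⟩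
  have hφ : ∀ x : O m, ((φ x : 𝓞 K) : K) = (x.re : K) + x.im * w := by
    intro x
    have e : φ x = (x.re : 𝓞 K) + (x.im : 𝓞 K) * W := by
      simp [φ, QuadraticAlgebra.lift]
    have e' := congrArg (algebraMap (𝓞 K) K) e
    rw [map_add, map_mul, map_intCast, map_intCast] at e'
    exact e'
  refine ⟨RingEquiv.ofBijective φ.toRingHom ⟨?_, ?_⟩⟩
  · rw [injective_iff_map_eq_zero]
    intro x hx
    have h1 : ((φ x : 𝓞 K) : K) = 0 := by
      have : φ x = 0 := hx
      rw [this]; rfl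
    rw [hφ] at h1
    obtain ⟨h2, h3⟩ := hindep x.re x.im (by push_cast; exact h1)
    ext
    · exact_mod_cast h2
    · exact_mod_cast h3
  · intro z
    obtain ⟨p, q, hz⟩ := hspan z
    suffices h : (∃ a : ℤ, p = a) ∧ ∃ b : ℤ, q = b by
      obtain ⟨⟨a, rfl⟩, ⟨b, rfl⟩⟩ := h
      refine ⟨⟨a, b⟩, RingOfIntegers.ext ?_⟩
      show ((φ _ : 𝓞 K) : K) = z
      rw [hφ, hz]; push_cast; rfl
    have hzi : IsIntegral ℤ (z : K) := z.2
    by_cases hq : q = 0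
    · refine ⟨?_, 0, by simpa using hq⟩
      rw [hq] at hz
      have h1 : IsIntegral ℤ p := by
        rw [hz] at hzi
        have : IsIntegral ℤ (algebraMap ℚ K p) := by simpa using hzi
        exact (isIntegral_algebraMap_iff (algebraMap ℚ K).injective).1 this
      obtain ⟨b, hb⟩ := (IsIntegrallyClosed.isIntegral_iff (R := ℤ)).1 h1
      exact ⟨b, by simpa using hb.symm⟩
    · obtain ⟨⟨s, hs⟩, ⟨n, hn⟩⟩ := exists_int_of_isIntegral_of_sq hzi (s := 2 * p + q)
        (n := p ^ 2 + p * q + m * q ^ 2) (by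
          rintro ⟨r, hr⟩
          refine hq (hindep (p - r) q ?_).2
          have hr' : (r : K) = z := by simpa using hr
          rw [Rat.cast_sub, hr', hz]; ring) (by
          rw [hz]; push_cast
          linear_combination (q : K) ^ 2 * hw)
      have hmq : (d : ℚ) = 4 * m - 1 := by exact_mod_cast congrArg (Int.cast : ℤ → ℚ) hm
      obtain ⟨b, hb⟩ := Rat.exists_int_of_prime_mul_sq hd (q := q) (n := 4 * n - s ^ 2) (by
        push_cast
        rw [← hn, ← hs, hmq]; ring)
      have hp2 : 2 * p = s - b := by rw [← hb, ← hs]; ring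
      have h4 : (s - b) * (s + b) + 4 * m * b ^ 2 = 4 * n := by
        have : (((s - b) * (s + b) + 4 * m * b ^ 2 : ℤ) : ℚ) = ((4 * n : ℤ) : ℚ) := by
          push_cast
          rw [← hn, ← hs, ← hb]; ring
        exact_mod_cast this
      have h5 : (s - b) % 2 = 0 := by
        have h6 : Even ((s - b) * (s + b)) := ⟨2 * n - 2 * m * b ^ 2, by linarith⟩
        rcases Int.even_mul.1 h6 with h7 | h7
        · exact Int.even_iff.1 h7
        · have := Int.even_iff.1 h7; omega
      refine ⟨⟨(s - b) / 2, ?_⟩, b, hb⟩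
      have h6 : s - b = 2 * ((s - b) / 2) := by omega
      have h7 : ((s - b : ℤ) : ℚ) = 2 * (((s - b) / 2 : ℤ) : ℚ) := by exact_mod_cast h6
      push_cast at h7
      linarith

end ringOfIntegers

section units
variable {m : ℤ}

/-- The norm form. -/
def nrm (x : O m) : ℤ := x.re * x.re + x.re * x.im + m * x.im * x.im

lemma nrm_mul (x y : O m) : nrm (x * y) = nrm x * nrm y := by
  simp only [nrm, QuadraticAlgebra.re_mul, QuadraticAlgebra.im_mul]; ring

lemma nrm_one : nrm (1 : O m) = 1 := by
  simp [nrm, QuadraticAlgebra.re_one, QuadraticAlgebra.im_one]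

lemma four_nrm (x : O m) : 4 * nrm x = (2 * x.re + x.im) ^ 2 + (4 * m - 1) * x.im ^ 2 := by
  simp only [nrm]; ring

lemma nrm_nonneg (hm : 1 ≤ m) (x : O m) : 0 ≤ nrm x := by
  have := four_nrm x
  nlinarith [sq_nonneg (2 * x.re + x.im), sq_nonneg x.im]

lemma nrm_eq_zero (hm : 1 ≤ m) {x : O m} : nrm x = 0 ↔ x = 0 := by
  constructor
  · intro h
    have h4 := four_nrm x
    rw [h] at h4
    have h1 : x.im ^ 2 = 0 := by nlinarith [sq_nonneg (2 * x.re + x.im), sq_nonneg x.im]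
    have h2 : x.im = 0 := by simpa using h1
    rw [h2] at h4
    have h3 : x.re = 0 := by simpa using h4.symm
    ext <;> assumption
  · rintro rfl; simp [nrm]

/-- A generator of the group of units. -/
def uz (m : ℤ) : O m := if m = 1 then ⟨0, 1⟩ else -1

lemma exists_uz_pow (hm : 1 ≤ m) {x y : O m} (h : x * y = 1) : ∃ k < 6, x = uz m ^ k := by
  have hn : nrm x = 1 := by
    have h1 : nrm x * nrm y = 1 := by rw [← nrm_mul, h, nrm_one]
    rcases Int.mul_eq_one_iff_eq_one_or_neg_one.1 h1 with h2 | h2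
    · exact h2.1
    · have := nrm_nonneg hm x; omega
  have h4 := four_nrm x
  rw [hn] at h4
  by_cases h1 : m = 1
  · subst h1
    have hi : x.im ^ 2 ≤ 1 := by nlinarith [sq_nonneg (2 * x.re + x.im)]
    have hi1 : x.im ≤ 1 := by nlinarith
    have hi2 : -1 ≤ x.im := by nlinarith
    have hr : (2 * x.re + x.im) ^ 2 ≤ 4 := by nlinarith [sq_nonneg x.im]
    have hr1 : 2 * x.re + x.im ≤ 2 := by nlinarith
    have hr2 : -2 ≤ 2 * x.re + x.im := by nlinarith
    have hu : uz 1 = ⟨0, 1⟩ := rfl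
    have e0 : uz 1 ^ 0 = ⟨1, 0⟩ := rfl
    have e1 : uz 1 ^ 1 = ⟨0, 1⟩ := rfl
    have e2 : uz 1 ^ 2 = ⟨-1, 1⟩ := rfl
    have e3 : uz 1 ^ 3 = ⟨-1, 0⟩ := rfl
    have e4 : uz 1 ^ 4 = ⟨0, -1⟩ := rfl
    have e5 : uz 1 ^ 5 = ⟨1, -1⟩ := rfl
    obtain ⟨a, b⟩ := x
    simp only at h4 hi1 hi2 hr1 hr2
    have ha1 : -1 ≤ a := by omega
    have ha2 : a ≤ 1 := by omega
    interval_cases b <;> interval_cases a <;> first | (exfalso; norm_num at h4; done) | skip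
    · exact ⟨4, by norm_num, e4.symm⟩
    · exact ⟨5, by norm_num, e5.symm⟩
    · exact ⟨3, by norm_num, e3.symm⟩
    · exact ⟨0, by norm_num, e0.symm⟩
    · exact ⟨2, by norm_num, e2.symm⟩
    · exact ⟨1, by norm_num, e1.symm⟩
  · have hi : x.im ^ 2 = 0 := by
      have : 2 ≤ m := by omega
      nlinarith [sq_nonneg (2 * x.re + x.im), sq_nonneg x.im]
    have hi' : x.im = 0 := by simpa using hi
    rw [hi'] at h4
    have h5 : (x.re - 1) * (x.re + 1) = 0 := by nlinarith
    simp only [uz, if_neg h1]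
    rcases mul_eq_zero.1 h5 with h6 | h6
    · exact ⟨0, by norm_num, by
        ext
        · rw [pow_zero, QuadraticAlgebra.re_one]; omega
        · rw [pow_zero, QuadraticAlgebra.im_one, hi']⟩
    · exact ⟨1, by norm_num, by
        ext
        · rw [pow_one, QuadraticAlgebra.re_neg, QuadraticAlgebra.re_one]; omega
        · rw [pow_one, QuadraticAlgebra.im_neg, QuadraticAlgebra.im_one, hi']; rfl⟩

lemma uz_pow_six : uz m ^ 6 = 1 := by
  by_cases h : m = 1
  · subst h; rfl
  · simp only [uz, if_neg h]; norm_num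

lemma pow_three_sub_one (hm : m % 2 = 1) (x : O m) : 2 ∣ x ∨ 2 ∣ x ^ 3 - 1 := by
  have hm' : (m : ZMod 2) = 1 := by
    have := (emod_two_eq_iff m 1).1 (by omega)
    simpa using this
  have e : x ^ 3 = x * x * x := by ring
  have dv : ∀ z : ℤ, 2 ∣ z ↔ (z : ZMod 2) = 0 := fun z =>
    (ZMod.intCast_zmod_eq_zero_iff_dvd z 2).symm
  simp only [two_dvd_iff, dv, e, QuadraticAlgebra.re_sub, QuadraticAlgebra.im_sub,
    QuadraticAlgebra.re_mul, QuadraticAlgebra.im_mul, QuadraticAlgebra.re_one,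
    QuadraticAlgebra.im_one]
  push_cast
  rw [hm']
  generalize (x.re : ZMod 2) = r
  generalize (x.im : ZMod 2) = s
  revert r s
  decide

end units

section embedding
variable {m : ℤ} {R : Type*} [CommRing R]

lemma dvd_of_symm_dvd (e : O m ≃+* R) (n : ℕ) [n.AtLeastTwo] {x : R}
    (h : (OfNat.ofNat n : O m) ∣ e.symm x) : (OfNat.ofNat n : R) ∣ x := by
  have := map_dvd e h
  rwa [map_ofNat, e.apply_symm_apply] at this

lemma symm_dvd_of_dvd (e : O m ≃+* R) (n : ℕ) [n.AtLeastTwo] {x : R}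
    (h : (OfNat.ofNat n : R) ∣ x) : (OfNat.ofNat n : O m) ∣ e.symm x := by
  have := map_dvd e.symm h
  rwa [map_ofNat] at this

/-- The matrix over `R` attached to an element of `SL₂(O)`. -/
def toGL (e : O m ≃+* R) (g : SL (O m)) : GL (Fin 2) R where
  val := !![e g.a, e g.b; e g.c, e g.d]
  inv := !![e g.d, -e g.b; -e g.c, e g.a]
  val_inv := by
    have h := congrArg e g.det
    rw [map_sub, map_mul, map_mul, map_one] at h
    ext i j; fin_cases i <;> fin_cases j <;> simp <;>
      first | (linear_combination h; done) | ring
  inv_val := by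
    have h := congrArg e g.det
    rw [map_sub, map_mul, map_mul, map_one] at h
    ext i j; fin_cases i <;> fin_cases j <;> simp <;>
      first | (linear_combination h; done) | ring

/-- The embedding of the congruence subgroup of `SL₂(O)` into `Γ₀(16)`. -/
def toGamma0 (e : O m ≃+* R) :
    Cong (m := m) 1 16 (Or.inr ⟨8, by norm_num⟩) →* Gamma0 (Ideal.span {(16 : R)}) where
  toFun g := ⟨toGL e g, by
    show e g.1.c ∈ Ideal.span {(16 : R)}
    rw [Ideal.mem_span_singleton]
    have := map_dvd e g.2.2.2.2
    rwa [map_ofNat] at this⟩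
  map_one' := by
    ext i j; fin_cases i <;> fin_cases j <;> simp [toGL]
  map_mul' g h := by
    ext i j; fin_cases i <;> fin_cases j <;> simp [toGL, Matrix.mul_apply]

lemma toGamma0_injective (e : O m ≃+* R) : Function.Injective (toGamma0 (m := m) e) := by
  intro g h hgh
  have h1 : ∀ i j, (toGL e g.1 : Matrix (Fin 2) (Fin 2) R) i j = (toGL e h.1 : Matrix (Fin 2) (Fin 2) R) i j := by
    intro i j
    rw [show toGL e g.1 = toGL e h.1 from congrArg Subtype.val hgh]
  ext : 2
  · exact e.injective (h1 0 0)
  · exact e.injective (h1 0 1)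
  · exact e.injective (h1 1 0)
  · exact e.injective (h1 1 1)

lemma two_dvd_lower {R : Type*} [CommRing R] (A : Gamma0 (Ideal.span {(16 : R)})) :
    2 ∣ (A.1 : Matrix (Fin 2) (Fin 2) R) 1 0 := by
  have := A.2
  have h : (A.1 : Matrix (Fin 2) (Fin 2) R) 1 0 ∈ Ideal.span {(16 : R)} := this
  rw [Ideal.mem_span_singleton] at h
  exact (show (2 : R) ∣ 16 from ⟨8, by norm_num⟩).trans h

/-- The upper left entry modulo two. -/
def upperLeft (R : Type*) [CommRing R] :
    Gamma0 (Ideal.span {(16 : R)}) →* R ⧸ Ideal.span {(2 : R)} where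
  toFun A := Ideal.Quotient.mk _ ((A.1 : Matrix (Fin 2) (Fin 2) R) 0 0)
  map_one' := by simp
  map_mul' A B := by
    rw [← map_mul, Ideal.Quotient.eq, Ideal.mem_span_singleton]
    obtain ⟨c, hc⟩ := two_dvd_lower B
    refine ⟨(A.1 : Matrix (Fin 2) (Fin 2) R) 0 1 * c, ?_⟩
    simp only [Subgroup.coe_mul, Units.val_mul, Matrix.mul_apply, Fin.sum_univ_two, hc]
    ring

/-- The determinant and the upper left entry modulo two. -/
def detUpper (R : Type*) [CommRing R] :
    Gamma0 (Ideal.span {(16 : R)}) →* Rˣ × (R ⧸ Ideal.span {(2 : R)})ˣ :=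
  (Matrix.GeneralLinearGroup.det.comp (Subgroup.subtype _)).prod (upperLeft R).toHomUnits

lemma range_toGamma0 (e : O m ≃+* R) : (toGamma0 e).range = (detUpper R).ker := by
  ext A
  rw [MonoidHom.mem_ker, MonoidHom.mem_range]
  constructor
  · rintro ⟨g, rfl⟩
    refine Prod.ext (Units.ext ?_) (Units.ext ?_)
    · show (!![e g.1.a, e g.1.b; e g.1.c, e g.1.d] : Matrix _ _ R).det = 1
      rw [Matrix.det_fin_two_of, ← map_mul, ← map_mul, ← map_sub, g.1.det, map_one]
    · show Ideal.Quotient.mk _ (e g.1.a) = 1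
      rw [← map_one (Ideal.Quotient.mk _), Ideal.Quotient.eq, Ideal.mem_span_singleton]
      have := map_dvd e g.2.1
      rwa [map_ofNat, map_sub, map_one] at this
  · intro h
    set a := (A.1 : Matrix (Fin 2) (Fin 2) R) 0 0 with ha
    set b := (A.1 : Matrix (Fin 2) (Fin 2) R) 0 1 with hb
    set c := (A.1 : Matrix (Fin 2) (Fin 2) R) 1 0 with hc
    set d := (A.1 : Matrix (Fin 2) (Fin 2) R) 1 1 with hd
    have h1 : a * d - b * c = 1 := by
      have : (A.1 : Matrix (Fin 2) (Fin 2) R).det = 1 :=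
        congrArg (fun x => ((x.1 : Rˣ) : R)) h
      rwa [Matrix.det_fin_two] at this
    have h2 : 2 ∣ a - 1 := by
      have : Ideal.Quotient.mk (Ideal.span {(2 : R)}) a = 1 :=
        congrArg (fun x => ((x.2 : (R ⧸ Ideal.span {(2 : R)})ˣ) : R ⧸ Ideal.span {(2 : R)})) h
      rwa [← map_one (Ideal.Quotient.mk _), Ideal.Quotient.eq, Ideal.mem_span_singleton] at this
    have h3 : 2 ∣ d - 1 := by
      obtain ⟨x, hx⟩ := h2
      obtain ⟨y, hy⟩ := two_dvd_lower A
      rw [← hc] at hy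
      refine ⟨b * y - x * d, ?_⟩
      linear_combination h1 - d * hx + b * hy
    have h16 : 16 ∣ c := Ideal.mem_span_singleton.1 A.2
    refine ⟨⟨⟨e.symm a, e.symm b, e.symm c, e.symm d, ?_⟩, ?_, ?_, one_dvd _, ?_⟩, ?_⟩
    · rw [← map_mul, ← map_mul, ← map_sub, h1, map_one]
    · have := symm_dvd_of_dvd e 2 h2
      rwa [map_sub, map_one] at this
    · have := symm_dvd_of_dvd e 2 h3
      rwa [map_sub, map_one] at this
    · exact symm_dvd_of_dvd e 16 h16
    · ext i j
      fin_cases i <;> fin_cases j <;> simp [toGamma0, toGL, ha, hb, hc, hd]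

theorem no_order_of_hasLift (hm1 : 1 ≤ m) (hm : m % 2 = 1)
    (H : HasLift (Cong (m := m) 1 16 (Or.inr ⟨8, by norm_num⟩)) (fun _ => 1)) (e : O m ≃+* R)
    {l : ℕ} (hl : l.Prime) (hl5 : 5 ≤ l) :
    ¬ ∃ x : Abelianization (Gamma0 (Ideal.span {(16 : R)})), orderOf x = l := by
  have huz : ∀ u : Rˣ, ∃ k < 6, e.symm u = uz m ^ k := by
    intro u
    refine exists_uz_pow hm1 (y := e.symm (u⁻¹ : Rˣ)) ?_
    rw [← map_mul, Units.mul_inv, map_one]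
  have hfin : Finite Rˣ := by
    choose f hf hf' using huz
    refine Finite.of_injective (fun u => (⟨f u, hf u⟩ : Fin 6)) ?_
    intro u v huv
    have : f u = f v := congrArg Fin.val huv
    exact Units.ext (e.symm.injective (by rw [hf', hf', this]))
  have hu6 : ∀ u : Rˣ, u ^ 6 = 1 := by
    intro u
    obtain ⟨k, -, hk⟩ := huz u
    refine Units.ext (e.symm.injective ?_)
    rw [Units.val_pow_eq_pow_val, map_pow, hk, ← pow_mul, mul_comm, pow_mul, uz_pow_six, one_pow,
      Units.val_one, map_one]
  have hfin2 : Finite (R ⧸ Ideal.span {(2 : R)}) := by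
    refine Finite.of_surjective (fun p : Bool × Bool => Ideal.Quotient.mk (Ideal.span {(2 : R)})
      (e ⟨if p.1 then 1 else 0, if p.2 then 1 else 0⟩)) ?_
    intro q
    obtain ⟨x, rfl⟩ := Ideal.Quotient.mk_surjective q
    refine ⟨((e.symm x).re % 2 = 1, (e.symm x).im % 2 = 1), ?_⟩
    rw [Ideal.Quotient.eq, Ideal.mem_span_singleton]
    refine dvd_of_symm_dvd e 2 ?_
    rw [map_sub, e.symm_apply_apply, two_dvd_iff]
    constructor <;>
      simp only [QuadraticAlgebra.re_sub, QuadraticAlgebra.im_sub, decide_eq_true_eq] <;>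
      split_ifs <;> omega
  have hu3 : ∀ u : (R ⧸ Ideal.span {(2 : R)})ˣ, u ^ 6 = 1 := by
    intro u
    obtain ⟨x, hx⟩ := Ideal.Quotient.mk_surjective (u : R ⧸ Ideal.span {(2 : R)})
    obtain ⟨y, hy⟩ := Ideal.Quotient.mk_surjective ((u⁻¹ : (R ⧸ Ideal.span {(2 : R)})ˣ) :
      R ⧸ Ideal.span {(2 : R)})
    have h3 : u ^ 3 = 1 := by
      refine Units.ext ?_
      rw [Units.val_pow_eq_pow_val, ← hx, Units.val_one, ← map_pow,
        ← map_one (Ideal.Quotient.mk _), Ideal.Quotient.eq, Ideal.mem_span_singleton]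
      refine dvd_of_symm_dvd e 2 ?_
      rw [map_sub, map_pow, map_one]
      refine (pow_three_sub_one hm (e.symm x)).resolve_left ?_
      intro h2
      have h2' := dvd_of_symm_dvd e 2 h2
      have h0 : (u : R ⧸ Ideal.span {(2 : R)}) = 0 := by
        rw [← hx, Ideal.Quotient.eq_zero_iff_mem, Ideal.mem_span_singleton]; exact h2'
      have h1 : (1 : R ⧸ Ideal.span {(2 : R)}) = 0 := by
        rw [← Units.mul_inv u, h0, zero_mul]
      rw [← map_one (Ideal.Quotient.mk _), Ideal.Quotient.eq_zero_iff_mem,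
        Ideal.mem_span_singleton] at h1
      have h4 := symm_dvd_of_dvd e 2 h1
      rw [map_one, two_dvd_iff] at h4
      have := h4.1
      rw [QuadraticAlgebra.re_one] at this
      omega
    rw [show 6 = 3 * 2 by norm_num, pow_mul, h3, one_pow]
  have hfinr : Finite (detUpper R).range := inferInstance
  haveI : Group.FG (detUpper R).range := inferInstance
  refine no_order_prime H (toGamma0 e) (toGamma0_injective e)
    (k := Group.rank (detUpper R).range) ?_ hl hl5
  rw [range_toGamma0, Subgroup.index_ker]
  have := card_dvd_exponent_pow_rank' (G := (detUpper R).range) (n := 6) ?_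
  · exact this
  · rintro ⟨⟨u, v⟩, h⟩
    refine Subtype.ext (Prod.ext ?_ ?_)
    · exact hu6 u
    · exact hu3 v

end embedding

section words
variable {m : ℤ}

/-- The diagonal matrix attached to the fundamental unit. -/
def hz (m : ℤ) : SL (O m) := ⟨uz m, 0, 0, uz m ^ 5, by
  rw [mul_zero, sub_zero, ← pow_succ', uz_pow_six]⟩

lemma trans_mul (x y : O m) : trans x * trans y = trans (x + y) := by
  ext1 <;> simp [trans, add_comm]

lemma trans_zero : trans (0 : O m) = 1 := by
  ext1 <;> simp [trans]

lemma hz_mul_trans (t : O m) : hz m * trans t = trans (uz m ^ 2 * t) * hz m := by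
  have h : uz m ^ 2 * t * uz m ^ 5 = uz m * t := by
    have : uz m ^ 2 * t * uz m ^ 5 = uz m ^ 6 * (uz m * t) := by ring
    rw [this, uz_pow_six, one_mul]
  ext1 <;> simp [trans, hz, h]

/-- The product of the steps `(t, i)`, each standing for a translation followed by `s i`. -/
def wprod (s : ℕ → SL (O m)) : List (O m × ℕ) → SL (O m)
  | [] => 1
  | x :: w => trans x.1 * s x.2 * wprod s w

/-- The increment along a word. -/
def inc {A : Type*} [AddCommGroup A] (s : ℕ → SL (O m)) (ψ : SL (O m) → O m → A)
    (β : ℕ → SL (O m) → A) (g : SL (O m)) : List (O m × ℕ) → A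
  | [] => 0
  | x :: w => ψ g x.1 + β x.2 (g * trans x.1) + inc s ψ β (g * trans x.1 * s x.2) w

/-- The trace form. -/
def tr (x : O m) : ℤ := 2 * x.re + x.im

end words

/-- An oriented edge leaving a face: the next face, and a word closing up the relation. -/
structure Edge (m : ℤ) where
  /-- translation of the next face -/
  t : O m
  /-- index of the next face -/
  n : ℕ
  /-- word along the edge -/
  w : List (O m × ℕ)
  /-- final translation -/
  b : O m
  /-- final unit -/
  k : ℕ

/-- A relation of the shape used for swaps and units. -/
structure Side (m : ℤ) where
  /-- translation -/
  t : O m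
  /-- index of the face -/
  n : ℕ
  /-- final translation -/
  b : O m
  /-- final unit -/
  k : ℕ

/-- The form `N(λ) - 1, λ μ̄, N(μ)` of a column. -/
def colq {m : ℤ} (g : SL (O m)) : ℤ × O m × ℤ := (nrm g.a - 1, g.a * star g.c, nrm g.c)

/-- The combinatorial geometry of a floor of isometric hemispheres. -/
structure Geom (m : ℤ) where
  /-- one matrix for each face -/
  s : ℕ → SL (O m)
  /-- number of faces -/
  n : ℕ
  /-- common denominator of the centers -/
  L : ℤ
  /-- weight of the lower row -/
  M : ℤ
  /-- bound on the displacement between adjacent faces -/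
  B : ℤ
  /-- scaled centers -/
  C : ℕ → O m
  /-- scaled weights -/
  W : ℕ → ℤ
  /-- scaled squared radii -/
  R : ℕ → ℤ
  /-- edges of each face -/
  E : ℕ → List (Edge m)
  /-- inverse of each face -/
  sw : ℕ → Side m
  /-- rotation of each face -/
  un : ℕ → Side m
  one_le : 1 ≤ m
  L_pos : 0 < L
  M_gt : 1 < M
  N_pos : ∀ i < n, 0 < nrm (s i).c
  hC : ∀ i < n, (nrm (s i).c : O m) * C i = (L : O m) * ((s i).a * star (s i).c)
  hR : ∀ i < n, nrm (s i).c * R i = L ^ 2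
  hW : ∀ i < n, L * W i = nrm (C i) - R i
  cover : ∀ z : O m, ∀ q : ℤ, 0 < q → ∃ i < n, ∃ t : O m,
    M * nrm ((q : O m) * (C i + (L : O m) * t) - (L : O m) * z) + L ^ 2 * q ^ 2 < M * R i * q ^ 2
  sw_lt : ∀ i < n, (sw i).n < n
  sw_eq : ∀ i < n, s i * trans (sw i).t * s (sw i).n = trans (sw i).b * hz m ^ (sw i).k
  un_lt : ∀ i < n, (un i).n < n
  un_eq : ∀ i < n, hz m * s i = trans (un i).t * s (un i).n * trans (un i).b * hz m ^ (un i).k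
  E_lt : ∀ i < n, ∀ e ∈ E i, e.n < n ∧ ∀ x ∈ e.w, x.2 < n
  E_eq : ∀ i < n, ∀ e ∈ E i,
    s i * wprod s e.w = trans e.t * s e.n * trans e.b * hz m ^ e.k
  E_mid : ∀ i < n, ∀ e ∈ E i, ∀ w ∈ e.w.inits, w ≠ [] → ∃ A B D : ℤ, 0 ≤ A ∧ 0 < B ∧ 0 < D ∧
    (D : ℤ) • colq (s i * wprod s w) = A • colq (s i) + B • colq (trans e.t * s e.n)
  E_disp : ∀ i < n, ∀ e ∈ E i, C e.n + (L : O m) * e.t ≠ C i ∧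
    |(C e.n + (L : O m) * e.t - C i).re| ≤ B ∧ |(C e.n + (L : O m) * e.t - C i).im| ≤ B
  farkas : ∀ j < n, ∀ k < n, ∀ t : O m, nrm (C k + (L : O m) * t - C j) ≤ 2 * (R j + R k) →
    (k = j ∧ t = 0) ∨ (C k + (L : O m) * t ≠ C j ∧ ∃ e ∈ E j, ∃ e' ∈ E j, ∃ a a' D : ℤ,
      0 ≤ a ∧ 0 ≤ a' ∧ 0 < D ∧
      (D : O m) * (C k + (L : O m) * t - C j) =
        (a : O m) * (C e.n + (L : O m) * e.t - C j) + (a' : O m) * (C e'.n + (L : O m) * e'.t - C j) ∧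
      a * (W e.n + tr (C e.n * star e.t) + L * nrm e.t - W j) +
        a' * (W e'.n + tr (C e'.n * star e'.t) + L * nrm e'.t - W j) ≤
        D * (W k + tr (C k * star t) + L * nrm t - W j))

section forms
variable {m : ℤ}

/-- The positive definite Hermitian form attached to the columns of `g`, at the first column. -/
def hform (M : ℤ) (g : SL (O m)) : ℤ := nrm g.a + M * nrm g.c

/-- The off-diagonal entry of the Hermitian form. -/
def hoff (M : ℤ) (g : SL (O m)) : O m := g.a * star g.b + (M : O m) * (g.c * star g.d)

/-- The Hermitian form at the second column. -/
def hlow (M : ℤ) (g : SL (O m)) : ℤ := nrm g.b + M * nrm g.d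

lemma tr_add (x y : O m) : tr (x + y) = tr x + tr y := by
  simp [tr]; ring

lemma tr_int_mul (k : ℤ) (x : O m) : tr ((k : O m) * x) = k * tr x := by
  simp [tr]; ring

lemma nrm_int_mul (k : ℤ) (x : O m) : nrm ((k : O m) * x) = k ^ 2 * nrm x := by
  simp [nrm]; ring

lemma nrm_add (x y : O m) : nrm (x + y) = nrm x + nrm y + tr (x * star y) := by
  simp [nrm, tr]; ring

lemma nrm_star (x : O m) : nrm (star x) = nrm x := by
  simp [nrm]; ring

lemma tr_star (x : O m) : tr (star x) = tr x := by
  simp [tr]; ring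

lemma mul_star_self (x : O m) : x * star x = (nrm x : O m) := by
  ext <;> simp [nrm] <;> ring

lemma hform_mul (M : ℤ) (g h : SL (O m)) : hform M (g * h) =
    hform M g + (hform M g * (colq h).1 + tr (hoff M g * (colq h).2.1) +
      hlow M g * (colq h).2.2) := by
  have e1 : nrm (g * h).a = nrm g.a * nrm h.a + nrm g.b * nrm h.c +
      tr (g.a * star g.b * (h.a * star h.c)) := by
    rw [SL.mul_a, nrm_add, nrm_mul, nrm_mul, star_mul]
    congr 2; ring
  have e2 : nrm (g * h).c = nrm g.c * nrm h.a + nrm g.d * nrm h.c +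
      tr (g.c * star g.d * (h.a * star h.c)) := by
    rw [SL.mul_c, nrm_add, nrm_mul, nrm_mul, star_mul]
    congr 2; ring
  simp only [hform, hoff, hlow, colq, e1, e2, add_mul, tr_add, mul_assoc, tr_int_mul]
  ring

lemma hform_mul_hlow (M : ℤ) (g : SL (O m)) :
    hform M g * hlow M g = nrm (hoff M g) + M := by
  have h1 : nrm (g.a * g.d - g.b * g.c) = 1 := by rw [g.det, nrm_one]
  rw [sub_eq_add_neg, nrm_add] at h1
  have h2 : tr (g.a * g.d * star (-(g.b * g.c))) = -tr (g.a * star g.b * star (g.c * star g.d)) := by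
    have : g.a * g.d * star (-(g.b * g.c)) =
        ((-1 : ℤ) : O m) * (g.a * star g.b * star (g.c * star g.d)) := by
      simp only [star_neg, star_mul, star_star]; push_cast; ring
    rw [this, tr_int_mul]; ring
  have h3 : nrm (-(g.b * g.c)) = nrm g.b * nrm g.c := by
    rw [show -(g.b * g.c) = ((-1 : ℤ) : O m) * (g.b * g.c) by push_cast; ring, nrm_int_mul, nrm_mul]
    ring
  rw [h2, h3, nrm_mul] at h1
  have h4 : tr (g.a * star g.b * star ((M : O m) * (g.c * star g.d))) =
      M * tr (g.a * star g.b * star (g.c * star g.d)) := by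
    rw [← tr_int_mul]
    congr 1
    simp only [star_mul, star_star, star_intCast]; ring
  rw [hoff, nrm_add, h4, nrm_int_mul, nrm_mul, nrm_mul, nrm_star, nrm_star]
  simp only [hform, hlow]
  linear_combination M * h1

lemma hform_mul_trans (M : ℤ) (g : SL (O m)) (t : O m) : hform M (g * trans t) = hform M g := by
  simp [hform, trans]

lemma nrm_uz : nrm (uz m) = 1 := by
  unfold uz
  split_ifs with h
  · subst h; rfl
  · simp [nrm, QuadraticAlgebra.re_one, QuadraticAlgebra.im_one]

lemma nrm_zero : nrm (0 : O m) = 0 := by simp [nrm]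

lemma hform_mul_hz (M : ℤ) (g : SL (O m)) : hform M (g * hz m) = hform M g := by
  simp [hform, hz, nrm_mul, nrm_uz]

lemma hform_mul_hz_pow (M : ℤ) (g : SL (O m)) (k : ℕ) :
    hform M (g * hz m ^ k) = hform M g := by
  induction k with
  | zero => simp
  | succ k ih => rw [pow_succ, ← mul_assoc, hform_mul_hz, ih]

end forms

namespace Geom
variable {m : ℤ} (G : Geom m)

/-- The scaled weight of a translated face. -/
def Wt (t : O m) (i : ℕ) : ℤ := G.W i + tr (G.C i * star t) + G.L * nrm t

/-- The power of `g` with respect to a face. -/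
def P (g : SL (O m)) (t : O m) (i : ℕ) : ℤ :=
  hform G.M g * G.Wt t i + tr (hoff G.M g * (G.C i + (G.L : O m) * t)) + G.L * hlow G.M g

variable {G}

lemma intCast_cancel {n : ℤ} (hn : n ≠ 0) {x y : O m} (h : (n : O m) * x = (n : O m) * y) :
    x = y := by
  have h1 := congrArg QuadraticAlgebra.re h
  have h2 := congrArg QuadraticAlgebra.im h
  simp at h1 h2
  ext
  · exact h1.resolve_right hn
  · exact h2.resolve_right hn

lemma nrm_mul_P {i : ℕ} (hi : i < G.n) (g : SL (O m)) (t : O m) : nrm (G.s i).c * G.P g t i =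
    G.L * (hform G.M (g * trans t * G.s i) - hform G.M g) := by
  have hN := G.N_pos i hi
  have hC := G.hC i hi
  have hR := G.hR i hi
  have hW := G.hW i hi
  set N := nrm (G.s i).c with hNd
  have hL := G.L_pos
  set l := (G.s i).a
  set u := (G.s i).c with hu
  have e1 : N * nrm (G.C i) = G.L ^ 2 * nrm l := by
    have := congrArg nrm hC
    rw [nrm_int_mul, nrm_int_mul, nrm_mul, nrm_star, ← hNd] at this
    apply mul_left_cancel₀ hN.ne'
    linear_combination this
  have e2 : N * G.W i = G.L * (nrm l - 1) := by
    apply mul_left_cancel₀ hL.ne'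
    linear_combination N * hW + e1 - hR
  have ct : N * tr (G.C i * star t) = G.L * tr (l * star (t * u)) := by
    rw [← tr_int_mul, ← tr_int_mul, ← mul_assoc, hC]
    congr 1; rw [star_mul]; ring
  have e3 : N * G.Wt t i = G.L * (nrm (l + t * u) - 1) := by
    rw [nrm_add, nrm_mul, Wt, ← hNd]
    linear_combination e2 + ct
  have e4 : (N : O m) * (G.C i + (G.L : O m) * t) = (G.L : O m) * ((l + t * u) * star u) := by
    rw [mul_add, hC, hNd, ← mul_star_self]; ring
  have e5 : N * tr (hoff G.M g * (G.C i + (G.L : O m) * t)) =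
      G.L * tr (hoff G.M g * ((l + t * u) * star u)) := by
    rw [← tr_int_mul, ← tr_int_mul]
    congr 1
    linear_combination hoff G.M g * e4
  rw [mul_assoc g, hform_mul]
  have c1 : (trans t * G.s i).a = l + t * u := by simp [trans, l, u]
  have c2 : (trans t * G.s i).c = u := by simp [trans, u]
  simp only [colq, c1, c2, P, ← hNd]
  linear_combination hform G.M g * e3 + e5

lemma P_neg_iff {i : ℕ} (hi : i < G.n) (g : SL (O m)) (t : O m) :
    G.P g t i < 0 ↔ hform G.M (g * trans t * G.s i) < hform G.M g := by
  have h := nrm_mul_P hi g t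
  have hN := G.N_pos i hi
  have hL := G.L_pos
  constructor
  · intro hp
    have : G.L * (hform G.M (g * trans t * G.s i) - hform G.M g) < 0 := by
      rw [← h]; exact mul_neg_of_pos_of_neg hN hp
    have := (pos_iff_neg_of_mul_neg this).1 hL
    linarith
  · intro hp
    have : nrm (G.s i).c * G.P g t i < 0 := by
      rw [h]; exact mul_neg_of_pos_of_neg hL (by linarith)
    exact (pos_iff_neg_of_mul_neg this).1 hN

lemma P_eq_zero_iff {i : ℕ} (hi : i < G.n) (g : SL (O m)) (t : O m) :
    G.P g t i = 0 ↔ hform G.M (g * trans t * G.s i) = hform G.M g := by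
  have h := nrm_mul_P hi g t
  have hN := G.N_pos i hi
  have hL := G.L_pos
  constructor
  · intro hp
    rw [hp, mul_zero] at h
    have := (mul_eq_zero.1 h.symm).resolve_left hL.ne'
    linarith
  · intro hp
    rw [hp, sub_self, mul_zero] at h
    exact (mul_eq_zero.1 h).resolve_left hN.ne'

lemma L_mul_Wt {i : ℕ} (hi : i < G.n) (t : O m) :
    G.L * G.Wt t i = nrm (G.C i + (G.L : O m) * t) - G.R i := by
  have hW := G.hW i hi
  have : tr (G.C i * star ((G.L : O m) * t)) = G.L * tr (G.C i * star t) := by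
    rw [← tr_int_mul]; congr 1; rw [star_mul, star_intCast]; ring
  rw [nrm_add, nrm_int_mul, this, Wt]
  linear_combination hW

lemma P_spec {i : ℕ} (hi : i < G.n) (g : SL (O m)) (t : O m) :
    hform G.M g * (G.L * G.P g t i) =
      nrm ((hform G.M g : O m) * (G.C i + (G.L : O m) * t) + (G.L : O m) * star (hoff G.M g)) +
        G.L ^ 2 * G.M - hform G.M g ^ 2 * G.R i := by
  have h1 := L_mul_Wt hi t
  have h2 := hform_mul_hlow G.M g
  have h3 : tr ((hform G.M g : O m) * (G.C i + (G.L : O m) * t) *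
      star ((G.L : O m) * star (hoff G.M g))) =
      hform G.M g * (G.L * tr (hoff G.M g * (G.C i + (G.L : O m) * t))) := by
    rw [← tr_int_mul, ← tr_int_mul]; congr 1
    rw [star_mul, star_star, star_intCast]; ring
  rw [nrm_add, nrm_int_mul, nrm_int_mul, nrm_star, h3, P]
  linear_combination hform G.M g ^ 2 * h1 + G.L ^ 2 * h2

lemma Wt_trans (s t : O m) (i : ℕ) : G.Wt (s + t) i =
    G.Wt t i + tr ((G.C i + (G.L : O m) * t) * star s) + G.L * nrm s := by
  simp only [Wt, star_add, mul_add, add_mul, tr_add, nrm_add, mul_assoc, tr_int_mul]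
  have : tr (s * star t) = tr (t * star s) := by
    rw [← tr_star (s * star t)]; congr 1; rw [star_mul, star_star]
  rw [this]; ring

lemma hoff_mul_trans (M : ℤ) (g : SL (O m)) (s : O m) :
    hoff M (g * trans s) = hoff M g + (hform M g : O m) * star s := by
  have h1 := mul_star_self g.a
  have h2 := mul_star_self g.c
  simp [hoff, trans, hform]
  linear_combination star s * h1 + M * star s * h2

lemma hlow_mul_trans (M : ℤ) (g : SL (O m)) (s : O m) :
    hlow M (g * trans s) = hform M g * nrm s + tr (hoff M g * s) + hlow M g := by
  simp only [hlow, hoff, hform, SL.mul_b, SL.mul_d, trans, mul_one, nrm_add, nrm_mul, star_mul,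
    add_mul, tr_add, mul_assoc, tr_int_mul]
  rw [show g.a * (s * star g.b) = g.a * (star g.b * s) by ring,
    show g.c * (s * star g.d) = g.c * (star g.d * s) by ring]
  ring

lemma P_trans (g : SL (O m)) (s t : O m) (i : ℕ) : G.P (g * trans s) t i = G.P g (s + t) i := by
  simp only [P, hform_mul_trans, hoff_mul_trans, hlow_mul_trans, Wt_trans, add_mul, mul_add,
    tr_add, mul_assoc, tr_int_mul]
  rw [show hoff G.M g * ((G.L : O m) * s) = (G.L : O m) * (hoff G.M g * s) by ring, tr_int_mul,
    show star s * ((G.L : O m) * t) = (G.L : O m) * (t * star s) by ring, tr_int_mul,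
    mul_comm (star s)]
  ring

lemma exists_P_neg {g : SL (O m)} (hc : g.c ≠ 0) : ∃ i < G.n, ∃ t, G.P g t i < 0 := by
  have hm := G.one_le
  have hM := G.M_gt
  have hL := G.L_pos
  have hq : G.M ≤ hform G.M g := by
    have h1 := nrm_nonneg hm g.a
    have h2 := nrm_nonneg hm g.c
    have h3 : nrm g.c ≠ 0 := fun h => hc ((nrm_eq_zero hm).1 h)
    have h4 : 1 ≤ nrm g.c := by omega
    unfold hform
    nlinarith
  obtain ⟨i, hi, t, h⟩ := G.cover (-star (hoff G.M g)) (hform G.M g) (by linarith)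
  refine ⟨i, hi, t, ?_⟩
  have h1 := P_spec hi g t
  rw [mul_neg, sub_neg_eq_add] at h
  have h2 : hform G.M g * (G.L * G.P g t i) < 0 := by
    rw [h1]
    have : G.M ^ 2 ≤ hform G.M g ^ 2 := by gcongr
    have : G.L ^ 2 * G.M ^ 2 ≤ G.L ^ 2 * hform G.M g ^ 2 := by gcongr
    by_contra hcon
    push Not at hcon
    have := mul_nonneg (by linarith : 0 ≤ G.M) hcon
    nlinarith
  have h3 := (pos_iff_neg_of_mul_neg h2).1 (by linarith)
  exact (pos_iff_neg_of_mul_neg h3).1 hL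

lemma c_eq_zero_of {g : SL (O m)} (h : hform G.M g ≤ 1) : g.c = 0 := by
  by_contra hc
  have h2 := nrm_nonneg G.one_le g.c
  have h3 : nrm g.c ≠ 0 := fun h => hc ((nrm_eq_zero G.one_le).1 h)
  have h4 : 1 ≤ nrm g.c := by omega
  have h5 := nrm_nonneg G.one_le g.a
  have := G.M_gt
  unfold hform at h
  nlinarith

lemma hform_of_c {g : SL (O m)} (h : g.c = 0) : hform G.M g = 1 := by
  have hd := g.det
  rw [h, mul_zero, sub_zero] at hd
  obtain ⟨k, -, hk⟩ := exists_uz_pow G.one_le hd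
  have : ∀ k : ℕ, nrm (uz m ^ k) = 1 := by
    intro k
    induction k with
    | zero => simp [nrm_one]
    | succ k ih => rw [pow_succ, nrm_mul, ih, nrm_uz, one_mul]
  simp [hform, h, hk, this, nrm_zero]

variable (G) in
lemma one_le_hform (g : SL (O m)) : 1 ≤ hform G.M g := by
  by_contra hc
  push Not at hc
  have := hform_of_c (G := G) (c_eq_zero_of (G := G) (g := g) (by omega))
  omega

lemma c_ne_zero_of_P_nonpos {g : SL (O m)} {t : O m} {i : ℕ} (hi : i < G.n) (h : G.P g t i ≤ 0) :
    g.c ≠ 0 := by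
  intro hc
  have h1 := hform_of_c (G := G) hc
  have h2 : hform G.M (g * trans t * G.s i) ≤ 1 := by
    refine le_trans ?_ h1.le
    rcases h.lt_or_eq with h | h
    · exact ((P_neg_iff hi g t).1 h).le
    · exact ((P_eq_zero_iff hi g t).1 h).le
  have h3 := c_eq_zero_of h2
  have h3 : g.d * (G.s i).c = 0 := by
    simp only [SL.mul_c, SL.mul_d, trans, hc, zero_mul, zero_add, mul_one] at h3
    simpa using h3
  have hd := g.det
  rw [hc, mul_zero, sub_zero] at hd
  have h4 : (G.s i).c = 0 := by linear_combination g.a * h3 - (G.s i).c * hd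
  have := G.N_pos i hi
  rw [h4] at this
  simp [nrm_zero] at this

end Geom

lemma finite_nrm_le {m : ℤ} (hm : 1 ≤ m) (b : ℤ) : {x : O m | nrm x ≤ b}.Finite := by
  have : Set.Finite ((fun p : ℤ × ℤ => (⟨p.1, p.2⟩ : O m)) ''
      (Set.Icc (-(2 * b)) (2 * b) ×ˢ Set.Icc (-(2 * b)) (2 * b))) :=
    ((Set.finite_Icc _ _).prod (Set.finite_Icc _ _)).image _
  refine this.subset fun x hx => ⟨(x.re, x.im), ?_, rfl⟩
  simp only [Set.mem_setOf_eq, nrm] at hx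
  have h0 : x.im * x.im ≤ m * x.im * x.im := by nlinarith [mul_self_nonneg x.im]
  have h1 : x.re * x.re + x.re * x.im + x.im * x.im ≤ b := by linarith
  have sq (y : ℤ) : y ≤ y * y := by
    rcases le_or_gt y 0 with h | h <;> nlinarith
  have sq' (y : ℤ) : -y ≤ y * y := by simpa using sq (-y)
  have h2 : 3 * (x.re * x.re) ≤ 4 * b := by nlinarith [mul_self_nonneg (x.re + 2 * x.im)]
  have h3 : 3 * (x.im * x.im) ≤ 4 * b := by nlinarith [mul_self_nonneg (2 * x.re + x.im)]
  have a1 := sq x.re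
  have a2 := sq' x.re
  have a3 := sq x.im
  have a4 := sq' x.im
  simp only [Set.mem_prod, Set.mem_Icc]
  refine ⟨⟨?_, ?_⟩, ?_, ?_⟩ <;> linarith

namespace Geom
variable {m : ℤ} {G : Geom m}

lemma hform_pos (G : Geom m) (g : SL (O m)) : 0 < hform G.M g :=
  lt_of_lt_of_le one_pos (one_le_hform G g)

lemma nrm_le_of_P_nonpos {g : SL (O m)} {t : O m} {i : ℕ} (hi : i < G.n) (h : G.P g t i ≤ 0) :
    nrm ((hform G.M g : O m) * (G.C i + (G.L : O m) * t) + (G.L : O m) * star (hoff G.M g)) ≤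
      hform G.M g ^ 2 * G.R i := by
  have h1 := P_spec hi g t
  have h2 := hform_pos G g
  have h3 := G.L_pos
  have h4 : hform G.M g * (G.L * G.P g t i) ≤ 0 :=
    mul_nonpos_of_nonneg_of_nonpos h2.le (mul_nonpos_of_nonneg_of_nonpos h3.le h)
  have h5 : 0 ≤ G.L ^ 2 * G.M := by have := G.M_gt; positivity
  linarith

lemma finite_P_neg (g : SL (O m)) :
    {x : O m × ℕ | x.2 < G.n ∧ G.P g x.1 x.2 < 0}.Finite := by
  have : {x : O m × ℕ | x.2 < G.n ∧ G.P g x.1 x.2 < 0} ⊆ ⋃ i ∈ Set.Iio G.n,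
      (fun t => (t, i)) '' ((fun t => (hform G.M g : O m) * (G.C i + (G.L : O m) * t) +
        (G.L : O m) * star (hoff G.M g)) ⁻¹' {x : O m | nrm x ≤ hform G.M g ^ 2 * G.R i}) := by
    rintro ⟨t, i⟩ ⟨hi, h⟩
    simp only [Set.mem_iUnion]
    exact ⟨i, hi, t, nrm_le_of_P_nonpos hi h.le, rfl⟩
  refine Set.Finite.subset (Set.Finite.biUnion (Set.finite_Iio _) fun i _ => ?_) this
  refine ((finite_nrm_le G.one_le _).preimage fun x _ y _ hxy => ?_).image _
  apply intCast_cancel G.L_pos.ne'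
  apply intCast_cancel (hform_pos G g).ne'
  linear_combination hxy

lemma nrm_sub_le_of_P_nonpos {g : SL (O m)} {t : O m} {j k : ℕ} (hj : j < G.n) (hk : k < G.n)
    (h : G.P g 0 j ≤ 0) (h' : G.P g t k ≤ 0) :
    nrm (G.C k + (G.L : O m) * t - G.C j) ≤ 2 * (G.R j + G.R k) := by
  have h1 := nrm_le_of_P_nonpos hj h
  have h2 := nrm_le_of_P_nonpos hk h'
  rw [mul_zero, add_zero] at h1
  have h3 := hform_pos G g
  set q := hform G.M g
  set x := (q : O m) * G.C j + (G.L : O m) * star (hoff G.M g)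
  set y := (q : O m) * (G.C k + (G.L : O m) * t) + (G.L : O m) * star (hoff G.M g)
  have h4 : (q : O m) * (G.C k + (G.L : O m) * t - G.C j) = y - x := by simp only [x, y]; ring
  have h5 : nrm (y - x) + nrm (y + x) = 2 * nrm x + 2 * nrm y := by simp [nrm]; ring
  have h6 := nrm_nonneg G.one_le (y + x)
  rw [← h4, nrm_int_mul] at h5
  have : q ^ 2 * nrm (G.C k + (G.L : O m) * t - G.C j) ≤ q ^ 2 * (2 * (G.R j + G.R k)) := by
    linarith
  exact le_of_mul_le_mul_left this (by positivity)

/-- A generic perturbation of `P`. -/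
def key (G : Geom m) (g : SL (O m)) (t : O m) (i : ℕ) : ℤ :=
  G.P g t i * (|G.B| + 2) ^ 2 + (G.C i + (G.L : O m) * t).re * (|G.B| + 2) +
    (G.C i + (G.L : O m) * t).im

lemma key_trans (g : SL (O m)) (s t : O m) (i : ℕ) : G.key (g * trans s) t i =
    G.key g (s + t) i - ((G.L * s.re) * (|G.B| + 2) + G.L * s.im) := by
  simp [key, P_trans]; ring

lemma key_ne_and_le {j : ℕ} (hj : j < G.n) {e : Edge m} (he : e ∈ G.E j) (g : SL (O m)) :
    G.key g e.t e.n ≠ G.key g 0 j ∧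
      (G.key g e.t e.n < G.key g 0 j → G.P g e.t e.n ≤ G.P g 0 j) := by
  obtain ⟨h1, h2, h3⟩ := G.E_disp j hj e he
  simp only [key, mul_zero, add_zero]
  set B := |G.B| with hB
  have hB0 : 0 ≤ B := abs_nonneg _
  have h2' := h2.trans (le_abs_self G.B)
  have h3' := h3.trans (le_abs_self G.B)
  rw [abs_le, ← hB] at h2' h3'
  set x := G.C e.n + (G.L : O m) * e.t
  set y := G.C j
  simp only [QuadraticAlgebra.re_sub, QuadraticAlgebra.im_sub] at h2' h3'
  constructor
  · intro h
    have hd : G.P g e.t e.n - G.P g 0 j = 0 := by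
      rcases lt_trichotomy (G.P g e.t e.n - G.P g 0 j) 0 with h0 | h0 | h0
      · exfalso
        have : (G.P g e.t e.n - G.P g 0 j) * (B + 2) ^ 2 ≤ (-1) * (B + 2) ^ 2 := by
          gcongr; lia
        nlinarith
      · exact h0
      · exfalso
        have : 1 * (B + 2) ^ 2 ≤ (G.P g e.t e.n - G.P g 0 j) * (B + 2) ^ 2 := by
          gcongr; lia
        nlinarith
    have hr : x.re - y.re = 0 := by
      have : (x.re - y.re) * (B + 2) + (x.im - y.im) = 0 := by
        linear_combination h - (B + 2) ^ 2 * hd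
      rcases lt_trichotomy (x.re - y.re) 0 with h0 | h0 | h0
      · exfalso
        have : (x.re - y.re) * (B + 2) ≤ (-1) * (B + 2) := by gcongr; lia
        linarith
      · exact h0
      · exfalso
        have : 1 * (B + 2) ≤ (x.re - y.re) * (B + 2) := by gcongr; lia
        linarith
    have hi : x.im - y.im = 0 := by
      linear_combination h - (B + 2) ^ 2 * hd - (B + 2) * hr
    exact h1 (by ext <;> linarith)
  · intro h
    by_contra hc
    push Not at hc
    have : 1 * (B + 2) ^ 2 ≤ (G.P g e.t e.n - G.P g 0 j) * (B + 2) ^ 2 := by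
      gcongr; lia
    nlinarith

lemma tr_sub (x y : O m) : tr (x - y) = tr x - tr y := by
  simp [tr]; ring

lemma farkas_P {j k : ℕ} (hj : j < G.n) (hk : k < G.n) {g : SL (O m)} {t : O m}
    (h : G.P g 0 j ≤ 0) (h' : G.P g t k ≤ 0) :
    (k = j ∧ t = 0) ∨ (∃ e ∈ G.E j, ∃ e' ∈ G.E j, ∃ a a' D : ℤ, 0 ≤ a ∧ 0 ≤ a' ∧ 0 < D ∧
      (a ≠ 0 ∨ a' ≠ 0) ∧
      a * (G.P g e.t e.n - G.P g 0 j) + a' * (G.P g e'.t e'.n - G.P g 0 j) ≤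
        D * (G.P g t k - G.P g 0 j) ∧
      a * (G.key g e.t e.n - G.key g 0 j) + a' * (G.key g e'.t e'.n - G.key g 0 j) ≤
        D * (G.key g t k - G.key g 0 j)) := by
  rcases G.farkas j hj k hk t (nrm_sub_le_of_P_nonpos hj hk h h') with h0 | h0
  · exact Or.inl h0
  obtain ⟨hne, e, he, e', he', a, a', D, ha, ha', hD, hC, hW⟩ := h0
  refine Or.inr ⟨e, he, e', he', a, a', D, ha, ha', hD, ?_, ?_⟩
  · by_contra hc
    push Not at hc
    rw [hc.1, hc.2, Int.cast_zero, zero_mul, zero_mul, add_zero] at hC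
    apply hne
    have : (D : O m) * (G.C k + (G.L : O m) * t) = (D : O m) * G.C j := by
      linear_combination hC
    exact intCast_cancel hD.ne' this
  have w0 : G.Wt 0 j = G.W j := by simp [Wt, tr, nrm]
  have hW' : a * (G.Wt e.t e.n - G.Wt 0 j) + a' * (G.Wt e'.t e'.n - G.Wt 0 j) ≤
      D * (G.Wt t k - G.Wt 0 j) := by rw [w0]; exact hW
  have htr : D * (tr (hoff G.M g * (G.C k + (G.L : O m) * t)) - tr (hoff G.M g * G.C j)) =
      a * (tr (hoff G.M g * (G.C e.n + (G.L : O m) * e.t)) - tr (hoff G.M g * G.C j)) +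
      a' * (tr (hoff G.M g * (G.C e'.n + (G.L : O m) * e'.t)) - tr (hoff G.M g * G.C j)) := by
    simp only [← tr_sub, ← mul_sub, ← tr_int_mul, ← tr_add]
    congr 1
    linear_combination hoff G.M g * hC
  have hP : a * (G.P g e.t e.n - G.P g 0 j) + a' * (G.P g e'.t e'.n - G.P g 0 j) ≤
        D * (G.P g t k - G.P g 0 j) := by
    have := mul_le_mul_of_nonneg_left hW' (hform_pos G g).le
    simp only [P, mul_zero, add_zero]
    linarith
  refine ⟨hP, ?_⟩
  have hre := congrArg QuadraticAlgebra.re hC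
  have him := congrArg QuadraticAlgebra.im hC
  simp only [QuadraticAlgebra.re_add, QuadraticAlgebra.im_add, QuadraticAlgebra.re_sub,
    QuadraticAlgebra.im_sub, QuadraticAlgebra.re_mul, QuadraticAlgebra.im_mul,
    QuadraticAlgebra.re_intCast, QuadraticAlgebra.im_intCast, mul_zero, zero_mul, add_zero,
    zero_add] at hre him
  have := mul_le_mul_of_nonneg_right hP (sq_nonneg (|G.B| + 2))
  simp only [key, QuadraticAlgebra.re_add, QuadraticAlgebra.im_add,
    QuadraticAlgebra.re_mul, QuadraticAlgebra.im_mul,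
    QuadraticAlgebra.re_intCast, QuadraticAlgebra.im_intCast, mul_zero, zero_mul, add_zero,
    zero_add, QuadraticAlgebra.re_zero, QuadraticAlgebra.im_zero]
  simp only [Int.cast_id] at hre him ⊢
  linear_combination this - (|G.B| + 2) * hre - him

lemma exists_edge_P_neg {j k : ℕ} (hj : j < G.n) (hk : k < G.n) {g : SL (O m)} {t : O m}
    (h : G.P g 0 j = 0) (h' : G.P g t k < 0) : ∃ e ∈ G.E j, G.P g e.t e.n < 0 := by
  rcases farkas_P hj hk h.le h'.le with ⟨rfl, rfl⟩ | h0
  · exact absurd h h'.ne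
  obtain ⟨e, he, e', he', a, a', D, ha, ha', hD, -, hP, -⟩ := h0
  by_contra hc
  push Not at hc
  have h1 := mul_nonneg ha (hc e he)
  have h2 := mul_nonneg ha' (hc e' he')
  have h3 := mul_neg_of_pos_of_neg hD h'
  rw [h] at hP
  linarith

/-- A function on strictly descending faces that is constant along edges is constant. -/
lemma eq_of_edges {A : Type*} {g : SL (O m)} (V : O m → ℕ → A)
    (hV : ∀ t, ∀ i < G.n, G.P g t i < 0 → ∀ e ∈ G.E i, G.P g (t + e.t) e.n < 0 →
      V t i = V (t + e.t) e.n)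
    {t : O m} {i : ℕ} (hi : i < G.n) (h : G.P g t i < 0)
    {t' : O m} {i' : ℕ} (hi' : i' < G.n) (h' : G.P g t' i' < 0) : V t i = V t' i' := by
  set S := {x : O m × ℕ | x.2 < G.n ∧ G.P g x.1 x.2 < 0} with hS
  have hfin : S.Finite := finite_P_neg g
  obtain ⟨⟨t0, i0⟩, ⟨hi0, hP0⟩, hmin⟩ := Set.exists_min_image S (fun x => G.key g x.1 x.2) hfin
    ⟨(t, i), hi, h⟩
  simp only at hi0 hP0 hmin
  have main : ∀ N : ℕ, ∀ x ∈ S, G.key g x.1 x.2 - G.key g t0 i0 = N → V x.1 x.2 = V t0 i0 := by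
    intro N
    induction N using Nat.strong_induction_on with
    | _ N ih =>
    rintro ⟨s, j⟩ ⟨hj, hPj⟩ hN
    simp only at hj hPj hN ⊢
    by_cases hloc : ∃ e ∈ G.E j, G.key g (s + e.t) e.n < G.key g s j
    · obtain ⟨e, he, hlt⟩ := hloc
      have hk := (key_ne_and_le hj he (g * trans s)).2
      rw [key_trans, key_trans, P_trans, P_trans, add_zero] at hk
      have hP' : G.P g (s + e.t) e.n < 0 := lt_of_le_of_lt (hk (by linarith)) hPj
      have hn := (G.E_lt j hj e he).1
      have h0 := hmin (s + e.t, e.n) ⟨hn, hP'⟩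
      simp only at h0
      rw [hV s j hj hPj e he hP']
      exact ih (G.key g (s + e.t) e.n - G.key g t0 i0).toNat (by omega) (s + e.t, e.n)
        ⟨hn, hP'⟩ (by simp only; omega)
    · push Not at hloc
      have hj0 : G.P (g * trans s) 0 j ≤ 0 := by rw [P_trans, add_zero]; exact hPj.le
      have h00 : G.P (g * trans s) (t0 - s) i0 ≤ 0 := by
        rw [P_trans, add_sub_cancel]; exact hP0.le
      rcases farkas_P hj hi0 hj0 h00 with ⟨h1, h2⟩ | h1
      · rw [h1, sub_eq_zero.1 h2]
      · exfalso
        obtain ⟨e, he, e', he', a, a', D, ha, ha', hD, hne, -, hK⟩ := h1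
        have k1 := (key_ne_and_le hj he (g * trans s)).1
        have k2 := (key_ne_and_le hj he' (g * trans s)).1
        have l1 := hloc e he
        have l2 := hloc e' he'
        simp only [key_trans, add_zero, add_sub_cancel] at hK k1 k2
        have d1 : 0 < G.key g (s + e.t) e.n - G.key g s j := by
          rcases l1.lt_or_eq with h | h
          · linarith
          · exact absurd (by rw [h]) k1
        have d2 : 0 < G.key g (s + e'.t) e'.n - G.key g s j := by
          rcases l2.lt_or_eq with h | h
          · linarith
          · exact absurd (by rw [h]) k2
        have d3 : 0 < a * (G.key g (s + e.t) e.n - G.key g s j) +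
            a' * (G.key g (s + e'.t) e'.n - G.key g s j) := by
          rcases hne with h | h
          · have := mul_pos (lt_of_le_of_ne ha h.symm) d1
            have := mul_nonneg ha' d2.le
            linarith
          · have := mul_pos (lt_of_le_of_ne ha' h.symm) d2
            have := mul_nonneg ha d1.le
            linarith
        have d4 : D * (G.key g t0 i0 - G.key g s j) ≤ 0 := by
          apply mul_nonpos_of_nonneg_of_nonpos hD.le
          linarith [Int.natCast_nonneg N]
        linarith
  have all : ∀ x ∈ S, V x.1 x.2 = V t0 i0 := fun x hx => by
    have h0 := hmin x hx
    exact main (G.key g x.1 x.2 - G.key g t0 i0).toNat x hx (by omega)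
  rw [all (t, i) ⟨hi, h⟩, all (t', i') ⟨hi', h'⟩]

end Geom

/-- Values on translations (`ψ`) and faces (`β`) satisfying the relations of the floor. -/
structure Compat {m : ℤ} (G : Geom m) {A : Type*} [AddCommGroup A] (ψ : SL (O m) → O m → A)
    (β : ℕ → SL (O m) → A) : Prop where
  add : ∀ g s t, ψ g (s + t) = ψ g s + ψ g t
  inv : ∀ g s t, ψ (g * trans s) t = ψ g t
  rot : ∀ g t, ψ (g * hz m) t = ψ g (uz m ^ 2 * t)
  swap : ∀ i < G.n, ∀ g, β i g + ψ (g * G.s i) (G.sw i).t +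
    β (G.sw i).n (g * G.s i * trans (G.sw i).t) = ψ g (G.sw i).b
  unit : ∀ i < G.n, ∀ g, β i (g * hz m) = ψ g (G.un i).t +
    β (G.un i).n (g * trans (G.un i).t) + ψ (g * trans (G.un i).t * G.s (G.un i).n) (G.un i).b
  edge : ∀ i < G.n, ∀ e ∈ G.E i, ∀ g, β i g + inc G.s ψ β (g * G.s i) e.w =
    ψ g e.t + β e.n (g * trans e.t) + ψ (g * trans e.t * G.s e.n) e.b

namespace Geom
variable {m : ℤ} (G : Geom m) {A : Type*} [AddCommGroup A] (ψ : SL (O m) → O m → A)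
  (β : ℕ → SL (O m) → A)

lemma toNat_lt {g h : SL (O m)} (hlt : hform G.M h < hform G.M g) :
    (hform G.M h).toNat < (hform G.M g).toNat := by
  have := hform_pos G g
  omega

open scoped Classical in
/-- The potential of a compatible system, by descent along the Hermitian form. -/
noncomputable def pot (g : SL (O m)) : A :=
  if h : ∃ x : O m × ℕ, x.2 < G.n ∧ hform G.M (g * trans x.1 * G.s x.2) < hform G.M g then
    pot (g * trans h.choose.1 * G.s h.choose.2) - β h.choose.2 (g * trans h.choose.1) -
      ψ g h.choose.1
  else ψ g (g.d * g.b)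
termination_by (hform G.M g).toNat
decreasing_by exact toNat_lt G h.choose_spec.2

variable {G ψ β}

lemma pot_of_c {g : SL (O m)} (hc : g.c = 0) : G.pot ψ β g = ψ g (g.d * g.b) := by
  rw [pot, dif_neg]
  rintro ⟨⟨t, i⟩, hi, hlt⟩
  exact c_ne_zero_of_P_nonpos hi ((P_neg_iff hi g t).2 hlt).le hc

lemma exists_pot {g : SL (O m)} (hc : g.c ≠ 0) : ∃ t, ∃ i < G.n, G.P g t i < 0 ∧
    G.pot ψ β g = G.pot ψ β (g * trans t * G.s i) - β i (g * trans t) - ψ g t := by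
  obtain ⟨i, hi, t, hP⟩ := exists_P_neg (G := G) hc
  have h : ∃ x : O m × ℕ, x.2 < G.n ∧ hform G.M (g * trans x.1 * G.s x.2) < hform G.M g :=
    ⟨(t, i), hi, (P_neg_iff hi g t).1 hP⟩
  refine ⟨h.choose.1, h.choose.2, h.choose_spec.1,
    (P_neg_iff h.choose_spec.1 g _).2 h.choose_spec.2, ?_⟩
  rw [pot, dif_pos h]

/-- The increment formula for a potential along a face. -/
def StepAt (G : Geom m) (ψ : SL (O m) → O m → A) (β : ℕ → SL (O m) → A) (F : SL (O m) → A)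
    (g : SL (O m)) (t : O m) (i : ℕ) : Prop :=
  F (g * trans t * G.s i) = F g + ψ g t + β i (g * trans t)

/-- Invariance of a potential under translations and units. -/
def CuspAt (ψ : SL (O m) → O m → A) (F : SL (O m) → A) (g : SL (O m)) : Prop :=
  (∀ t, F (g * trans t) = F g + ψ g t) ∧ F (g * hz m) = F g

lemma CuspAt.pow {F : SL (O m) → A} {g : SL (O m)}
    (h : ∀ k : ℕ, CuspAt ψ F (g * hz m ^ k)) (k : ℕ) : F (g * hz m ^ k) = F g := by
  induction k with
  | zero => simp
  | succ k ih => rw [pow_succ, ← mul_assoc, (h k).2, ih]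

lemma trans_hz_pow {F : SL (O m) → A} {v : ℤ} (hcusp : ∀ g, hform G.M g < v → CuspAt ψ F g)
    {g : SL (O m)} (hg : hform G.M g < v) (b : O m) (k : ℕ) :
    F (g * trans b * hz m ^ k) = F g + ψ g b := by
  rw [CuspAt.pow (ψ := ψ) (F := F) (g := g * trans b), (hcusp g hg).1]
  intro k
  apply hcusp
  rwa [hform_mul_hz_pow, hform_mul_trans]

lemma along_word {F : SL (O m) → A} {u v : ℤ} (huv : v ≤ u + 1)
    (hF : ∀ g t, ∀ i < G.n, hform G.M g ≤ u → hform G.M (g * trans t * G.s i) < v →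
      StepAt G ψ β F g t i) (w : List (O m × ℕ)) : ∀ g : SL (O m), hform G.M g ≤ u →
    (∀ x ∈ w, x.2 < G.n) →
    (∀ p ∈ w.inits, p ≠ [] → hform G.M (g * wprod G.s p) < v) →
    F (g * wprod G.s w) = F g + inc G.s ψ β g w := by
  induction w with
  | nil => intro g _ _ _; simp [wprod, inc]
  | cons x w ih =>
    intro g hg hx hp
    have h1 : hform G.M (g * trans x.1 * G.s x.2) < v := by
      have := hp [x] (by simp) (by simp)
      simpa [wprod, mul_assoc] using this
    have h2 := hF g x.1 x.2 (hx x (by simp)) hg h1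
    have h3 := ih (g * trans x.1 * G.s x.2) (by omega) (fun y hy => hx y (by simp [hy])) (by
      intro p hp' hne
      have := hp (x :: p) (by
        rw [List.inits_cons]
        simpa using hp') (by simp)
      simpa only [wprod, mul_assoc] using this)
    simp only [wprod, inc]
    rw [show g * (trans x.1 * G.s x.2 * wprod G.s w) = g * trans x.1 * G.s x.2 * wprod G.s w by
      simp only [mul_assoc], h3, h2]
    abel

lemma hform_inits {g : SL (O m)} {j : ℕ} (hj : j < G.n) {e : Edge m} (he : e ∈ G.E j)
    (h1 : hform G.M (g * G.s j) ≤ hform G.M g)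
    (h2 : hform G.M (g * trans e.t * G.s e.n) < hform G.M g) {p : List (O m × ℕ)}
    (hp : p ∈ e.w.inits) (hne : p ≠ []) :
    hform G.M (g * G.s j * wprod G.s p) < hform G.M g := by
  obtain ⟨a, b, D, ha, hb, hD, h⟩ := G.E_mid j hj e he p hp hne
  rw [mul_assoc, hform_mul] at h2 ⊢
  rw [hform_mul] at h1
  have e1 := congrArg Prod.fst h
  have e2 := congrArg (fun x => x.2.1) h
  have e3 := congrArg (fun x => x.2.2) h
  simp only [Prod.fst_add, Prod.snd_add, Prod.smul_fst, Prod.smul_snd, smul_eq_mul] at e1 e2 e3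
  rw [zsmul_eq_mul, zsmul_eq_mul, zsmul_eq_mul] at e2
  set x := colq (G.s j)
  set y := colq (trans e.t * G.s e.n)
  set z := colq (G.s j * wprod G.s p)
  have e4 : D * tr (hoff G.M g * z.2.1) = a * tr (hoff G.M g * x.2.1) +
      b * tr (hoff G.M g * y.2.1) := by
    simp only [← tr_int_mul, ← tr_add]
    congr 1
    linear_combination hoff G.M g * e2
  have key : D * (hform G.M g * z.1 + tr (hoff G.M g * z.2.1) + hlow G.M g * z.2.2) < 0 := by
    have k1 := mul_nonpos_of_nonneg_of_nonpos ha (by linarith :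
      hform G.M g * x.1 + tr (hoff G.M g * x.2.1) + hlow G.M g * x.2.2 ≤ 0)
    have k2 := mul_neg_of_pos_of_neg hb (by linarith :
      hform G.M g * y.1 + tr (hoff G.M g * y.2.1) + hlow G.M g * y.2.2 < 0)
    have k3 : D * (hform G.M g * z.1 + tr (hoff G.M g * z.2.1) + hlow G.M g * z.2.2) =
        a * (hform G.M g * x.1 + tr (hoff G.M g * x.2.1) + hlow G.M g * x.2.2) +
        b * (hform G.M g * y.1 + tr (hoff G.M g * y.2.1) + hlow G.M g * y.2.2) := by
      linear_combination hform G.M g * e1 + e4 + hlow G.M g * e3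
    linarith
  have := (pos_iff_neg_of_mul_neg key).1 hD
  linarith

/-- The two faces adjacent along an edge predict the same value. -/
lemma edge_step (H : Compat G ψ β) {F : SL (O m) → A} {u v : ℤ} (huv : v ≤ u + 1)
    (hF : ∀ g t, ∀ i < G.n, hform G.M g ≤ u → hform G.M (g * trans t * G.s i) < v →
      StepAt G ψ β F g t i)
    (hcusp : ∀ g, hform G.M g < v → CuspAt ψ F g)
    {g : SL (O m)} (hg : hform G.M g = v) {j : ℕ} (hj : j < G.n) {e : Edge m} (he : e ∈ G.E j)
    (t : O m) (h1 : hform G.M (g * trans t * G.s j) ≤ v)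
    (h1u : hform G.M (g * trans t * G.s j) ≤ u)
    (h2 : hform G.M (g * trans (t + e.t) * G.s e.n) < v) :
    F (g * trans t * G.s j) - β j (g * trans t) - ψ g t =
      F (g * trans (t + e.t) * G.s e.n) - β e.n (g * trans (t + e.t)) - ψ g (t + e.t) := by
  have ht : g * trans (t + e.t) = g * trans t * trans e.t := by rw [mul_assoc, trans_mul]
  rw [ht] at h2 ⊢
  set k := g * trans t with hk
  have hkv : hform G.M k = v := by rw [hk, hform_mul_trans, hg]
  have h3 := along_word huv hF e.w (k * G.s j) h1u (G.E_lt j hj e he).2 (fun p hp hne => by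
    rw [← hkv] at h1 h2 ⊢
    exact hform_inits hj he h1 h2 hp hne)
  have h4 : k * G.s j * wprod G.s e.w = k * trans e.t * G.s e.n * trans e.b * hz m ^ e.k := by
    rw [mul_assoc, G.E_eq j hj e he]; simp only [mul_assoc]
  rw [h4, trans_hz_pow hcusp h2] at h3
  have h5 := H.edge j hj e he k
  have h6 : ψ g (t + e.t) = ψ g t + ψ k e.t := by rw [H.add, hk, H.inv]
  rw [h6]
  have h7 : F (k * G.s j) = F (k * trans e.t * G.s e.n) + ψ (k * trans e.t * G.s e.n) e.b -
      inc G.s ψ β (k * G.s j) e.w := by rw [h3]; abel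
  have h8 : ψ (k * trans e.t * G.s e.n) e.b = β j k + inc G.s ψ β (k * G.s j) e.w -
    ψ k e.t - β e.n (k * trans e.t) := by rw [h5]; abel
  rw [h7, h8]; abel

/-- The statement proved by induction on the level. -/
def Below (G : Geom m) (ψ : SL (O m) → O m → A) (β : ℕ → SL (O m) → A) (v : ℤ) : Prop :=
  (∀ g, hform G.M g < v → CuspAt ψ (G.pot ψ β) g) ∧
  ∀ g t, ∀ i < G.n, hform G.M g < v → hform G.M (g * trans t * G.s i) < v →
    StepAt G ψ β (G.pot ψ β) g t i

lemma Below.step_down (H : Compat G ψ β) {v : ℤ} (h : Below G ψ β v) (g : SL (O m)) (t : O m)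
    (i : ℕ) (hi : i < G.n) (hg : hform G.M g ≤ v) (hlt : hform G.M (g * trans t * G.s i) < v) :
    StepAt G ψ β (G.pot ψ β) g t i := by
  rcases hg.lt_or_eq with hg | hg
  · exact h.2 g t i hi hg hlt
  have hP : G.P g t i < 0 := by rw [P_neg_iff hi, hg]; exact hlt
  obtain ⟨t', i', hi', hP', he⟩ := exists_pot (ψ := ψ) (β := β) (c_ne_zero_of_P_nonpos hi hP.le)
  have := eq_of_edges (G := G) (g := g)
    (fun t i => G.pot ψ β (g * trans t * G.s i) - β i (g * trans t) - ψ g t)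
    (fun t j hj hPj e hE hPn => by
      rw [P_neg_iff hj, hg] at hPj
      rw [P_neg_iff (G.E_lt j hj e hE).1, hg] at hPn
      exact edge_step H (u := v - 1) (v := v) (by omega)
        (fun g t i hi hg hlt => h.2 g t i hi (by omega) hlt) h.1 hg hj hE t hPj.le (by omega) hPn)
    hi hP hi' hP'
  rw [← this] at he
  rw [StepAt, he]; abel

lemma Below.cusp (H : Compat G ψ β) {v : ℤ} (h : Below G ψ β v) (g : SL (O m))
    (hg : hform G.M g ≤ v) : CuspAt ψ (G.pot ψ β) g := by
  rcases hg.lt_or_eq with hg | hg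
  · exact h.1 g hg
  by_cases hc : g.c = 0
  · have hd := g.det
    rw [hc, mul_zero, sub_zero] at hd
    constructor
    · intro t
      rw [pot_of_c hc, pot_of_c (by simp [trans, hc]), H.inv, ← H.add]
      congr 1
      simp only [SL.mul_d, SL.mul_b, trans, hc]
      linear_combination t * hd
    · rw [pot_of_c hc, pot_of_c (by simp [hz, hc]), H.rot]
      congr 1
      simp only [SL.mul_d, SL.mul_b, hz, hc]
      linear_combination (uz m ^ 6 + 1) * (g.d * g.b) * uz_pow_six (m := m)
  constructor
  · intro s
    obtain ⟨t, i, hi, hP, he⟩ := exists_pot (G := G) (ψ := ψ) (β := β) (g := g * trans s)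
      (by simpa [trans] using hc)
    have e1 : g * trans s * trans t = g * trans (s + t) := by rw [mul_assoc, trans_mul]
    rw [P_trans, P_neg_iff hi, hg] at hP
    have h2 := h.step_down H g (s + t) i hi hg.le hP
    rw [he, e1, h2, H.inv, H.add]; abel
  · obtain ⟨t, i, hi, hP, he⟩ := exists_pot (G := G) (ψ := ψ) (β := β) (g := g * hz m)
      (by
        have : uz m * uz m ^ 5 = 1 := by rw [← pow_succ', uz_pow_six]
        intro h0
        simp only [SL.mul_c, hz, mul_zero, add_zero] at h0
        exact hc (by linear_combination uz m ^ 5 * h0 - g.c * this))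
    rw [P_neg_iff hi, hform_mul_hz, hg] at hP
    have e1 : g * hz m * trans t = g * trans (uz m ^ 2 * t) * hz m := by
      rw [mul_assoc, hz_mul_trans, mul_assoc]
    set k := g * trans (uz m ^ 2 * t) with hk
    have e2 : k * hz m * G.s i = k * trans (G.un i).t * G.s (G.un i).n * trans (G.un i).b *
        hz m ^ (G.un i).k := by
      rw [mul_assoc, G.un_eq i hi]; simp only [mul_assoc]
    rw [e1, e2, hform_mul_hz_pow, hform_mul_trans] at hP
    have e3 : k * trans (G.un i).t = g * trans (uz m ^ 2 * t + (G.un i).t) := by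
      rw [hk, mul_assoc, trans_mul]
    have h2 := h.step_down H g _ _ (G.un_lt i hi) hg.le (by rw [← e3]; exact hP)
    rw [StepAt, ← e3, H.add] at h2
    have h3 := H.unit i hi k
    have h4 : ψ k (G.un i).t = ψ g (G.un i).t := by rw [hk, H.inv]
    rw [he, e1, e2, trans_hz_pow h.1 hP, h2, h3, h4, H.rot]
    abel

lemma Below.succ (H : Compat G ψ β) {v : ℤ} (h : Below G ψ β v) : Below G ψ β (v + 1) := by
  refine ⟨fun g hg => h.cusp H g (by omega), fun g t i hi hg hlt => ?_⟩
  by_cases hlt' : hform G.M (g * trans t * G.s i) < v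
  · exact h.step_down H g t i hi (by omega) hlt'
  have hev : hform G.M (g * trans t * G.s i) = v := by omega
  by_cases hg' : hform G.M g < v
  · set k := g * trans t * G.s i with hk
    have e1 : k * trans (G.sw i).t * G.s (G.sw i).n =
        g * trans (t + (G.sw i).b) * hz m ^ (G.sw i).k := by
      rw [← trans_mul, hk]
      simp only [mul_assoc]
      rw [← mul_assoc (G.s i), G.sw_eq i hi]
    have h1 := h.step_down H k (G.sw i).t (G.sw i).n (G.sw_lt i hi) hev.le (by
      rw [e1, hform_mul_hz_pow, hform_mul_trans]; exact hg')
    rw [StepAt, e1, trans_hz_pow h.1 hg', H.add] at h1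
    have h2 := H.swap i hi (g * trans t)
    rw [← hk, H.inv] at h2
    rw [StepAt, ← hk]
    have h3 : G.pot ψ β k = G.pot ψ β g + (ψ g t + ψ g (G.sw i).b) - ψ k (G.sw i).t -
      β (G.sw i).n (k * trans (G.sw i).t) := by rw [h1]; abel
    rw [h3, ← h2]; abel
  · have hgv : hform G.M g = v := by omega
    have hPi : G.P g t i = 0 := by rw [P_eq_zero_iff hi, hgv, hev]
    obtain ⟨k, hk, t', hPk⟩ := exists_P_neg (G := G) (c_ne_zero_of_P_nonpos hi hPi.le)
    obtain ⟨e, he, hPe⟩ := exists_edge_P_neg (g := g * trans t) (t := t' - t) hi hk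
      (by rw [P_trans, add_zero, hPi]) (by rw [P_trans, add_sub_cancel]; exact hPk)
    have hn := (G.E_lt i hi e he).1
    rw [P_trans, P_neg_iff hn, hgv] at hPe
    have h1 := edge_step H (F := G.pot ψ β) (u := v) (v := v) (by omega) (h.step_down H) h.1 hgv hi
      he t hev.le hev.le hPe
    rw [h.step_down H g _ _ hn hgv.le hPe] at h1
    rw [StepAt, ← sub_eq_zero]
    have : G.pot ψ β (g * trans t * G.s i) = G.pot ψ β (g * trans t * G.s i) -
      β i (g * trans t) - ψ g t + ψ g t + β i (g * trans t) := by abel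
    rw [this, h1]; abel

/-- Every compatible system integrates to a potential. -/
theorem exists_potential (H : Compat G ψ β) : ∃ F : SL (O m) → A,
    (∀ g t, F (g * trans t) = F g + ψ g t) ∧ (∀ g, F (g * hz m) = F g) ∧
    ∀ i < G.n, ∀ g, F (g * G.s i) = F g + β i g := by
  have hb : ∀ v : ℕ, Below G ψ β v := by
    intro v
    induction v with
    | zero =>
      have := hform_pos G
      refine ⟨fun g hg => ?_, fun g t i hi hg => ?_⟩
      · have := this g; push_cast at hg; omega
      · have := this g; push_cast at hg; omega
    | succ v ih => push_cast; exact ih.succ H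
  have h1 : ∀ g, CuspAt ψ (G.pot ψ β) g := fun g =>
    (hb ((hform G.M g).toNat + 1)).1 g (by push_cast; omega)
  refine ⟨G.pot ψ β, fun g => (h1 g).1, fun g => (h1 g).2, fun i hi g => ?_⟩
  have h2 := (hb ((hform G.M g).toNat + (hform G.M (g * trans 0 * G.s i)).toNat + 1)).2 g 0 i hi
    (by push_cast; omega) (by push_cast; omega)
  have h3 : ψ g 0 = 0 := by simpa using H.add g 0 0
  rw [StepAt, trans_zero, mul_one, h3, add_zero] at h2
  exact h2

variable (G) in
/-- A function that is right invariant under the generators is constant. -/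
theorem eq_of_invariant {X : Type*} (F : SL (O m) → X) (h1 : ∀ g t, F (g * trans t) = F g)
    (h2 : ∀ g, F (g * hz m) = F g) (h3 : ∀ i < G.n, ∀ g, F (g * G.s i) = F g) (g : SL (O m)) :
    F g = F 1 := by
  induction hn : (hform G.M g).toNat using Nat.strong_induction_on generalizing g with
  | _ n ih =>
  by_cases hc : g.c = 0
  · have hd := g.det
    rw [hc, mul_zero, sub_zero] at hd
    obtain ⟨k, hk, ha⟩ := exists_uz_pow G.one_le hd
    have hpow : ∀ k : ℕ, F (hz m ^ k) = F 1 := by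
      intro k
      induction k with
      | zero => simp
      | succ k ih => rw [pow_succ, h2, ih]
    have hzp : ∀ k : ℕ, (hz m ^ k).a = uz m ^ k ∧ (hz m ^ k).b = 0 ∧ (hz m ^ k).c = 0 ∧
        (hz m ^ k).d = uz m ^ (5 * k) := by
      intro k
      induction k with
      | zero => simp
      | succ k ih =>
        obtain ⟨i1, i2, i3, i4⟩ := ih
        rw [pow_succ]
        have a1 : (hz m).a = uz m := rfl
        have a2 : (hz m).b = 0 := rfl
        have a3 : (hz m).c = 0 := rfl
        have a4 : (hz m).d = uz m ^ 5 := rfl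
        simp only [SL.mul_a, SL.mul_b, SL.mul_c, SL.mul_d, i1, i2, i3, i4, a1, a2, a3, a4]
        refine ⟨by ring, by ring, by ring, by ring⟩
    have hg : g = hz m ^ k * trans (g.d * g.b) := by
      obtain ⟨i1, i2, i3, i4⟩ := hzp k
      have hu : uz m ^ k * uz m ^ (5 * k) = 1 := by
        rw [← pow_add, show k + 5 * k = 6 * k by ring, pow_mul, uz_pow_six, one_pow]
      ext1
      · simp only [SL.mul_a, i1, i2, trans, ha]; ring
      · simp only [SL.mul_b, i1, i2, trans]; rw [← ha]; linear_combination -g.b * hd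
      · simp only [SL.mul_c, i3, i4, trans, hc]; ring
      · simp only [SL.mul_d, i3, i4, trans]
        rw [ha] at hd
        linear_combination uz m ^ (5 * k) * hd - g.d * hu
    rw [hg, h1, hpow]
  · obtain ⟨i, hi, t, hP⟩ := exists_P_neg (G := G) hc
    rw [P_neg_iff hi] at hP
    rw [← h1 g t, ← h3 i hi]
    exact ih _ (by rw [← hn]; exact toNat_lt G hP) _ rfl

end Geom

section cosets
variable {m : ℤ}

/-- The bottom row modulo two, as a number below sixteen. -/
def code (g : SL (O m)) : ℕ :=
  (g.c.re % 2 + 2 * (g.c.im % 2) + 4 * (g.d.re % 2) + 8 * (g.d.im % 2)).toNat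

lemma code_eq_iff (g h : SL (O m)) : code g = code h ↔ 2 ∣ g.c - h.c ∧ 2 ∣ g.d - h.d := by
  rw [two_dvd_iff, two_dvd_iff]
  simp only [code, QuadraticAlgebra.re_sub, QuadraticAlgebra.im_sub]
  omega

lemma code_pos (g : SL (O m)) : 1 ≤ code g ∧ code g ≤ 15 := by
  refine ⟨?_, by simp only [code]; omega⟩
  by_contra h
  have h0 : code g = 0 := by omega
  have h1 : (2 : O m) ∣ g.c ∧ (2 : O m) ∣ g.d := by
    rw [two_dvd_iff, two_dvd_iff]; simp only [code] at h0; omega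
  have h2 : (2 : O m) ∣ 1 := by
    rw [← g.det]; exact dvd_sub (h1.2.mul_left _) (h1.1.mul_left _)
  have h3 := (two_dvd_iff.1 h2).1
  have h4 : (1 : O m).re = 1 := rfl
  omega

lemma mem_GB_of_code {g h : SL (O m)} (H : code g = code h) : g * h⁻¹ ∈ GB m := by
  obtain ⟨⟨x, hx⟩, ⟨y, hy⟩⟩ := (code_eq_iff g h).1 H
  rw [sub_eq_iff_eq_add] at hx hy
  have hg := g.det
  have hh := h.det
  refine ⟨⟨-(g.a * y) + g.b * x, ?_⟩, ⟨-x * h.b + y * h.a, ?_⟩, one_dvd _, ⟨x * h.d - y * h.c, ?_⟩⟩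
  · simp only [SL.mul_a, SL.inv_a, SL.inv_c]
    rw [hx, hy] at hg
    linear_combination hg
  · simp only [SL.mul_d, SL.inv_b, SL.inv_d]
    rw [hx, hy]
    linear_combination hh
  · simp only [SL.mul_c, SL.inv_a, SL.inv_c]
    rw [hx, hy]
    ring

lemma code_mul_left {γ : SL (O m)} (hγ : γ ∈ GB m) (g : SL (O m)) : code (γ * g) = code g := by
  obtain ⟨-, ⟨d, hd⟩, -, ⟨c, hc⟩⟩ := hγ
  rw [sub_eq_iff_eq_add] at hd
  rw [code_eq_iff]
  constructor
  · exact ⟨c * g.a + d * g.c, by rw [SL.mul_c, hc, hd]; ring⟩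
  · exact ⟨c * g.b + d * g.d, by rw [SL.mul_d, hc, hd]; ring⟩

variable (α β : ℤ × ℤ) (rep : ℕ → SL (O m))

/-- The sign of a matrix relative to its coset representative. -/
def sg (g : SL (O m)) : ℤˣ := rho α β (g * (rep (code g))⁻¹)

variable {α β rep} (hrep : ∀ x, 1 ≤ x → x ≤ 15 → code (rep x) = x)
include hrep

lemma code_rep_code (g : SL (O m)) : code (rep (code g)) = code g :=
  hrep _ (code_pos g).1 (code_pos g).2

lemma mul_rep_inv_mem (g : SL (O m)) : g * (rep (code g))⁻¹ ∈ GB m :=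
  mem_GB_of_code (code_rep_code hrep g).symm

lemma sg_mul_left {γ : SL (O m)} (hγ : γ ∈ GB m) (g : SL (O m)) :
    sg α β rep (γ * g) = rho α β γ * sg α β rep g := by
  rw [sg, code_mul_left hγ, mul_assoc, rho_isCharOn α β _ hγ _ (mul_rep_inv_mem hrep g), sg]

omit hrep in
lemma eq_mul_rep (g : SL (O m)) : g = g * (rep (code g))⁻¹ * rep (code g) := by
  rw [inv_mul_cancel_right]

lemma code_mul (g h : SL (O m)) : code (g * h) = code (rep (code g) * h) := by
  conv_lhs => rw [eq_mul_rep (rep := rep) g, mul_assoc]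
  rw [code_mul_left (mul_rep_inv_mem hrep g)]

lemma sg_mul (g h : SL (O m)) :
    sg α β rep (g * h) = sg α β rep g * sg α β rep (rep (code g) * h) := by
  conv_lhs => rw [eq_mul_rep (rep := rep) g, mul_assoc]
  rw [sg_mul_left hrep (mul_rep_inv_mem hrep g)]
  rfl

lemma sg_rep {x : ℕ} (h1 : 1 ≤ x) (h2 : x ≤ 15) : sg α β rep (rep x) = 1 := by
  rw [sg, hrep x h1 h2, mul_inv_cancel, (rho_isCharOn α β).map_one]

lemma equivariant_eq {A : Type*} [AddCommGroup A] {u : SL (O m) → A}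
    (hu : ∀ γ ∈ GB m, ∀ g, u (γ * g) = rho α β γ • u g) (g : SL (O m)) :
    u g = sg α β rep g • u (rep (code g)) := by
  conv_lhs => rw [eq_mul_rep (rep := rep) g]
  rw [hu _ (mul_rep_inv_mem hrep g), sg]

omit hrep in
lemma conj_four_mem (g : SL (O m)) (t : O m) : g * trans (4 * t) * g⁻¹ ∈ GB m := by
  have h := g.det
  refine ⟨⟨-(2 * t * g.a * g.c), ?_⟩, ⟨2 * t * g.a * g.c, ?_⟩, one_dvd _,
    ⟨-(2 * t * g.c * g.c), ?_⟩⟩ <;> simp [trans] <;> first | linear_combination h | ring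

omit hrep in
lemma rho_conj_four (g : SL (O m)) (t : O m) : rho α β (g * trans (4 * t) * g⁻¹) = 1 := by
  have h1 : (g * trans (4 * t) * g⁻¹).c = 2 * (-(2 * t * g.c * g.c)) := by
    simp [trans]; ring
  have h2 : (g * trans (4 * t) * g⁻¹).b = 2 * (2 * t * g.a * g.a) := by
    simp [trans]; ring
  rw [rho, h1, h2, divn_two_mul, chi_two_mul, show -(2 * t * g.c * g.c) = 2 * (-(t * g.c * g.c)) by
    ring, chi_two_mul, one_mul]

omit hrep in
lemma mul_trans_four (g : SL (O m)) (t : O m) :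
    g * trans (4 * t) = g * trans (4 * t) * g⁻¹ * g := by simp

omit hrep in
lemma code_mul_four (g : SL (O m)) (t : O m) : code (g * trans (4 * t)) = code g := by
  rw [mul_trans_four, code_mul_left (conj_four_mem g t)]

lemma sg_mul_four (g : SL (O m)) (t : O m) : sg α β rep (g * trans (4 * t)) = sg α β rep g := by
  rw [mul_trans_four, sg_mul_left hrep (conj_four_mem g t), rho_conj_four, one_mul]

end cosets

section average
variable {m : ℤ} {A : Type*} [AddCommGroup A]

lemma sum_range_four_shift (f : ℤ → A) (h : ∀ x, f (x + 4) = f x) (n : ℤ) :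
    ∑ a ∈ Finset.range 4, f (a + n) = ∑ a ∈ Finset.range 4, f a := by
  have step : ∀ n : ℤ, ∑ a ∈ Finset.range 4, f (a + (n + 1)) = ∑ a ∈ Finset.range 4, f (a + n) := by
    intro n
    have := h n
    simp only [Finset.sum_range_succ, Finset.sum_range_zero, Nat.cast_ofNat, Nat.cast_one,
      Nat.cast_zero, zero_add]
    rw [show (3 : ℤ) + (n + 1) = n + 4 by ring, show (2 : ℤ) + (n + 1) = 3 + n by ring,
      show (1 : ℤ) + (n + 1) = 2 + n by ring, show n + 1 = 1 + n by ring, this]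
    abel
  induction n using Int.induction_on with
  | zero => simp
  | succ n ih => rw [step, ih]
  | pred n ih => rw [← ih, ← step (-n - 1)]; simp

/-- The sum of a function over a box of representatives modulo four. -/
def boxsum (f : O m → A) : A :=
  ∑ a ∈ Finset.range 4, ∑ b ∈ Finset.range 4, f ⟨(a : ℤ), (b : ℤ)⟩

lemma boxsum_shift (f : O m → A) (h : ∀ x t, f (x + 4 * t) = f x) (t : O m) :
    boxsum (fun x => f (t + x)) = boxsum f := by
  have e1 : ∀ x y : ℤ, f ⟨x + 4, y⟩ = f ⟨x, y⟩ := by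
    intro x y
    rw [← h ⟨x, y⟩ 1, mul_one]
    congr 1
    ext
    · rfl
    · exact (add_zero y).symm
  have e2 : ∀ x y : ℤ, f ⟨x, y + 4⟩ = f ⟨x, y⟩ := by
    intro x y
    rw [← h ⟨x, y⟩ ⟨0, 1⟩, show (4 : O m) * ⟨0, 1⟩ = ⟨0, 4⟩ by
      rw [show (4 : O m) * ⟨0, 1⟩ = ⟨0, 1⟩ + ⟨0, 1⟩ + ⟨0, 1⟩ + ⟨0, 1⟩ by ring]; rfl]
    congr 1
    ext
    · exact (add_zero x).symm
    · rfl
  have e3 : ∀ a b : ℤ, f (t + ⟨a, b⟩) = f ⟨a + t.re, b + t.im⟩ := by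
    intro a b
    congr 1
    ext <;> simp [add_comm]
  simp only [boxsum, e3]
  rw [sum_range_four_shift (fun a => ∑ b ∈ Finset.range 4, f ⟨a, (b : ℤ) + t.im⟩)
    (fun x => Finset.sum_congr rfl fun b _ => e1 _ _)]
  refine Finset.sum_congr rfl fun a _ => ?_
  exact sum_range_four_shift (fun b => f ⟨(a : ℤ), b⟩) (fun y => e2 _ _) _

lemma boxsum_add_const (f : O m → A) (a : A) : boxsum (fun x => f x + a) = boxsum f + 16 • a := by
  simp only [boxsum, Finset.sum_add_distrib, Finset.sum_const, Finset.card_range, smul_smul]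
  norm_num

end average

section cusp
variable {m : ℤ} {α β : ℤ × ℤ} {rep : ℕ → SL (O m)} {M : Type*} [AddCommGroup M] [Module Z6 M]

lemma smul_units_comm (u : ℤˣ) (r : Z6) (x : M) : r • u • x = u • r • x := by
  rcases Int.units_eq_one_or u with rfl | rfl <;> simp

lemma exists_translation_part {c : SL (O m) → M} (hc : IsCrossed (GB m) (rho α β) c) :
    ∃ ψ : SL (O m) → O m → M, (∀ g t, 4 • ψ g t = c (g * trans (4 * t) * g⁻¹)) ∧
      (∀ g s t, ψ g (s + t) = ψ g s + ψ g t) ∧ (∀ g s t, ψ (g * trans s) t = ψ g t) ∧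
      (∀ g t, ψ (g * hz m) t = ψ g (uz m ^ 2 * t)) ∧
      ∀ γ ∈ GB m, ∀ g t, ψ (γ * g) t = rho α β γ • ψ g t := by
  have hchar := rho_isCharOn (m := m) α β
  obtain ⟨r, hr⟩ := exists_zsmul_eq (M := M) (n := 4) (k := 2) (by norm_num)
  refine ⟨fun g t => r • c (g * trans (4 * t) * g⁻¹), ?_, ?_, ?_, ?_, ?_⟩
  · intro g t
    exact_mod_cast hr _
  · intro g s t
    simp only
    rw [← smul_add]
    congr 1
    have : g * trans (4 * (s + t)) * g⁻¹ = g * trans (4 * s) * g⁻¹ * (g * trans (4 * t) * g⁻¹) := by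
      rw [mul_add, ← trans_mul]; group
    rw [this, hc _ (conj_four_mem g s) _ (conj_four_mem g t), rho_conj_four, one_smul]
  · intro g s t
    simp only
    congr 2
    have : trans s * trans (4 * t) = trans (4 * t) * trans s := by
      rw [trans_mul, trans_mul, add_comm]
    rw [mul_assoc g, this]; group
  · intro g t
    simp only
    congr 2
    rw [mul_assoc g, hz_mul_trans, show uz m ^ 2 * (4 * t) = 4 * (uz m ^ 2 * t) by ring]
    group
  · intro γ hγ g t
    simp only
    have h1 := conj_four_mem g t
    have e : γ * g * trans (4 * t) * (γ * g)⁻¹ = γ * (g * trans (4 * t) * g⁻¹) * γ⁻¹ := by group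
    have h2 := hc γ hγ γ⁻¹ ((GB m).inv_mem hγ)
    rw [mul_inv_cancel, hc.map_one hchar] at h2
    rw [e, hc _ ((GB m).mul_mem hγ h1) _ ((GB m).inv_mem hγ), hc γ hγ _ h1, hchar γ hγ _ h1,
      rho_conj_four, mul_one, add_right_comm, ← h2, zero_add, smul_units_comm]

variable (hrep : ∀ x, 1 ≤ x → x ≤ 15 → code (rep x) = x)
include hrep

/-- A crossed homomorphism has a primitive which is adapted to the cusp at infinity. -/
lemma exists_cusp_primitive {c : SL (O m) → M} (hc : IsCrossed (GB m) (rho α β) c) :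
    ∃ (F : SL (O m) → M) (ψ : SL (O m) → O m → M),
      (∀ γ ∈ GB m, ∀ g, F (γ * g) = c γ + rho α β γ • F g) ∧
      (∀ g t, F (g * trans t) = F g + ψ g t) ∧ (∀ g, F (g * hz m) = F g) ∧
      (∀ g s t, ψ g (s + t) = ψ g s + ψ g t) ∧ (∀ g s t, ψ (g * trans s) t = ψ g t) ∧
      (∀ g t, ψ (g * hz m) t = ψ g (uz m ^ 2 * t)) ∧
      ∀ γ ∈ GB m, ∀ g t, ψ (γ * g) t = rho α β γ • ψ g t := by
  obtain ⟨ψ, h4, hadd, hinv, hrot, heq⟩ := exists_translation_part hc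
  obtain ⟨r, hr⟩ := exists_zsmul_eq (M := M) (n := 16) (k := 4) (by norm_num)
  obtain ⟨r', hr'⟩ := exists_zsmul_eq (M := M) (n := 6) (k := 1) (by norm_num)
  have hψ4 : ∀ g t, ψ g (4 * t) = 4 • ψ g t := by
    intro g t
    rw [show (4 : O m) * t = t + t + t + t by ring, hadd, hadd, hadd]
    abel
  let F0 : SL (O m) → M := fun g => c (g * (rep (code g))⁻¹)
  have hF0 : ∀ γ ∈ GB m, ∀ g, F0 (γ * g) = c γ + rho α β γ • F0 g := by
    intro γ hγ g
    simp only [F0]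
    rw [code_mul_left hγ, mul_assoc, hc γ hγ _ (mul_rep_inv_mem hrep g)]
  let H : SL (O m) → O m → M := fun g x => F0 (g * trans x) - ψ g x
  have hH4 : ∀ g x t, H g (x + 4 * t) = H g x := by
    intro g x t
    simp only [H]
    have : g * trans (x + 4 * t) = g * trans (4 * t) * g⁻¹ * (g * trans x) := by
      rw [add_comm, ← trans_mul]; group
    rw [this, hF0 _ (conj_four_mem g t), rho_conj_four, one_smul, hadd, hψ4, h4]
    abel
  have hHt : ∀ g t x, H (g * trans t) x = H g (t + x) + ψ g t := by
    intro g t x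
    simp only [H]
    rw [mul_assoc, trans_mul, hinv, hadd]
    abel
  have hHγ : ∀ γ ∈ GB m, ∀ g x, H (γ * g) x = rho α β γ • H g x + c γ := by
    intro γ hγ g x
    simp only [H]
    rw [mul_assoc, hF0 γ hγ, heq γ hγ, smul_sub]
    abel
  let F1 : SL (O m) → M := fun g => r • boxsum (H g)
  have hr16 : ∀ x : M, r • (16 • x) = x := by
    intro x
    rw [smul_comm]
    exact_mod_cast hr x
  have hF1t : ∀ g t, F1 (g * trans t) = F1 g + ψ g t := by
    intro g t
    simp only [F1]
    rw [show H (g * trans t) = fun x => H g (t + x) + ψ g t from funext (hHt g t),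
      boxsum_add_const, boxsum_shift _ (hH4 g), smul_add, hr16]
  have hF1γ : ∀ γ ∈ GB m, ∀ g, F1 (γ * g) = c γ + rho α β γ • F1 g := by
    intro γ hγ g
    simp only [F1]
    rw [show H (γ * g) = fun x => rho α β γ • H g x + c γ from funext (hHγ γ hγ g),
      boxsum_add_const, smul_add, hr16, add_comm]
    simp only [boxsum, ← Finset.smul_sum]
    rw [smul_units_comm]
  have hz6 : hz m ^ 6 = 1 := by
    have h6 := uz_pow_six (m := m)
    have : ∀ k : ℕ, (hz m ^ k).a = uz m ^ k ∧ (hz m ^ k).b = 0 ∧ (hz m ^ k).c = 0 ∧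
        (hz m ^ k).d = (uz m ^ 5) ^ k := by
      intro k
      induction k with
      | zero => simp
      | succ k ih =>
        obtain ⟨i1, i2, i3, i4⟩ := ih
        rw [pow_succ]
        refine ⟨?_, ?_, ?_, ?_⟩
        · rw [SL.mul_a, i1, i2]; simp [hz, pow_succ]
        · rw [SL.mul_b, i1, i2]; simp [hz]
        · rw [SL.mul_c, i3, i4]; simp [hz]
        · rw [SL.mul_d, i3, i4]; simp [hz, pow_succ]
    obtain ⟨i1, i2, i3, i4⟩ := this 6
    ext1
    · rw [i1, h6]; rfl
    · rw [i2]; rfl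
    · rw [i3]; rfl
    · rw [i4, ← pow_mul, show 5 * 6 = 6 * 5 by norm_num, pow_mul, h6, one_pow]; rfl
  have hF1k : ∀ (k : ℕ) g t, F1 (g * trans t * hz m ^ k) = F1 (g * hz m ^ k) + ψ g t := by
    intro k
    induction k with
    | zero => intro g t; simpa using hF1t g t
    | succ k ih =>
      intro g t
      have e : g * trans t * hz m ^ (k + 1) = g * hz m * trans (uz m ^ 4 * t) * hz m ^ k := by
        rw [mul_assoc g (hz m), hz_mul_trans, pow_succ',
          show uz m ^ 2 * (uz m ^ 4 * t) = t by linear_combination t * uz_pow_six (m := m)]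
        simp only [mul_assoc]
      rw [e, ih, hrot, show uz m ^ 2 * (uz m ^ 4 * t) = t by
        linear_combination t * uz_pow_six (m := m), pow_succ', mul_assoc]
  have hr6 : ∀ x : M, r' • (6 • x) = x := by
    intro x
    rw [smul_comm]
    exact_mod_cast hr' x
  refine ⟨fun g => r' • ∑ k ∈ Finset.range 6, F1 (g * hz m ^ k), ψ, ?_, ?_, ?_, hadd, hinv, hrot,
    heq⟩
  · intro γ hγ g
    simp only [mul_assoc]
    simp only [hF1γ γ hγ, Finset.sum_add_distrib, Finset.sum_const, Finset.card_range, smul_add,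
      ← Finset.smul_sum, hr6, smul_units_comm]
  · intro g t
    simp only [hF1k, Finset.sum_add_distrib, Finset.sum_const, Finset.card_range, smul_add, hr6]
  · intro g
    simp only
    congr 1
    have e : ∀ k, g * hz m * hz m ^ k = g * hz m ^ (k + 1) := by
      intro k; rw [pow_succ', mul_assoc]
    simp only [e]
    rw [Finset.sum_range_succ, hz6, Finset.sum_range_succ' (fun k => F1 (g * hz m ^ k)), pow_zero]

end cusp

section system
variable {m : ℤ}

/-- The generators acting on cosets: two translations, the unit and the faces. -/
def gen (G : Geom m) : ℕ → SL (O m)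
  | 0 => trans 1
  | 1 => trans ⟨0, 1⟩
  | 2 => hz m
  | i + 3 => G.s i

/-- The invariants of an element of `GB` that determine its signs. -/
def pars (g : SL (O m)) : ℕ :=
  ((divn 2 g.c).re % 2 + 2 * ((divn 2 g.c).im % 2) + 4 * (g.b.re % 2) + 8 * (g.b.im % 2)).toNat

/-- The sign determined by the output of `pars`. -/
def epsZ (α β : ℤ × ℤ) (p : ℕ) : ℤ :=
  if (α.1 * (p % 2 : ℕ) + α.2 * (p / 2 % 2 : ℕ) + β.1 * (p / 4 % 2 : ℕ) + β.2 * (p / 8 % 2 : ℕ)) % 2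
    = 0 then 1 else -1

lemma rho_eq_epsZ (α β : ℤ × ℤ) (g : SL (O m)) : (rho α β g : ℤ) = epsZ α β (pars g) := by
  have h1 : ((pars g % 2 : ℕ) : ℤ) = (divn 2 g.c).re % 2 := by simp only [pars]; omega
  have h2 : ((pars g / 2 % 2 : ℕ) : ℤ) = (divn 2 g.c).im % 2 := by simp only [pars]; omega
  have h3 : ((pars g / 4 % 2 : ℕ) : ℤ) = g.b.re % 2 := by simp only [pars]; omega
  have h4 : ((pars g / 8 % 2 : ℕ) : ℤ) = g.b.im % 2 := by simp only [pars]; omega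
  rw [epsZ, h1, h2, h3, h4, rho, chi, chi, ← Int.negOnePow_add]
  set u := α.1 * (divn 2 g.c).re + α.2 * (divn 2 g.c).im + (β.1 * g.b.re + β.2 * g.b.im) with hu
  have e : (α.1 * ((divn 2 g.c).re % 2) + α.2 * ((divn 2 g.c).im % 2) + β.1 * (g.b.re % 2) +
      β.2 * (g.b.im % 2)) % 2 = u % 2 := by
    rw [hu]
    apply Int.ModEq.eq
    rw [← add_assoc]
    gcongr <;> exact Int.mod_modEq _ _
  rw [e]
  split_ifs with h
  · rw [Int.negOnePow_even _ (Int.even_iff.2 h)]; rfl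
  · rw [Int.negOnePow_odd _ (Int.odd_iff.2 (by omega))]; rfl

/-- Coset representatives together with the action of the generators. -/
structure Tab (G : Geom m) where
  /-- coset representatives -/
  rep : ℕ → SL (O m)
  /-- packed action of the generators -/
  act : ℕ → ℕ → ℕ
  hrep : ∀ x, 1 ≤ x → x ≤ 15 → code (rep x) = x
  act_code : ∀ j < G.n + 3, ∀ x, 1 ≤ x → x ≤ 15 → code (rep x * gen G j) = act j x % 16
  act_pars : ∀ j < G.n + 3, ∀ x, 1 ≤ x → x ≤ 15 →
    pars (rep x * gen G j * (rep (act j x % 16))⁻¹) = act j x / 16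

section states
variable (α β : ℤ × ℤ) (act : ℕ → ℕ → ℕ)

/-- The action of a generator on a coset with sign. -/
def stp (j : ℕ) (s : ℕ × ℤ) : ℕ × ℤ := (act j s.1 % 16, s.2 * epsZ α β (act j s.1 / 16))

/-- Repeated action of a generator. -/
def stpn (j : ℕ) : ℕ → ℕ × ℤ → ℕ × ℤ
  | 0, s => s
  | k + 1, s => stpn j k (stp α β act j s)

/-- The action of a translation on a coset with sign. -/
def stT (t : O m) (s : ℕ × ℤ) : ℕ × ℤ :=
  stpn α β act 1 (t.im % 4).toNat (stpn α β act 0 (t.re % 4).toNat s)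

/-- Terms of the value on a translation. -/
def tpsi (c : ℤ) (s : ℕ × ℤ) (t : O m) : List (ℤ × ℕ) :=
  [(c * s.2 * t.re, s.1), (c * s.2 * t.im, 16 + s.1)]

/-- Terms of the value on a face. -/
def tbet (c : ℤ) (s : ℕ × ℤ) (i : ℕ) : List (ℤ × ℕ) := [(c * s.2, 16 * (i + 2) + s.1)]

/-- Terms of the increment along a word. -/
def tinc (s : ℕ × ℤ) : List (O m × ℕ) → List (ℤ × ℕ)
  | [] => []
  | x :: w => tpsi 1 s x.1 ++ (tbet 1 (stT α β act x.1 s) x.2 ++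
      tinc (stp α β act (x.2 + 3) (stT α β act x.1 s)) w)

end states

/-- The evaluation of a linear form. -/
def ev {A : Type*} [AddCommGroup A] (b : ℕ → A) : List (ℤ × ℕ) → A
  | [] => 0
  | x :: l => x.1 • b x.2 + ev b l

lemma ev_append {A : Type*} [AddCommGroup A] (b : ℕ → A) (l l' : List (ℤ × ℕ)) :
    ev b (l ++ l') = ev b l + ev b l' := by
  induction l with
  | nil => simp [ev]
  | cons x l ih => simp only [List.cons_append, ev, ih, add_assoc]

/-- The relations of a floor. -/
inductive Rel (m : ℤ) where
  | inv (s t : O m)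
  | rot (t : O m)
  | swap (i : ℕ)
  | unit (i : ℕ)
  | edge (i : ℕ) (e : Edge m)

/-- The list of all relations. -/
def rels (G : Geom m) : List (Rel m) :=
  [.inv 1 1, .inv 1 ⟨0, 1⟩, .inv ⟨0, 1⟩ 1, .inv ⟨0, 1⟩ ⟨0, 1⟩, .rot 1, .rot ⟨0, 1⟩] ++
  (List.range G.n).flatMap fun i => .swap i :: .unit i :: (G.E i).map (.edge i)

/-- The linear form of a relation at a coset with sign. -/
def terms (G : Geom m) (α β : ℤ × ℤ) (act : ℕ → ℕ → ℕ) (s : ℕ × ℤ) : Rel m → List (ℤ × ℕ)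
  | .inv x t => tpsi 1 (stT α β act x s) t ++ tpsi (-1) s t
  | .rot t => tpsi 1 (stp α β act 2 s) t ++ tpsi (-1) s (uz m ^ 2 * t)
  | .swap i => tbet 1 s i ++ (tpsi 1 (stp α β act (i + 3) s) (G.sw i).t ++
      (tbet 1 (stT α β act (G.sw i).t (stp α β act (i + 3) s)) (G.sw i).n ++
        tpsi (-1) s (G.sw i).b))
  | .unit i => tbet 1 (stp α β act 2 s) i ++ (tpsi (-1) s (G.un i).t ++
      (tbet (-1) (stT α β act (G.un i).t s) (G.un i).n ++
        tpsi (-1) (stp α β act ((G.un i).n + 3) (stT α β act (G.un i).t s)) (G.un i).b))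
  | .edge i e => tbet 1 s i ++ (tinc α β act (stp α β act (i + 3) s) e.w ++
      (tpsi (-1) s e.t ++ (tbet (-1) (stT α β act e.t s) e.n ++
        tpsi (-1) (stp α β act (e.n + 3) (stT α β act e.t s)) e.b)))

/-- The defect of a relation. -/
def val (G : Geom m) {A : Type*} [AddCommGroup A] (ψ : SL (O m) → O m → A)
    (β : ℕ → SL (O m) → A) (g : SL (O m)) : Rel m → A
  | .inv x t => ψ (g * trans x) t - ψ g t
  | .rot t => ψ (g * hz m) t - ψ g (uz m ^ 2 * t)
  | .swap i => β i g + (ψ (g * G.s i) (G.sw i).t +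
      (β (G.sw i).n (g * G.s i * trans (G.sw i).t) - ψ g (G.sw i).b))
  | .unit i => β i (g * hz m) + (-ψ g (G.un i).t +
      (-β (G.un i).n (g * trans (G.un i).t) - ψ (g * trans (G.un i).t * G.s (G.un i).n) (G.un i).b))
  | .edge i e => β i g + (inc G.s ψ β (g * G.s i) e.w + (-ψ g e.t +
      (-β e.n (g * trans e.t) - ψ (g * trans e.t * G.s e.n) e.b)))

variable {G : Geom m} (T : Tab G) (α β : ℤ × ℤ)

/-- The coset with sign of a matrix. -/
def Tab.st (g : SL (O m)) : ℕ × ℤ := (code g, (sg α β T.rep g : ℤ))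

variable {α β}

lemma Tab.st_gen {j : ℕ} (hj : j < G.n + 3) (g : SL (O m)) :
    T.st α β (g * gen G j) = stp α β T.act j (T.st α β g) := by
  have h1 := code_pos g
  have h2 := T.act_code j hj _ h1.1 h1.2
  have h3 := T.act_pars j hj _ h1.1 h1.2
  ext
  · simp only [Tab.st, stp]
    rw [code_mul T.hrep, h2]
  · simp only [Tab.st, stp]
    rw [sg_mul T.hrep, Units.val_mul, ← h3, ← rho_eq_epsZ, sg, sg, h2]

lemma Tab.st_hz (g : SL (O m)) : T.st α β (g * hz m) = stp α β T.act 2 (T.st α β g) :=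
  T.st_gen (j := 2) (by omega) g

lemma Tab.st_s {i : ℕ} (hi : i < G.n) (g : SL (O m)) :
    T.st α β (g * G.s i) = stp α β T.act (i + 3) (T.st α β g) :=
  T.st_gen (j := i + 3) (by omega) g

lemma Tab.st_gen_pow {j : ℕ} (hj : j < G.n + 3) (k : ℕ) : ∀ g : SL (O m),
    T.st α β (g * gen G j ^ k) = stpn α β T.act j k (T.st α β g) := by
  induction k with
  | zero => intro g; simp [stpn]
  | succ k ih => intro g; rw [pow_succ', ← mul_assoc, ih, stpn, T.st_gen hj]

lemma trans_pow {R : Type*} [CommRing R] (t : R) (k : ℕ) : trans t ^ k = trans (k * t) := by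
  induction k with
  | zero => ext1 <;> simp [trans]
  | succ k ih => rw [pow_succ, ih]; ext1 <;> simp [trans]; ring

lemma Tab.st_trans (t : O m) (g : SL (O m)) :
    T.st α β (g * trans t) = stT α β T.act t (T.st α β g) := by
  have e : g * trans t = g * gen G 0 ^ (t.re % 4).toNat * gen G 1 ^ (t.im % 4).toNat *
      trans (4 * ⟨t.re / 4, t.im / 4⟩) := by
    simp only [gen, trans_pow, mul_assoc, trans_mul]
    congr 2
    rw [show (4 : O m) * ⟨t.re / 4, t.im / 4⟩ = ⟨t.re / 4, t.im / 4⟩ + ⟨t.re / 4, t.im / 4⟩ +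
      ⟨t.re / 4, t.im / 4⟩ + ⟨t.re / 4, t.im / 4⟩ by ring]
    ext
    · simp; omega
    · simp; omega
  have h4 : ∀ (h : SL (O m)) u, T.st α β (h * trans (4 * u)) = T.st α β h := by
    intro h u
    simp only [Tab.st]
    rw [code_mul_four, sg_mul_four T.hrep]
  rw [e, h4, T.st_gen_pow (by omega), T.st_gen_pow (by omega)]
  rfl

variable {A : Type*} [AddCommGroup A]

lemma ev_inc {ψ : SL (O m) → O m → A} {B : ℕ → SL (O m) → A} {b : ℕ → A}
    (hψ : ∀ c g t, ev b (tpsi c (T.st α β g) t) = c • ψ g t)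
    (hB : ∀ c g, ∀ i < G.n, ev b (tbet c (T.st α β g) i) = c • B i g) (w : List (O m × ℕ)) :
    ∀ g, (∀ x ∈ w, x.2 < G.n) → ev b (tinc α β T.act (T.st α β g) w) = inc G.s ψ B g w := by
  induction w with
  | nil => intro g _; rfl
  | cons x w ih =>
    intro g hx
    have hx1 := hx x (by simp)
    rw [tinc, inc, ← T.st_trans, ← T.st_s hx1, ev_append, ev_append, hψ, hB _ _ _ hx1,
      ih _ (fun y hy => hx y (by simp [hy])), one_smul, one_smul, add_assoc]

lemma ev_terms {ψ : SL (O m) → O m → A} {B : ℕ → SL (O m) → A} {b : ℕ → A}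
    (hψ : ∀ c g t, ev b (tpsi c (T.st α β g) t) = c • ψ g t)
    (hB : ∀ c g, ∀ i < G.n, ev b (tbet c (T.st α β g) i) = c • B i g) {r : Rel m}
    (hr : r ∈ rels G) (g : SL (O m)) :
    ev b (terms G α β T.act (T.st α β g) r) = val G ψ B g r := by
  cases r with
  | inv x t => simp only [terms, val, ← T.st_trans, ev_append, hψ]; simp [sub_eq_add_neg]
  | rot t => simp only [terms, val, ← T.st_hz, ev_append, hψ]; simp [sub_eq_add_neg]
  | swap i =>
    have hi : i < G.n := by simpa [rels] using hr
    have hn := G.sw_lt i hi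
    simp only [terms, val, ← T.st_s hi, ← T.st_trans, ev_append, hψ, hB _ _ _ hi, hB _ _ _ hn]
    simp [sub_eq_add_neg]
  | unit i =>
    have hi : i < G.n := by simpa [rels] using hr
    have hn := G.un_lt i hi
    simp only [terms, val, ← T.st_hz, ← T.st_trans, ← T.st_s hn, ev_append, hψ, hB _ _ _ hi,
      hB _ _ _ hn]
    simp [sub_eq_add_neg]
  | edge i e =>
    have hi : i < G.n ∧ e ∈ G.E i := by simpa [rels] using hr
    have hn := G.E_lt i hi.1 e hi.2
    simp only [terms, val, ← T.st_s hi.1, ← T.st_trans, ← T.st_s hn.1, ev_append, hψ,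
      hB _ _ _ hi.1, hB _ _ _ hn.1, ev_inc T hψ hB _ _ hn.2]
    simp [sub_eq_add_neg]

lemma inc_equivariant {ψ : SL (O m) → O m → A} {B : ℕ → SL (O m) → A} {s : ℕ → SL (O m)} {u : ℤˣ}
    {γ : SL (O m)} (hψ : ∀ g t, ψ (γ * g) t = u • ψ g t) (hB : ∀ i g, B i (γ * g) = u • B i g)
    (w : List (O m × ℕ)) : ∀ g, inc s ψ B (γ * g) w = u • inc s ψ B g w := by
  induction w with
  | nil => intro g; simp [inc]
  | cons x w ih => intro g; simp only [inc, mul_assoc, hψ, hB, ih, smul_add]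

lemma val_equivariant {ψ : SL (O m) → O m → A} {B : ℕ → SL (O m) → A} {u : ℤˣ}
    {γ : SL (O m)} (hψ : ∀ g t, ψ (γ * g) t = u • ψ g t) (hB : ∀ i g, B i (γ * g) = u • B i g)
    (r : Rel m) (g : SL (O m)) : val G ψ B (γ * g) r = u • val G ψ B g r := by
  cases r <;> simp only [val, mul_assoc, hψ, hB, smul_add, smul_sub, smul_neg,
    inc_equivariant hψ hB]

lemma inc_of_primitive {ψ : SL (O m) → O m → A} {B : ℕ → SL (O m) → A} {F : SL (O m) → A}
    {s : ℕ → SL (O m)} (h1 : ∀ g t, F (g * trans t) = F g + ψ g t)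
    (h3 : ∀ i g, F (g * s i) = F g + B i g) (w : List (O m × ℕ)) :
    ∀ g, F (g * wprod s w) = F g + inc s ψ B g w := by
  induction w with
  | nil => intro g; simp [inc, wprod]
  | cons x w ih =>
    intro g
    rw [wprod, ← mul_assoc, ih, ← mul_assoc, h3, h1, inc]
    abel

lemma val_of_primitive {ψ : SL (O m) → O m → A} {B : ℕ → SL (O m) → A} {F : SL (O m) → A}
    (h1 : ∀ g t, F (g * trans t) = F g + ψ g t) (h2 : ∀ g, F (g * hz m) = F g)
    (h3 : ∀ i g, F (g * G.s i) = F g + B i g) (hinv : ∀ g s t, ψ (g * trans s) t = ψ g t)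
    (hrot : ∀ g t, ψ (g * hz m) t = ψ g (uz m ^ 2 * t)) {r : Rel m} (hr : r ∈ rels G)
    (g : SL (O m)) : val G ψ B g r = 0 := by
  have h2k : ∀ (k : ℕ) g, F (g * hz m ^ k) = F g := by
    intro k
    induction k with
    | zero => intro g; simp
    | succ k ih => intro g; rw [pow_succ, ← mul_assoc, h2, ih]
  have h1' : ∀ g t, ψ g t = F (g * trans t) - F g := fun g t => by rw [h1]; abel
  have h3' : ∀ i g, B i g = F (g * G.s i) - F g := fun i g => by rw [h3]; abel
  cases r with
  | inv x t => simp only [val, hinv, sub_self]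
  | rot t => simp only [val, hrot, sub_self]
  | swap i =>
    have hi : i < G.n := by simpa [rels] using hr
    have e := congrArg (fun x => F (g * x)) (G.sw_eq i hi)
    simp only [← mul_assoc, h2k] at e
    simp only [val, h1', h3', e]
    abel
  | unit i =>
    have hi : i < G.n := by simpa [rels] using hr
    have e := congrArg (fun x => F (g * x)) (G.un_eq i hi)
    simp only [← mul_assoc, h2k] at e
    simp only [val, h1', h3', e, h2]
    abel
  | edge i e =>
    have hi : i < G.n ∧ e ∈ G.E i := by simpa [rels] using hr
    have h := congrArg (fun x => F (g * x)) (G.E_eq i hi.1 e hi.2)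
    have h' := inc_of_primitive h1 h3 e.w (g * G.s i)
    simp only [← mul_assoc, h2k] at h
    rw [h] at h'
    simp only [val]
    rw [show inc G.s ψ B (g * G.s i) e.w = F (g * trans e.t * G.s e.n * trans e.b) -
      F (g * G.s i) by rw [h']; abel]
    simp only [h1', h3']
    abel

lemma Compat.of_val {ψ : SL (O m) → O m → A} {B : ℕ → SL (O m) → A}
    (hadd : ∀ g s t, ψ g (s + t) = ψ g s + ψ g t)
    (H : ∀ r ∈ rels G, ∀ g, val G ψ B g r = 0) : Compat G ψ B := by
  have hspan : ∀ (f : O m →+ A), f 1 = 0 → f ⟨0, 1⟩ = 0 → ∀ t, f t = 0 := by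
    intro f h1 h2 t
    have : t = t.re • 1 + t.im • ⟨0, 1⟩ := by ext <;> simp
    rw [this, map_add, map_zsmul, map_zsmul, h1, h2, smul_zero, smul_zero, add_zero]
  let ψ' : SL (O m) → O m →+ A := fun g => AddMonoidHom.mk' (ψ g) (hadd g)
  have hinv : ∀ s : O m, (∀ g, ψ (g * trans s) 1 = ψ g 1) →
      (∀ g, ψ (g * trans s) ⟨0, 1⟩ = ψ g ⟨0, 1⟩) → ∀ g t, ψ (g * trans s) t = ψ g t := by
    intro s h1 h2 g t
    have := hspan (ψ' (g * trans s) - ψ' g) (sub_eq_zero.2 (h1 g)) (sub_eq_zero.2 (h2 g)) t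
    exact sub_eq_zero.1 this
  have i1 := hinv 1 (fun g => sub_eq_zero.1 (H (.inv 1 1) (by simp [rels]) g))
    (fun g => sub_eq_zero.1 (H (.inv 1 ⟨0, 1⟩) (by simp [rels]) g))
  have i2 := hinv ⟨0, 1⟩ (fun g => sub_eq_zero.1 (H (.inv ⟨0, 1⟩ 1) (by simp [rels]) g))
    (fun g => sub_eq_zero.1 (H (.inv ⟨0, 1⟩ ⟨0, 1⟩) (by simp [rels]) g))
  refine ⟨hadd, ?_, ?_, ?_, ?_, ?_⟩
  · let S : AddSubgroup (O m) :=
      { carrier := {s | ∀ g t, ψ (g * trans s) t = ψ g t}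
        zero_mem' := by intro g t; rw [trans_zero, mul_one]
        add_mem' := by
          intro x y hx hy g t
          rw [← trans_mul, ← mul_assoc, hy, hx]
        neg_mem' := by
          intro x hx g t
          have := hx (g * trans (-x)) t
          rwa [mul_assoc, trans_mul, neg_add_cancel, trans_zero, mul_one, eq_comm] at this }
    intro g s t
    have h1 : (1 : O m) ∈ S := i1
    have h2 : (⟨0, 1⟩ : O m) ∈ S := i2
    have h3 : s = s.re • 1 + s.im • ⟨0, 1⟩ := by ext <;> simp
    have : s ∈ S := by rw [h3]; exact S.add_mem (S.zsmul_mem h1 _) (S.zsmul_mem h2 _)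
    exact this g t
  · intro g t
    have := hspan (ψ' (g * hz m) - (ψ' g).comp (AddMonoidHom.mulLeft (uz m ^ 2)))
      (H (.rot 1) (by simp [rels]) g) (H (.rot ⟨0, 1⟩) (by simp [rels]) g) t
    exact sub_eq_zero.1 this
  · intro i hi g
    have := H (.swap i) (by simpa [rels] using hi) g
    simp only [val] at this
    rw [← sub_eq_zero, ← this]
    abel
  · intro i hi g
    have := H (.unit i) (by simpa [rels] using hi) g
    simp only [val] at this
    rw [← sub_eq_zero, ← this]
    abel
  · intro i hi e he g
    have := H (.edge i e) (by simpa [rels] using ⟨hi, he⟩) g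
    simp only [val] at this
    rw [← sub_eq_zero, ← this]
    abel

lemma Tab.st_rep {x : ℕ} (h1 : 1 ≤ x) (h2 : x ≤ 15) : T.st α β (T.rep x) = (x, 1) := by
  rw [Tab.st, T.hrep x h1 h2, sg_rep T.hrep h1 h2]; rfl

/-- A lift of the linear system gives a lift of crossed homomorphisms. -/
theorem hasLift_of_system (H : ∀ b : ℕ → Qmod,
    (∀ r ∈ rels G, ∀ x, 1 ≤ x → x ≤ 15 → ev b (terms G α β T.act (x, 1) r) = 0) →
    ∃ b' : ℕ → ℚ, (∀ r ∈ rels G, ∀ x, 1 ≤ x → x ≤ 15 → ev b' (terms G α β T.act (x, 1) r) = 0) ∧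
      ∀ v < 16 * (G.n + 2), v % 16 ≠ 0 → toQmod (b' v) = b v) :
    HasLift (GB m) (rho α β) := by
  intro c hc
  obtain ⟨F, ψ, hF, h1, h2, hadd, hinv, hrot, heq⟩ := exists_cusp_primitive T.hrep hc
  let B : ℕ → SL (O m) → Qmod := fun i g => F (g * G.s i) - F g
  have h3 : ∀ i g, F (g * G.s i) = F g + B i g := fun i g => by simp only [B]; abel
  have hBeq : ∀ i, ∀ γ ∈ GB m, ∀ g, B i (γ * g) = rho α β γ • B i g := by
    intro i γ hγ g
    simp only [B]
    rw [mul_assoc, hF γ hγ, hF γ hγ, smul_sub]; abel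
  let b : ℕ → Qmod := fun v =>
    if v / 16 = 0 then ψ (T.rep (v % 16)) 1 else
    if v / 16 = 1 then ψ (T.rep (v % 16)) ⟨0, 1⟩ else B (v / 16 - 2) (T.rep (v % 16))
  have hb0 : ∀ x, 1 ≤ x → x ≤ 15 → b x = ψ (T.rep x) 1 := by
    intro x hx1 hx2
    simp only [b]
    rw [if_pos (by omega), Nat.mod_eq_of_lt (by omega)]
  have hb1 : ∀ x, 1 ≤ x → x ≤ 15 → b (16 + x) = ψ (T.rep x) ⟨0, 1⟩ := by
    intro x hx1 hx2
    simp only [b]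
    rw [if_neg (by omega), if_pos (by omega), show (16 + x) % 16 = x by omega]
  have hb2 : ∀ i x, 1 ≤ x → x ≤ 15 → b (16 * (i + 2) + x) = B i (T.rep x) := by
    intro i x hx1 hx2
    simp only [b]
    rw [if_neg (by omega), if_neg (by omega), show (16 * (i + 2) + x) % 16 = x by omega,
      show (16 * (i + 2) + x) / 16 - 2 = i by omega]
  have hzs : ∀ g (t : O m), ψ g t = t.re • ψ g 1 + t.im • ψ g ⟨0, 1⟩ := by
    intro g t
    let f : O m →+ Qmod := AddMonoidHom.mk' (ψ g) (hadd g)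
    have h3 : t = t.re • 1 + t.im • ⟨0, 1⟩ := by ext <;> simp
    conv_lhs => rw [h3]
    change f _ = _
    rw [map_add, map_zsmul, map_zsmul]; rfl
  have hψ : ∀ c g t, ev b (tpsi c (T.st α β g) t) = c • ψ g t := by
    intro c g t
    have hx := code_pos g
    simp only [tpsi, ev, Tab.st]
    have he := equivariant_eq (α := α) (β := β) T.hrep (u := fun g => ψ g t)
      (fun γ hγ g => heq γ hγ g t) g
    rw [hb0 _ hx.1 hx.2, hb1 _ hx.1 hx.2, he, hzs (T.rep (code g)) t, Units.smul_def]
    module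
  have hB : ∀ c g, ∀ i < G.n, ev b (tbet c (T.st α β g) i) = c • B i g := by
    intro c g i hi
    have hx := code_pos g
    simp only [tbet, ev, Tab.st]
    rw [hb2 i _ hx.1 hx.2, equivariant_eq T.hrep (hBeq i) g, Units.smul_def]
    module
  obtain ⟨b', hb', hlift⟩ := H b (by
    intro r hr x hx1 hx2
    rw [← T.st_rep hx1 hx2, ev_terms T hψ hB hr]
    exact val_of_primitive h1 h2 h3 hinv hrot hr _)
  let ψ' : SL (O m) → O m → ℚ := fun g t => ev b' (tpsi 1 (T.st α β g) t)
  let B' : ℕ → SL (O m) → ℚ := fun i g => ev b' (tbet 1 (T.st α β g) i)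
  have hst : ∀ γ ∈ GB m, ∀ g, T.st α β (γ * g) =
      ((T.st α β g).1, (rho α β γ : ℤ) * (T.st α β g).2) := by
    intro γ hγ g
    simp only [Tab.st]
    rw [code_mul_left hγ, sg_mul_left T.hrep hγ, Units.val_mul]
  have hψ'γ : ∀ γ ∈ GB m, ∀ g t, ψ' (γ * g) t = rho α β γ • ψ' g t := by
    intro γ hγ g t
    simp only [ψ', hst γ hγ, tpsi, ev, Units.smul_def]
    module
  have hB'γ : ∀ γ ∈ GB m, ∀ i g, B' i (γ * g) = rho α β γ • B' i g := by
    intro γ hγ i g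
    simp only [B', hst γ hγ, tbet, ev, Units.smul_def]
    module
  have hC : Compat G ψ' B' := by
    refine Compat.of_val ?_ ?_
    · intro g s t
      simp only [ψ', tpsi, ev, QuadraticAlgebra.re_add, QuadraticAlgebra.im_add]
      module
    · intro r hr g
      have hγ := mul_rep_inv_mem T.hrep g
      rw [eq_mul_rep (rep := T.rep) g, val_equivariant (hψ'γ _ hγ) (hB'γ _ hγ),
        ← ev_terms T (ψ := ψ') (B := B') (b := b') ?_ ?_ hr, T.st_rep (code_pos g).1 (code_pos g).2,
        hb' r hr _ (code_pos g).1 (code_pos g).2, smul_zero]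
      · intro c g t
        simp only [ψ', tpsi, ev]
        module
      · intro c g i _
        simp only [B', tbet, ev]
        module
  obtain ⟨F', f1, f2, f3⟩ := Geom.exists_potential hC
  have lψ : ∀ g t, toQmod (ψ' g t) = ψ g t := by
    intro g t
    have hx := code_pos g
    have e := hψ 1 g t
    rw [one_smul] at e
    rw [← e]
    simp only [ψ', tpsi, ev, Tab.st, map_add, map_zsmul, map_zero]
    rw [hlift _ (by omega) (by omega), hlift _ (by omega) (by omega)]
  have lB : ∀ i < G.n, ∀ g, toQmod (B' i g) = B i g := by
    intro i hi g
    have hx := code_pos g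
    have e := hB 1 g i hi
    rw [one_smul] at e
    rw [← e]
    simp only [B', tbet, ev, Tab.st, map_add, map_zsmul, map_zero]
    rw [hlift _ (by omega) (by omega)]
  have hκ := Geom.eq_of_invariant G (fun g => toQmod (F' g) - F g)
    (fun g t => by simp only [f1, h1, map_add, lψ]; abel)
    (fun g => by simp only [f2, h2])
    (fun i hi g => by simp only [f3 i hi, h3, map_add, lB i hi]; abel)
  obtain ⟨k, hk⟩ := Submodule.mkQ_surjective Z6sub (toQmod (F' 1) - F 1)
  have hF' : ∀ g, toQmod (F' g - k) = F g := by
    intro g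
    rw [map_sub, hk, ← hκ g]
    abel
  have hγ : ∀ γ ∈ GB m, ∀ g, F' (γ * g) - rho α β γ • F' g = F' γ - rho α β γ • F' 1 := by
    intro γ hγ g
    have := Geom.eq_of_invariant G (fun g => F' (γ * g) - rho α β γ • F' g)
      (fun g t => by simp only [f1, ← mul_assoc, hψ'γ γ hγ, smul_add]; abel)
      (fun g => by simp only [f2, ← mul_assoc])
      (fun i hi g => by simp only [f3 i hi, ← mul_assoc, hB'γ γ hγ, smul_add]; abel) g
    simpa using this
  refine ⟨fun γ => (F' γ - k) - rho α β γ • (F' 1 - k), ?_, ?_⟩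
  · intro g hg h hh
    have e := hγ g hg h
    simp only
    rw [rho_isCharOn α β g hg h hh, show F' (g * h) = F' g - rho α β g • F' 1 + rho α β g • F' h by
      rw [← e]; abel, mul_smul]
    simp only [smul_sub]
    abel
  · intro g hg
    simp only
    have e := hF g hg 1
    rw [mul_one] at e
    rw [map_sub, toQmod_units_smul, hF', hF', e]
    abel

end system

/-- Instructions of a straight-line evaluation of a linear form on states in `[0, 32)`. -/
inductive Ins where
  | add (c j : ℕ)
  | sub (c j : ℕ)
  | mv (j : ℕ)
  | rst

/-- The decoded state. -/
def dec (s : ℕ) : ℕ × ℤ := (s % 16, if s / 16 % 2 = 0 then 1 else -1)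

section sem
variable (tf : ℕ → ℕ × ℤ → ℕ × ℤ) (x : ℕ)

/-- The terms collected by a program. -/
def trace : List Ins → ℕ × ℤ → List (ℤ × ℕ)
  | [], _ => []
  | .add c j :: l, s => (c * s.2, 16 * j + s.1) :: trace l s
  | .sub c j :: l, s => (-c * s.2, 16 * j + s.1) :: trace l s
  | .mv j :: l, s => trace l (tf j s)
  | .rst :: l, _ => trace l (x, 1)

end sem

section compile
variable {m : ℤ} (G : Geom m)

def iadd (c : ℤ) (j : ℕ) (l : List Ins) : List Ins := match c with
  | .ofNat 0 => l
  | .ofNat (n + 1) => .add (n + 1) j :: l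
  | .negSucc n => .sub (n + 1) j :: l

def ips (c : ℤ) (t : O m) (l : List Ins) : List Ins := iadd (c * t.re) 0 (iadd (c * t.im) 1 l)

def imt (t : O m) (l : List Ins) : List Ins :=
  if t.re % 4 = 0 ∧ t.im % 4 = 0 then l
  else .mv ((t.re % 4).toNat + 4 * (t.im % 4).toNat) :: l

def iinc : List (O m × ℕ) → List Ins → List Ins
  | [], l => l
  | x :: w, l => ips 1 x.1 (imt x.1 (iadd 1 (x.2 + 2) (.mv (x.2 + 17) :: iinc w l)))

/-- The program of a relation. -/
def comp : Rel m → List Ins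
  | .inv x t => imt x (ips 1 t (.rst :: ips (-1) t []))
  | .rot t => .mv 16 :: ips 1 t (.rst :: ips (-1) (uz m ^ 2 * t) [])
  | .swap i => iadd 1 (i + 2) (.mv (i + 17) :: ips 1 (G.sw i).t (imt (G.sw i).t
      (iadd 1 ((G.sw i).n + 2) (.rst :: ips (-1) (G.sw i).b []))))
  | .unit i => .mv 16 :: iadd 1 (i + 2) (.rst :: ips (-1) (G.un i).t (imt (G.un i).t
      (iadd (-1) ((G.un i).n + 2) (.mv ((G.un i).n + 17) :: ips (-1) (G.un i).b []))))
  | .edge i e => iadd 1 (i + 2) (.mv (i + 17) :: iinc e.w (.rst :: ips (-1) e.t (imt e.t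
      (iadd (-1) (e.n + 2) (.mv (e.n + 17) :: ips (-1) e.b [])))))

variable (α β : ℤ × ℤ) (act : ℕ → ℕ → ℕ)

/-- The move performed by the instruction `mv k`. -/
def tabf (k : ℕ) (s : ℕ × ℤ) : ℕ × ℤ :=
  if k < 16 then stT α β act (⟨(k % 4 : ℕ), (k / 4 : ℕ)⟩ : O m) s else stp α β act (k - 14) s

variable {A : Type*} [AddCommGroup A] (b : ℕ → A) (x : ℕ)

lemma ev_trace_iadd (tf : ℕ → ℕ × ℤ → ℕ × ℤ) (c : ℤ) (j : ℕ) (l : List Ins) (s : ℕ × ℤ) :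
    ev b (trace tf x (iadd c j l) s) = (c * s.2) • b (16 * j + s.1) + ev b (trace tf x l s) := by
  match c with
  | .ofNat 0 => simp [iadd]
  | .ofNat (n + 1) => simp [iadd, trace, ev]
  | .negSucc n => simp [iadd, trace, ev, Int.negSucc_eq]

lemma ev_trace_ips (tf : ℕ → ℕ × ℤ → ℕ × ℤ) (c : ℤ) (t : O m) (l : List Ins) (s : ℕ × ℤ) :
    ev b (trace tf x (ips c t l) s) = ev b (tpsi c s t) + ev b (trace tf x l s) := by
  simp only [ips, ev_trace_iadd, tpsi, ev, mul_zero, zero_add, mul_one, add_zero]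
  rw [mul_right_comm c t.re, mul_right_comm c t.im, add_assoc]

lemma ev_trace_bet (tf : ℕ → ℕ × ℤ → ℕ × ℤ) (c : ℤ) (i : ℕ) (l : List Ins) (s : ℕ × ℤ) :
    ev b (trace tf x (iadd c (i + 2) l) s) = ev b (tbet c s i) + ev b (trace tf x l s) := by
  simp only [ev_trace_iadd, tbet, ev, add_zero]

lemma trace_imt (t : O m) (l : List Ins) (s : ℕ × ℤ) :
    trace (tabf (m := m) α β act) x (imt t l) s =
      trace (tabf (m := m) α β act) x l (stT α β act t s) := by
  rw [imt]
  split_ifs with h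
  · simp [stT, h.1, h.2, stpn]
  · rw [trace, tabf, if_pos (by omega)]
    congr 1
    simp only [stT]
    congr 2 <;> omega

lemma tabf_hz (s : ℕ × ℤ) : tabf (m := m) α β act 16 s = stp α β act 2 s := rfl

lemma tabf_face (i : ℕ) (s : ℕ × ℤ) : tabf (m := m) α β act (i + 17) s = stp α β act (i + 3) s := by
  rw [tabf, if_neg (by omega), show i + 17 - 14 = i + 3 by omega]

lemma ev_trace_iinc (w : List (O m × ℕ)) (l : List Ins) :
    ∀ s, ev b (trace (tabf (m := m) α β act) x (iinc w (.rst :: l)) s) =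
      ev b (tinc α β act s w) + ev b (trace (tabf (m := m) α β act) x l (x, 1)) := by
  induction w with
  | nil => intro s; simp [iinc, tinc, ev, trace]
  | cons z w ih =>
    intro s
    rw [iinc, ev_trace_ips, trace_imt, ev_trace_bet, trace, tabf_face, ih, tinc, ev_append, ev_append]
    simp only [add_assoc]

/-- The program of a relation computes its linear form. -/
lemma ev_trace_comp (r : Rel m) :
    ev b (trace (tabf (m := m) α β act) x (comp G r) (x, 1)) = ev b (terms G α β act (x, 1) r) := by
  cases r with
  | inv y t =>
    rw [comp, trace_imt, ev_trace_ips, trace, ev_trace_ips, terms, ev_append, trace, ev, add_zero]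
  | rot t =>
    rw [comp, trace, tabf_hz, ev_trace_ips, trace, ev_trace_ips, terms, ev_append, trace, ev, add_zero]
  | swap i =>
    rw [comp, ev_trace_bet, trace, tabf_face, ev_trace_ips, trace_imt, ev_trace_bet, trace,
      ev_trace_ips, trace, terms, ev_append, ev_append, ev_append, ev, add_zero]
  | unit i =>
    rw [comp, trace, tabf_hz, ev_trace_bet, trace, ev_trace_ips, trace_imt, ev_trace_bet, trace,
      tabf_face, ev_trace_ips, trace, terms, ev_append, ev_append, ev_append, ev, add_zero]
  | edge i e =>
    rw [comp, ev_trace_bet, trace, tabf_face, ev_trace_iinc, ev_trace_ips, trace_imt,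
      ev_trace_bet, trace, tabf_face, ev_trace_ips, trace, terms, ev_append, ev_append, ev_append,
      ev_append, ev, add_zero]

end compile

section ev
variable {A : Type*} [AddCommGroup A]

lemma ev_sub (b b' : ℕ → A) (l : List (ℤ × ℕ)) :
    ev (fun v => b v - b' v) l = ev b l - ev b' l := by
  induction l with
  | nil => simp [ev]
  | cons x l ih => simp only [ev, ih, smul_sub]; abel

lemma ev_sum_smul {ι : Type*} (S : Finset ι) (N : ℕ → ι → ℤ) (z : ι → A) (l : List (ℤ × ℕ)) :
    ev (fun v => ∑ k ∈ S, N v k • z k) l = ∑ k ∈ S, ev (fun v => N v k) l • z k := by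
  induction l with
  | nil => simp [ev]
  | cons x l ih =>
    simp only [ev, ih, Finset.smul_sum, ← Finset.sum_add_distrib, add_smul, smul_eq_mul, mul_smul]

end ev

section exec

/-- Force the evaluation of a numeral before substituting it. -/
noncomputable def forceN {γ : Type} (n : ℕ) (f : ℕ → γ) : γ :=
  Nat.rec (f 0) (fun k _ => f (k + 1)) n

lemma forceN_eq {γ : Type} (n : ℕ) (f : ℕ → γ) : forceN n f = f n := by cases n <;> rfl

/-- Table lookup. -/
def nxt (tb : List ℕ) (j s : ℕ) : ℕ :=
  Nat.xor (Nat.land (Nat.shiftRight (tb.getD j 0) (Nat.mul 8 (Nat.mod s 16))) 31) (Nat.land s 16)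

/-- A fold over the terms of a program. -/
noncomputable def exec (tb : List ℕ) (f : ℕ → ℕ → ℕ → ℕ → ℕ) (f' : ℕ → ℕ → ℕ → ℕ → ℕ) (x : ℕ) (p : List Ins) :
    ℕ → ℕ → ℕ :=
  List.rec (fun _ acc => acc) (fun i _ ih s acc =>
    Ins.rec (fun c j => ih s (f c j s acc)) (fun c j => ih s (f' c j s acc))
      (fun j => forceN (nxt tb j s) fun s => ih s acc) (ih x acc) i) p

variable (tb : List ℕ) (f f' : ℕ → ℕ → ℕ → ℕ → ℕ) (x : ℕ)

lemma exec_nil (s acc : ℕ) : exec tb f f' x [] s acc = acc := rfl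
lemma exec_add (c j : ℕ) (l : List Ins) (s acc : ℕ) :
    exec tb f f' x (.add c j :: l) s acc = exec tb f f' x l s (f c j s acc) := rfl
lemma exec_sub (c j : ℕ) (l : List Ins) (s acc : ℕ) :
    exec tb f f' x (.sub c j :: l) s acc = exec tb f f' x l s (f' c j s acc) := rfl
lemma exec_mv (j : ℕ) (l : List Ins) (s acc : ℕ) :
    exec tb f f' x (.mv j :: l) s acc = exec tb f f' x l (nxt tb j s) acc :=
  forceN_eq (nxt tb j s) fun s => exec tb f f' x l s acc
lemma exec_rst (l : List Ins) (s acc : ℕ) :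
    exec tb f f' x (.rst :: l) s acc = exec tb f f' x l x acc := rfl

/-- The tables represent the moves. -/
def TabRep (tf : ℕ → ℕ × ℤ → ℕ × ℤ) : Prop :=
  ∀ j s, s < 32 → dec (nxt tb j s) = tf j (dec s) ∧ nxt tb j s < 32

/-- Packed table of a function on `[0, n)` with values below `256`. -/
def pk (f : ℕ → ℕ) : ℕ → ℕ
  | 0 => 0
  | n + 1 => pk f n + f n * 2 ^ (8 * n)

lemma pk_lt {f : ℕ → ℕ} (hf : ∀ x, f x < 256) (n : ℕ) : pk f n < 2 ^ (8 * n) := by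
  induction n with
  | zero => simp [pk]
  | succ n ih =>
    have h := hf n
    rw [pk, mul_add, pow_add]
    have : f n * 2 ^ (8 * n) ≤ 255 * 2 ^ (8 * n) := Nat.mul_le_mul_right _ (by omega)
    norm_num
    omega

lemma pk_get {f : ℕ → ℕ} (hf : ∀ x, f x < 256) {n x : ℕ} (hx : x < n) :
    pk f n / 2 ^ (8 * x) % 256 = f x := by
  induction n with
  | zero => omega
  | succ n ih =>
    rw [pk]
    rcases Nat.lt_succ_iff_lt_or_eq.1 hx with h | rfl
    · obtain ⟨k, rfl⟩ : ∃ k, n = x + 1 + k := ⟨n - (x + 1), by omega⟩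
      rw [show f (x + 1 + k) * 2 ^ (8 * (x + 1 + k)) = (256 * (f (x + 1 + k) * 2 ^ (8 * k))) * 2 ^ (8 * x) by
        rw [show 8 * (x + 1 + k) = 8 * k + 8 * x + 8 by ring, pow_add, pow_add]; norm_num; ring,
        Nat.add_mul_div_right _ _ (by positivity), Nat.add_mul_mod_self_left]
      exact ih h
    · rw [Nat.add_mul_div_right _ _ (by positivity), Nat.div_eq_of_lt (pk_lt hf _), zero_add,
        Nat.mod_eq_of_lt (hf _)]

/-- The encoding of a state. -/
def enc (s : ℕ × ℤ) : ℕ := s.1 % 16 + if s.2 = 1 then 0 else 16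

lemma enc_lt (s : ℕ × ℤ) : enc s < 32 := by
  rw [enc]; split_ifs <;> omega

lemma dec_enc {s : ℕ × ℤ} (h1 : s.1 < 16) (h2 : s.2 = 1 ∨ s.2 = -1) : dec (enc s) = s := by
  obtain ⟨a, u⟩ := s
  simp only at h1 h2
  rcases h2 with rfl | rfl
  · simp only [enc, dec, if_true, add_zero, Nat.mod_mod, Nat.mod_eq_of_lt h1, Nat.div_eq_of_lt h1]
  · simp only [enc, dec, Nat.mod_eq_of_lt h1, if_neg (by decide : ¬ (-1 : ℤ) = 1)]
    rw [if_neg (by omega), show (a + 16) % 16 = a by omega]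

/-- The action given by a list of packed tables. -/
def actOf (l : List ℕ) (j x : ℕ) : ℕ := Nat.shiftRight (l.getD j 0) (8 * x) % 256

/-- The tables of all moves. -/
def tabs (m : ℤ) (α β : ℤ × ℤ) (l : List ℕ) : List ℕ :=
  (List.range 16).map (fun k => pk (fun x => enc (tabf (m := m) α β (actOf l) k (x, 1))) 16) ++
    (l.drop 2).map fun a => pk (fun x => enc (stp α β (fun _ y => Nat.shiftRight a (8 * y) % 256) 0 (x, 1))) 16

section
variable {m : ℤ} {α β : ℤ × ℤ} {act : ℕ → ℕ → ℕ}

lemma epsZ_eq (p : ℕ) : epsZ α β p = 1 ∨ epsZ α β p = -1 := by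
  rw [epsZ]; split_ifs <;> simp

lemma stp_sgn (j : ℕ) {s : ℕ × ℤ} (h1 : s.1 < 16) (h : s.2 = 1 ∨ s.2 = -1) :
    (stp α β act j s).1 < 16 ∧ ((stp α β act j s).2 = 1 ∨ (stp α β act j s).2 = -1) := by
  refine ⟨Nat.mod_lt _ (by norm_num), ?_⟩
  simp only [stp]
  rcases h with h | h <;> rcases epsZ_eq (α := α) (β := β) (act j s.1 / 16) with h' | h' <;>
    simp [h, h']

lemma stpn_sgn (j k : ℕ) : ∀ {s : ℕ × ℤ}, s.1 < 16 → (s.2 = 1 ∨ s.2 = -1) →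
    (stpn α β act j k s).1 < 16 ∧ ((stpn α β act j k s).2 = 1 ∨ (stpn α β act j k s).2 = -1) := by
  induction k with
  | zero => intro s h1 h2; exact ⟨h1, h2⟩
  | succ k ih => intro s h1 h2; exact ih (stp_sgn j h1 h2).1 (stp_sgn j h1 h2).2

lemma tabf_sgn (j : ℕ) {s : ℕ × ℤ} (h1 : s.1 < 16) (h : s.2 = 1 ∨ s.2 = -1) :
    (tabf (m := m) α β act j s).1 < 16 ∧
      ((tabf (m := m) α β act j s).2 = 1 ∨ (tabf (m := m) α β act j s).2 = -1) := by
  rw [tabf]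
  split_ifs
  · have := stpn_sgn (act := act) (α := α) (β := β) 0 (Int.toNat ((⟨(j % 4 : ℕ), (j / 4 : ℕ)⟩ : O m).re % 4)) h1 h
    exact stpn_sgn 1 _ this.1 this.2
  · exact stp_sgn _ h1 h

lemma stp_smul (j : ℕ) (x : ℕ) (u : ℤ) :
    stp α β act j (x, u) = ((stp α β act j (x, 1)).1, u * (stp α β act j (x, 1)).2) := by
  simp [stp]

lemma stpn_smul (j k : ℕ) : ∀ (s : ℕ × ℤ) (u : ℤ),
    stpn α β act j k (s.1, u * s.2) = ((stpn α β act j k s).1, u * (stpn α β act j k s).2) := by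
  induction k with
  | zero => intro s u; rfl
  | succ k ih =>
    intro s u
    rw [stpn, stpn, ← ih]
    simp [stp, mul_assoc]

lemma tabf_smul (j : ℕ) (x : ℕ) (u : ℤ) :
    tabf (m := m) α β act j (x, u) =
      ((tabf (m := m) α β act j (x, 1)).1, u * (tabf (m := m) α β act j (x, 1)).2) := by
  simp only [tabf]
  split_ifs
  · simp only [stT]
    rw [← stpn_smul, ← stpn_smul]; simp
  · exact stp_smul _ _ _

lemma nxt_of_pk {tb : List ℕ} {j s : ℕ} {h : ℕ × ℤ → ℕ × ℤ} (hs : s < 32)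
    (htb : tb.getD j 0 = pk (fun x => enc (h (x, 1))) 16)
    (h1 : ∀ s : ℕ × ℤ, s.1 < 16 → (s.2 = 1 ∨ s.2 = -1) → (h s).1 < 16 ∧ ((h s).2 = 1 ∨ (h s).2 = -1))
    (h2 : ∀ x u, h (x, u) = ((h (x, 1)).1, u * (h (x, 1)).2)) :
    dec (nxt tb j s) = h (dec s) ∧ nxt tb j s < 32 := by
  have e : Nat.land (Nat.shiftRight (tb.getD j 0) (Nat.mul 8 (Nat.mod s 16))) 31 = enc (h (s % 16, 1)) := by
    change (tb.getD j 0 >>> (8 * (s % 16))) &&& 31 = _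
    rw [htb, show 31 = 2 ^ 5 - 1 by norm_num, Nat.and_two_pow_sub_one_eq_mod, Nat.shiftRight_eq_div_pow]
    have := pk_get (f := fun x => enc (h (x, 1))) (fun x => (enc_lt _).trans (by norm_num)) (n := 16)
      (Nat.mod_lt s (by norm_num : 0 < 16))
    have h3 := enc_lt (h (s % 16, 1))
    omega
  have h3 := enc_lt (h (s % 16, 1))
  have h4 := h1 (s % 16, 1) (Nat.mod_lt _ (by norm_num)) (Or.inl rfl)
  have h5 := dec_enc h4.1 h4.2
  rw [nxt, e]
  generalize enc (h (s % 16, 1)) = y at h3 h5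
  have key : ∀ y < 32, ∀ s < 32, dec (Nat.xor y (Nat.land s 16)) = ((dec y).1, (dec s).2 * (dec y).2) ∧
    Nat.xor y (Nat.land s 16) < 32 := by decide +kernel
  refine ⟨?_, (key y h3 s hs).2⟩
  rw [(key y h3 s hs).1, h5, ← h2]; rfl

lemma tabRep_tabs (l : List ℕ) : TabRep (tabs m α β l) (tabf (m := m) α β (actOf l)) := by
  intro j s hs
  by_cases hj : j < 16
  · refine nxt_of_pk hs ?_ (fun s => tabf_sgn j) (tabf_smul j)
    rw [tabs, List.getD_append _ _ _ _ (by simpa using hj), List.getD_eq_getElem _ _ (by simpa using hj)]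
    simp
  · have e : ∀ s, tabf (m := m) α β (actOf l) j s =
        stp α β (fun _ y => Nat.shiftRight (l.getD (j - 14) 0) (8 * y) % 256) 0 s := by
      intro s
      rw [tabf, if_neg hj]; rfl
    rw [e]
    refine nxt_of_pk hs ?_ (fun s => stp_sgn 0) (stp_smul 0)
    rw [tabs, List.getD_append_right _ _ _ _ (by simpa using hj)]
    simp only [List.length_map, List.length_range]
    by_cases h : j - 14 < l.length
    · rw [List.getD_eq_getElem _ _ (by simp; omega), List.getD_eq_getElem _ _ h]
      simp [show 2 + (j - 16) = j - 14 by omega]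
    · rw [List.getD_eq_default _ _ (by simp; omega), List.getD_eq_default _ _ (by omega)]
      have : ∀ n, pk (fun x => enc (stp α β (fun _ y => Nat.shiftRight 0 (8 * y) % 256) 0 (x, 1))) n = 0 := by
        intro n
        induction n with
        | zero => rfl
        | succ n ih =>
          have e0 : Nat.shiftRight 0 (8 * n) = 0 := Nat.zero_shiftRight _
          rw [pk, ih]
          simp [enc, stp, epsZ, e0]
      exact (this 16).symm

end

end exec

section digits

/-- The offset representing the zero vector of length `f`. -/
def off : ℕ → ℕ
  | 0 => 0
  | k + 1 => off k + 1024 * 2 ^ (32 * k)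

/-- The mask of the forbidden bits of a packed vector of length `f`. -/
def hiM : ℕ → ℕ
  | 0 => 0
  | k + 1 => 2 ^ 32 * hiM k + (2 ^ 32 - 2 ^ 11)

/-- The entries of a packed vector. -/
def dg (p k : ℕ) : ℤ := (p / 2 ^ (32 * k) % 2 ^ 32 : ℕ) - 1024

lemma hiM_testBit {f k i : ℕ} (hk : k < f) (hi : 11 ≤ i) (hi' : i < 32) :
    (hiM f).testBit (32 * k + i) = true := by
  induction f generalizing k with
  | zero => omega
  | succ f ih =>
    rw [hiM, Nat.testBit_two_pow_mul_add _ (by norm_num)]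
    rcases k with _ | k
    · rw [if_pos (by omega)]
      interval_cases i <;> decide
    · rw [if_neg (by omega), show 32 * (k + 1) + i - 32 = 32 * k + i by omega]
      exact ih (by omega)

lemma abs_dg_le {f p : ℕ} (hp : p &&& hiM f = 0) {k : ℕ} (hk : k < f) : |dg p k| ≤ 1024 := by
  have : p / 2 ^ (32 * k) % 2 ^ 32 < 2 ^ 11 := by
    refine Nat.lt_pow_two_of_testBit _ fun i hi => ?_
    rw [Nat.testBit_mod_two_pow, Nat.testBit_div_two_pow]
    by_cases h : i < 32
    · have h1 : (p &&& hiM f).testBit (32 * k + i) = false := by rw [hp]; simp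
      rw [Nat.testBit_and, hiM_testBit hk hi h, Bool.and_true] at h1
      rw [add_comm i, h1, Bool.and_false]
    · simp [h]
  rw [dg, abs_le]
  constructor <;> omega

lemma sum_dg (p : ℕ) (f : ℕ) :
    ((p % 2 ^ (32 * f) : ℕ) : ℤ) - off f = ∑ k ∈ Finset.range f, dg p k • (2 : ℤ) ^ (32 * k) := by
  induction f with
  | zero => simp [off, Nat.mod_one]
  | succ f ih =>
    rw [Finset.sum_range_succ, ← ih, off, dg, show 32 * (f + 1) = 32 * f + 32 by ring, pow_add,
      Nat.mod_mul]
    push_cast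
    simp only [smul_eq_mul]
    ring

lemma le_two_off {f p : ℕ} (hp : p < 2 ^ (32 * f)) (h : p &&& hiM f = 0) : p ≤ 2 * off f := by
  have h1 := sum_dg p f
  rw [Nat.mod_eq_of_lt hp] at h1
  have h2 : ∑ k ∈ Finset.range f, dg p k • (2 : ℤ) ^ (32 * k) ≤
      ∑ k ∈ Finset.range f, (1024 : ℤ) * (2 : ℤ) ^ (32 * k) := by
    refine Finset.sum_le_sum fun k hk => ?_
    have := (abs_le.1 (abs_dg_le h (Finset.mem_range.1 hk))).2
    simp only [smul_eq_mul]
    nlinarith [pow_pos (two_pos : (0 : ℤ) < 2) (32 * k)]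
  have h3 : ∀ f, ∑ k ∈ Finset.range f, (1024 : ℤ) * (2 : ℤ) ^ (32 * k) = off f := by
    intro f
    induction f with
    | zero => rfl
    | succ f ih => rw [Finset.sum_range_succ, ih, off]; push_cast; rfl
  rw [h3] at h2
  omega

lemma digits_unique {f : ℕ} {z : ℕ → ℤ} (hz : ∀ k < f, |z k| < 2 ^ 32)
    (h : ∑ k ∈ Finset.range f, z k • (2 : ℤ) ^ (32 * k) = 0) : ∀ k < f, z k = 0 := by
  induction f generalizing z with
  | zero => intro k hk; omega
  | succ f ih =>
    rw [Finset.sum_range_succ'] at h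
    have e : ∑ k ∈ Finset.range f, z (k + 1) • (2 : ℤ) ^ (32 * (k + 1)) =
        2 ^ 32 * ∑ k ∈ Finset.range f, z (k + 1) • (2 : ℤ) ^ (32 * k) := by
      rw [Finset.mul_sum]
      refine Finset.sum_congr rfl fun k _ => ?_
      simp only [smul_eq_mul, mul_add, pow_add]; ring
    rw [e] at h
    have h0 := abs_lt.1 (hz 0 (by omega))
    simp only [mul_zero, pow_zero, smul_eq_mul, mul_one] at h h0
    have h1 : z 0 = 0 := by omega
    have h2 := ih (z := fun k => z (k + 1)) (fun k hk => hz (k + 1) (by omega)) (by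
      simp only [smul_eq_mul]; omega)
    intro k hk
    rcases k with _ | k
    · exact h1
    · exact h2 k (by omega)

end digits

section packed

/-- A word of the memory. -/
def wd (KK PW mem v : ℕ) : ℕ := Nat.mod (Nat.shiftRight mem (Nat.mul KK v)) PW

noncomputable def addf (KK PW O2 mem c j s acc : ℕ) : ℕ :=
  Nat.add acc (Nat.mul c (Nat.rec (wd KK PW mem (Nat.add (Nat.mul 16 j) (Nat.mod s 16)))
    (fun _ _ => Nat.sub O2 (wd KK PW mem (Nat.add (Nat.mul 16 j) (Nat.mod s 16)))) (Nat.land s 16)))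

noncomputable def subf (KK PW O2 mem c j s acc : ℕ) : ℕ :=
  Nat.add acc (Nat.mul c (Nat.rec (Nat.sub O2 (wd KK PW mem (Nat.add (Nat.mul 16 j) (Nat.mod s 16))))
    (fun _ _ => wd KK PW mem (Nat.add (Nat.mul 16 j) (Nat.mod s 16))) (Nat.land s 16)))

/-- The packed evaluation of a program. -/
noncomputable def pev (tb : List ℕ) (KK PW O2 mem x : ℕ) (p : List Ins) : ℕ :=
  exec tb (addf KK PW O2 mem) (subf KK PW O2 mem) x p x 0

/-- The sum of the absolute values of the coefficients. -/
def l1 : List Ins → ℕ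
  | [] => 0
  | .add c _ :: l => Nat.add c (l1 l)
  | .sub c _ :: l => Nat.add c (l1 l)
  | .mv _ :: l => l1 l
  | .rst :: l => l1 l

lemma dec_cases : ∀ s < 32, (Nat.land s 16 = 0 ∧ (dec s).2 = 1) ∨ (Nat.land s 16 = 15 + 1 ∧ (dec s).2 = -1) := by
  decide +kernel

lemma dec_start : ∀ x < 16, dec x = (x, 1) := by decide +kernel

variable {tb : List ℕ} {tf : ℕ → ℕ × ℤ → ℕ × ℤ} (hT : TabRep tb tf)
include hT

lemma exec_eq {KK PW O mem x : ℕ} (hx : x < 16) (hw : ∀ v, wd KK PW mem v ≤ 2 * O) (p : List Ins) :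
    ∀ s acc, s < 32 → (exec tb (addf KK PW (2 * O) mem) (subf KK PW (2 * O) mem) x p s acc : ℤ) =
      acc + O * l1 p + ev (fun v => (wd KK PW mem v : ℤ) - O) (trace tf x p (dec s)) := by
  induction p with
  | nil => intro s acc _; simp [exec_nil, l1, trace, ev]
  | cons i p ih =>
    intro s acc hs
    cases i with
    | add c j =>
      have hw := hw (16 * j + (dec s).1)
      rw [exec_add, ih _ _ hs, trace, ev, l1]
      rcases dec_cases s hs with ⟨h1, h2⟩ | ⟨h1, h2⟩
      · simp only [addf, h1, h2, Nat.add_eq, Nat.mul_eq, smul_eq_mul]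
        push_cast
        change _ + _ * (wd KK PW mem (16 * j + (dec s).1) : ℤ) + _ + _ = _
        ring
      · simp only [addf, h1, h2, Nat.add_eq, Nat.mul_eq, smul_eq_mul]
        push_cast
        change _ + _ * ((2 * O - wd KK PW mem (16 * j + (dec s).1) : ℕ) : ℤ) + _ + _ = _
        rw [Nat.cast_sub hw]
        push_cast
        ring
    | sub c j =>
      have hw := hw (16 * j + (dec s).1)
      rw [exec_sub, ih _ _ hs, trace, ev, l1]
      rcases dec_cases s hs with ⟨h1, h2⟩ | ⟨h1, h2⟩
      · simp only [subf, h1, h2, Nat.add_eq, Nat.mul_eq, smul_eq_mul]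
        push_cast
        change _ + _ * ((2 * O - wd KK PW mem (16 * j + (dec s).1) : ℕ) : ℤ) + _ + _ = _
        rw [Nat.cast_sub hw]
        push_cast
        ring
      · simp only [subf, h1, h2, Nat.add_eq, Nat.mul_eq, smul_eq_mul]
        push_cast
        change _ + _ * (wd KK PW mem (16 * j + (dec s).1) : ℤ) + _ + _ = _
        ring
    | mv j =>
      rw [exec_mv, ih _ _ (hT j s hs).2, trace, l1, (hT j s hs).1]
    | rst =>
      rw [exec_rst, ih _ _ (by omega), trace, l1, dec_start x hx]

lemma abs_ev_trace_le {h : ℤ} {b : ℕ → ℤ} (hb : ∀ v, |b v| ≤ h) {x : ℕ} (hx : x < 16) (p : List Ins) :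
    ∀ s < 32, |ev b (trace tf x p (dec s))| ≤ h * l1 p := by
  induction p with
  | nil => intro s _; simp [trace, ev, l1]
  | cons i p ih =>
    intro s hs
    have hd : |(dec s).2| = 1 := by rcases dec_cases s hs with h | h <;> simp [h.2]
    cases i with
    | add c j =>
      rw [trace, ev, l1]
      refine (abs_add_le _ _).trans ?_
      have h1 := ih s hs
      have h2 := hb (16 * j + (dec s).1)
      rw [smul_eq_mul, abs_mul, abs_mul, hd, Nat.abs_cast]
      simp only [Nat.add_eq]
      push_cast
      nlinarith [Int.natCast_nonneg c]
    | sub c j =>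
      rw [trace, ev, l1]
      refine (abs_add_le _ _).trans ?_
      have h1 := ih s hs
      have h2 := hb (16 * j + (dec s).1)
      rw [smul_eq_mul, abs_mul, abs_mul, hd, abs_neg, Nat.abs_cast]
      simp only [Nat.add_eq]
      push_cast
      nlinarith [Int.natCast_nonneg c]
    | mv j => rw [trace, l1, ← (hT j s hs).1]; exact ih _ (hT j s hs).2
    | rst => rw [trace, l1, ← dec_start x hx]; exact ih x (by omega)

omit hT in
/-- The memory contains small vectors. -/
def memOK (f NV mem : ℕ) : Bool :=
  decide (mem < 2 ^ (32 * f * NV)) &&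
    (List.range NV).all fun v => Nat.beq (Nat.land (wd (32 * f) (2 ^ (32 * f)) mem v) (hiM f)) 0

omit hT in
lemma memOK.land {f NV mem : ℕ} (h : memOK f NV mem = true) (v : ℕ) :
    wd (32 * f) (2 ^ (32 * f)) mem v &&& hiM f = 0 := by
  simp only [memOK, Bool.and_eq_true, decide_eq_true_eq, List.all_eq_true, List.mem_range, Nat.beq_eq] at h
  by_cases hv : v < NV
  · exact h.2 v hv
  · have : wd (32 * f) (2 ^ (32 * f)) mem v = 0 := by
      change (mem >>> (32 * f * v)) % _ = 0
      rw [Nat.shiftRight_eq_div_pow, Nat.div_eq_of_lt, Nat.zero_mod]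
      exact h.1.trans_le (Nat.pow_le_pow_right two_pos (Nat.mul_le_mul_left _ (by omega)))
    rw [this]; simp

omit hT in
lemma wd_lt (f mem v : ℕ) : wd (32 * f) (2 ^ (32 * f)) mem v < 2 ^ (32 * f) := Nat.mod_lt _ (by positivity)

variable {f NV mem : ℕ} (hm : memOK f NV mem = true)
include hm

lemma pev_eq {x : ℕ} (hx : x < 16) (p : List Ins) :
    (pev tb (32 * f) (2 ^ (32 * f)) (2 * off f) mem x p : ℤ) - off f * l1 p =
      ∑ k ∈ Finset.range f, ev (fun v => dg (wd (32 * f) (2 ^ (32 * f)) mem v) k) (trace tf x p (x, 1)) •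
        (2 : ℤ) ^ (32 * k) := by
  rw [pev, exec_eq hT hx (fun v => le_two_off (wd_lt f mem v) (memOK.land hm v)) p x 0 (by omega), dec_start x hx,
    ← ev_sum_smul]
  have : (fun v => ((wd (32 * f) (2 ^ (32 * f)) mem v : ℕ) : ℤ) - off f) = fun v =>
      ∑ k ∈ Finset.range f, dg (wd (32 * f) (2 ^ (32 * f)) mem v) k • (2 : ℤ) ^ (32 * k) := by
    funext v
    rw [← sum_dg, Nat.mod_eq_of_lt (wd_lt f mem v)]
  rw [this]
  push_cast
  ring

lemma abs_ev_dg {x : ℕ} (hx : x < 16) (p : List Ins) {k : ℕ} (hk : k < f) :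
    |ev (fun v => dg (wd (32 * f) (2 ^ (32 * f)) mem v) k) (trace tf x p (x, 1))| ≤ 1024 * l1 p := by
  rw [← dec_start x hx]
  exact abs_ev_trace_le hT (fun v => abs_dg_le (memOK.land hm v) hk) hx p x (by omega)

lemma ev_dg_eq_zero {x : ℕ} (hx : x < 16) {p : List Ins} (hp : l1 p ≤ 2 ^ 20)
    (h : pev tb (32 * f) (2 ^ (32 * f)) (2 * off f) mem x p = off f * l1 p) {k : ℕ} (hk : k < f) :
    ev (fun v => dg (wd (32 * f) (2 ^ (32 * f)) mem v) k) (trace tf x p (x, 1)) = 0 := by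
  refine digits_unique (f := f)
    (z := fun k => ev (fun v => dg (wd (32 * f) (2 ^ (32 * f)) mem v) k) (trace tf x p (x, 1)))
    (fun k hk => ?_) ?_ k hk
  · have := abs_ev_dg hT hm hx p hk
    have h2 : (l1 p : ℤ) ≤ 2 ^ 20 := by exact_mod_cast hp
    omega
  · rw [← pev_eq hT hm hx p, h]; push_cast; ring

omit hT in
lemma dg_eq {v : ℕ} {z : ℕ → ℤ} (hz : ∀ k < f, |z k| ≤ 1)
    (h : (wd (32 * f) (2 ^ (32 * f)) mem v : ℤ) = off f + ∑ k ∈ Finset.range f, z k • (2 : ℤ) ^ (32 * k))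
    {k : ℕ} (hk : k < f) : dg (wd (32 * f) (2 ^ (32 * f)) mem v) k = z k := by
  have h1 := sum_dg (wd (32 * f) (2 ^ (32 * f)) mem v) f
  rw [Nat.mod_eq_of_lt (wd_lt f mem v), h] at h1
  refine sub_eq_zero.1 (digits_unique (f := f) (z := fun k => dg (wd (32 * f) (2 ^ (32 * f)) mem v) k - z k)
    (fun k hk => ?_) ?_ k hk)
  · have h2 := abs_le.1 (abs_dg_le (memOK.land hm v) hk)
    have h3 := abs_le.1 (hz k hk)
    rw [abs_lt]; constructor <;> omega
  · simp only [sub_smul, Finset.sum_sub_distrib]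
    rw [← h1]; ring

end packed

section scan

noncomputable def sadd (kn v c j s acc : ℕ) : ℕ :=
  cond (Nat.beq (Nat.add (Nat.mul 16 j) (Nat.mod s 16)) v)
    (Nat.add acc (Nat.rec c (fun _ _ => Nat.mul 1048576 c) (Nat.land s 16)))
    (Nat.rec (Nat.add acc 1099511627776) (fun _ _ => acc)
      (Nat.land (Nat.shiftRight kn (Nat.add (Nat.mul 16 j) (Nat.mod s 16))) 1))

noncomputable def ssub (kn v c j s acc : ℕ) : ℕ :=
  cond (Nat.beq (Nat.add (Nat.mul 16 j) (Nat.mod s 16)) v)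
    (Nat.add acc (Nat.rec (Nat.mul 1048576 c) (fun _ _ => c) (Nat.land s 16)))
    (Nat.rec (Nat.add acc 1099511627776) (fun _ _ => acc)
      (Nat.land (Nat.shiftRight kn (Nat.add (Nat.mul 16 j) (Nat.mod s 16))) 1))

/-- The packed coefficient of `v` in a program whose other variables are known. -/
noncomputable def scan (tb : List ℕ) (kn v x : ℕ) (p : List Ins) : ℕ :=
  exec tb (sadd kn v) (ssub kn v) x p x 0

/-- The known variables. -/
def Known (kn w : ℕ) : Prop := Nat.land (Nat.shiftRight kn w) 1 ≠ 0

lemma known_iff {kn w : ℕ} : Known kn w ↔ kn.testBit w = true := by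
  rw [Known, Nat.testBit]
  change kn >>> w &&& 1 ≠ 0 ↔ _
  rw [Nat.and_comm]; simp

lemma rec_known {kn w a b : ℕ} (h : Known kn w) :
    (Nat.rec a (fun _ _ => b) (Nat.land (Nat.shiftRight kn w) 1) : ℕ) = b := by
  rw [Known] at h
  cases e : Nat.land (Nat.shiftRight kn w) 1 with
  | zero => exact absurd e h
  | succ => rfl

lemma rec_not_known {kn w a b : ℕ} (h : ¬ Known kn w) :
    (Nat.rec a (fun _ _ => b) (Nat.land (Nat.shiftRight kn w) 1) : ℕ) = a := by
  rw [Known, not_not] at h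
  rw [h]; rfl

variable {tb : List ℕ} {tf : ℕ → ℕ × ℤ → ℕ × ℤ} (hT : TabRep tb tf)
  {A : Type*} [AddCommGroup A] {y : ℕ → A} {kn : ℕ}

include hT in
lemma exec_scan (hy : ∀ w, Known kn w → y w = 0) (v : ℕ) {x : ℕ} (hx : x < 16) (p : List Ins) :
    ∀ s acc, s < 32 → ∃ a n z, exec tb (sadd kn v) (ssub kn v) x p s acc =
      acc + a + 1048576 * n + 1099511627776 * z ∧ a ≤ l1 p ∧
      (z = 0 → ev y (trace tf x p (dec s)) = ((a : ℤ) - n) • y v) := by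
  induction p with
  | nil => intro s acc _; exact ⟨0, 0, 0, by simp [exec_nil], by simp, by simp [trace, ev]⟩
  | cons i p ih =>
    intro s acc hs
    cases i with
    | add c j =>
      obtain ⟨a, n, z, h1, h2, h3⟩ := ih s (sadd kn v c j s acc) hs
      rw [exec_add, h1, trace, ev, l1]
      by_cases hv : 16 * j + s % 16 = v
      · have e : Nat.beq (Nat.add (Nat.mul 16 j) (Nat.mod s 16)) v = true := by rw [Nat.beq_eq]; exact hv
        rw [sadd, e, cond_true, show 16 * j + (dec s).1 = v from hv]
        rcases dec_cases s hs with ⟨g1, g2⟩ | ⟨g1, g2⟩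
        · refine ⟨c + a, n, z, ?_, ?_, fun hz => ?_⟩
          · rw [g1]; change acc + c + a + _ + _ = _; ring
          · simpa using h2
          · rw [h3 hz, g2]; push_cast; module
        · refine ⟨a, c + n, z, ?_, ?_, fun hz => ?_⟩
          · rw [g1]; change acc + 1048576 * c + a + _ + _ = _; ring
          · simp only [Nat.add_eq]; omega
          · rw [h3 hz, g2]; push_cast; module
      · have e : Nat.beq (Nat.add (Nat.mul 16 j) (Nat.mod s 16)) v = false := by
          rw [← Bool.not_eq_true, Nat.beq_eq]; exact hv
        rw [sadd, e, cond_false]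
        by_cases hk : Known kn (16 * j + s % 16)
        · refine ⟨a, n, z, ?_, ?_, fun hz => ?_⟩
          · erw [rec_known hk]
          · simp only [Nat.add_eq]; omega
          · rw [h3 hz, show y (16 * j + (dec s).1) = 0 from hy _ hk, smul_zero, zero_add]
        · refine ⟨a, n, z + 1, ?_, ?_, fun hz => by omega⟩
          · erw [rec_not_known hk]; simp only [Nat.add_eq]; ring
          · simp only [Nat.add_eq]; omega
    | sub c j =>
      obtain ⟨a, n, z, h1, h2, h3⟩ := ih s (ssub kn v c j s acc) hs
      rw [exec_sub, h1, trace, ev, l1]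
      by_cases hv : 16 * j + s % 16 = v
      · have e : Nat.beq (Nat.add (Nat.mul 16 j) (Nat.mod s 16)) v = true := by rw [Nat.beq_eq]; exact hv
        rw [ssub, e, cond_true, show 16 * j + (dec s).1 = v from hv]
        rcases dec_cases s hs with ⟨g1, g2⟩ | ⟨g1, g2⟩
        · refine ⟨a, c + n, z, ?_, ?_, fun hz => ?_⟩
          · rw [g1]; change acc + 1048576 * c + a + _ + _ = _; ring
          · simp only [Nat.add_eq]; omega
          · rw [h3 hz, g2]; push_cast; module
        · refine ⟨c + a, n, z, ?_, ?_, fun hz => ?_⟩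
          · rw [g1]; change acc + c + a + _ + _ = _; ring
          · simpa using h2
          · rw [h3 hz, g2]; push_cast; module
      · have e : Nat.beq (Nat.add (Nat.mul 16 j) (Nat.mod s 16)) v = false := by
          rw [← Bool.not_eq_true, Nat.beq_eq]; exact hv
        rw [ssub, e, cond_false]
        by_cases hk : Known kn (16 * j + s % 16)
        · refine ⟨a, n, z, ?_, ?_, fun hz => ?_⟩
          · erw [rec_known hk]
          · simp only [Nat.add_eq]; omega
          · rw [h3 hz, show y (16 * j + (dec s).1) = 0 from hy _ hk, smul_zero, zero_add]
        · refine ⟨a, n, z + 1, ?_, ?_, fun hz => by omega⟩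
          · erw [rec_not_known hk]; simp only [Nat.add_eq]; ring
          · simp only [Nat.add_eq]; omega
    | mv j =>
      obtain ⟨a, n, z, h1, h2, h3⟩ := ih (nxt tb j s) acc (hT j s hs).2
      exact ⟨a, n, z, by rw [exec_mv, h1], h2, fun hz => by rw [trace, ← (hT j s hs).1, h3 hz]⟩
    | rst =>
      obtain ⟨a, n, z, h1, h2, h3⟩ := ih x acc (by omega)
      exact ⟨a, n, z, by rw [exec_rst, h1], h2, fun hz => by rw [trace, ← dec_start x hx, h3 hz]⟩

include hT in
lemma eq_zero_of_scan (hy : ∀ w, Known kn w → y w = 0) {v x : ℕ} (hx : x < 16) {p : List Ins}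
    (hp : l1 p ≤ 2 ^ 20 - 1) (h : scan tb kn v x p = 1 ∨ scan tb kn v x p = 1048576)
    (h0 : ev y (trace tf x p (x, 1)) = 0) : y v = 0 := by
  obtain ⟨a, n, z, h1, h2, h3⟩ := exec_scan hT hy v hx p x 0 (by omega)
  change scan tb kn v x p = _ at h1
  rw [h1] at h
  have hz : z = 0 := by omega
  rw [dec_start x hx, h0] at h3
  have h4 := h3 hz
  rcases (show (a = 1 ∧ n = 0) ∨ (a = 0 ∧ n = 1) by omega) with ⟨rfl, rfl⟩ | ⟨rfl, rfl⟩
  · simpa using h4.symm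
  · simpa using h4.symm

include hT in
lemma ev_eq_zero_of_scan (hy : ∀ w, Known kn w → y w = 0) {v x : ℕ} (hx : x < 16) {p : List Ins}
    (h : scan tb kn v x p = 0) : ev y (trace tf x p (x, 1)) = 0 := by
  obtain ⟨a, n, z, h1, h2, h3⟩ := exec_scan hT hy v hx p x 0 (by omega)
  change scan tb kn v x p = _ at h1
  rw [h1] at h
  rw [← dec_start x hx, h3 (by omega), show a = 0 by omega, show n = 0 by omega]
  simp

/-- Adjoin a variable to the known ones. -/
def addk (kn v : ℕ) : ℕ := Nat.lor kn (Nat.shiftLeft 1 v)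

lemma known_addk {kn v w : ℕ} (h : Known (addk kn v) w) : Known kn w ∨ w = v := by
  rw [known_iff] at h ⊢
  change (kn ||| 1 <<< v).testBit w = true at h
  rw [Nat.testBit_or, Bool.or_eq_true, Nat.one_shiftLeft, Nat.testBit_two_pow] at h
  rcases h with h | h
  · exact Or.inl h
  · exact Or.inr (by simpa using h : v = w).symm

lemma known_foldl (l : List ℕ) : ∀ {kn w : ℕ}, Known (l.foldl addk kn) w → Known kn w ∨ w ∈ l := by
  induction l with
  | nil => intro kn w h; exact Or.inl h
  | cons v l ih =>
    intro kn w h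
    rcases ih h with h | h
    · rcases known_addk h with h | rfl
      · exact Or.inl h
      · simp
    · simp [h]

/-- Check that the equations `l` determine their variables successively. -/
noncomputable def ordOK (tb : List ℕ) (ps : List (List Ins)) (fin : ℕ → Bool) (l : List (ℕ × ℕ × ℕ)) : ℕ → Bool :=
  List.rec (fun kn => fin kn) (fun e _ ih kn =>
    and (forceN (scan tb kn e.2.1 (e.1 % 15 + 1) (ps.getD (e.1 / 15) [])) fun r =>
      or (Nat.beq r 1) (Nat.beq r 1048576)) (forceN (addk kn e.2.1) ih)) l

include hT in
lemma ordOK_sound {ps : List (List Ins)} {fin : ℕ → Bool} (hps : ∀ p ∈ ps, l1 p ≤ 2 ^ 20 - 1)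
    (l : List (ℕ × ℕ × ℕ)) : ∀ {kn : ℕ}, (∀ w, Known kn w → y w = 0) →
    (∀ e ∈ l, ev y (trace tf (e.1 % 15 + 1) (ps.getD (e.1 / 15) []) (e.1 % 15 + 1, 1)) = 0) →
    ordOK tb ps fin l kn = true → ∃ kn', fin kn' = true ∧ ∀ w, Known kn' w → y w = 0 := by
  induction l with
  | nil => intro kn hy _ h; exact ⟨kn, h, hy⟩
  | cons e l ih =>
    intro kn hy hl h
    change and _ (forceN (addk kn e.2.1) (fun kn => ordOK tb ps fin l kn)) = true at h
    rw [forceN_eq, forceN_eq, Bool.and_eq_true, Bool.or_eq_true, Nat.beq_eq, Nat.beq_eq] at h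
    refine ih (fun w hw => ?_) (fun e he => hl e (by simp [he])) h.2
    rcases known_addk hw with hw | rfl
    · exact hy w hw
    · refine eq_zero_of_scan hT hy (by omega) ?_ h.1 (hl e (by simp))
      by_cases hi : e.1 / 15 < ps.length
      · rw [List.getD_eq_getElem _ _ hi]; exact hps _ (List.getElem_mem hi)
      · rw [List.getD_eq_default _ _ (by omega)]; simp [l1]

end scan

section force

/-- Force the evaluation of an instruction. -/
noncomputable def forceI {γ : Type} (i : Ins) : (Ins → γ) → γ :=
  Ins.rec (fun c j k => forceN c fun c => forceN j fun j => k (.add c j))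
    (fun c j k => forceN c fun c => forceN j fun j => k (.sub c j))
    (fun j k => forceN j fun j => k (.mv j)) (fun k => k .rst) i

lemma forceI_eq {γ : Type} (i : Ins) (k : Ins → γ) : forceI i k = k i := by
  cases i with
  | add c j =>
    change forceN c (fun c => forceN j fun j => k (.add c j)) = _
    rw [forceN_eq, forceN_eq]
  | sub c j =>
    change forceN c (fun c => forceN j fun j => k (.sub c j)) = _
    rw [forceN_eq, forceN_eq]
  | mv j => exact forceN_eq j fun j => k (.mv j)
  | rst => rfl

/-- Force the evaluation of a list. -/
noncomputable def forceL {γ δ : Type} (F : δ → (δ → γ) → γ) (l : List δ) : (List δ → γ) → γ :=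
  List.rec (fun k => k []) (fun i _ ih k => F i fun i => ih fun l => k (i :: l)) l

lemma forceL_eq {γ δ : Type} {F : δ → (δ → γ) → γ} (hF : ∀ i k, F i k = k i) (l : List δ) :
    ∀ k : List δ → γ, forceL F l k = k l := by
  induction l with
  | nil => intro k; rfl
  | cons i l ih =>
    intro k
    change F i (fun i => forceL F l fun l => k (i :: l)) = _
    rw [hF, ih]

/-- Force the evaluation of the tables. -/
noncomputable def forceT {γ : Type} : List ℕ → (List ℕ → γ) → γ := forceL forceN

lemma forceT_eq {γ : Type} (l : List ℕ) (k : List ℕ → γ) : forceT l k = k l := forceL_eq forceN_eq l k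

/-- Force the evaluation of the programs. -/
noncomputable def forceP {γ : Type} : List (List Ins) → (List (List Ins) → γ) → γ := forceL (forceL forceI)

lemma forceP_eq {γ : Type} (l : List (List Ins)) (k : List (List Ins) → γ) : forceP l k = k l :=
  forceL_eq (forceL_eq forceI_eq) l k

end force

section cert

/-- Combination of the values of a function. -/
def dotE {A : Type*} [AddCommGroup A] (h : ℕ → A) : List ℤ → List ℕ → A
  | y :: ys, e :: es => y • h e + dotE h ys es
  | _, _ => 0

lemma dotE_eq_zero {A : Type*} [AddCommGroup A] {h : ℕ → A} (H : ∀ e, h e = 0) (ys : List ℤ) :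
    ∀ es, dotE h ys es = 0 := by
  induction ys with
  | nil => intro es; cases es <;> rfl
  | cons y ys ih =>
    intro es
    cases es with
    | nil => rfl
    | cons e es => rw [dotE, ih, H, smul_zero, add_zero]

lemma dotE_congr {A : Type*} [AddCommGroup A] {h h' : ℕ → A} (ys : List ℤ) :
    ∀ {es}, (∀ e ∈ es, h e = h' e) → dotE h ys es = dotE h' ys es := by
  induction ys with
  | nil => intro es _; cases es <;> rfl
  | cons y ys ih =>
    intro es H
    cases es with
    | nil => rfl
    | cons e es => rw [dotE, dotE, ih (fun e he => H e (by simp [he])), H e (by simp)]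

lemma dotE_sum {A ι : Type*} [AddCommGroup A] (S : Finset ι) (h : ι → ℕ → ℤ) (c : ι → A) (ys : List ℤ) :
    ∀ es, dotE (fun e => ∑ k ∈ S, h k e • c k) ys es = ∑ k ∈ S, dotE (h k) ys es • c k := by
  induction ys with
  | nil => intro es; cases es <;> simp [dotE]
  | cons y ys ih =>
    intro es
    cases es with
    | nil => simp [dotE]
    | cons e es =>
      simp only [dotE, ih, Finset.smul_sum, ← Finset.sum_add_distrib, add_smul, smul_eq_mul, mul_smul]

lemma abs_dotE_le {h : ℕ → ℤ} {n : ℕ → ℕ} {c : ℤ} (H : ∀ e, |h e| ≤ c * n e) (ys : List ℤ) :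
    ∀ es, |dotE h ys es| ≤ c * dotE (fun e => (n e : ℤ)) (ys.map fun y => |y|) es := by
  induction ys with
  | nil => intro es; cases es <;> simp [dotE]
  | cons y ys ih =>
    intro es
    cases es with
    | nil => simp [dotE]
    | cons e es =>
      simp only [dotE, List.map_cons, smul_eq_mul]
      calc _ ≤ |y * h e| + |dotE h ys es| := abs_add_le _ _
        _ ≤ |y| * (c * n e) + c * dotE (fun e => (n e : ℤ)) (ys.map fun y => |y|) es := by
          rw [abs_mul]
          exact add_le_add (mul_le_mul_of_nonneg_left (H e) (abs_nonneg _)) (ih es)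
        _ = _ := by ring

/-- A certificate for a system of linear forms over `ℤ[1/6]`. -/
structure Cert where
  /-- free variables -/
  fr : List ℕ
  /-- seeds -/
  sd : List ℕ
  /-- the seeds in terms of the free variables -/
  W : List (List ℤ)
  /-- equations determining the other variables: row, variable, sign -/
  ord : List (ℕ × ℕ × ℕ)
  /-- equations determining the seeds -/
  ex : List ℕ
  /-- inverse of the matrix of these equations, up to the denominator -/
  Y : List (List ℤ)
  /-- denominator -/
  DY : ℕ

variable (tb : List ℕ) (ps : List (List Ins)) (C : Cert) (NV : ℕ)

/-- The memory containing given vectors. -/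
def initM (KK O : ℕ) (l : List (ℕ × ℤ)) : ℕ :=
  Int.toNat (l.foldl (fun a e => a + e.2 * 2 ^ (KK * e.1)) (O * ((2 ^ (KK * NV) - 1) / (2 ^ KK - 1)) : ℕ))

/-- Solve for the other variables. -/
noncomputable def propM (KK PW O O2 : ℕ) (l : List (ℕ × ℕ × ℕ)) : ℕ → ℕ :=
  List.rec (fun mem => mem) (fun e _ ih mem =>
    forceN (pev tb KK PW O2 mem (e.1 % 15 + 1) (ps.getD (e.1 / 15) [])) fun r =>
    forceN (Nat.mul O (l1 (ps.getD (e.1 / 15) []))) fun t =>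
    forceN (Nat.rec
        (Nat.sub (Nat.add mem (Nat.shiftLeft t (Nat.mul KK e.2.1))) (Nat.shiftLeft r (Nat.mul KK e.2.1)))
        (fun _ _ => Nat.sub (Nat.add mem (Nat.shiftLeft r (Nat.mul KK e.2.1))) (Nat.shiftLeft t (Nat.mul KK e.2.1)))
        e.2.2) ih) l

/-- The packed integer vector of a list. -/
def packZ : List ℤ → ℤ
  | [] => 0
  | z :: l => z + 2 ^ 32 * packZ l

/-- Check of the null space. -/
noncomputable def checkN : Bool :=
  Nat.beq C.fr.length 0 ||
  forceN (32 * C.fr.length) fun KK => forceN (2 ^ KK) fun PW => forceN (off C.fr.length) fun O =>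
  forceN (2 * O) fun O2 =>
  forceN (propM tb ps KK PW O O2 C.ord (initM NV KK O
    ((C.fr.zipIdx.map fun e => (e.1, 2 ^ (32 * e.2))) ++ C.sd.zip (C.W.map packZ)))) fun mem =>
  memOK C.fr.length NV mem &&
  ((ps.all fun p => forceN (Nat.mul O (l1 p)) fun t =>
      (List.range' 1 15).all fun x => Nat.beq (pev tb KK PW O2 mem x p) t) &&
    C.fr.zipIdx.all fun e => Nat.beq (wd KK PW mem e.1) (Nat.add O (2 ^ (32 * e.2))))

/-- Check of the seeds. -/
noncomputable def checkS : Bool :=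
  Nat.beq C.sd.length 0 ||
  forceN (32 * C.sd.length) fun KK => forceN (2 ^ KK) fun PW => forceN (off C.sd.length) fun O =>
  forceN (2 * O) fun O2 =>
  forceN (propM tb ps KK PW O O2 C.ord
    (initM NV KK O (C.sd.zipIdx.map fun e => (e.1, 2 ^ (32 * e.2))))) fun mem =>
  memOK C.sd.length NV mem &&
  ((C.ord.all fun e => Nat.beq (pev tb KK PW O2 mem (e.1 % 15 + 1) (ps.getD (e.1 / 15) []))
      (Nat.mul O (l1 (ps.getD (e.1 / 15) [])))) &&
    (C.sd.zipIdx.all fun e => Nat.beq (wd KK PW mem e.1) (Nat.add O (2 ^ (32 * e.2)))) &&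
    (C.fr.all fun v => Nat.beq (wd KK PW mem v) O) &&
    ((List.range C.sd.length).all fun j =>
      decide (dotE (fun e => (l1 (ps.getD (e / 15) []) : ℤ)) ((C.Y.getD j []).map fun y => |y|) C.ex ≤ 2 ^ 20) &&
      decide (dotE (fun e => (pev tb KK PW O2 mem (e % 15 + 1) (ps.getD (e / 15) []) : ℤ) -
        O * l1 (ps.getD (e / 15) [])) (C.Y.getD j []) C.ex = C.DY * 2 ^ (32 * j))))

/-- The check of a certificate. -/
noncomputable def check : Bool :=
  forceT tb fun tb => forceP ps fun ps =>
  (ps.all fun p => Nat.ble (l1 p) 1048575) &&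
  (checkN tb ps C NV && checkS tb ps C NV) &&
  (Nat.ble C.DY 1048576 && Nat.beq (216 % C.DY) 0) &&
  ordOK tb ps (fun kn =>
    ((List.range NV).all fun v => Nat.beq (v % 16) 0 || Nat.beq (Nat.land (Nat.shiftRight kn v) 1) 1) &&
    C.ex.all fun e => Nat.beq (scan tb kn 0 (e % 15 + 1) (ps.getD (e / 15) [])) 0)
    C.ord ((C.fr ++ C.sd).foldl addk 0)

variable {tb ps C NV} {tf : ℕ → ℕ × ℤ → ℕ × ℤ} (hT : TabRep tb tf)

/-- The terms of a row. -/
def rowT (tf : ℕ → ℕ × ℤ → ℕ × ℤ) (ps : List (List Ins)) (i : ℕ) : List (ℤ × ℕ) :=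
  trace tf (i % 15 + 1) (ps.getD (i / 15) []) (i % 15 + 1, 1)

omit hT in
lemma l1_row (hps : ∀ p ∈ ps, l1 p ≤ 1048575) (i : ℕ) : l1 (ps.getD i []) ≤ 1048575 := by
  by_cases hi : i < ps.length
  · rw [List.getD_eq_getElem _ _ hi]; exact hps _ (List.getElem_mem hi)
  · rw [List.getD_eq_default _ _ (by omega)]; simp [l1]

omit hT in
lemma all_zipIdx {l : List ℕ} {P : ℕ × ℕ → Bool} (h : l.zipIdx.all P = true) {k : ℕ} (hk : k < l.length) :
    P (l.getD k 0, k) = true := by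
  rw [List.all_eq_true] at h
  refine h _ ?_
  rw [List.getD_eq_getElem _ _ hk, List.mem_zipIdx_iff_getElem?]
  simp [hk]

omit hT in
lemma dg_single {f mem v j : ℕ} (hm : memOK f NV mem = true) (hj : j < f)
    (h : wd (32 * f) (2 ^ (32 * f)) mem v = off f + 2 ^ (32 * j)) {k : ℕ} (hk : k < f) :
    dg (wd (32 * f) (2 ^ (32 * f)) mem v) k = if k = j then 1 else 0 := by
  refine dg_eq (z := fun k => if k = j then 1 else 0) hm (fun k _ => by split_ifs <;> simp) ?_ hk
  rw [h]
  simp [hj]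

omit hT in
lemma dg_zero {f mem v : ℕ} (hm : memOK f NV mem = true)
    (h : wd (32 * f) (2 ^ (32 * f)) mem v = off f) {k : ℕ} (hk : k < f) :
    dg (wd (32 * f) (2 ^ (32 * f)) mem v) k = 0 := by
  refine dg_eq (z := fun k => 0) hm (fun k _ => by simp) ?_ hk
  rw [h]; simp

include hT in
lemma checkN_sound (hps : ∀ p ∈ ps, l1 p ≤ 1048575) (h : checkN tb ps C NV = true) :
    ∃ N : ℕ → ℕ → ℤ,
      (∀ p ∈ ps, ∀ x, 1 ≤ x → x ≤ 15 → ∀ k < C.fr.length, ev (fun v => N v k) (trace tf x p (x, 1)) = 0) ∧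
      ∀ j < C.fr.length, ∀ k < C.fr.length, N (C.fr.getD j 0) k = if k = j then 1 else 0 := by
  rw [checkN, Bool.or_eq_true] at h
  rcases h with h | h
  · rw [Nat.beq_eq] at h
    exact ⟨0, fun _ _ _ _ _ k hk => by omega, fun j hj => by omega⟩
  simp only [forceN_eq, Bool.and_eq_true] at h
  obtain ⟨hm, h1, h2⟩ := h
  generalize propM _ _ _ _ _ _ _ _ = mem at hm h1 h2
  refine ⟨fun v k => dg (wd (32 * C.fr.length) (2 ^ (32 * C.fr.length)) mem v) k, ?_, ?_⟩
  · intro p hp x hx1 hx2 k hk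
    rw [List.all_eq_true] at h1
    have := h1 p hp
    rw [List.all_eq_true] at this
    have := this x (by rw [List.mem_range'_1]; omega)
    rw [Nat.beq_eq] at this
    exact ev_dg_eq_zero hT hm (by omega) ((hps p hp).trans (by norm_num)) this hk
  · intro j hj k hk
    have := all_zipIdx h2 hj
    rw [Nat.beq_eq] at this
    exact dg_single hm hj this hk

include hT in
lemma checkS_sound (hps : ∀ p ∈ ps, l1 p ≤ 1048575) (hDY : C.DY ≤ 1048576) (h : checkS tb ps C NV = true) :
    ∃ P : ℕ → ℕ → ℤ,
      (∀ e ∈ C.ord, ∀ k < C.sd.length, ev (fun v => P v k) (rowT tf ps e.1) = 0) ∧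
      (∀ j < C.sd.length, ∀ k < C.sd.length, P (C.sd.getD j 0) k = if k = j then 1 else 0) ∧
      (∀ v ∈ C.fr, ∀ k < C.sd.length, P v k = 0) ∧
      ∀ j < C.sd.length, ∀ k < C.sd.length,
        dotE (fun e => ev (fun v => P v k) (rowT tf ps e)) (C.Y.getD j []) C.ex = if k = j then (C.DY : ℤ) else 0 := by
  rw [checkS, Bool.or_eq_true] at h
  rcases h with h | h
  · rw [Nat.beq_eq] at h
    exact ⟨0, fun _ _ k hk => by omega, fun j hj => by omega, fun _ _ k hk => by omega, fun j hj => by omega⟩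
  simp only [forceN_eq, Bool.and_eq_true] at h
  obtain ⟨hm, ⟨⟨h1, h2⟩, h3⟩, h4⟩ := h
  generalize propM _ _ _ _ _ _ _ _ = mem at hm h1 h2 h3 h4
  refine ⟨fun v k => dg (wd (32 * C.sd.length) (2 ^ (32 * C.sd.length)) mem v) k, ?_, ?_, ?_, ?_⟩
  · intro e he k hk
    rw [List.all_eq_true] at h1
    have := h1 e he
    rw [Nat.beq_eq] at this
    exact ev_dg_eq_zero hT hm (by omega) ((l1_row hps _).trans (by norm_num)) this hk
  · intro j hj k hk
    have := all_zipIdx h2 hj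
    rw [Nat.beq_eq] at this
    exact dg_single hm hj this hk
  · intro v hv k hk
    rw [List.all_eq_true] at h3
    have := h3 v hv
    rw [Nat.beq_eq] at this
    exact dg_zero hm this hk
  · intro j hj k hk
    rw [List.all_eq_true] at h4
    have h5 := h4 j (by simpa using hj)
    rw [Bool.and_eq_true, decide_eq_true_eq, decide_eq_true_eq] at h5
    obtain ⟨h5, h6⟩ := h5
    refine sub_eq_zero.1 (digits_unique (f := C.sd.length)
      (z := fun k => dotE (fun e => ev (fun v => dg (wd (32 * C.sd.length) (2 ^ (32 * C.sd.length)) mem v) k)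
        (rowT tf ps e)) (C.Y.getD j []) C.ex - if k = j then (C.DY : ℤ) else 0) (fun k hk => ?_) ?_ k hk)
    · have h7 := abs_dotE_le (h := fun e => ev (fun v => dg (wd (32 * C.sd.length) (2 ^ (32 * C.sd.length)) mem v) k)
        (rowT tf ps e)) (c := 1024) (n := fun e => l1 (ps.getD (e / 15) []))
        (fun e => abs_ev_dg hT hm (by omega) _ hk) (C.Y.getD j []) C.ex
      have h8 : (C.DY : ℤ) ≤ 1048576 := by exact_mod_cast hDY
      rw [abs_le] at h7
      rw [abs_lt]
      split_ifs <;> constructor <;> omega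
    · simp only [sub_smul, Finset.sum_sub_distrib]
      simp only [rowT]
      rw [← dotE_sum, dotE_congr (h' := fun e => (pev tb (32 * C.sd.length) (2 ^ (32 * C.sd.length))
        (2 * off C.sd.length) mem (e % 15 + 1) (ps.getD (e / 15) []) : ℤ) -
        off C.sd.length * l1 (ps.getD (e / 15) [])) _ (fun e _ => (pev_eq hT hm (by omega) _).symm), h6]
      simp [hj]

include hT in
/-- A system with a certificate has liftable solutions. -/
theorem lift_of_check (h : check tb ps C NV = true) {b : ℕ → Qmod}
    (hb : ∀ p ∈ ps, ∀ x, 1 ≤ x → x ≤ 15 → ev b (trace tf x p (x, 1)) = 0) :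
    ∃ b' : ℕ → ℚ, (∀ p ∈ ps, ∀ x, 1 ≤ x → x ≤ 15 → ev b' (trace tf x p (x, 1)) = 0) ∧
      ∀ v < NV, v % 16 ≠ 0 → toQmod (b' v) = b v := by
  rw [check, forceT_eq, forceP_eq] at h
  simp only [Bool.and_eq_true, List.all_eq_true, Nat.ble_eq, Nat.beq_eq] at h
  obtain ⟨⟨⟨hps, hN, hS⟩, hD1, hD2⟩, hO⟩ := h
  obtain ⟨N, hN1, hN2⟩ := checkN_sound hT hps hN
  obtain ⟨P, hP1, hP2, hP3, hP4⟩ := checkS_sound hT hps hD1 hS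
  set f := C.fr.length
  set s := C.sd.length
  have rowz : ∀ {A : Type} [AddCommGroup A] {c : ℕ → A},
      (∀ p ∈ ps, ∀ x, 1 ≤ x → x ≤ 15 → ev c (trace tf x p (x, 1)) = 0) → ∀ i, ev c (rowT tf ps i) = 0 := by
    intro A _ c hc i
    rw [rowT]
    by_cases hi : i / 15 < ps.length
    · rw [List.getD_eq_getElem _ _ hi]; exact hc _ (List.getElem_mem hi) _ (by omega) (by omega)
    · rw [List.getD_eq_default _ _ (by omega)]; rfl
  set x : ℕ → Qmod := fun v => b v - ∑ k ∈ Finset.range f, N v k • b (C.fr.getD k 0) with hx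
  have hx1 : ∀ p ∈ ps, ∀ y, 1 ≤ y → y ≤ 15 → ev x (trace tf y p (y, 1)) = 0 := by
    intro p hp y h1 h2
    rw [hx, ev_sub, hb p hp y h1 h2, ev_sum_smul, Finset.sum_eq_zero, sub_zero]
    intro k hk
    rw [hN1 p hp y h1 h2 k (Finset.mem_range.1 hk), zero_smul]
  have hx2 : ∀ j < f, x (C.fr.getD j 0) = 0 := by
    intro j hj
    rw [hx]
    change b _ - ∑ k ∈ Finset.range f, N (C.fr.getD j 0) k • b (C.fr.getD k 0) = 0
    rw [Finset.sum_congr rfl fun k hk => by rw [hN2 j hj k (Finset.mem_range.1 hk)]]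
    simp [hj]
  set y : ℕ → Qmod := fun v => x v - ∑ k ∈ Finset.range s, P v k • x (C.sd.getD k 0) with hy
  have hyr : ∀ i, ev y (rowT tf ps i) = -∑ k ∈ Finset.range s, ev (fun v => P v k) (rowT tf ps i) • x (C.sd.getD k 0) := by
    intro i
    rw [hy, ev_sub, rowz hx1, ev_sum_smul, zero_sub]
  obtain ⟨kn, hfin, hkn⟩ := ordOK_sound (y := y) hT (fun p hp => (hps p hp).trans (by norm_num)) C.ord
    (kn := (C.fr ++ C.sd).foldl addk 0) (fun w hw => by
      rcases known_foldl _ hw with h | h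
      · exact absurd (known_iff.1 h) (by simp)
      rw [hy]
      rcases List.mem_append.1 h with h | h
      · obtain ⟨j, hj, rfl⟩ := List.getElem_of_mem h
        have e := hx2 j hj
        rw [List.getD_eq_getElem _ _ hj] at e
        change x _ - _ = 0
        rw [e, Finset.sum_eq_zero, sub_zero]
        intro k hk
        rw [hP3 _ h k (Finset.mem_range.1 hk), zero_smul]
      · obtain ⟨j, hj, rfl⟩ := List.getElem_of_mem h
        have e := hP2 j hj
        rw [List.getD_eq_getElem _ _ hj] at e
        change x _ - ∑ k ∈ Finset.range s, P _ k • x (C.sd.getD k 0) = 0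
        rw [Finset.sum_congr rfl fun k hk => by rw [e k (Finset.mem_range.1 hk)]]
        simp [hj, s])
    (fun e he => by
      change ev y (rowT tf ps e.1) = 0
      rw [hyr, Finset.sum_eq_zero, neg_zero]
      intro k hk
      rw [hP1 e he k (Finset.mem_range.1 hk), zero_smul]) hO
  simp only [Bool.and_eq_true, List.all_eq_true, Nat.beq_eq, List.mem_range, Bool.or_eq_true] at hfin
  have hsd : ∀ j < s, x (C.sd.getD j 0) = 0 := by
    intro j hj
    have h1 : dotE (fun e => ∑ k ∈ Finset.range s, ev (fun v => P v k) (rowT tf ps e) • x (C.sd.getD k 0))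
        (C.Y.getD j []) C.ex = 0 := by
      rw [dotE_congr (h' := fun _ => 0) _ fun e he => ?_, dotE_eq_zero fun _ => rfl]
      have h2 : ev y (rowT tf ps e) = 0 := ev_eq_zero_of_scan hT hkn (by omega) (hfin.2 e he)
      rw [hyr, neg_eq_zero] at h2
      exact h2
    rw [dotE_sum, Finset.sum_congr rfl fun k hk => by rw [hP4 j hj k (Finset.mem_range.1 hk)]] at h1
    simp only [ite_smul, zero_smul, Finset.sum_ite_eq', Finset.mem_range, hj, if_true] at h1
    refine eq_zero_of_dvd_six_pow (n := C.DY) (k := 3) ?_ h1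
    have : C.DY ∣ 216 := Nat.dvd_of_mod_eq_zero hD2
    exact_mod_cast this
  choose q hq using fun v => Submodule.mkQ_surjective Z6sub (b v)
  refine ⟨fun v => ∑ k ∈ Finset.range f, N v k • q (C.fr.getD k 0), ?_, ?_⟩
  · intro p hp z h1 h2
    rw [ev_sum_smul, Finset.sum_eq_zero]
    intro k hk
    rw [hN1 p hp z h1 h2 k (Finset.mem_range.1 hk), zero_smul]
  · intro v hv hv0
    have h1 : y v = 0 := hkn v (by
      rcases hfin.1 v hv with h | h
      · exact absurd h hv0
      · rw [Known, h]; exact one_ne_zero)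
    have h2 : x v = 0 := by
      change x v - ∑ k ∈ Finset.range s, P v k • x (C.sd.getD k 0) = 0 at h1
      rwa [Finset.sum_eq_zero (fun k hk => by rw [hsd k (Finset.mem_range.1 hk), smul_zero]), sub_zero] at h1
    have h3 : b v = ∑ k ∈ Finset.range f, N v k • b (C.fr.getD k 0) := sub_eq_zero.1 h2
    rw [h3, map_sum]
    refine Finset.sum_congr rfl fun k _ => ?_
    rw [map_zsmul]
    exact congrArg _ (hq _)

end cert

section atlas
variable {m : ℤ}

/-- One face of the floor: a matrix, its scaled center, and the relations it takes part in. -/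
structure Face (m : ℤ) where
  /-- upper left entry -/
  a : O m
  /-- upper right entry -/
  b : O m
  /-- lower left entry -/
  c : O m
  /-- lower right entry -/
  d : O m
  /-- scaled center -/
  C : O m
  /-- inverse -/
  sw : Side m
  /-- rotation -/
  un : Side m
  /-- edges in cyclic order -/
  E : List (Edge m)

/-- A subdivision of a rectangle into rectangles, each contained in a disc. -/
inductive Cov
  | leaf (i : ℕ) (u v : ℤ)
  | cx (x : ℤ) (l r : Cov)
  | cy (y : ℤ) (l r : Cov)

/-- Numerical description of a floor. -/
structure Atlas (m : ℤ) where
  /-- faces -/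
  fs : List (Face m)
  /-- common denominator of the centers -/
  L : ℤ
  /-- weight of the lower row -/
  M : ℤ
  /-- bound on displacements -/
  B : ℤ
  /-- denominator used in the covering -/
  Q : ℤ
  /-- covering of the unit square -/
  cov : Cov

/-- The matrix with given entries, if its determinant is one. -/
def mkSL (a b c d : O m) : SL (O m) := if h : a * d - b * c = 1 then ⟨a, b, c, d, h⟩ else 1

/-- Entrywise comparison. -/
def eqS (g h : SL (O m)) : Bool :=
  decide (g.a = h.a) && decide (g.b = h.b) && decide (g.c = h.c) && decide (g.d = h.d)

lemma eqS_eq {g h : SL (O m)} (e : eqS g h = true) : g = h := by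
  simp only [eqS, Bool.and_eq_true, decide_eq_true_eq] at e
  ext1
  exacts [e.1.1.1, e.1.1.2, e.1.2, e.2]

namespace Atlas
variable (A : Atlas m)

/-- The face of given index. -/
def face (i : ℕ) : Face m := A.fs.getD i ⟨0, 0, 0, 0, 0, ⟨0, 0, 0, 0⟩, ⟨0, 0, 0, 0⟩, []⟩
/-- The matrix of a face. -/
def s (i : ℕ) : SL (O m) := mkSL (A.face i).a (A.face i).b (A.face i).c (A.face i).d
/-- The number of faces. -/
def n : ℕ := A.fs.length
/-- Scaled centers. -/
def C (i : ℕ) : O m := (A.face i).C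
/-- Scaled squared radii. -/
def R (i : ℕ) : ℤ := A.L ^ 2 / nrm (A.face i).c
/-- Scaled weights. -/
def W (i : ℕ) : ℤ := (nrm (A.face i).C - A.R i) / A.L

/-- The conditions on a single face. -/
def faceOK (i : ℕ) : Bool :=
  decide (0 < nrm (A.s i).c) &&
  decide ((nrm (A.s i).c : O m) * A.C i = (A.L : O m) * ((A.s i).a * star (A.s i).c)) &&
  decide (nrm (A.s i).c * A.R i = A.L ^ 2) && decide (A.L * A.W i = nrm (A.C i) - A.R i) &&
  decide ((A.face i).sw.n < A.n) &&
  eqS (A.s i * trans (A.face i).sw.t * A.s (A.face i).sw.n)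
    (trans (A.face i).sw.b * hz m ^ (A.face i).sw.k) &&
  decide ((A.face i).un.n < A.n) &&
  eqS (hz m * A.s i)
    (trans (A.face i).un.t * A.s (A.face i).un.n * trans (A.face i).un.b * hz m ^ (A.face i).un.k)

/-- A vector is a given positive combination of two others. -/
def combOK (v₀ v₁ v : ℤ × O m × ℤ) (A B D : ℤ) : Bool :=
  decide (0 ≤ A) && decide (0 < B) && decide (0 < D) && decide (D * v.1 = A * v₀.1 + B * v₁.1) &&
  decide (D * v.2.1.re = A * v₀.2.1.re + B * v₁.2.1.re) &&
  decide (D * v.2.1.im = A * v₀.2.1.im + B * v₁.2.1.im) &&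
  decide (D * v.2.2 = A * v₀.2.2 + B * v₁.2.2)

/-- Solve for the coefficients using two coordinates. -/
def solveOK (v₀ v₁ v : ℤ × O m × ℤ) (f : ℤ × O m × ℤ → ℤ) : Bool :=
  let A := f v * v₁.2.2 - f v₁ * v.2.2
  let B := f v₀ * v.2.2 - f v * v₀.2.2
  let D := f v₀ * v₁.2.2 - f v₁ * v₀.2.2
  combOK v₀ v₁ v A B D || combOK v₀ v₁ v (-A) (-B) (-D)

/-- The columns met along a word lie on an edge. -/
def midOK (v₀ v₁ : ℤ × O m × ℤ) : List (O m × ℕ) → SL (O m) → Bool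
  | [], _ => true
  | x :: w, g =>
    (solveOK v₀ v₁ (colq (g * (trans x.1 * A.s x.2))) (fun v => v.2.1.re) ||
      solveOK v₀ v₁ (colq (g * (trans x.1 * A.s x.2))) (fun v => v.2.1.im)) &&
    midOK v₀ v₁ w (g * (trans x.1 * A.s x.2))

/-- The displacement along an edge. -/
def disp (i k : ℕ) (t : O m) : O m := A.C k + (A.L : O m) * t - A.C i

/-- The conditions on an edge. -/
def edgeOK (i : ℕ) (e : Edge m) : Bool :=
  decide (e.n < A.n) && (e.w.all fun x => decide (x.2 < A.n)) &&
  eqS (A.s i * wprod A.s e.w) (trans e.t * A.s e.n * trans e.b * hz m ^ e.k) &&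
  A.midOK (colq (A.s i)) (colq (trans e.t * A.s e.n)) e.w (A.s i) &&
  !decide (A.disp i e.n e.t = 0) &&
  decide (|(A.disp i e.n e.t).re| ≤ A.B) && decide (|(A.disp i e.n e.t).im| ≤ A.B)

/-- The difference of weights. -/
def dW (i k : ℕ) (t : O m) : ℤ := A.W k + tr (A.C k * star t) + A.L * nrm t - A.W i

/-- A neighbour imposes no new constraint beyond two given edges. -/
def farkasP (x : O m) (w : ℤ) (e e' : ℤ × ℤ × ℤ) : Bool :=
  decide (0 ≤ x.re * e'.2.1 - x.im * e'.1) && (decide (0 ≤ e.1 * x.im - e.2.1 * x.re) &&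
  (decide (0 < e.1 * e'.2.1 - e.2.1 * e'.1) &&
  decide ((x.re * e'.2.1 - x.im * e'.1) * e.2.2 + (e.1 * x.im - e.2.1 * x.re) * e'.2.2 ≤
    (e.1 * e'.2.1 - e.2.1 * e'.1) * w)))

/-- The edge of a face as displacement and weight. -/
def edv (i : ℕ) (e : Edge m) : ℤ × ℤ × ℤ :=
  ((A.disp i e.n e.t).re, (A.disp i e.n e.t).im, A.dW i e.n e.t)

/-- The constraints of all close neighbours follow from the edges. -/
def farkasOK (j : ℕ) : Bool :=
  (List.range A.n).all fun k => [-3, -2, -1, 0, 1, 2, 3].all fun v =>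
    !decide ((4 * m - 1) * (A.disp j k ⟨0, v⟩).im ^ 2 ≤ 8 * (A.R j + A.R k)) ||
    [-3, -2, -1, 0, 1, 2, 3].all fun u =>
      !decide (nrm (A.disp j k ⟨u, v⟩) ≤ 2 * (A.R j + A.R k)) ||
      (decide (k = j) && decide (u = 0) && decide (v = 0)) ||
      (!decide (A.disp j k ⟨u, v⟩ = 0) &&
        ((A.face j).E.zip ((A.face j).E.rotate 1)).any fun e =>
          farkasP (A.disp j k ⟨u, v⟩) (A.dW j k ⟨u, v⟩) (A.edv j e.1) (A.edv j e.2))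

/-- A point lies in a disc. -/
def inDisc (i : ℕ) (c z : O m) : Bool :=
  decide (A.M * nrm ((A.Q : O m) * c - (A.L : O m) * z) + A.L ^ 2 * A.Q ^ 2 < A.M * A.R i * A.Q ^ 2)

/-- A rectangle is covered by the discs. -/
def covOK : Cov → ℤ → ℤ → ℤ → ℤ → Bool
  | .leaf i u v, x₀, x₁, y₀, y₁ => decide (i < A.n) &&
    A.inDisc i (A.C i + (A.L : O m) * ⟨u, v⟩) ⟨x₀, y₀⟩ &&
    A.inDisc i (A.C i + (A.L : O m) * ⟨u, v⟩) ⟨x₀, y₁⟩ &&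
    A.inDisc i (A.C i + (A.L : O m) * ⟨u, v⟩) ⟨x₁, y₀⟩ &&
    A.inDisc i (A.C i + (A.L : O m) * ⟨u, v⟩) ⟨x₁, y₁⟩
  | .cx x l r, x₀, x₁, y₀, y₁ => covOK l x₀ x y₀ y₁ && covOK r x x₁ y₀ y₁
  | .cy y l r, x₀, x₁, y₀, y₁ => covOK l x₀ x₁ y₀ y && covOK r x₀ x₁ y y₁


/-- The whole verification. -/
def ok : Bool :=
  decide (1 ≤ m) && decide (0 < A.L) && decide (1 < A.M) && decide (0 < A.Q) &&
  ((List.range A.n).all fun i => A.faceOK i && ((A.face i).E.all fun e => A.edgeOK i e) &&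
    decide (0 ≤ (A.C i).re) && decide ((A.C i).re < A.L) &&
    decide (0 ≤ (A.C i).im) && decide ((A.C i).im < A.L) && A.farkasOK i) &&
  A.covOK A.cov 0 A.Q 0 A.Q

end Atlas
end atlas

section soundness
variable {m : ℤ}

lemma quadratic_neg_of_endpoints {a b c x₀ x₁ x : ℤ} (ha : 0 ≤ a) (h₀ : x₀ ≤ x) (h₁ : x ≤ x₁)
    (f₀ : a * x₀ ^ 2 + b * x₀ + c < 0) (f₁ : a * x₁ ^ 2 + b * x₁ + c < 0) :
    a * x ^ 2 + b * x + c < 0 := by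
  rcases h₀.eq_or_lt with rfl | h₀
  · exact f₀
  rcases h₁.eq_or_lt with rfl | h₁
  · exact f₁
  have e : (x₁ - x₀) * (a * x ^ 2 + b * x + c) = (x₁ - x) * (a * x₀ ^ 2 + b * x₀ + c) +
      (x - x₀) * (a * x₁ ^ 2 + b * x₁ + c) - a * ((x - x₀) * (x₁ - x) * (x₁ - x₀)) := by ring
  have t₀ := mul_neg_of_pos_of_neg (sub_pos.2 h₁) f₀
  have t₁ := mul_neg_of_pos_of_neg (sub_pos.2 h₀) f₁
  have t₂ := mul_nonneg ha (mul_pos (mul_pos (sub_pos.2 h₀) (sub_pos.2 h₁)) (sub_pos.2 (h₀.trans h₁))).le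
  nlinarith

namespace Atlas
variable {A : Atlas m}

lemma inDisc_iff {i : ℕ} {c z : O m} : A.inDisc i c z = true ↔
    A.M * nrm ((A.Q : O m) * c - (A.L : O m) * z) + A.L ^ 2 * A.Q ^ 2 < A.M * A.R i * A.Q ^ 2 := by
  simp [inDisc]

lemma nrm_lin (k l : ℤ) (c z : O m) : nrm ((k : O m) * c - (l : O m) * z) =
    (k * c.re - l * z.re) ^ 2 + (k * c.re - l * z.re) * (k * c.im - l * z.im) +
      m * (k * c.im - l * z.im) ^ 2 := by
  simp [nrm]; ring

lemma disc_of_corners (hm : 1 ≤ m) (hM : 0 < A.M) (hQ : 0 < A.Q) {i : ℕ} {c : O m} {x₀ x₁ y₀ y₁ : ℤ}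
    (h₀₀ : A.inDisc i c ⟨x₀, y₀⟩ = true) (h₀₁ : A.inDisc i c ⟨x₀, y₁⟩ = true)
    (h₁₀ : A.inDisc i c ⟨x₁, y₀⟩ = true) (h₁₁ : A.inDisc i c ⟨x₁, y₁⟩ = true)
    {z : O m} {q : ℤ} (hq : 0 < q) (hx₀ : x₀ * q ≤ A.Q * z.re) (hx₁ : A.Q * z.re ≤ x₁ * q)
    (hy₀ : y₀ * q ≤ A.Q * z.im) (hy₁ : A.Q * z.im ≤ y₁ * q) :
    A.M * nrm ((q : O m) * c - (A.L : O m) * z) + A.L ^ 2 * q ^ 2 < A.M * A.R i * q ^ 2 := by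
  rw [inDisc_iff, nrm_lin] at h₀₀ h₀₁ h₁₀ h₁₁
  rw [nrm_lin]
  dsimp only at h₀₀ h₀₁ h₁₀ h₁₁
  set M := A.M; set Q := A.Q; set L := A.L; set R := A.R i; set X := c.re; set Y := c.im
  have q2 : 0 < q ^ 2 := by positivity
  have key : ∀ {y : ℤ}, M * ((Q * X - L * x₀) ^ 2 + (Q * X - L * x₀) * (Q * Y - L * y) + m * (Q * Y - L * y) ^ 2) + L ^ 2 * Q ^ 2 < M * R * Q ^ 2 →
      M * ((Q * X - L * x₁) ^ 2 + (Q * X - L * x₁) * (Q * Y - L * y) + m * (Q * Y - L * y) ^ 2) + L ^ 2 * Q ^ 2 < M * R * Q ^ 2 →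
      M * ((q * (Q * X) - L * (Q * z.re)) ^ 2 + (q * (Q * X) - L * (Q * z.re)) * (q * (Q * Y) - L * (y * q)) + m * (q * (Q * Y) - L * (y * q)) ^ 2) + L ^ 2 * Q ^ 2 * q ^ 2 < M * R * Q ^ 2 * q ^ 2 := by
    intro y e₀ e₁
    have := quadratic_neg_of_endpoints (a := M * L ^ 2)
      (b := M * (-2 * L * q * Q * X - L * (q * (Q * Y) - L * (y * q))))
      (c := M * ((q * (Q * X)) ^ 2 + q * (Q * X) * (q * (Q * Y) - L * (y * q)) + m * (q * (Q * Y) - L * (y * q)) ^ 2) + L ^ 2 * Q ^ 2 * q ^ 2 - M * R * Q ^ 2 * q ^ 2)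
      (by positivity) hx₀ hx₁
      (by linarith [mul_lt_mul_of_pos_right e₀ q2]) (by linarith [mul_lt_mul_of_pos_right e₁ q2])
    linarith
  have e := quadratic_neg_of_endpoints (a := M * m * L ^ 2)
      (b := M * (-2 * m * L * q * Q * Y - L * (q * (Q * X) - L * (Q * z.re))))
      (c := M * ((q * (Q * X) - L * (Q * z.re)) ^ 2 + (q * (Q * X) - L * (Q * z.re)) * (q * (Q * Y)) + m * (q * (Q * Y)) ^ 2) + L ^ 2 * Q ^ 2 * q ^ 2 - M * R * Q ^ 2 * q ^ 2)
      (by positivity) hy₀ hy₁ (by linarith [key h₀₀ h₁₀]) (by linarith [key h₀₁ h₁₁])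
  refine lt_of_mul_lt_mul_left (a := Q ^ 2) ?_ (by positivity)
  linarith

lemma covOK_sound (hm : 1 ≤ m) (hM : 0 < A.M) (hQ : 0 < A.Q) {z : O m} {q : ℤ} (hq : 0 < q) (T : Cov) :
    ∀ {x₀ x₁ y₀ y₁ : ℤ}, A.covOK T x₀ x₁ y₀ y₁ = true → x₀ * q ≤ A.Q * z.re → A.Q * z.re ≤ x₁ * q →
      y₀ * q ≤ A.Q * z.im → A.Q * z.im ≤ y₁ * q → ∃ i < A.n, ∃ t : O m,
    A.M * nrm ((q : O m) * (A.C i + (A.L : O m) * t) - (A.L : O m) * z) + A.L ^ 2 * q ^ 2 <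
      A.M * A.R i * q ^ 2 := by
  induction T with
  | leaf i u v =>
    intro x₀ x₁ y₀ y₁ h hx₀ hx₁ hy₀ hy₁
    simp only [covOK, Bool.and_eq_true, decide_eq_true_eq] at h
    obtain ⟨⟨⟨⟨hi, h1⟩, h2⟩, h3⟩, h4⟩ := h
    exact ⟨i, hi, ⟨u, v⟩, disc_of_corners hm hM hQ h1 h2 h3 h4 hq hx₀ hx₁ hy₀ hy₁⟩
  | cx x l r hl hr =>
    intro x₀ x₁ y₀ y₁ h hx₀ hx₁ hy₀ hy₁
    simp only [covOK, Bool.and_eq_true] at h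
    rcases le_total (A.Q * z.re) (x * q) with e | e
    · exact hl h.1 hx₀ e hy₀ hy₁
    · exact hr h.2 e hx₁ hy₀ hy₁
  | cy y l r hl hr =>
    intro x₀ x₁ y₀ y₁ h hx₀ hx₁ hy₀ hy₁
    simp only [covOK, Bool.and_eq_true] at h
    rcases le_total (A.Q * z.im) (y * q) with e | e
    · exact hl h.1 hx₀ hx₁ hy₀ e
    · exact hr h.2 hx₀ hx₁ e hy₁

lemma cover_of_covOK (hm : 1 ≤ m) (hM : 0 < A.M) (hQ : 0 < A.Q)
    (h : A.covOK A.cov 0 A.Q 0 A.Q = true) (z : O m) {q : ℤ} (hq : 0 < q) : ∃ i < A.n, ∃ t : O m,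
    A.M * nrm ((q : O m) * (A.C i + (A.L : O m) * t) - (A.L : O m) * z) + A.L ^ 2 * q ^ 2 <
      A.M * A.R i * q ^ 2 := by
  have bd : ∀ x : ℤ, 0 * q ≤ A.Q * (x % q) ∧ A.Q * (x % q) ≤ A.Q * q := fun x =>
    ⟨by have := mul_nonneg hQ.le (Int.emod_nonneg x hq.ne'); linarith,
      mul_le_mul_of_nonneg_left (Int.emod_lt_of_pos x hq).le hQ.le⟩
  obtain ⟨i, hi, t, ht⟩ := covOK_sound hm hM hQ (z := ⟨z.re % q, z.im % q⟩) hq A.cov h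
    (bd _).1 (bd _).2 (bd _).1 (bd _).2
  refine ⟨i, hi, t + ⟨z.re / q, z.im / q⟩, ?_⟩
  have e : (q : O m) * (A.C i + (A.L : O m) * (t + ⟨z.re / q, z.im / q⟩)) - (A.L : O m) * z =
      (q : O m) * (A.C i + (A.L : O m) * t) - (A.L : O m) * ⟨z.re % q, z.im % q⟩ := by
    have h1 := Int.emod_add_mul_ediv z.re q
    have h2 := Int.emod_add_mul_ediv z.im q
    ext
    · simp; linear_combination A.L * h1
    · simp; linear_combination A.L * h2
  rwa [e]

lemma solveOK_sound {v₀ v₁ v : ℤ × O m × ℤ} {f : ℤ × O m × ℤ → ℤ} (h : solveOK v₀ v₁ v f = true) :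
    ∃ A B D : ℤ, 0 ≤ A ∧ 0 < B ∧ 0 < D ∧ D • v = A • v₀ + B • v₁ := by
  have key : ∀ {A B D : ℤ}, combOK v₀ v₁ v A B D = true →
      ∃ A B D : ℤ, 0 ≤ A ∧ 0 < B ∧ 0 < D ∧ D • v = A • v₀ + B • v₁ := by
    intro A B D h
    simp only [combOK, Bool.and_eq_true, decide_eq_true_eq] at h
    obtain ⟨⟨⟨⟨⟨⟨hA, hB⟩, hD⟩, h1⟩, h2⟩, h3⟩, h4⟩ := h
    exact ⟨A, B, D, hA, hB, hD, Prod.ext (by simpa using h1)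
      (Prod.ext (QuadraticAlgebra.ext (by simpa using h2) (by simpa using h3)) (by simpa using h4))⟩
  simp only [solveOK, Bool.or_eq_true] at h
  exact h.elim key key

lemma midOK_sound {v₀ v₁ : ℤ × O m × ℤ} : ∀ {W : List (O m × ℕ)} {g : SL (O m)},
    A.midOK v₀ v₁ W g = true → ∀ w ∈ W.inits, w ≠ [] → ∃ a B D : ℤ, 0 ≤ a ∧ 0 < B ∧ 0 < D ∧
      D • colq (g * wprod A.s w) = a • v₀ + B • v₁
  | [], g, _, w, hw, hn => by simp at hw; exact absurd hw hn
  | x :: W, g, h, w, hw, hn => by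
    simp only [midOK, Bool.and_eq_true, Bool.or_eq_true] at h
    have h1 := h.1.elim solveOK_sound solveOK_sound
    rw [List.inits_cons, List.mem_cons, List.mem_map] at hw
    obtain hw | ⟨w', hw', rfl⟩ := hw
    · exact absurd hw hn
    rw [wprod, ← mul_assoc]
    by_cases hn' : w' = []
    · subst hn'
      simpa only [wprod, mul_one] using h1
    · exact midOK_sound h.2 w' hw' hn'

lemma farkasOK_sound (hm : 1 ≤ m) (hL : 0 < A.L)
    (hN : ∀ i < A.n, 0 < nrm (A.s i).c) (hR : ∀ i < A.n, nrm (A.s i).c * A.R i = A.L ^ 2)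
    (hC : ∀ i < A.n, 0 ≤ (A.C i).re ∧ (A.C i).re < A.L ∧ 0 ≤ (A.C i).im ∧ (A.C i).im < A.L)
    {j : ℕ} (hj : j < A.n) (h : A.farkasOK j = true) {k : ℕ} (hk : k < A.n) {t : O m}
    (ht : nrm (A.C k + (A.L : O m) * t - A.C j) ≤ 2 * (A.R j + A.R k)) :
    (k = j ∧ t = 0) ∨ (A.C k + (A.L : O m) * t ≠ A.C j ∧
      ∃ e ∈ (A.face j).E, ∃ e' ∈ (A.face j).E, ∃ a a' D : ℤ, 0 ≤ a ∧ 0 ≤ a' ∧ 0 < D ∧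
      (D : O m) * (A.C k + (A.L : O m) * t - A.C j) =
        (a : O m) * (A.C e.n + (A.L : O m) * e.t - A.C j) +
          (a' : O m) * (A.C e'.n + (A.L : O m) * e'.t - A.C j) ∧
      a * (A.W e.n + tr (A.C e.n * star e.t) + A.L * nrm e.t - A.W j) +
        a' * (A.W e'.n + tr (A.C e'.n * star e'.t) + A.L * nrm e'.t - A.W j) ≤
        D * (A.W k + tr (A.C k * star t) + A.L * nrm t - A.W j)) := by
  obtain ⟨u, v⟩ := t
  have hRle : ∀ i < A.n, A.R i ≤ A.L ^ 2 := by
    intro i hi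
    have h1 := hN i hi
    have h2 := hR i hi
    have h3 : 0 < A.R i := by
      by_contra h3
      have : nrm (A.s i).c * A.R i ≤ 0 := mul_nonpos_of_nonneg_of_nonpos h1.le (not_lt.1 h3)
      have : 0 < A.L ^ 2 := by positivity
      omega
    nlinarith
  have hx : nrm (A.disp j k ⟨u, v⟩) ≤ 2 * (A.R j + A.R k) := ht
  have hj' := hRle j hj
  have hk' := hRle k hk
  set x := A.disp j k ⟨u, v⟩ with xdef
  have hxv : x.re * x.re + x.re * x.im + m * x.im * x.im ≤ 2 * (A.R j + A.R k) := hx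
  have him : (4 * m - 1) * x.im ^ 2 ≤ 8 * (A.R j + A.R k) := by
    nlinarith [sq_nonneg (2 * x.re + x.im)]
  have hm' : 0 ≤ (m - 1) * x.im ^ 2 := mul_nonneg (by omega) (sq_nonneg _)
  have bim : |x.im| < 3 * A.L := by
    refine abs_lt_of_sq_lt_sq ?_ (by positivity)
    nlinarith [pow_pos hL 2]
  have bre : |x.re| < 3 * A.L := by
    refine abs_lt_of_sq_lt_sq ?_ (by positivity)
    nlinarith [sq_nonneg (x.re + 2 * x.im), pow_pos hL 2]
  have ere : x.re = (A.C k).re + A.L * u - (A.C j).re := by simp [xdef, disp]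
  have eim : x.im = (A.C k).im + A.L * v - (A.C j).im := by simp [xdef, disp]
  have small : ∀ {y c c' w : ℤ}, |y| < 3 * A.L → y = c + A.L * w - c' → 0 ≤ c → c < A.L → 0 ≤ c' →
      c' < A.L → w ∈ [(-3 : ℤ), -2, -1, 0, 1, 2, 3] := by
    intro y c c' w hy e h1 h2 h3 h4
    rw [abs_lt] at hy
    have a1 : -4 < w := by
      by_contra! hh
      nlinarith
    have a2 : w < 4 := by
      by_contra! hh
      nlinarith
    interval_cases w <;> simp
  obtain ⟨c1, c2, c3, c4⟩ := hC j hj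
  obtain ⟨c5, c6, c7, c8⟩ := hC k hk
  rw [farkasOK, List.all_eq_true] at h
  have h := h k (List.mem_range.2 hk)
  rw [List.all_eq_true] at h
  have h := h v (small bim eim c7 c8 c3 c4)
  have ev : (A.disp j k ⟨0, v⟩).im = x.im := by simp [xdef, disp]
  simp only [ev, him, decide_true, Bool.not_true, Bool.false_or] at h
  rw [List.all_eq_true] at h
  have h := h u (small bre ere c5 c6 c1 c2)
  simp only [← xdef, hx, decide_true, Bool.not_true, Bool.false_or, Bool.or_eq_true, Bool.and_eq_true,
    decide_eq_true_eq, Bool.not_eq_true', decide_eq_false_iff_not] at h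
  obtain ⟨⟨h1, h2⟩, h3⟩ | ⟨hne, h⟩ := h
  · exact Or.inl ⟨h1, by ext <;> simp [h2, h3]⟩
  refine Or.inr ⟨fun e => hne (by rw [xdef, disp, e, sub_self]), ?_⟩
  rw [List.any_eq_true] at h
  obtain ⟨⟨e, e'⟩, he, h⟩ := h
  obtain ⟨he, he'⟩ := List.of_mem_zip he
  rw [List.mem_rotate] at he'
  simp only [farkasP, Bool.and_eq_true, decide_eq_true_eq] at h
  obtain ⟨h1, h2, h3, h4⟩ := h
  refine ⟨e, he, e', he', _, _, _, h1, h2, h3, ?_, h4⟩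
  change _ * x = _ * A.disp j e.n e.t + _ * A.disp j e'.n e'.t
  ext
  · simp [edv]; ring
  · simp [edv]; ring

/-- The geometry described by a verified atlas. -/
def geom (A : Atlas m) (h : A.ok = true) : Geom m := by
  have h' := h
  simp only [ok, faceOK, edgeOK, Bool.and_eq_true, decide_eq_true_eq, List.all_eq_true, List.mem_range,
    Bool.not_eq_true', decide_eq_false_iff_not] at h'
  exact {
  s := A.s
  n := A.n
  L := A.L
  M := A.M
  B := A.B
  C := A.C
  W := A.W
  R := A.R
  E := fun i => (A.face i).E
  sw := fun i => (A.face i).sw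
  un := fun i => (A.face i).un
  one_le := h'.1.1.1.1.1
  L_pos := h'.1.1.1.1.2
  M_gt := h'.1.1.1.2
  N_pos := fun i hi => by have := h'.1.2 i hi; tauto
  hC := fun i hi => by have := h'.1.2 i hi; tauto
  hR := fun i hi => by have := h'.1.2 i hi; tauto
  hW := fun i hi => by have := h'.1.2 i hi; tauto
  cover := fun z q hq => cover_of_covOK h'.1.1.1.1.1 (by linarith [h'.1.1.1.2]) h'.1.1.2 h'.2 z hq
  sw_lt := fun i hi => by have := h'.1.2 i hi; tauto
  sw_eq := fun i hi => eqS_eq (by have := h'.1.2 i hi; tauto)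
  un_lt := fun i hi => by have := h'.1.2 i hi; tauto
  un_eq := fun i hi => eqS_eq (by have := h'.1.2 i hi; tauto)
  E_lt := fun i hi e he => by have := (h'.1.2 i hi).1.1.1.1.1.2 e he; tauto
  E_eq := fun i hi e he => eqS_eq (by have := (h'.1.2 i hi).1.1.1.1.1.2 e he; tauto)
  E_mid := fun i hi e he => midOK_sound (by have := (h'.1.2 i hi).1.1.1.1.1.2 e he; tauto)
  E_disp := fun i hi e he => by
    have := (h'.1.2 i hi).1.1.1.1.1.2 e he
    refine ⟨fun e' => ?_, ?_⟩
    · exact this.1.1.2 (by rw [disp, e', sub_self])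
    · rw [disp] at this; tauto
  farkas := fun j hj k hk t ht => farkasOK_sound h'.1.1.1.1.1 h'.1.1.1.1.2
    (fun i hi => by have := h'.1.2 i hi; tauto) (fun i hi => by have := h'.1.2 i hi; tauto)
    (fun i hi => by have := h'.1.2 i hi; tauto) hj (h'.1.2 j hj).2 hk ht }

end Atlas

end soundness

section tables
variable {m : ℤ}

/-- The factor between the three blocks of five coset representatives. -/
def cosetStep (m : ℤ) : SL (O m) := mkSL ⟨0, 1⟩ 2 ⟨(m ^ 2 - 1) / 2, 0⟩ ⟨m, -m⟩

/-- Coset representatives. -/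
def cosetRep (m : ℤ) (x : ℕ) : SL (O m) :=
  let c := [0, 1, 11, 6, 0, 2, 14, 8, 10, 3, 12, 9, 5, 4, 13, 7].getD x 0
  [1, cosetStep m, cosetStep m * cosetStep m].getD (c / 5) 1 *
    [1, mkSL 0 (-1) 1 0, mkSL 0 (-1) 1 1, mkSL 0 (-1) 1 ⟨0, 1⟩, mkSL 0 (-1) 1 ⟨1, 1⟩].getD (c % 5) 1

/-- The given numbers encode the action of the generators on cosets. -/
def tabOK (G : Geom m) (l : List ℕ) : Bool :=
  (List.range' 1 15).all fun x => Nat.beq (code (cosetRep m x)) x &&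
    (List.range (G.n + 3)).all fun j => Nat.beq (code (cosetRep m x * gen G j)) (actOf l j x % 16) &&
      Nat.beq (pars (cosetRep m x * gen G j * (cosetRep m (actOf l j x % 16))⁻¹)) (actOf l j x / 16)

/-- The table described by a verified list. -/
def Tab.ofList (G : Geom m) (l : List ℕ) (h : tabOK G l = true) : Tab G := by
  simp only [tabOK, List.all_eq_true, Bool.and_eq_true, Nat.beq_eq, List.mem_range, List.mem_range'_1] at h
  exact {
  rep := cosetRep m
  act := actOf l
  hrep := fun x h1 h2 => (h x ⟨h1, by omega⟩).1
  act_code := fun j hj x h1 h2 => ((h x ⟨h1, by omega⟩).2 j hj).1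
  act_pars := fun j hj x h1 h2 => ((h x ⟨h1, by omega⟩).2 j hj).2 }

lemma Tab.ofList_act (G : Geom m) (l : List ℕ) (h : tabOK G l = true) :
    (Tab.ofList G l h).act = actOf l := rfl

/-- The verification of a certificate for one character. -/
noncomputable def certOK (G : Geom m) (l : List ℕ) (α β : ℤ × ℤ) (C : Cert) : Bool :=
  check (tabs m α β l) ((rels G).map (comp G)) C (16 * (G.n + 2))

lemma hasLift_of_certOK {G : Geom m} {l : List ℕ} (hl : tabOK G l = true) {α β : ℤ × ℤ} {C : Cert}
    (h : certOK G l α β C = true) : HasLift (GB m) (rho α β) := by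
  refine hasLift_of_system (Tab.ofList G l hl) fun b hb => ?_
  rw [Tab.ofList_act] at *
  obtain ⟨b', h1, h2⟩ := lift_of_check (tabRep_tabs l) h (b := b) (by
    intro p hp x hx hx'
    obtain ⟨r, hr, rfl⟩ := List.mem_map.1 hp
    rw [ev_trace_comp]
    exact hb r hr x hx hx')
  refine ⟨b', fun r hr x hx hx' => ?_, h2⟩
  rw [← ev_trace_comp]
  exact h1 _ (List.mem_map_of_mem hr) x hx hx'

theorem no_order_of_certs {d : ℕ} (hd : d.Prime) (hdm : (d : ℤ) = 4 * m - 1) (hm : m % 2 = 1)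
    {G : Geom m} {l : List ℕ} (hl : tabOK G l = true) {C₀ C₁ C₂ C₃ : Cert}
    (h₀ : certOK G l (0, 0) (0, 0) C₀ = true) (h₁ : certOK G l (0, 1) (0, 0) C₁ = true)
    (h₂ : certOK G l (0, 1) (0, 1) C₂ = true) (h₃ : certOK G l (0, 1) (1, 0) C₃ = true)
    (K : Type*) [Field K] [NumberField K] (hdeg : Module.finrank ℚ K = 2) (sqd : K)
    (hsqd : sqd ^ 2 = -(d : K)) {p : ℕ} (hp : p.Prime) (hp5 : 5 ≤ p) :
    ¬ ∃ x : Abelianization (Gamma0 (Ideal.span {(16 : 𝓞 K)})), orderOf x = p := by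
  obtain ⟨e⟩ := exists_ringEquiv hd hdm K hdeg sqd hsqd
  exact no_order_of_hasLift G.one_le hm (hasLift_sixteen (hasLift_rhoP hm (hasLift_rho_of_four hm
    (hasLift_of_certOK hl h₀) (hasLift_of_certOK hl h₁) (hasLift_of_certOK hl h₂)
    (hasLift_of_certOK hl h₃)))) e hp hp5

end tables

/-- The floor for discriminant `-3`. -/
def atlas3 : Atlas 1 where
  fs := [
    ⟨⟨0, 0⟩, ⟨1, -1⟩, ⟨0, -1⟩, ⟨0, 0⟩, ⟨0, 0⟩, ⟨⟨0, 0⟩, 0, ⟨0, 0⟩, 3⟩, ⟨⟨0, 0⟩, 0, ⟨0, 0⟩, 5⟩,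
    [⟨⟨0, -1⟩, 0, [(⟨-1, 0⟩, 0)], ⟨1, 0⟩, 1⟩,
      ⟨⟨1, -1⟩, 0, [(⟨-1, 1⟩, 0)], ⟨1, -1⟩, 0⟩,
      ⟨⟨1, 0⟩, 0, [(⟨0, 1⟩, 0)], ⟨0, -1⟩, 5⟩,
      ⟨⟨0, 1⟩, 0, [(⟨1, 0⟩, 0)], ⟨-1, 0⟩, 4⟩,
      ⟨⟨-1, 1⟩, 0, [(⟨1, -1⟩, 0)], ⟨-1, 1⟩, 3⟩,
      ⟨⟨-1, 0⟩, 0, [(⟨0, -1⟩, 0)], ⟨0, 1⟩, 2⟩]⟩]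
  L := 1
  M := 1000000
  B := 1
  Q := 1024
  cov := .cx 512 (.cy 512 (.leaf 0 0 0) (.leaf 0 0 1)) (.cy 512 (.leaf 0 1 0) (.leaf 0 1 1))

lemma atlas3_ok : atlas3.ok = true := by decide +kernel

/-- The action of the generators on cosets for discriminant `-3`. -/
def action3 : List ℕ := [46554656868538934293434662287904998656, 14715725787088356399938216805593385216,
    54805221329827640929263641398406742528, 267536929118977564714609622409839643648]

lemma action3_ok : tabOK (atlas3.geom atlas3_ok) action3 = true := by decide +kernel

/-- A certificate for discriminant `-3`. -/
def cert3A : Cert where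
  fr := [1, 2, 36]
  sd := [37, 39]
  W := [[0, 0, 0], [0, 0, 0]]
  ord := [(0, 5, 0), (30, 9, 0), (8, 13, 0), (75, 18, 0), (16, 26, 0), (46, 30, 0), (20, 22, 1), (1, 10, 0),
    (31, 14, 0), (5, 6, 1), (76, 19, 0), (17, 31, 0), (47, 23, 0), (21, 27, 0), (60, 17, 1), (15, 21, 0), (45,
    25, 0), (23, 29, 0), (77, 3, 0), (2, 15, 0), (32, 7, 0), (6, 11, 0), (94, 46, 0), (115, 43, 1), (96, 42,
    0), (111, 45, 0), (124, 38, 0), (110, 47, 0), (98, 41, 0), (91, 34, 0), (105, 33, 1), (90, 44, 0), (106,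
    35, 0), (92, 40, 0), (123, 20, 0), (82, 8, 0), (127, 24, 0), (86, 12, 0), (63, 4, 0), (78, 28, 0)]
  ex := [100, 102]
  Y := [[1, 0], [0, 1]]
  DY := 2

lemma cert3A_ok : certOK (atlas3.geom atlas3_ok) action3 (0, 0) (0, 0) cert3A = true := by
  decide +kernel

/-- A certificate for discriminant `-3`. -/
def cert3B : Cert where
  fr := [39, 36]
  sd := [2, 1, 37]
  W := [[0, 0], [0, 0], [0, 0]]
  ord := [(0, 5, 0), (30, 9, 0), (8, 13, 0), (75, 18, 0), (16, 26, 0), (46, 30, 0), (20, 22, 1), (1, 10, 0),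
    (31, 14, 0), (5, 6, 1), (76, 19, 0), (17, 31, 0), (47, 23, 0), (21, 27, 0), (60, 17, 1), (15, 21, 0), (45,
    25, 0), (23, 29, 0), (77, 3, 0), (2, 15, 0), (32, 7, 0), (6, 11, 0), (94, 46, 0), (115, 43, 1), (96, 42,
    0), (111, 45, 1), (124, 38, 1), (110, 47, 1), (98, 41, 0), (91, 34, 0), (105, 33, 1), (90, 44, 0), (106,
    35, 0), (92, 40, 0), (123, 20, 0), (82, 8, 0), (127, 24, 0), (86, 12, 0), (63, 4, 0), (78, 28, 0)]
  ex := [9, 24, 100]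
  Y := [[-1, 0, 0], [0, 1, 0], [0, 0, -1]]
  DY := 2

lemma cert3B_ok : certOK (atlas3.geom atlas3_ok) action3 (0, 1) (0, 0) cert3B = true := by
  decide +kernel

/-- A certificate for discriminant `-3`. -/
def cert3C : Cert where
  fr := []
  sd := [2, 1, 37, 39, 36]
  W := [[], [], [], [], []]
  ord := [(0, 5, 0), (30, 9, 0), (8, 13, 0), (75, 18, 0), (16, 26, 0), (46, 30, 0), (20, 22, 1), (1, 10, 0),
    (31, 14, 0), (5, 6, 1), (76, 19, 0), (17, 31, 0), (47, 23, 0), (21, 27, 0), (60, 17, 1), (15, 21, 0), (45,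
    25, 0), (23, 29, 0), (77, 3, 0), (2, 15, 0), (32, 7, 0), (6, 11, 0), (94, 46, 0), (115, 43, 1), (96, 42,
    1), (111, 45, 1), (124, 38, 1), (110, 47, 1), (98, 41, 0), (91, 34, 0), (105, 33, 1), (90, 44, 0), (106,
    35, 0), (92, 40, 0), (123, 20, 0), (82, 8, 0), (127, 24, 0), (86, 12, 0), (63, 4, 0), (78, 28, 0)]
  ex := [9, 24, 100, 102, 168]
  Y := [[-2, 0, 0, 0, 0], [0, 2, 0, 0, 0], [0, 0, -2, 0, 0], [0, 0, 0, -2, 0], [0, 0, 0, 0, 1]]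
  DY := 4

lemma cert3C_ok : certOK (atlas3.geom atlas3_ok) action3 (0, 1) (0, 1) cert3C = true := by
  decide +kernel

/-- A certificate for discriminant `-3`. -/
def cert3D : Cert where
  fr := []
  sd := [2, 1, 39, 37, 36]
  W := [[], [], [], [], []]
  ord := [(0, 5, 0), (30, 9, 0), (8, 13, 0), (75, 18, 0), (16, 26, 0), (46, 30, 0), (20, 22, 1), (1, 10, 0),
    (31, 14, 0), (5, 6, 1), (76, 19, 0), (17, 31, 0), (47, 23, 0), (21, 27, 0), (60, 17, 1), (15, 21, 0), (45,
    25, 0), (23, 29, 0), (77, 3, 0), (2, 15, 0), (32, 7, 0), (6, 11, 0), (94, 46, 1), (115, 43, 1), (96, 42,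
    0), (111, 45, 1), (124, 38, 0), (110, 47, 1), (98, 41, 0), (91, 34, 0), (105, 33, 1), (90, 44, 0), (106,
    35, 0), (92, 40, 0), (123, 20, 0), (82, 8, 0), (127, 24, 0), (86, 12, 0), (63, 4, 0), (78, 28, 0)]
  ex := [9, 24, 156, 163, 172]
  Y := [[-2, 0, 0, 0, 0], [0, 2, 0, 0, 0], [0, 0, 2, 0, 0], [0, 0, 0, 2, 0], [0, 0, 0, 0, 1]]
  DY := 4

lemma cert3D_ok : certOK (atlas3.geom atlas3_ok) action3 (0, 1) (1, 0) cert3D = true := by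
  decide +kernel

/-- The floor for discriminant `-11`. -/
def atlas11 : Atlas 3 where
  fs := [
    ⟨⟨0, 0⟩, ⟨1, 0⟩, ⟨-1, 0⟩, ⟨0, 0⟩, ⟨0, 0⟩, ⟨⟨0, 0⟩, 0, ⟨0, 0⟩, 1⟩, ⟨⟨0, 0⟩, 0, ⟨0, 0⟩, 1⟩,
    [⟨⟨0, -1⟩, 0, [(⟨1, -1⟩, 0), (⟨0, 1⟩, 0), (⟨1, -1⟩, 0), (⟨0, 1⟩, 0)], ⟨-1, 1⟩, 0⟩,
      ⟨⟨1, -1⟩, 0, [(⟨0, -1⟩, 0), (⟨-1, 1⟩, 0), (⟨0, -1⟩, 0), (⟨-1, 1⟩, 0)], ⟨0, 1⟩, 0⟩,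
      ⟨⟨1, 0⟩, 0, [(⟨-1, 0⟩, 0)], ⟨1, 0⟩, 0⟩,
      ⟨⟨0, 1⟩, 0, [(⟨-1, 1⟩, 0), (⟨0, -1⟩, 0), (⟨-1, 1⟩, 0), (⟨0, -1⟩, 0)], ⟨1, -1⟩, 0⟩,
      ⟨⟨-1, 1⟩, 0, [(⟨0, 1⟩, 0), (⟨1, -1⟩, 0), (⟨0, 1⟩, 0), (⟨1, -1⟩, 0)], ⟨0, -1⟩, 0⟩,
      ⟨⟨-1, 0⟩, 0, [(⟨1, 0⟩, 0)], ⟨-1, 0⟩, 1⟩]⟩]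
  L := 1
  M := 1000000
  B := 1
  Q := 1024
  cov := .cy 512 (.cx 512 (.cy 256 (.leaf 0 0 0) (.cx 256 (.leaf 0 0 0) (.leaf 0 1 0))) (.leaf 0 1 0)) (.cx
    512 (.leaf 0 0 1) (.cy 768 (.cx 768 (.leaf 0 0 1) (.leaf 0 1 1)) (.leaf 0 1 1)))

lemma atlas11_ok : atlas11.ok = true := by decide +kernel

/-- The action of the generators on cosets for discriminant `-11`. -/
def action11 : List ℕ := [46554656868538934293434662287904998656, 14715725787088356399938216805593385216,
    20011376718272490338853433276725592320, 318327530945503956869858709665898562560]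

lemma action11_ok : tabOK (atlas11.geom atlas11_ok) action11 = true := by decide +kernel

/-- A certificate for discriminant `-11`. -/
def cert11A : Cert where
  fr := [2, 7, 17, 18, 19, 38, 39, 33, 34, 24, 35]
  sd := [37, 42, 1]
  W := [[0, 0, 0, 0, 0, 0, 0, 0, 0, 0, 0], [0, 0, 0, 0, 0, 0, 0, 0, 0, 0, 0], [-1, -1, 0, 0, 0, 0, 0, 0, 0, 0,
    0]]
  ord := [(0, 5, 0), (30, 9, 0), (8, 13, 0), (1, 10, 0), (31, 14, 0), (5, 6, 1), (6, 11, 0), (32, 3, 1), (2,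
    15, 0), (15, 21, 0), (45, 25, 0), (23, 29, 0), (16, 26, 0), (46, 30, 0), (20, 22, 1), (17, 31, 0), (47,
    23, 0), (21, 27, 0), (95, 41, 0), (96, 45, 0), (155, 46, 1), (100, 43, 0), (90, 36, 0), (153, 4, 1), (124,
    47, 0), (91, 40, 0), (157, 8, 1), (120, 20, 1), (92, 44, 0), (161, 12, 1), (121, 28, 0)]
  ex := [94, 99, 156]
  Y := [[1, 0, 0], [0, 1, 0], [0, 0, -1]]
  DY := 2

lemma cert11A_ok : certOK (atlas11.geom atlas11_ok) action11 (0, 0) (0, 0) cert11A = true := by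
  decide +kernel

/-- A certificate for discriminant `-11`. -/
def cert11B : Cert where
  fr := [39, 33, 42, 34, 24, 35]
  sd := [2, 7, 18, 19, 1, 17, 37, 38]
  W := [[0, 0, 0, 0, 0, 0], [0, 0, 0, 0, 0, 0], [0, 0, 0, 0, 0, 0], [0, 0, 0, 0, 0, 0], [0, 0, 0, 0, 0, 0],
    [0, 0, 0, 0, 0, 0], [0, 0, 0, 0, 0, 0], [-1, 0, 0, 0, 0, 0]]
  ord := [(0, 5, 0), (30, 9, 0), (8, 13, 0), (1, 10, 0), (31, 14, 0), (5, 6, 1), (6, 11, 0), (32, 3, 1), (2,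
    15, 0), (15, 21, 0), (45, 25, 0), (23, 29, 0), (16, 26, 0), (46, 30, 0), (20, 22, 1), (17, 31, 0), (47,
    23, 0), (21, 27, 0), (95, 41, 0), (96, 45, 1), (155, 46, 0), (100, 43, 0), (90, 36, 0), (153, 4, 1), (124,
    47, 1), (91, 40, 0), (159, 8, 0), (120, 20, 1), (92, 44, 0), (164, 12, 0), (122, 28, 1)]
  ex := [9, 10, 24, 25, 38, 53, 94, 158]
  Y := [[-1, 0, 0, 0, 0, 0, 0, 0], [0, -1, 0, 0, 0, 0, 0, 0], [0, 0, -1, 0, 0, 0, 0, 0], [0, 0, 0, -1, 0, 0,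
    0, 0], [0, 0, 0, 0, -1, 0, 0, 0], [0, 0, 0, 0, 0, -1, 0, 0], [0, 0, 0, 0, 0, 0, 1, 0], [0, -1, 0, 0, 0, 0,
    0, -1]]
  DY := 2

lemma cert11B_ok : certOK (atlas11.geom atlas11_ok) action11 (0, 1) (0, 0) cert11B = true := by
  decide +kernel

/-- A certificate for discriminant `-11`. -/
def cert11C : Cert where
  fr := [39]
  sd := [2, 7, 24, 18, 19, 1, 17, 37, 42, 34, 35, 33, 38]
  W := [[0], [0], [0], [0], [0], [0], [0], [0], [0], [0], [0], [0], [-1]]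
  ord := [(0, 5, 0), (30, 9, 0), (8, 13, 0), (1, 10, 0), (31, 14, 0), (5, 6, 1), (6, 11, 0), (32, 3, 1), (2,
    15, 0), (15, 21, 0), (45, 25, 0), (23, 29, 0), (16, 26, 0), (46, 30, 0), (20, 22, 1), (17, 31, 0), (47,
    23, 0), (21, 27, 0), (95, 41, 1), (96, 45, 0), (155, 46, 0), (100, 43, 0), (90, 36, 0), (153, 4, 1), (124,
    47, 1), (91, 40, 0), (157, 8, 1), (136, 20, 1), (92, 44, 0), (161, 12, 1), (135, 28, 1)]
  ex := [9, 10, 22, 24, 25, 38, 53, 94, 99, 202, 206, 180, 158]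
  Y := [[-2, 0, 0, 0, 0, 0, 0, 0, 0, 0, 0, 0, 0], [0, -2, 0, 0, 0, 0, 0, 0, 0, 0, 0, 0, 0], [0, 0, -2, 0, 0,
    0, 0, 0, 0, 0, 0, 0, 0], [0, 0, 0, -2, 0, 0, 0, 0, 0, 0, 0, 0, 0], [0, 0, 0, 0, -2, 0, 0, 0, 0, 0, 0, 0,
    0], [0, 0, 0, 0, 0, -2, 0, 0, 0, 0, 0, 0, 0], [0, 0, 0, 0, 0, 0, -2, 0, 0, 0, 0, 0, 0], [0, 0, 0, 0, 0, 0,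
    0, 2, 0, 0, 0, 0, 0], [0, 0, 0, 0, 0, 0, 0, 0, 2, 0, 0, 0, 0], [0, 0, 0, 0, 0, 0, 0, 0, 0, -1, 0, 0, 0],
    [0, 0, 0, 0, 0, 0, 0, 0, 0, 0, -1, 0, 0], [0, 0, 0, 0, 2, 0, 0, 0, 0, 0, -1, 1, 0], [0, -2, 0, 0, 0, 0, 0,
    0, 0, 0, 0, 0, 2]]
  DY := 4

lemma cert11C_ok : certOK (atlas11.geom atlas11_ok) action11 (0, 1) (0, 1) cert11C = true := by
  decide +kernel

/-- A certificate for discriminant `-11`. -/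
def cert11D : Cert where
  fr := []
  sd := [2, 7, 18, 19, 42, 1, 24, 17, 35, 38, 37, 33, 34, 39]
  W := [[], [], [], [], [], [], [], [], [], [], [], [], [], []]
  ord := [(0, 5, 0), (30, 9, 0), (8, 13, 0), (1, 10, 0), (31, 14, 0), (5, 6, 1), (6, 11, 0), (32, 3, 1), (2,
    15, 0), (15, 21, 0), (45, 25, 0), (23, 29, 0), (16, 26, 0), (46, 30, 0), (20, 22, 1), (17, 31, 0), (47,
    23, 0), (21, 27, 0), (95, 41, 1), (96, 45, 1), (155, 46, 0), (100, 43, 0), (90, 36, 0), (153, 4, 1), (134,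
    47, 0), (91, 40, 0), (159, 8, 0), (136, 20, 1), (92, 44, 0), (161, 12, 1), (121, 28, 0)]
  ex := [9, 10, 24, 25, 37, 38, 52, 53, 206, 158, 174, 3, 181, 104]
  Y := [[-2, 0, 0, 0, 0, 0, 0, 0, 0, 0, 0, 0, 0, 0], [0, -2, 0, 0, 0, 0, 0, 0, 0, 0, 0, 0, 0, 0], [0, 0, -2,
    0, 0, 0, 0, 0, 0, 0, 0, 0, 0, 0], [0, 0, 0, -2, 0, 0, 0, 0, 0, 0, 0, 0, 0, 0], [0, 0, 0, 0, 2, 0, 0, 0, 0,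
    0, 0, 0, 0, 0], [0, 0, 0, 0, 0, -2, 0, 0, 0, 0, 0, 0, 0, 0], [0, 0, 0, 0, 0, 0, -2, 0, 0, 0, 0, 0, 0, 0],
    [0, 0, 0, 0, 0, 0, 0, -2, 0, 0, 0, 0, 0, 0], [0, 0, 0, 0, 0, 0, 0, 0, -1, 0, 0, 0, 0, 0], [-1, 1, 2, 0, 1,
    -1, 0, 1, 0, 1, -1, 0, 0, -1], [2, 2, 0, 0, 0, 2, 0, -2, 0, -2, 2, 0, 0, 0], [1, 1, 0, 0, 0, 1, 0, -1, 0,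
    -1, 1, 1, 0, 0], [1, 1, 0, 0, 0, 1, 0, 1, 0, -1, 1, 1, 1, 0], [-1, -1, 2, 0, 1, -1, 0, 1, 0, -1, -1, 0, 0,
    -1]]
  DY := 4

lemma cert11D_ok : certOK (atlas11.geom atlas11_ok) action11 (0, 1) (1, 0) cert11D = true := by
  decide +kernel

/-- The floor for discriminant `-19`. -/
def atlas19 : Atlas 5 where
  fs := [
    ⟨⟨0, 0⟩, ⟨1, 0⟩, ⟨-1, 0⟩, ⟨0, 0⟩, ⟨0, 0⟩, ⟨⟨0, 0⟩, 0, ⟨0, 0⟩, 1⟩, ⟨⟨0, 0⟩, 0, ⟨0, 0⟩, 1⟩,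
    [⟨⟨0, -1⟩, 1, [(⟨0, -1⟩, 2), (⟨-1, 1⟩, 0)], ⟨-1, 1⟩, 0⟩,
      ⟨⟨0, -1⟩, 2, [(⟨0, -1⟩, 1), (⟨-1, 1⟩, 0)], ⟨-1, 1⟩, 0⟩,
      ⟨⟨1, 0⟩, 0, [(⟨-1, 0⟩, 0)], ⟨1, 0⟩, 0⟩,
      ⟨⟨0, 0⟩, 1, [(⟨-1, 0⟩, 2), (⟨-1, 0⟩, 0)], ⟨0, 0⟩, 0⟩,
      ⟨⟨-1, 0⟩, 2, [(⟨0, 0⟩, 1), (⟨0, 0⟩, 0)], ⟨-1, 0⟩, 0⟩,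
      ⟨⟨-1, 0⟩, 0, [(⟨1, 0⟩, 0)], ⟨-1, 0⟩, 1⟩]⟩,
    ⟨⟨0, -1⟩, ⟨-2, 0⟩, ⟨-2, 0⟩, ⟨-1, 1⟩, ⟨0, 2⟩, ⟨⟨-1, 0⟩, 2, ⟨1, 0⟩, 1⟩, ⟨⟨0, 0⟩, 1, ⟨0, 0⟩, 1⟩,
    [⟨⟨0, 0⟩, 0, [(⟨0, 0⟩, 0), (⟨0, 0⟩, 1)], ⟨0, 0⟩, 0⟩,
      ⟨⟨0, 0⟩, 2, [(⟨-1, 0⟩, 1)], ⟨0, 0⟩, 0⟩,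
      ⟨⟨0, 1⟩, 0, [(⟨-1, 1⟩, 0), (⟨0, -1⟩, 1)], ⟨1, -1⟩, 0⟩,
      ⟨⟨-1, 0⟩, 2, [(⟨0, 0⟩, 1)], ⟨-1, 0⟩, 1⟩]⟩,
    ⟨⟨-1, -1⟩, ⟨-3, 0⟩, ⟨-2, 0⟩, ⟨-2, 1⟩, ⟨2, 2⟩, ⟨⟨-1, 0⟩, 1, ⟨1, 0⟩, 1⟩, ⟨⟨0, 0⟩, 2, ⟨0, 0⟩, 1⟩,
    [⟨⟨1, 0⟩, 0, [(⟨-1, 0⟩, 0), (⟨-1, 0⟩, 2)], ⟨1, 0⟩, 0⟩,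
      ⟨⟨1, 0⟩, 1, [(⟨-2, 0⟩, 2)], ⟨1, 0⟩, 0⟩,
      ⟨⟨0, 1⟩, 0, [(⟨-1, 1⟩, 0), (⟨0, -1⟩, 2)], ⟨1, -1⟩, 0⟩,
      ⟨⟨0, 0⟩, 1, [(⟨-1, 0⟩, 2)], ⟨0, 0⟩, 1⟩]⟩]
  L := 4
  M := 1000000
  B := 4
  Q := 1024
  cov := .cy 512 (.cy 256 (.cx 512 (.leaf 0 0 0) (.leaf 0 1 0)) (.cx 512 (.cy 384 (.cx 256 (.leaf 0 0 0)
    (.leaf 0 1 0)) (.cx 256 (.leaf 1 0 0) (.leaf 2 0 0))) (.cy 384 (.leaf 0 1 0) (.cx 768 (.leaf 2 0 0) (.leaf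
    1 1 0))))) (.cy 768 (.cx 512 (.cy 640 (.cx 256 (.leaf 1 0 0) (.leaf 2 0 0)) (.leaf 0 0 1)) (.cy 640 (.cx
    768 (.leaf 2 0 0) (.leaf 1 1 0)) (.cx 768 (.leaf 0 0 1) (.leaf 0 1 1)))) (.cx 512 (.leaf 0 0 1) (.leaf 0 1
    1)))

lemma atlas19_ok : atlas19.ok = true := by decide +kernel

/-- The action of the generators on cosets for discriminant `-19`. -/
def action19 : List ℕ := [46554656868538934293434662287904998656, 14715725787088356399938216805593385216,
    20011376718272490338853433276725592320, 318244129672262132158517454992308700160,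
    12270251255808323959384804795599757824, 77246849033977991814176370089805813504]

lemma action19_ok : tabOK (atlas19.geom atlas19_ok) action19 = true := by decide +kernel

/-- A certificate for discriminant `-19`. -/
def cert19A : Cert where
  fr := [6, 17, 23, 26, 39, 49, 50, 59, 33, 34, 35, 20]
  sd := [1, 53, 38, 11]
  W := [[0, 1, -1, 0, -1, -1, -1, 0, 0, 0, 0, 0], [-1, -1, 0, 1, 1, 1, 0, -1, 0, 0, 0, 0], [1, 1, 0, -1, 0,
    -1, 0, 0, 0, 0, 0, 0], [-1, -1, 1, 0, 1, 1, 1, 0, 0, 0, 0, 0]]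
  ord := [(0, 5, 0), (30, 9, 0), (8, 13, 0), (5, 14, 0), (31, 2, 1), (1, 10, 0), (6, 7, 1), (32, 3, 1), (2,
    15, 0), (15, 21, 0), (45, 25, 0), (23, 29, 0), (21, 27, 0), (47, 19, 1), (17, 31, 0), (16, 18, 1), (46,
    30, 0), (20, 22, 1), (95, 41, 0), (96, 45, 0), (155, 46, 1), (100, 43, 0), (210, 74, 0), (211, 79, 0),
    (285, 69, 1), (212, 51, 0), (214, 70, 0), (257, 67, 1), (215, 54, 0), (132, 42, 0), (220, 65, 0), (244,
    37, 1), (255, 58, 0), (219, 75, 0), (249, 61, 0), (222, 66, 0), (256, 63, 0), (224, 77, 0), (245, 47, 0),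
    (289, 62, 0), (223, 71, 0), (290, 78, 1), (218, 57, 0), (261, 55, 0), (216, 73, 0), (90, 36, 0), (153, 4,
    1), (91, 40, 0), (157, 8, 1), (240, 56, 0), (217, 68, 0), (92, 44, 0), (161, 12, 1), (241, 60, 0), (221,
    72, 0), (242, 52, 0), (213, 76, 0), (120, 24, 0), (121, 28, 0)]
  ex := [156, 94, 128, 130]
  Y := [[0, -1, -1, 2], [-1, 1, 1, 0], [0, 0, -1, 0], [-1, 1, 1, -2]]
  DY := 2

lemma cert19A_ok : certOK (atlas19.geom atlas19_ok) action19 (0, 0) (0, 0) cert19A = true := by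
  decide +kernel

/-- A certificate for discriminant `-19`. -/
def cert19B : Cert where
  fr := [39, 49, 53, 33, 34, 35, 20]
  sd := [6, 11, 26, 23, 1, 17, 38, 50, 59]
  W := [[0, 0, 0, 0, 0, 0, 0], [0, 0, 0, 0, 0, 0, 0], [0, 0, 0, 0, 0, 0, 0], [0, 0, 0, 0, 0, 0, 0], [0, 0, 0,
    0, 0, 0, 0], [0, 0, 0, 0, 0, 0, 0], [-1, 0, 0, 0, 0, 0, 0], [0, 0, 0, 0, 0, 0, 0], [0, 0, 1, 0, 0, 0, 0]]
  ord := [(0, 5, 0), (30, 9, 0), (8, 13, 0), (5, 14, 1), (31, 2, 1), (1, 10, 0), (6, 7, 1), (32, 3, 1), (2,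
    15, 0), (15, 21, 0), (45, 25, 0), (23, 29, 0), (21, 27, 0), (47, 19, 1), (17, 31, 0), (16, 18, 1), (46,
    30, 0), (20, 22, 1), (95, 41, 1), (96, 45, 0), (155, 46, 0), (100, 43, 0), (210, 74, 0), (211, 79, 1),
    (285, 69, 1), (212, 51, 0), (214, 70, 1), (257, 67, 1), (215, 54, 0), (132, 42, 0), (220, 65, 1), (244,
    37, 1), (255, 58, 0), (219, 75, 1), (249, 61, 0), (222, 66, 1), (256, 63, 1), (224, 77, 0), (245, 47, 0),
    (289, 62, 0), (223, 71, 1), (290, 78, 1), (173, 57, 1), (261, 55, 0), (171, 73, 0), (90, 36, 0), (153, 4,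
    1), (91, 40, 0), (159, 8, 0), (240, 56, 1), (217, 68, 1), (92, 44, 0), (164, 12, 0), (241, 60, 0), (221,
    72, 0), (242, 52, 1), (213, 76, 1), (120, 24, 1), (121, 28, 0)]
  ex := [9, 10, 24, 25, 38, 53, 158, 271, 130]
  Y := [[1, 0, 0, 0, 0, 0, 0, 0, 0], [0, -1, 0, 0, 0, 0, 0, 0, 0], [0, 0, -1, 0, 0, 0, 0, 0, 0], [0, 0, 0, -1,
    0, 0, 0, 0, 0], [0, 0, 0, 0, -1, 0, 0, 0, 0], [0, 0, 0, 0, 0, -1, 0, 0, 0], [0, -1, 0, 0, 0, 0, 1, 0, 0],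
    [1, 0, -1, 0, 1, 0, -1, 1, 0], [1, 1, 0, 1, 1, 0, -1, 1, 2]]
  DY := 2

lemma cert19B_ok : certOK (atlas19.geom atlas19_ok) action19 (0, 1) (0, 0) cert19B = true := by
  decide +kernel

/-- A certificate for discriminant `-19`. -/
def cert19C : Cert where
  fr := [39, 53]
  sd := [6, 11, 26, 23, 1, 20, 17, 34, 35, 38, 50, 59, 49, 33]
  W := [[0, 0], [0, 0], [0, 0], [0, 0], [0, 0], [0, 0], [0, 0], [0, 0], [0, 0], [-1, 0], [0, 0], [0, 1], [1,
    0], [0, 0]]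
  ord := [(0, 5, 0), (30, 9, 0), (8, 13, 0), (5, 14, 1), (31, 2, 1), (1, 10, 0), (6, 7, 1), (32, 3, 1), (2,
    15, 0), (15, 21, 0), (45, 25, 0), (23, 29, 0), (21, 27, 0), (47, 19, 1), (17, 31, 0), (16, 18, 1), (46,
    30, 0), (20, 22, 1), (95, 41, 0), (96, 45, 1), (155, 46, 0), (100, 43, 0), (210, 74, 0), (211, 79, 1),
    (285, 69, 1), (212, 51, 0), (214, 70, 1), (257, 67, 1), (215, 54, 0), (132, 42, 1), (220, 65, 1), (244,
    37, 1), (255, 58, 0), (219, 75, 1), (249, 61, 1), (222, 66, 1), (256, 63, 1), (224, 77, 0), (245, 47, 0),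
    (289, 62, 0), (223, 71, 1), (290, 78, 1), (218, 57, 0), (261, 55, 0), (216, 73, 1), (90, 36, 0), (153, 4,
    1), (91, 40, 0), (157, 8, 1), (240, 56, 1), (217, 68, 1), (92, 44, 0), (161, 12, 1), (241, 60, 0), (221,
    72, 1), (242, 52, 1), (213, 76, 0), (120, 24, 1), (121, 28, 1)]
  ex := [9, 10, 24, 25, 38, 48, 53, 202, 206, 158, 271, 130, 369, 277]
  Y := [[2, 0, 0, 0, 0, 0, 0, 0, 0, 0, 0, 0, 0, 0], [0, -2, 0, 0, 0, 0, 0, 0, 0, 0, 0, 0, 0, 0], [0, 0, -2, 0,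
    0, 0, 0, 0, 0, 0, 0, 0, 0, 0], [0, 0, 0, -2, 0, 0, 0, 0, 0, 0, 0, 0, 0, 0], [0, 0, 0, 0, -2, 0, 0, 0, 0,
    0, 0, 0, 0, 0], [0, 0, 0, 0, 0, -2, 0, 0, 0, 0, 0, 0, 0, 0], [0, 0, 0, 0, 0, 0, -2, 0, 0, 0, 0, 0, 0, 0],
    [0, 0, 0, 0, 0, 0, 0, -1, 0, 0, 0, 0, 0, 0], [0, 0, 0, 0, 0, 0, 0, 0, -1, 0, 0, 0, 0, 0], [0, -2, 0, 0, 0,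
    0, 0, 0, 0, -2, 0, 0, 0, 0], [2, 0, -2, 0, -2, 0, 0, 0, 0, 2, 2, 0, 0, 0], [2, 2, 0, 2, -2, 0, 0, 0, 0, 2,
    2, 4, 0, 0], [2, 2, 0, 0, 0, 0, -2, 0, 0, 2, 0, 0, -2, 0], [3, -4, -4, -4, 2, 0, 0, 0, 0, 2, 2, -4, 1,
    -1]]
  DY := 4

lemma cert19C_ok : certOK (atlas19.geom atlas19_ok) action19 (0, 1) (0, 1) cert19C = true := by
  decide +kernel

/-- A certificate for discriminant `-19`. -/
def cert19D : Cert where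
  fr := []
  sd := [6, 11, 20, 26, 23, 1, 17, 35, 38, 49, 59, 50, 53, 33, 39, 34]
  W := [[], [], [], [], [], [], [], [], [], [], [], [], [], [], [], []]
  ord := [(0, 5, 0), (30, 9, 0), (8, 13, 0), (5, 14, 1), (31, 2, 1), (1, 10, 0), (6, 7, 1), (32, 3, 1), (2,
    15, 0), (15, 21, 0), (45, 25, 0), (23, 29, 0), (21, 27, 0), (47, 19, 1), (17, 31, 0), (16, 18, 1), (46,
    30, 0), (20, 22, 1), (95, 41, 0), (96, 45, 0), (155, 46, 0), (100, 43, 0), (210, 74, 0), (211, 79, 1),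
    (285, 69, 1), (212, 51, 0), (214, 70, 1), (257, 67, 1), (215, 54, 0), (132, 42, 0), (220, 65, 1), (244,
    37, 1), (255, 58, 0), (219, 75, 1), (249, 61, 0), (222, 66, 1), (256, 63, 1), (224, 77, 0), (245, 47, 0),
    (289, 62, 0), (178, 71, 0), (290, 78, 1), (218, 57, 0), (261, 55, 0), (171, 73, 0), (90, 36, 0), (153, 4,
    1), (91, 40, 0), (159, 8, 0), (240, 56, 1), (217, 68, 0), (92, 44, 0), (161, 12, 1), (241, 60, 0), (221,
    72, 0), (242, 52, 1), (213, 76, 0), (120, 24, 0), (121, 28, 0)]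
  ex := [9, 10, 18, 24, 25, 38, 53, 206, 158, 369, 279, 291, 124, 3, 37, 278]
  Y := [[4, 0, 0, 0, 0, 0, 0, 0, 0, 0, 0, 0, 0, 0, 0, 0], [0, -4, 0, 0, 0, 0, 0, 0, 0, 0, 0, 0, 0, 0, 0, 0],
    [0, 0, -4, 0, 0, 0, 0, 0, 0, 0, 0, 0, 0, 0, 0, 0], [0, 0, 0, -4, 0, 0, 0, 0, 0, 0, 0, 0, 0, 0, 0, 0], [0,
    0, 0, 0, -4, 0, 0, 0, 0, 0, 0, 0, 0, 0, 0, 0], [0, 0, 0, 0, 0, -4, 0, 0, 0, 0, 0, 0, 0, 0, 0, 0], [0, 0,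
    0, 0, 0, 0, -4, 0, 0, 0, 0, 0, 0, 0, 0, 0], [0, 0, 0, 0, 0, 0, 0, -2, 0, 0, 0, 0, 0, 0, 0, 0], [-2, -4, 0,
    2, 2, 0, -4, 0, -2, -2, 2, 0, -2, 0, 2, 0], [6, 4, 0, -2, -2, 0, 0, 0, 2, -2, -2, 0, 2, 0, -2, 0], [0, 4,
    0, 1, -1, 0, 0, 0, 0, 0, -4, 3, 2, 0, 0, 0], [0, 4, 0, -2, -2, 4, 0, 0, 0, 0, -4, -2, 0, 0, 0, 0], [0, 4,
    0, 3, 1, -4, 0, 0, 0, 0, 0, 1, 2, 0, 0, 0], [2, 4, 0, 2, 0, -4, 0, 0, 2, 0, -2, 2, 2, 2, 0, 0], [-2, -8,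
    0, 2, 2, 0, -4, 0, 2, -2, 2, 0, -2, 0, 2, 0], [2, 0, -2, -2, 0, 4, -2, 0, -2, 0, -2, -2, -2, -2, 0, 2]]
  DY := 8

lemma cert19D_ok : certOK (atlas19.geom atlas19_ok) action19 (0, 1) (1, 0) cert19D = true := by
  decide +kernel

/-- The floor for discriminant `-43`. -/
def atlas43 : Atlas 11 where
  fs := [
    ⟨⟨0, 0⟩, ⟨1, 0⟩, ⟨-1, 0⟩, ⟨0, 0⟩, ⟨0, 0⟩, ⟨⟨0, 0⟩, 0, ⟨0, 0⟩, 1⟩, ⟨⟨0, 0⟩, 0, ⟨0, 0⟩, 1⟩,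
    [⟨⟨-1, -1⟩, 4, [(⟨0, -1⟩, 4), (⟨-1, 1⟩, 0), (⟨0, -1⟩, 4), (⟨-1, 1⟩, 0)], ⟨-2, 1⟩, 0⟩,
      ⟨⟨0, -1⟩, 3, [(⟨0, -1⟩, 5), (⟨-2, 1⟩, 1)], ⟨0, 0⟩, 0⟩,
      ⟨⟨0, -1⟩, 5, [(⟨0, -1⟩, 3), (⟨-1, 0⟩, 2)], ⟨-1, 1⟩, 0⟩,
      ⟨⟨0, -1⟩, 4, [(⟨-1, -1⟩, 4), (⟨-2, 1⟩, 0), (⟨-1, -1⟩, 4), (⟨-2, 1⟩, 0)], ⟨-1, 1⟩, 0⟩,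
      ⟨⟨1, 0⟩, 0, [(⟨-1, 0⟩, 0)], ⟨1, 0⟩, 0⟩,
      ⟨⟨0, 0⟩, 8, [(⟨-1, 0⟩, 8), (⟨-1, 0⟩, 0), (⟨-1, 0⟩, 8), (⟨-1, 0⟩, 0)], ⟨0, 0⟩, 0⟩,
      ⟨⟨0, 0⟩, 6, [(⟨-1, 0⟩, 7), (⟨-2, 0⟩, 1)], ⟨0, 0⟩, 0⟩,
      ⟨⟨-1, 0⟩, 7, [(⟨0, 0⟩, 6), (⟨-1, 0⟩, 2)], ⟨-1, 0⟩, 0⟩,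
      ⟨⟨-1, 0⟩, 8, [(⟨0, 0⟩, 8), (⟨0, 0⟩, 0), (⟨0, 0⟩, 8), (⟨0, 0⟩, 0)], ⟨-1, 0⟩, 0⟩,
      ⟨⟨-1, 0⟩, 0, [(⟨1, 0⟩, 0)], ⟨-1, 0⟩, 1⟩]⟩,
    ⟨⟨0, -1⟩, ⟨-5, 0⟩, ⟨-2, 0⟩, ⟨-1, 1⟩, ⟨0, 18⟩, ⟨⟨-1, 0⟩, 2, ⟨1, 0⟩, 1⟩, ⟨⟨0, 0⟩, 1, ⟨0, 0⟩, 1⟩,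
    [⟨⟨0, 0⟩, 6, [(⟨-1, 0⟩, 7), (⟨-2, 1⟩, 0)], ⟨-1, 1⟩, 0⟩,
      ⟨⟨0, 0⟩, 8, [(⟨-1, 0⟩, 8), (⟨-1, 0⟩, 1)], ⟨0, 0⟩, 0⟩,
      ⟨⟨0, 0⟩, 2, [(⟨-1, 0⟩, 1)], ⟨0, 0⟩, 0⟩,
      ⟨⟨0, 0⟩, 3, [(⟨-1, 0⟩, 5), (⟨-2, 1⟩, 0)], ⟨0, 0⟩, 0⟩,
      ⟨⟨-1, 0⟩, 4, [(⟨-1, 0⟩, 4), (⟨-1, 0⟩, 1)], ⟨-1, 0⟩, 0⟩,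
      ⟨⟨-1, 0⟩, 2, [(⟨0, 0⟩, 1)], ⟨-1, 0⟩, 1⟩]⟩,
    ⟨⟨-1, -1⟩, ⟨-6, 0⟩, ⟨-2, 0⟩, ⟨-2, 1⟩, ⟨18, 18⟩, ⟨⟨-1, 0⟩, 1, ⟨1, 0⟩, 1⟩, ⟨⟨0, 0⟩, 2, ⟨0, 0⟩, 1⟩,
    [⟨⟨0, 0⟩, 8, [(⟨-1, 0⟩, 8), (⟨-1, 0⟩, 2)], ⟨0, 0⟩, 0⟩,
      ⟨⟨0, 0⟩, 7, [(⟨-1, 0⟩, 6), (⟨-1, 1⟩, 0)], ⟨-2, 1⟩, 0⟩,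
      ⟨⟨1, 0⟩, 1, [(⟨-2, 0⟩, 2)], ⟨1, 0⟩, 0⟩,
      ⟨⟨0, 0⟩, 4, [(⟨-2, 0⟩, 4), (⟨-2, 0⟩, 2)], ⟨0, 0⟩, 0⟩,
      ⟨⟨0, 0⟩, 5, [(⟨-1, 0⟩, 3), (⟨0, 0⟩, 0)], ⟨-2, 1⟩, 0⟩,
      ⟨⟨0, 0⟩, 1, [(⟨-1, 0⟩, 2)], ⟨0, 0⟩, 1⟩]⟩,
    ⟨⟨0, -2⟩, ⟨-7, 0⟩, ⟨-3, 0⟩, ⟨-1, 1⟩, ⟨0, 24⟩, ⟨⟨-1, 0⟩, 7, ⟨2, 0⟩, 1⟩, ⟨⟨0, 0⟩, 3, ⟨0, 0⟩, 1⟩,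
    [⟨⟨0, 0⟩, 1, [(⟨0, 0⟩, 0), (⟨0, 0⟩, 6)], ⟨0, 0⟩, 0⟩,
      ⟨⟨0, 0⟩, 5, [(⟨-1, 0⟩, 8)], ⟨-1, 1⟩, 0⟩,
      ⟨⟨0, 1⟩, 0, [(⟨-1, 0⟩, 2), (⟨-1, 0⟩, 6)], ⟨1, -1⟩, 0⟩,
      ⟨⟨-1, 0⟩, 4, [(⟨0, 0⟩, 6)], ⟨-1, 0⟩, 1⟩]⟩,
    ⟨⟨-2, -2⟩, ⟨-17, 0⟩, ⟨-3, 0⟩, ⟨-4, 2⟩, ⟨24, 24⟩, ⟨⟨-2, 0⟩, 4, ⟨2, 0⟩, 1⟩, ⟨⟨0, 0⟩, 4, ⟨0, 0⟩, 1⟩,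
    [⟨⟨0, 0⟩, 2, [(⟨-1, 0⟩, 1), (⟨-1, 0⟩, 4)], ⟨0, 0⟩, 0⟩,
      ⟨⟨1, 0⟩, 1, [(⟨-2, 0⟩, 2), (⟨-2, 0⟩, 4)], ⟨1, 0⟩, 0⟩,
      ⟨⟨1, 0⟩, 3, [(⟨-2, 0⟩, 5)], ⟨2, -1⟩, 0⟩,
      ⟨⟨1, 1⟩, 0, [(⟨-2, 1⟩, 0), (⟨-1, -1⟩, 4), (⟨-2, 1⟩, 0), (⟨-1, -1⟩, 4)], ⟨2, -1⟩, 0⟩,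
      ⟨⟨0, 1⟩, 0, [(⟨-1, 1⟩, 0), (⟨0, -1⟩, 4), (⟨-1, 1⟩, 0), (⟨0, -1⟩, 4)], ⟨1, -1⟩, 0⟩,
      ⟨⟨0, 0⟩, 5, [(⟨-1, 0⟩, 3)], ⟨-2, 1⟩, 1⟩]⟩,
    ⟨⟨-1, -2⟩, ⟨-31, 0⟩, ⟨-3, 0⟩, ⟨-6, 4⟩, ⟨12, 24⟩, ⟨⟨-2, 1⟩, 6, ⟨1, 0⟩, 1⟩, ⟨⟨0, 0⟩, 5, ⟨0, 0⟩, 1⟩,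
    [⟨⟨0, 0⟩, 2, [(⟨-2, 1⟩, 0), (⟨-1, 0⟩, 7)], ⟨1, 0⟩, 0⟩,
      ⟨⟨0, 0⟩, 4, [(⟨-3, 1⟩, 7)], ⟨1, 0⟩, 0⟩,
      ⟨⟨0, 1⟩, 0, [(⟨-2, 1⟩, 1), (⟨-1, 0⟩, 7)], ⟨2, -1⟩, 0⟩,
      ⟨⟨0, 0⟩, 3, [(⟨-2, 1⟩, 8)], ⟨0, 0⟩, 1⟩]⟩,
    ⟨⟨0, -1⟩, ⟨-7, 0⟩, ⟨-3, 0⟩, ⟨-2, 2⟩, ⟨0, 12⟩, ⟨⟨-1, 0⟩, 5, ⟨2, -1⟩, 1⟩, ⟨⟨0, 0⟩, 6, ⟨0, 0⟩, 1⟩,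
    [⟨⟨0, 0⟩, 0, [(⟨-1, 0⟩, 2), (⟨-1, 0⟩, 3)], ⟨0, 0⟩, 0⟩,
      ⟨⟨0, 0⟩, 8, [(⟨-1, 0⟩, 3)], ⟨0, 0⟩, 0⟩,
      ⟨⟨0, 0⟩, 1, [(⟨-1, 1⟩, 0), (⟨0, -1⟩, 3)], ⟨0, 0⟩, 0⟩,
      ⟨⟨-1, 0⟩, 7, [(⟨-1, 0⟩, 4)], ⟨-1, 0⟩, 1⟩]⟩,
    ⟨⟨-2, -1⟩, ⟨-11, 0⟩, ⟨-3, 0⟩, ⟨-6, 2⟩, ⟨24, 12⟩, ⟨⟨-2, 0⟩, 3, ⟨1, 0⟩, 1⟩, ⟨⟨0, 0⟩, 7, ⟨0, 0⟩, 1⟩,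
    [⟨⟨1, 0⟩, 0, [(⟨-2, 0⟩, 1), (⟨-1, 0⟩, 5)], ⟨2, -1⟩, 0⟩,
      ⟨⟨1, 0⟩, 6, [(⟨-3, 0⟩, 4)], ⟨1, 0⟩, 0⟩,
      ⟨⟨0, 0⟩, 2, [(⟨-2, 1⟩, 0), (⟨0, -1⟩, 5)], ⟨1, -1⟩, 0⟩,
      ⟨⟨0, 0⟩, 8, [(⟨-2, 0⟩, 5)], ⟨1, -1⟩, 1⟩]⟩,
    ⟨⟨-1, -1⟩, ⟨-4, 0⟩, ⟨-3, 0⟩, ⟨-2, 1⟩, ⟨12, 12⟩, ⟨⟨-1, 0⟩, 8, ⟨1, 0⟩, 1⟩, ⟨⟨0, 0⟩, 8, ⟨0, 0⟩, 1⟩,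
    [⟨⟨0, 0⟩, 0, [(⟨0, 0⟩, 0), (⟨0, 0⟩, 8), (⟨0, 0⟩, 0), (⟨0, 0⟩, 8)], ⟨0, 0⟩, 0⟩,
      ⟨⟨1, 0⟩, 0, [(⟨-1, 0⟩, 0), (⟨-1, 0⟩, 8), (⟨-1, 0⟩, 0), (⟨-1, 0⟩, 8)], ⟨1, 0⟩, 0⟩,
      ⟨⟨0, 0⟩, 7, [(⟨-1, 0⟩, 6)], ⟨-1, 0⟩, 0⟩,
      ⟨⟨0, 0⟩, 2, [(⟨-1, 0⟩, 1), (⟨-1, 0⟩, 8)], ⟨0, 0⟩, 0⟩,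
      ⟨⟨0, 0⟩, 1, [(⟨-1, 0⟩, 2), (⟨-1, 0⟩, 8)], ⟨0, 0⟩, 0⟩,
      ⟨⟨0, 0⟩, 6, [(⟨-1, 0⟩, 7)], ⟨1, 0⟩, 1⟩]⟩]
  L := 36
  M := 1000000
  B := 36
  Q := 1024
  cov := .cy 512 (.cy 256 (.cx 512 (.cy 128 (.leaf 0 0 0) (.cx 256 (.leaf 0 0 0) (.cy 192 (.leaf 0 0 0) (.cx
    384 (.leaf 0 0 0) (.leaf 0 1 0))))) (.leaf 0 1 0)) (.cx 512 (.cy 384 (.cx 256 (.cy 320 (.cx 128 (.leaf 6 0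
    0) (.cy 288 (.cx 192 (.leaf 0 0 0) (.leaf 8 0 0)) (.leaf 6 0 0))) (.leaf 6 0 0)) (.leaf 8 0 0)) (.cx 256
    (.leaf 1 0 0) (.cy 448 (.cx 384 (.cy 416 (.leaf 8 0 0) (.leaf 1 0 0)) (.leaf 2 0 0)) (.leaf 2 0 0)))) (.cy
    384 (.cx 768 (.cy 320 (.cx 640 (.cy 288 (.leaf 0 1 0) (.leaf 7 0 0)) (.leaf 7 0 0)) (.leaf 7 0 0)) (.cy
    320 (.cx 896 (.leaf 7 0 0) (.leaf 6 1 0)) (.leaf 6 1 0))) (.cx 768 (.leaf 2 0 0) (.cy 448 (.cx 896 (.cy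
    416 (.leaf 6 1 0) (.leaf 1 1 0)) (.leaf 1 1 0)) (.leaf 1 1 0)))))) (.cy 768 (.cx 512 (.cy 640 (.cx 256
    (.cy 576 (.leaf 1 0 0) (.cx 128 (.leaf 1 0 0) (.cy 608 (.leaf 1 0 0) (.leaf 3 0 0)))) (.leaf 2 0 0)) (.cx
    256 (.cy 704 (.leaf 3 0 0) (.cx 128 (.leaf 3 0 0) (.leaf 5 0 0))) (.cy 704 (.leaf 5 0 0) (.cx 384 (.leaf 5
    0 0) (.cy 736 (.leaf 4 0 0) (.leaf 0 0 1)))))) (.cy 640 (.cx 768 (.cy 576 (.leaf 2 0 0) (.cx 640 (.leaf 2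
    0 0) (.cy 608 (.leaf 1 1 0) (.leaf 4 0 0)))) (.leaf 1 1 0)) (.cx 768 (.leaf 4 0 0) (.cy 704 (.leaf 3 1 0)
    (.cx 896 (.cy 736 (.leaf 3 1 0) (.cx 832 (.leaf 4 0 0) (.leaf 0 1 1))) (.leaf 3 1 0)))))) (.cx 512 (.leaf
    0 0 1) (.cy 896 (.cx 768 (.cy 832 (.cx 640 (.leaf 0 0 1) (.leaf 0 1 1)) (.leaf 0 0 1)) (.leaf 0 1 1))
    (.leaf 0 1 1))))

lemma atlas43_ok : atlas43.ok = true := by decide +kernel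

/-- The action of the generators on cosets for discriminant `-43`. -/
def action43 : List ℕ := [46554656868538934293434662287904998656, 14715725787088356399938216805593385216,
    20011376718272490338853433276725592320, 318327530945503956869858709665898562560,
    27929980259170967186115219635651163648, 50786326202924685604512751693215118080,
    286218208075970104493898593254931751936, 275709162133544015349949516134300005376,
    80967518860695249068286385004403651840, 146258673089736205235965191928504112640,
    103972931982420754262489123510215755264, 220270307865610115407037067950781727488]

lemma action43_ok : tabOK (atlas43.geom atlas43_ok) action43 = true := by decide +kernel

/-- A certificate for discriminant `-43`. -/
def cert43A : Cert where
  fr := [22, 27, 29, 54, 59, 50, 162, 91, 93, 119, 33, 20, 40, 38, 39, 168, 35]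
  sd := [5, 103, 107, 15, 10, 49, 24]
  W := [[-1, 0, 1, 1, 1, 0, 1, 0, 0, 0, 0, 0, 0, -2, 0, 0, 0], [-1, 1, 0, 1, 2, 0, 0, -1, 1, 0, 0, 0, 0, -2,
    2, 0, 0], [1, 0, -1, -2, -1, 0, -1, 0, 0, 0, 0, 0, 0, 2, 0, 0, 0], [0, 1, -1, 0, 0, 0, -1, -1, 1, 0, 0, 0,
    0, 0, 2, 0, 0], [1, -1, 0, -1, -1, 0, 0, 1, -1, 0, 0, 0, 0, 2, -2, 0, 0], [0, -1, 1, -1, 0, 1, 0, 1, -1,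
    0, 0, 0, 0, 0, -2, 0, 0], [-2, 2, 0, 4, 4, 0, 2, -2, 2, 0, 0, 1, 0, -8, 4, 0, 0]]
  ord := [(0, 1, 1), (30, 9, 0), (8, 13, 0), (1, 2, 1), (31, 14, 0), (5, 6, 1), (2, 3, 1), (32, 7, 0), (6, 11,
    0), (20, 30, 0), (46, 18, 1), (16, 26, 0), (21, 23, 1), (47, 19, 1), (17, 31, 0), (23, 25, 1), (45, 17,
    1), (15, 21, 0), (275, 75, 0), (280, 77, 0), (335, 70, 1), (282, 61, 0), (270, 78, 0), (375, 69, 1), (276,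
    55, 0), (610, 110, 0), (478, 101, 0), (271, 71, 0), (331, 66, 1), (274, 53, 0), (376, 74, 1), (278, 57,
    0), (606, 109, 0), (471, 106, 0), (991, 165, 0), (316, 167, 0), (520, 146, 0), (859, 133, 0), (590, 86,
    0), (515, 145, 0), (545, 37, 0), (595, 138, 0), (550, 42, 0), (730, 123, 0), (732, 125, 0), (149, 47, 0),
    (124, 105, 1), (605, 102, 0), (522, 147, 0), (552, 143, 0), (864, 170, 1), (869, 175, 1), (990, 161, 0),
    (992, 163, 0), (725, 118, 0), (139, 58, 0), (279, 67, 0), (332, 51, 0), (272, 73, 0), (317, 169, 0), (377,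
    79, 1), (283, 62, 0), (330, 65, 1), (284, 63, 0), (315, 174, 0), (473, 111, 0), (726, 130, 0), (856, 87,
    0), (516, 149, 0), (591, 129, 0), (855, 94, 0), (523, 159, 0), (593, 89, 0), (518, 154, 0), (857, 131, 0),
    (728, 121, 0), (733, 126, 0), (90, 36, 0), (183, 4, 1), (540, 81, 0), (510, 148, 0), (546, 132, 0), (724,
    117, 0), (135, 116, 0), (723, 137, 0), (863, 84, 0), (513, 153, 0), (91, 34, 0), (187, 8, 1), (541, 82,
    0), (511, 152, 0), (548, 136, 0), (729, 122, 0), (136, 120, 0), (727, 142, 0), (868, 88, 0), (517, 158,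
    0), (95, 41, 0), (547, 56, 1), (277, 68, 0), (96, 45, 0), (185, 46, 1), (100, 43, 0), (862, 90, 0), (519,
    150, 0), (549, 139, 0), (995, 166, 0), (860, 134, 0), (544, 85, 0), (514, 157, 0), (858, 164, 1), (993,
    173, 0), (867, 141, 0), (554, 95, 0), (524, 155, 0), (588, 100, 1), (600, 97, 0), (592, 104, 1), (601, 98,
    0), (720, 113, 0), (721, 114, 0), (722, 115, 0), (92, 44, 0), (191, 12, 1), (542, 83, 0), (512, 156, 0),
    (553, 140, 0), (865, 171, 1), (866, 172, 1), (318, 52, 0), (273, 76, 0), (333, 60, 0), (281, 72, 0), (543,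
    135, 0), (551, 92, 0), (521, 151, 0), (596, 108, 1), (602, 99, 0), (716, 124, 1), (137, 28, 1), (734, 127,
    0)]
  ex := [186, 99, 94, 694, 882, 873, 877]
  Y := [[1, 1, 1, 2, -2, 0, 0], [0, -2, 1, 4, -2, 2, 0], [-2, -1, 0, -2, 2, 0, 0], [-1, -2, 0, 2, 0, 2, 0],
    [-1, 1, -1, -4, 2, -2, 0], [1, 3, 1, -4, 0, -2, 0], [12, 2, 3, 4, -8, 4, -2]]
  DY := 2

lemma cert43A_ok : certOK (atlas43.geom atlas43_ok) action43 (0, 0) (0, 0) cert43A = true := by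
  decide +kernel

/-- A certificate for discriminant `-43`. -/
def cert43B : Cert where
  fr := [54, 59, 49, 162, 93, 119, 33, 20, 40, 39, 168, 35]
  sd := [10, 15, 22, 27, 5, 29, 38, 107, 91, 50, 103, 24]
  W := [[0, 0, 0, 0, 0, 0, 0, 0, 0, 0, 0, 0], [0, 0, 0, 0, 0, 0, 0, 0, 0, 0, 0, 0], [0, 0, 0, 0, 0, 0, 0, 0,
    0, 0, 0, 0], [0, 0, 0, 0, 0, 0, 0, 0, 0, 0, 0, 0], [0, 0, 0, 0, 0, 0, 0, 0, 0, 0, 0, 0], [0, 0, 0, 0, 0,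
    0, 0, 0, 0, 0, 0, 0], [0, 0, 0, 0, 0, 0, 0, 0, 0, -1, 0, 0], [-1, 0, 0, 0, 0, 0, 0, 0, 0, 0, 0, 0], [0, 0,
    0, -1, -1, 2, 0, 0, 2, 0, -2, 0], [2, 1, -1, -2, -2, 2, 0, 0, 2, 0, -2, 0], [1, 0, 0, -1, -2, 2, 0, 0, 2,
    0, -2, 0], [-4, 0, 0, 0, 4, 0, 0, -1, -4, -2, 4, 0]]
  ord := [(0, 1, 1), (30, 9, 0), (8, 13, 0), (1, 2, 1), (31, 14, 0), (5, 6, 1), (2, 3, 1), (32, 7, 0), (6, 11,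
    0), (20, 30, 1), (46, 18, 1), (16, 26, 0), (21, 23, 1), (47, 19, 1), (17, 31, 0), (23, 25, 1), (45, 17,
    1), (15, 21, 0), (275, 75, 0), (280, 77, 1), (335, 70, 1), (282, 61, 0), (270, 78, 1), (375, 69, 1), (276,
    55, 0), (610, 110, 0), (478, 101, 1), (271, 71, 1), (331, 66, 1), (274, 53, 0), (376, 74, 0), (278, 57,
    0), (471, 106, 0), (477, 109, 1), (316, 167, 1), (319, 165, 1), (520, 146, 1), (859, 133, 0), (590, 86,
    0), (515, 145, 1), (545, 37, 1), (595, 138, 1), (550, 42, 1), (730, 123, 0), (732, 125, 0), (149, 47, 0),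
    (124, 105, 0), (470, 102, 1), (522, 147, 0), (552, 143, 1), (864, 170, 1), (869, 175, 1), (990, 161, 0),
    (992, 163, 0), (725, 118, 0), (139, 58, 0), (279, 67, 1), (332, 51, 0), (272, 73, 0), (317, 169, 0), (377,
    79, 0), (283, 62, 0), (315, 174, 1), (330, 65, 1), (284, 63, 0), (473, 111, 1), (726, 130, 1), (856, 87,
    1), (516, 149, 1), (591, 129, 1), (855, 94, 0), (523, 159, 1), (593, 89, 0), (518, 154, 0), (857, 131, 0),
    (728, 121, 0), (733, 126, 0), (90, 36, 0), (183, 4, 1), (540, 81, 0), (510, 148, 1), (546, 132, 1), (724,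
    117, 0), (135, 116, 0), (723, 137, 0), (863, 84, 0), (513, 153, 0), (91, 34, 0), (189, 8, 0), (541, 82,
    0), (511, 152, 0), (548, 136, 1), (729, 122, 0), (136, 120, 0), (727, 142, 0), (868, 88, 0), (517, 158,
    1), (95, 41, 0), (547, 56, 1), (277, 68, 1), (96, 45, 1), (185, 46, 0), (100, 43, 0), (862, 90, 0), (519,
    150, 0), (549, 139, 0), (995, 166, 0), (860, 134, 0), (544, 85, 0), (514, 157, 1), (858, 164, 1), (993,
    173, 0), (867, 141, 0), (554, 95, 0), (524, 155, 1), (588, 100, 1), (600, 97, 0), (592, 104, 1), (601, 98,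
    0), (720, 113, 0), (721, 114, 0), (722, 115, 0), (92, 44, 0), (194, 12, 0), (542, 83, 0), (512, 156, 1),
    (553, 140, 0), (865, 171, 1), (866, 172, 1), (318, 52, 0), (273, 76, 1), (333, 60, 1), (281, 72, 0), (543,
    135, 1), (551, 92, 0), (521, 151, 1), (596, 108, 1), (602, 99, 0), (716, 124, 1), (137, 28, 1), (734, 127,
    0)]
  ex := [9, 10, 24, 25, 38, 53, 188, 1067, 122, 201, 965, 877]
  Y := [[-1, 0, 0, 0, 0, 0, 0, 0, 0, 0, 0, 0], [0, -1, 0, 0, 0, 0, 0, 0, 0, 0, 0, 0], [0, 0, 1, 0, 0, 0, 0, 0,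
    0, 0, 0, 0], [0, 0, 0, -1, 0, 0, 0, 0, 0, 0, 0, 0], [0, 0, 0, 0, -1, 0, 0, 0, 0, 0, 0, 0], [0, 0, 0, 0, 0,
    -1, 0, 0, 0, 0, 0, 0], [0, -1, 0, 0, 0, 0, -1, 0, 0, 0, 0, 0], [0, -3, 0, 0, 0, 0, 0, -1, 0, 0, 0, 0], [1,
    4, -4, -1, 3, 1, 0, 0, -2, 2, -2, 0], [1, 8, -7, -2, 4, 1, 0, 0, -4, 4, -2, 0], [6, 4, -7, 0, -3, 1, 0,
    -1, -4, 2, -2, 0], [-7, -14, 10, 0, 6, -2, -2, 1, 8, -4, 4, -2]]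
  DY := 2

lemma cert43B_ok : certOK (atlas43.geom atlas43_ok) action43 (0, 1) (0, 0) cert43B = true := by
  decide +kernel

/-- A certificate for discriminant `-43`. -/
def cert43C : Cert where
  fr := [50, 162, 91, 39, 168]
  sd := [10, 15, 24, 22, 27, 5, 20, 29, 40, 35, 38, 103, 107, 54, 119, 93, 33, 59, 49]
  W := [[0, 0, 0, 0, 0], [0, 0, 0, 0, 0], [0, 0, 0, 0, 0], [0, 0, 0, 0, 0], [0, 0, 0, 0, 0], [0, 0, 0, 0, 0],
    [0, 0, 0, 0, 0], [0, 0, 0, 0, 0], [0, 0, 0, 0, 0], [0, 0, 0, 0, 0], [0, 0, 0, -1, 0], [0, 1, 0, 0, 0], [0,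
    0, 0, 0, 0], [0, 0, 0, 0, 0], [1, 0, 0, 0, 0], [0, 1, -1, 0, 0], [0, 0, 0, 0, 0], [0, 1, 0, 0, 0], [-1, 1,
    0, 0, 0]]
  ord := [(0, 1, 1), (30, 9, 0), (8, 13, 0), (1, 2, 1), (31, 14, 0), (5, 6, 1), (2, 3, 1), (32, 7, 0), (6, 11,
    0), (20, 30, 1), (46, 18, 1), (16, 26, 0), (21, 23, 1), (47, 19, 1), (17, 31, 0), (23, 25, 1), (45, 17,
    1), (15, 21, 0), (275, 75, 0), (280, 77, 1), (335, 70, 1), (282, 61, 0), (270, 78, 1), (375, 69, 1), (276,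
    55, 0), (610, 110, 0), (478, 101, 1), (271, 71, 1), (331, 66, 1), (274, 53, 0), (376, 74, 0), (278, 57,
    0), (606, 109, 1), (471, 106, 0), (991, 165, 1), (316, 167, 1), (520, 146, 1), (859, 133, 0), (590, 86,
    0), (515, 145, 0), (545, 37, 0), (595, 138, 1), (550, 42, 1), (730, 123, 0), (732, 125, 0), (149, 47, 0),
    (124, 105, 0), (605, 102, 0), (522, 147, 1), (552, 143, 1), (864, 170, 1), (869, 175, 1), (990, 161, 0),
    (992, 163, 0), (725, 118, 0), (139, 58, 1), (279, 67, 1), (332, 51, 0), (272, 73, 0), (317, 169, 0), (377,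
    79, 0), (283, 62, 0), (330, 65, 1), (284, 63, 0), (315, 174, 1), (473, 111, 1), (726, 130, 1), (856, 87,
    1), (516, 149, 0), (591, 129, 0), (855, 94, 1), (523, 159, 1), (593, 89, 0), (518, 154, 1), (857, 131, 0),
    (728, 121, 0), (733, 126, 0), (90, 36, 0), (183, 4, 1), (540, 81, 0), (510, 148, 0), (546, 132, 0), (724,
    117, 0), (135, 116, 1), (723, 137, 0), (863, 84, 0), (513, 153, 0), (91, 34, 0), (187, 8, 1), (541, 82,
    0), (511, 152, 1), (548, 136, 0), (729, 122, 0), (136, 120, 1), (727, 142, 1), (868, 88, 1), (517, 158,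
    1), (95, 41, 1), (547, 56, 1), (277, 68, 0), (96, 45, 0), (185, 46, 0), (100, 43, 0), (862, 90, 1), (519,
    150, 1), (549, 139, 1), (995, 166, 0), (860, 134, 0), (544, 85, 0), (514, 157, 1), (858, 164, 1), (993,
    173, 1), (867, 141, 0), (554, 95, 0), (524, 155, 0), (588, 100, 1), (600, 97, 0), (592, 104, 0), (601, 98,
    0), (720, 113, 0), (721, 114, 0), (722, 115, 0), (92, 44, 0), (191, 12, 1), (542, 83, 0), (512, 156, 1),
    (553, 140, 0), (865, 171, 1), (866, 172, 1), (318, 52, 0), (273, 76, 1), (333, 60, 1), (281, 72, 1), (543,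
    135, 0), (551, 92, 0), (521, 151, 1), (596, 108, 0), (602, 99, 0), (716, 124, 1), (137, 28, 1), (734, 127,
    0)]
  ex := [9, 10, 22, 24, 25, 38, 48, 53, 262, 266, 188, 849, 1067, 170, 306, 303, 465, 144, 882]
  Y := [[-2, 0, 0, 0, 0, 0, 0, 0, 0, 0, 0, 0, 0, 0, 0, 0, 0, 0, 0], [0, -2, 0, 0, 0, 0, 0, 0, 0, 0, 0, 0, 0,
    0, 0, 0, 0, 0, 0], [0, 0, -2, 0, 0, 0, 0, 0, 0, 0, 0, 0, 0, 0, 0, 0, 0, 0, 0], [0, 0, 0, 2, 0, 0, 0, 0, 0,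
    0, 0, 0, 0, 0, 0, 0, 0, 0, 0], [0, 0, 0, 0, -2, 0, 0, 0, 0, 0, 0, 0, 0, 0, 0, 0, 0, 0, 0], [0, 0, 0, 0, 0,
    -2, 0, 0, 0, 0, 0, 0, 0, 0, 0, 0, 0, 0, 0], [0, 0, 0, 0, 0, 0, -2, 0, 0, 0, 0, 0, 0, 0, 0, 0, 0, 0, 0],
    [0, 0, 0, 0, 0, 0, 0, -2, 0, 0, 0, 0, 0, 0, 0, 0, 0, 0, 0], [0, 0, 0, 0, 0, 0, 0, 0, 1, 0, 0, 0, 0, 0, 0,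
    0, 0, 0, 0], [0, 0, 0, 0, 0, 0, 0, 0, 0, -1, 0, 0, 0, 0, 0, 0, 0, 0, 0], [0, -2, 0, 0, 0, 0, 0, 0, 0, 0,
    2, 0, 0, 0, 0, 0, 0, 0, 0], [0, 6, 0, -3, 3, 2, 0, 2, -2, 4, -2, -2, -1, 2, -2, -2, 0, 1, -2], [-2, -2, 0,
    1, 1, 2, 0, 0, -2, 2, 0, 0, -3, 0, 0, -2, 0, 1, 2], [2, -4, 0, -1, -1, -2, 0, 0, 2, -2, 0, 0, 1, 0, 0, 2,
    0, -1, -2], [-1, 13, 0, -1, 1, 3, 0, 0, -2, 1, -1, -3, 1, 3, -1, 0, 0, 0, 0], [-4, 10, 0, -2, 4, 0, 0, 2,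
    -4, 6, -2, -2, -2, 2, -2, -4, 0, 0, 0], [-1, -6, 0, 2, -2, 0, -1, 0, 0, -2, 0, 1, -3, -2, 1, 2, -1, 0, 0],
    [0, 6, 0, -3, 3, 0, 0, 2, -2, 4, -2, 0, -1, 2, -2, -2, 0, 1, -2], [-4, -16, 0, 3, -1, -6, 0, 0, 2, -2, 0,
    2, -1, -4, 0, 2, 0, -1, -2]]
  DY := 4

lemma cert43C_ok : certOK (atlas43.geom atlas43_ok) action43 (0, 1) (0, 1) cert43C = true := by
  decide +kernel

/-- A certificate for discriminant `-43`. -/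
def cert43D : Cert where
  fr := []
  sd := [10, 15, 20, 22, 27, 5, 24, 29, 35, 38, 103, 50, 162, 107, 91, 54, 40, 33, 93, 168, 59, 49, 119, 39]
  W := [[], [], [], [], [], [], [], [], [], [], [], [], [], [], [], [], [], [], [], [], [], [], [], []]
  ord := [(0, 1, 1), (30, 9, 0), (8, 13, 0), (1, 2, 1), (31, 14, 0), (5, 6, 1), (2, 3, 1), (32, 7, 0), (6, 11,
    0), (20, 30, 1), (46, 18, 1), (16, 26, 0), (21, 23, 1), (47, 19, 1), (17, 31, 0), (23, 25, 1), (45, 17,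
    1), (15, 21, 0), (275, 75, 0), (280, 77, 1), (335, 70, 1), (282, 61, 0), (270, 78, 1), (375, 69, 1), (276,
    55, 0), (475, 110, 0), (478, 101, 1), (271, 71, 1), (331, 66, 1), (274, 53, 0), (376, 74, 0), (278, 57,
    0), (471, 106, 0), (477, 109, 1), (991, 165, 1), (316, 167, 1), (520, 146, 0), (859, 133, 0), (590, 86,
    0), (515, 145, 0), (545, 37, 0), (595, 138, 0), (550, 42, 0), (730, 123, 0), (732, 125, 0), (149, 47, 0),
    (134, 102, 1), (605, 105, 1), (522, 147, 0), (552, 143, 0), (864, 170, 1), (869, 175, 1), (990, 161, 0),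
    (992, 163, 0), (725, 118, 0), (139, 58, 0), (279, 67, 1), (332, 51, 0), (272, 73, 0), (317, 169, 0), (377,
    79, 0), (283, 62, 0), (315, 174, 1), (330, 65, 1), (284, 63, 0), (473, 111, 1), (726, 130, 0), (856, 87,
    0), (516, 149, 1), (591, 129, 1), (855, 94, 1), (523, 159, 0), (593, 89, 0), (518, 154, 1), (857, 131, 0),
    (728, 121, 0), (733, 126, 0), (90, 36, 0), (183, 4, 1), (540, 81, 0), (510, 148, 1), (546, 132, 1), (724,
    117, 0), (135, 116, 0), (723, 137, 1), (863, 84, 1), (513, 153, 0), (91, 34, 0), (189, 8, 0), (541, 82,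
    0), (511, 152, 1), (548, 136, 0), (729, 122, 0), (136, 120, 1), (727, 142, 0), (868, 88, 0), (517, 158,
    1), (95, 41, 1), (547, 56, 1), (277, 68, 1), (96, 45, 1), (185, 46, 0), (100, 43, 0), (862, 90, 1), (519,
    150, 0), (549, 139, 1), (995, 166, 0), (860, 134, 0), (544, 85, 0), (514, 157, 0), (858, 164, 1), (993,
    173, 1), (867, 141, 0), (554, 95, 0), (524, 155, 0), (588, 100, 0), (600, 97, 0), (592, 104, 1), (601, 98,
    0), (720, 113, 0), (721, 114, 0), (722, 115, 0), (92, 44, 0), (191, 12, 1), (542, 83, 0), (512, 156, 0),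
    (553, 140, 1), (865, 171, 1), (866, 172, 1), (318, 52, 0), (273, 76, 0), (333, 60, 0), (281, 72, 1), (543,
    135, 1), (551, 92, 0), (521, 151, 1), (596, 108, 0), (602, 99, 0), (716, 124, 1), (137, 28, 1), (734, 127,
    0)]
  ex := [9, 10, 18, 24, 25, 38, 52, 53, 266, 188, 37, 597, 874, 364, 719, 450, 143, 1077, 712, 584, 786, 699,
    882, 861]
  Y := [[-4, 0, 0, 0, 0, 0, 0, 0, 0, 0, 0, 0, 0, 0, 0, 0, 0, 0, 0, 0, 0, 0, 0, 0], [0, -4, 0, 0, 0, 0, 0, 0,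
    0, 0, 0, 0, 0, 0, 0, 0, 0, 0, 0, 0, 0, 0, 0, 0], [0, 0, -4, 0, 0, 0, 0, 0, 0, 0, 0, 0, 0, 0, 0, 0, 0, 0,
    0, 0, 0, 0, 0, 0], [0, 0, 0, 4, 0, 0, 0, 0, 0, 0, 0, 0, 0, 0, 0, 0, 0, 0, 0, 0, 0, 0, 0, 0], [0, 0, 0, 0,
    -4, 0, 0, 0, 0, 0, 0, 0, 0, 0, 0, 0, 0, 0, 0, 0, 0, 0, 0, 0], [0, 0, 0, 0, 0, -4, 0, 0, 0, 0, 0, 0, 0, 0,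
    0, 0, 0, 0, 0, 0, 0, 0, 0, 0], [0, 0, 0, 0, 0, 0, -4, 0, 0, 0, 0, 0, 0, 0, 0, 0, 0, 0, 0, 0, 0, 0, 0, 0],
    [0, 0, 0, 0, 0, 0, 0, -4, 0, 0, 0, 0, 0, 0, 0, 0, 0, 0, 0, 0, 0, 0, 0, 0], [0, 0, 0, 0, 0, 0, 0, 0, -2, 0,
    0, 0, 0, 0, 0, 0, 0, 0, 0, 0, 0, 0, 0, 0], [-2, 2, 0, 2, -2, 0, 0, 0, -2, 2, 2, 2, 6, 2, 2, 4, 0, 4, 2, 4,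
    2, -2, 0, -2], [-6, -2, 0, 0, -2, 0, 0, -4, 0, 2, -4, -4, -2, 0, 2, -2, 0, 0, -2, 0, 0, 2, 0, 2], [-1, -2,
    0, -1, 2, 4, 0, 0, 1, 0, 0, 1, -3, -1, -1, -3, 0, -2, -1, -2, -1, 0, 0, 2], [-6, -10, 2, 0, -2, 8, 0, -8,
    0, 2, 4, 4, 6, 2, -2, -2, 0, 0, 2, 0, 0, 2, 0, 2], [-8, 0, 2, 0, 0, 4, 0, -8, 0, 0, 0, 4, 4, 2, 0, 0, 0,
    0, 0, 0, 0, 0, 0, 0], [-3, 4, 0, 0, 0, 4, 0, 0, 0, 0, -4, -1, -1, 0, 1, -1, 0, 0, -2, 0, 0, 0, 0, 0], [-2,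
    0, -2, 0, 0, -4, 0, 0, 0, 0, 0, -2, -2, -2, 2, 2, 0, 0, 0, 0, 0, 0, 0, 0], [4, 8, -2, 0, 2, -4, 2, 4, 0,
    -2, 0, 0, -2, 0, 0, 2, -4, 0, 0, 0, 0, -2, 0, -2], [-4, -6, 0, 0, -2, 4, 0, -4, 0, 2, 0, 0, 2, 0, 0, -2,
    0, 2, 0, 0, 0, 2, 0, 2], [7, 6, -2, 0, 2, -8, 0, 12, 0, -2, 0, -5, -7, -2, 3, 1, 0, 0, 0, 0, 0, -2, 0,
    -2], [-4, 4, 0, 1, 2, -4, 2, -4, 1, 2, 0, 6, 0, 1, -2, 2, -4, -2, 1, 2, -1, -2, 0, 0], [0, 6, 0, 0, 2, 4,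
    0, 4, 0, -2, 0, 2, 0, 0, 0, 0, 0, 0, -2, 0, 0, -2, 0, -2], [-7, -8, 0, 1, -4, 0, 0, -8, -1, 2, 4, 1, 3, 1,
    1, 3, 0, 2, 3, 2, 1, 2, 0, 0], [9, -2, -4, -7, 0, -4, 0, 8, 1, -2, -4, -9, -11, -5, 3, -1, 0, -2, -5, -2,
    -1, 2, 4, 0], [-2, -2, 0, 2, -2, 0, 0, 0, -2, -2, 2, 2, 6, 2, 2, 4, 0, 4, 2, 4, 2, -2, 0, -2]]
  DY := 8

lemma cert43D_ok : certOK (atlas43.geom atlas43_ok) action43 (0, 1) (1, 0) cert43D = true := by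
  decide +kernel

/-- The floor for discriminant `-67`. -/
def atlas67 : Atlas 17 where
  fs := [
    ⟨⟨0, 0⟩, ⟨1, 0⟩, ⟨-1, 0⟩, ⟨0, 0⟩, ⟨0, 0⟩, ⟨⟨0, 0⟩, 0, ⟨0, 0⟩, 1⟩, ⟨⟨0, 0⟩, 0, ⟨0, 0⟩, 1⟩,
    [⟨⟨-1, -1⟩, 20, [(⟨0, -1⟩, 21)], ⟨-5, 1⟩, 1⟩,
      ⟨⟨-1, -1⟩, 10, [(⟨0, -1⟩, 11), (⟨-4, 2⟩, 8)], ⟨0, 0⟩, 0⟩,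
      ⟨⟨0, -1⟩, 9, [(⟨0, -1⟩, 12), (⟨-1, 1⟩, 0)], ⟨-1, 1⟩, 0⟩,
      ⟨⟨0, -1⟩, 12, [(⟨0, -1⟩, 9), (⟨-1, 1⟩, 0)], ⟨-1, 1⟩, 0⟩,
      ⟨⟨0, -1⟩, 11, [(⟨-1, -1⟩, 10), (⟨-1, 0⟩, 8)], ⟨-3, 2⟩, 0⟩,
      ⟨⟨0, -1⟩, 21, [(⟨-1, -1⟩, 20)], ⟨5, -1⟩, 0⟩,
      ⟨⟨1, 0⟩, 0, [(⟨-1, 0⟩, 0)], ⟨1, 0⟩, 0⟩,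
      ⟨⟨0, 0⟩, 17, [(⟨-1, 0⟩, 24)], ⟨0, 0⟩, 0⟩,
      ⟨⟨0, 0⟩, 16, [(⟨-1, 0⟩, 15), (⟨-3, 0⟩, 4)], ⟨0, 0⟩, 0⟩,
      ⟨⟨0, 0⟩, 13, [(⟨-1, 0⟩, 14), (⟨-1, 0⟩, 0)], ⟨0, 0⟩, 0⟩,
      ⟨⟨-1, 0⟩, 14, [(⟨0, 0⟩, 13), (⟨0, 0⟩, 0)], ⟨-1, 0⟩, 0⟩,
      ⟨⟨-1, 0⟩, 15, [(⟨0, 0⟩, 16), (⟨-2, 0⟩, 4)], ⟨-1, 0⟩, 0⟩,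
      ⟨⟨-1, 0⟩, 24, [(⟨0, 0⟩, 17)], ⟨0, 0⟩, 1⟩,
      ⟨⟨-1, 0⟩, 0, [(⟨1, 0⟩, 0)], ⟨-1, 0⟩, 1⟩]⟩,
    ⟨⟨0, -1⟩, ⟨-8, 0⟩, ⟨-2, 0⟩, ⟨-1, 1⟩, ⟨0, 1656⟩, ⟨⟨-1, 0⟩, 2, ⟨1, 0⟩, 1⟩, ⟨⟨0, 0⟩, 1, ⟨0, 0⟩, 1⟩,
    [⟨⟨-1, 0⟩, 18, [(⟨-1, 0⟩, 23)], ⟨0, 0⟩, 1⟩,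
      ⟨⟨0, 0⟩, 6, [(⟨-1, 0⟩, 7), (⟨-2, 0⟩, 9)], ⟨0, 0⟩, 0⟩,
      ⟨⟨0, 0⟩, 8, [(⟨-1, 0⟩, 8), (⟨-1, 0⟩, 1), (⟨-1, 0⟩, 8), (⟨-1, 0⟩, 1)], ⟨0, 0⟩, 0⟩,
      ⟨⟨0, 0⟩, 2, [(⟨-1, 0⟩, 1)], ⟨0, 0⟩, 0⟩,
      ⟨⟨0, 0⟩, 19, [(⟨-1, 0⟩, 22)], ⟨0, 1⟩, 0⟩,
      ⟨⟨0, 0⟩, 3, [(⟨-1, 0⟩, 5), (⟨-2, 1⟩, 13)], ⟨0, 0⟩, 0⟩,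
      ⟨⟨-1, 0⟩, 4, [(⟨-1, 0⟩, 4), (⟨-1, 0⟩, 1), (⟨-1, 0⟩, 4), (⟨-1, 0⟩, 1)], ⟨-1, 0⟩, 0⟩,
      ⟨⟨-1, 0⟩, 2, [(⟨0, 0⟩, 1)], ⟨-1, 0⟩, 1⟩]⟩,
    ⟨⟨-1, -1⟩, ⟨-9, 0⟩, ⟨-2, 0⟩, ⟨-2, 1⟩, ⟨1656, 1656⟩, ⟨⟨-1, 0⟩, 1, ⟨1, 0⟩, 1⟩, ⟨⟨0, 0⟩, 2, ⟨0, 0⟩, 1⟩,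
    [⟨⟨0, 0⟩, 8, [(⟨-1, 0⟩, 8), (⟨-1, 0⟩, 2), (⟨-1, 0⟩, 8), (⟨-1, 0⟩, 2)], ⟨0, 0⟩, 0⟩,
      ⟨⟨0, 0⟩, 7, [(⟨-1, 0⟩, 6), (⟨-1, 0⟩, 12)], ⟨-1, 0⟩, 0⟩,
      ⟨⟨0, 0⟩, 23, [(⟨-2, 0⟩, 18)], ⟨0, 0⟩, 0⟩,
      ⟨⟨1, 0⟩, 1, [(⟨-2, 0⟩, 2)], ⟨1, 0⟩, 0⟩,
      ⟨⟨0, 0⟩, 4, [(⟨-2, 0⟩, 4), (⟨-2, 0⟩, 2), (⟨-2, 0⟩, 4), (⟨-2, 0⟩, 2)], ⟨0, 0⟩, 0⟩,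
      ⟨⟨0, 0⟩, 5, [(⟨-1, 0⟩, 3), (⟨-1, 0⟩, 14)], ⟨-1, 1⟩, 0⟩,
      ⟨⟨0, 0⟩, 22, [(⟨-1, 0⟩, 19)], ⟨0, -1⟩, 1⟩,
      ⟨⟨0, 0⟩, 1, [(⟨-1, 0⟩, 2)], ⟨0, 0⟩, 1⟩]⟩,
    ⟨⟨0, -2⟩, ⟨-11, 0⟩, ⟨-3, 0⟩, ⟨-1, 1⟩, ⟨0, 2208⟩, ⟨⟨-1, 0⟩, 7, ⟨2, 0⟩, 1⟩, ⟨⟨0, 0⟩, 3, ⟨0, 0⟩, 1⟩,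
    [⟨⟨0, 0⟩, 1, [(⟨-1, 0⟩, 14), (⟨-1, 0⟩, 6)], ⟨0, 0⟩, 0⟩,
      ⟨⟨0, 0⟩, 19, [(⟨-1, 0⟩, 15)], ⟨5, 0⟩, 0⟩,
      ⟨⟨0, 0⟩, 5, [(⟨-1, 0⟩, 8)], ⟨-1, 1⟩, 0⟩,
      ⟨⟨0, 0⟩, 9, [(⟨-1, 0⟩, 2), (⟨-1, 0⟩, 6)], ⟨0, 0⟩, 0⟩,
      ⟨⟨-1, 0⟩, 10, [(⟨-1, 0⟩, 23)], ⟨-1, 0⟩, 0⟩,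
      ⟨⟨-1, 0⟩, 4, [(⟨0, 0⟩, 6)], ⟨-1, 0⟩, 1⟩]⟩,
    ⟨⟨-2, -2⟩, ⟨-25, 0⟩, ⟨-3, 0⟩, ⟨-4, 2⟩, ⟨2208, 2208⟩, ⟨⟨-2, 0⟩, 4, ⟨2, 0⟩, 1⟩, ⟨⟨0, 0⟩, 4, ⟨0, 0⟩, 1⟩,
    [⟨⟨0, 0⟩, 2, [(⟨-1, 0⟩, 1), (⟨-1, 0⟩, 4), (⟨-1, 0⟩, 1), (⟨-1, 0⟩, 4)], ⟨0, 0⟩, 0⟩,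
      ⟨⟨1, 0⟩, 1, [(⟨-2, 0⟩, 2), (⟨-2, 0⟩, 4), (⟨-2, 0⟩, 2), (⟨-2, 0⟩, 4)], ⟨1, 0⟩, 0⟩,
      ⟨⟨1, 0⟩, 3, [(⟨-2, 0⟩, 5)], ⟨2, -1⟩, 0⟩,
      ⟨⟨0, 0⟩, 10, [(⟨-2, 0⟩, 11), (⟨-4, 2⟩, 0)], ⟨0, 0⟩, 0⟩,
      ⟨⟨0, 0⟩, 11, [(⟨-2, 0⟩, 10), (⟨0, 0⟩, 0)], ⟨-4, 2⟩, 0⟩,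
      ⟨⟨0, 0⟩, 5, [(⟨-1, 0⟩, 3)], ⟨-2, 1⟩, 1⟩]⟩,
    ⟨⟨-1, -2⟩, ⟨-47, 0⟩, ⟨-3, 0⟩, ⟨-6, 4⟩, ⟨1104, 2208⟩, ⟨⟨-2, 1⟩, 6, ⟨1, 0⟩, 1⟩, ⟨⟨0, 0⟩, 5, ⟨0, 0⟩, 1⟩,
    [⟨⟨0, 0⟩, 22, [(⟨-2, 1⟩, 16)], ⟨4, -1⟩, 0⟩,
      ⟨⟨0, 0⟩, 2, [(⟨-2, 1⟩, 13), (⟨-1, 0⟩, 7)], ⟨1, 0⟩, 0⟩,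
      ⟨⟨0, 0⟩, 4, [(⟨-3, 1⟩, 7)], ⟨1, 0⟩, 0⟩,
      ⟨⟨0, 0⟩, 11, [(⟨-3, 1⟩, 18)], ⟨-4, 2⟩, 0⟩,
      ⟨⟨0, 0⟩, 12, [(⟨-2, 1⟩, 1), (⟨-1, 0⟩, 7)], ⟨1, 0⟩, 0⟩,
      ⟨⟨0, 0⟩, 3, [(⟨-2, 1⟩, 8)], ⟨0, 0⟩, 1⟩]⟩,
    ⟨⟨0, -1⟩, ⟨-11, 0⟩, ⟨-3, 0⟩, ⟨-2, 2⟩, ⟨0, 1104⟩, ⟨⟨-1, 0⟩, 5, ⟨2, -1⟩, 1⟩, ⟨⟨0, 0⟩, 6, ⟨0, 0⟩, 1⟩,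
    [⟨⟨0, 0⟩, 13, [(⟨-1, 0⟩, 2), (⟨-1, 0⟩, 3)], ⟨0, 0⟩, 0⟩,
      ⟨⟨0, 0⟩, 16, [(⟨-1, 0⟩, 22)], ⟨-4, 1⟩, 1⟩,
      ⟨⟨0, 0⟩, 8, [(⟨-1, 0⟩, 3)], ⟨0, 0⟩, 0⟩,
      ⟨⟨0, 0⟩, 1, [(⟨-1, 0⟩, 12), (⟨-1, 0⟩, 3)], ⟨0, 0⟩, 0⟩,
      ⟨⟨-1, 0⟩, 18, [(⟨-1, 0⟩, 11)], ⟨4, -2⟩, 1⟩,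
      ⟨⟨-1, 0⟩, 7, [(⟨-1, 0⟩, 4)], ⟨-1, 0⟩, 1⟩]⟩,
    ⟨⟨-2, -1⟩, ⟨-15, 0⟩, ⟨-3, 0⟩, ⟨-6, 2⟩, ⟨2208, 1104⟩, ⟨⟨-2, 0⟩, 3, ⟨1, 0⟩, 1⟩, ⟨⟨0, 0⟩, 7, ⟨0, 0⟩, 1⟩,
    [⟨⟨0, 0⟩, 15, [(⟨-2, 0⟩, 19)], ⟨-5, 0⟩, 1⟩,
      ⟨⟨0, 0⟩, 14, [(⟨-2, 0⟩, 1), (⟨-1, 0⟩, 5)], ⟨1, -1⟩, 0⟩,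
      ⟨⟨1, 0⟩, 6, [(⟨-3, 0⟩, 4)], ⟨1, 0⟩, 0⟩,
      ⟨⟨0, 0⟩, 23, [(⟨-3, 0⟩, 10)], ⟨1, 0⟩, 1⟩,
      ⟨⟨0, 0⟩, 2, [(⟨-2, 0⟩, 9), (⟨-1, 0⟩, 5)], ⟨1, -1⟩, 0⟩,
      ⟨⟨0, 0⟩, 8, [(⟨-2, 0⟩, 5)], ⟨1, -1⟩, 1⟩]⟩,
    ⟨⟨-1, -1⟩, ⟨-6, 0⟩, ⟨-3, 0⟩, ⟨-2, 1⟩, ⟨1104, 1104⟩, ⟨⟨-1, 0⟩, 8, ⟨1, 0⟩, 1⟩, ⟨⟨0, 0⟩, 8, ⟨0, 0⟩, 1⟩,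
    [⟨⟨0, 0⟩, 16, [(⟨-1, 0⟩, 15), (⟨-2, 1⟩, 0)], ⟨-2, 1⟩, 0⟩,
      ⟨⟨0, 0⟩, 15, [(⟨-1, 0⟩, 16), (⟨-2, 1⟩, 0)], ⟨-2, 1⟩, 0⟩,
      ⟨⟨0, 0⟩, 7, [(⟨-1, 0⟩, 6)], ⟨-1, 0⟩, 0⟩,
      ⟨⟨0, 0⟩, 2, [(⟨-1, 0⟩, 1), (⟨-1, 0⟩, 8), (⟨-1, 0⟩, 1), (⟨-1, 0⟩, 8)], ⟨0, 0⟩, 0⟩,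
      ⟨⟨0, 0⟩, 1, [(⟨-1, 0⟩, 2), (⟨-1, 0⟩, 8), (⟨-1, 0⟩, 2), (⟨-1, 0⟩, 8)], ⟨0, 0⟩, 0⟩,
      ⟨⟨0, 0⟩, 6, [(⟨-1, 0⟩, 7)], ⟨1, 0⟩, 1⟩]⟩,
    ⟨⟨0, -3⟩, ⟨-38, 0⟩, ⟨-4, 0⟩, ⟨-3, 3⟩, ⟨0, 2484⟩, ⟨⟨-1, 0⟩, 12, ⟨1, 0⟩, 1⟩, ⟨⟨0, 0⟩, 9, ⟨0, 0⟩, 1⟩,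
    [⟨⟨0, 0⟩, 3, [(⟨-1, 0⟩, 5), (⟨-2, 1⟩, 1)], ⟨0, 0⟩, 0⟩,
      ⟨⟨0, 0⟩, 12, [(⟨-1, 0⟩, 9)], ⟨0, 0⟩, 0⟩,
      ⟨⟨0, 1⟩, 0, [(⟨-1, 1⟩, 0), (⟨0, -1⟩, 9)], ⟨1, -1⟩, 0⟩,
      ⟨⟨-1, 0⟩, 10, [(⟨-1, 0⟩, 11)], ⟨3, -2⟩, 1⟩]⟩,
    ⟨⟨-3, -3⟩, ⟨-14, 0⟩, ⟨-4, 0⟩, ⟨-2, 1⟩, ⟨2484, 2484⟩, ⟨⟨-1, 0⟩, 15, ⟨3, 0⟩, 1⟩, ⟨⟨0, 0⟩, 10, ⟨0, 0⟩, 1⟩,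
    [⟨⟨0, 0⟩, 4, [(⟨0, 0⟩, 0), (⟨0, 0⟩, 16)], ⟨0, 0⟩, 0⟩,
      ⟨⟨1, 0⟩, 3, [(⟨-1, 0⟩, 24)], ⟨-1, 0⟩, 1⟩,
      ⟨⟨1, 0⟩, 9, [(⟨-1, 0⟩, 16)], ⟨1, 0⟩, 0⟩,
      ⟨⟨1, 1⟩, 0, [(⟨-1, 0⟩, 8), (⟨-1, 0⟩, 16)], ⟨2, -1⟩, 0⟩,
      ⟨⟨0, 0⟩, 20, [(⟨-1, 0⟩, 7)], ⟨3, 0⟩, 1⟩,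
      ⟨⟨0, 0⟩, 11, [(⟨-1, 0⟩, 14)], ⟨-3, 2⟩, 1⟩]⟩,
    ⟨⟨-2, -3⟩, ⟨-122, 0⟩, ⟨-4, 0⟩, ⟨-15, 9⟩, ⟨1656, 2484⟩, ⟨⟨-4, 2⟩, 16, ⟨2, 0⟩, 1⟩, ⟨⟨0, 0⟩, 11, ⟨0, 0⟩, 1⟩,
    [⟨⟨0, 0⟩, 5, [(⟨-4, 2⟩, 17)], ⟨-3, 1⟩, 1⟩,
      ⟨⟨0, 0⟩, 4, [(⟨-4, 2⟩, 0), (⟨-1, 0⟩, 15)], ⟨1, 0⟩, 0⟩,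
      ⟨⟨0, 0⟩, 10, [(⟨-4, 2⟩, 13)], ⟨0, 0⟩, 0⟩,
      ⟨⟨0, 0⟩, 21, [(⟨-4, 2⟩, 6)], ⟨7, -1⟩, 1⟩,
      ⟨⟨0, 1⟩, 0, [(⟨-4, 2⟩, 8), (⟨-1, 0⟩, 15)], ⟨2, -1⟩, 0⟩,
      ⟨⟨0, 0⟩, 12, [(⟨-4, 2⟩, 15)], ⟨1, 0⟩, 1⟩]⟩,
    ⟨⟨-1, -3⟩, ⟨-39, 0⟩, ⟨-4, 0⟩, ⟨-4, 3⟩, ⟨828, 2484⟩, ⟨⟨-1, 0⟩, 9, ⟨1, 0⟩, 1⟩, ⟨⟨0, 0⟩, 12, ⟨0, 0⟩, 1⟩,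
    [⟨⟨0, 0⟩, 5, [(⟨-1, 0⟩, 3), (⟨-1, 0⟩, 2)], ⟨-1, 1⟩, 0⟩,
      ⟨⟨0, 0⟩, 11, [(⟨-2, 0⟩, 10)], ⟨-3, 2⟩, 0⟩,
      ⟨⟨0, 1⟩, 0, [(⟨-1, 1⟩, 0), (⟨0, -1⟩, 12)], ⟨1, -1⟩, 0⟩,
      ⟨⟨0, 0⟩, 9, [(⟨-1, 0⟩, 12)], ⟨0, 0⟩, 1⟩]⟩,
    ⟨⟨0, -1⟩, ⟨-4, 0⟩, ⟨-4, 0⟩, ⟨-1, 1⟩, ⟨0, 828⟩, ⟨⟨-1, 0⟩, 14, ⟨1, 0⟩, 1⟩, ⟨⟨0, 0⟩, 13, ⟨0, 0⟩, 1⟩,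
    [⟨⟨0, 0⟩, 0, [(⟨0, 0⟩, 0), (⟨0, 0⟩, 13)], ⟨0, 0⟩, 0⟩,
      ⟨⟨0, 0⟩, 16, [(⟨-1, 0⟩, 15)], ⟨1, 0⟩, 0⟩,
      ⟨⟨0, 0⟩, 6, [(⟨-1, 0⟩, 7), (⟨-2, 0⟩, 1)], ⟨0, 0⟩, 0⟩,
      ⟨⟨-1, 0⟩, 14, [(⟨0, 0⟩, 13)], ⟨-1, 0⟩, 1⟩]⟩,
    ⟨⟨-3, -1⟩, ⟨-7, 0⟩, ⟨-4, 0⟩, ⟨-4, 1⟩, ⟨2484, 828⟩, ⟨⟨-1, 0⟩, 13, ⟨1, 0⟩, 1⟩, ⟨⟨0, 0⟩, 14, ⟨0, 0⟩, 1⟩,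
    [⟨⟨1, 0⟩, 0, [(⟨-1, 0⟩, 0), (⟨-1, 0⟩, 14)], ⟨1, 0⟩, 0⟩,
      ⟨⟨1, 0⟩, 13, [(⟨-2, 0⟩, 14)], ⟨1, 0⟩, 0⟩,
      ⟨⟨0, 0⟩, 7, [(⟨-1, 0⟩, 6), (⟨-1, 0⟩, 2)], ⟨-1, 0⟩, 0⟩,
      ⟨⟨0, 0⟩, 15, [(⟨-1, 0⟩, 16)], ⟨-1, 0⟩, 1⟩]⟩,
    ⟨⟨-2, -1⟩, ⟨-17, 0⟩, ⟨-4, 0⟩, ⟨-9, 3⟩, ⟨1656, 828⟩, ⟨⟨-3, 0⟩, 10, ⟨1, 0⟩, 1⟩, ⟨⟨0, 0⟩, 15, ⟨0, 0⟩, 1⟩,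
    [⟨⟨0, 0⟩, 24, [(⟨-2, 0⟩, 3)], ⟨1, 0⟩, 0⟩,
      ⟨⟨1, 0⟩, 0, [(⟨-3, 0⟩, 4), (⟨-2, 0⟩, 11)], ⟨4, -2⟩, 0⟩,
      ⟨⟨0, 0⟩, 14, [(⟨-3, 0⟩, 11)], ⟨3, -2⟩, 0⟩,
      ⟨⟨0, 0⟩, 7, [(⟨-3, 0⟩, 20)], ⟨-3, 0⟩, 0⟩,
      ⟨⟨0, 0⟩, 8, [(⟨-2, 1⟩, 0), (⟨0, -1⟩, 11)], ⟨3, -2⟩, 0⟩,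
      ⟨⟨0, 0⟩, 16, [(⟨-2, 0⟩, 9)], ⟨-1, 0⟩, 1⟩]⟩,
    ⟨⟨-1, -1⟩, ⟨-14, 0⟩, ⟨-4, 0⟩, ⟨-6, 3⟩, ⟨828, 828⟩, ⟨⟨-2, 0⟩, 11, ⟨4, -2⟩, 1⟩, ⟨⟨0, 0⟩, 16, ⟨0, 0⟩, 1⟩,
    [⟨⟨0, 0⟩, 0, [(⟨-2, 0⟩, 4), (⟨-2, 0⟩, 10)], ⟨0, 0⟩, 0⟩,
      ⟨⟨0, 0⟩, 17, [(⟨-2, 0⟩, 5)], ⟨3, -1⟩, 0⟩,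
      ⟨⟨0, 0⟩, 15, [(⟨-2, 0⟩, 12)], ⟨-1, 0⟩, 0⟩,
      ⟨⟨0, 0⟩, 8, [(⟨-2, 1⟩, 0), (⟨-1, -1⟩, 10)], ⟨0, 0⟩, 0⟩,
      ⟨⟨0, 0⟩, 6, [(⟨-2, 0⟩, 21)], ⟨-7, 1⟩, 0⟩,
      ⟨⟨0, 0⟩, 13, [(⟨-2, 0⟩, 10)], ⟨0, 0⟩, 1⟩]⟩,
    ⟨⟨3, -1⟩, ⟨-9, 0⟩, ⟨-2, -1⟩, ⟨-5, 2⟩, ⟨1152, 720⟩, ⟨⟨0, 0⟩, 18, ⟨0, 0⟩, 1⟩, ⟨⟨0, 0⟩, 17, ⟨0, 0⟩, 1⟩,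
    [⟨⟨0, 0⟩, 0, [(⟨0, 0⟩, 23)], ⟨-1, 0⟩, 1⟩,
      ⟨⟨0, 0⟩, 24, [(⟨1, 0⟩, 1)], ⟨1, 0⟩, 1⟩,
      ⟨⟨0, 0⟩, 16, [(⟨1, 0⟩, 6)], ⟨-1, 0⟩, 1⟩]⟩,
    ⟨⟨5, -2⟩, ⟨-9, 0⟩, ⟨-2, -1⟩, ⟨-3, 1⟩, ⟨2736, 1296⟩, ⟨⟨0, 0⟩, 17, ⟨0, 0⟩, 1⟩, ⟨⟨0, 0⟩, 18, ⟨0, 0⟩, 1⟩,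
    [⟨⟨1, 0⟩, 6, [(⟨0, 0⟩, 16)], ⟨1, 0⟩, 0⟩,
      ⟨⟨1, 0⟩, 1, [(⟨0, 0⟩, 24)], ⟨-1, 0⟩, 0⟩,
      ⟨⟨0, 0⟩, 23, [(⟨0, 0⟩, 0)], ⟨1, 0⟩, 0⟩]⟩,
    ⟨⟨10, -2⟩, ⟨-53, -1⟩, ⟨-2, -1⟩, ⟨-8, 5⟩, ⟨576, 2016⟩, ⟨⟨2, 0⟩, 20, ⟨-1, 0⟩, 1⟩, ⟨⟨0, 0⟩, 19, ⟨0, 0⟩, 1⟩,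
    [⟨⟨0, 0⟩, 1, [(⟨2, 0⟩, 21)], ⟨-7, 1⟩, 1⟩,
      ⟨⟨0, 0⟩, 22, [(⟨3, 1⟩, 0)], ⟨2, 0⟩, 1⟩,
      ⟨⟨0, 0⟩, 3, [(⟨2, 0⟩, 10)], ⟨0, 0⟩, 1⟩]⟩,
    ⟨⟨12, -3⟩, ⟨-45, -2⟩, ⟨-2, -1⟩, ⟨-8, 3⟩, ⟨2160, 2592⟩, ⟨⟨1, 0⟩, 19, ⟨-2, 0⟩, 1⟩, ⟨⟨0, 0⟩, 20, ⟨0, 0⟩, 1⟩,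
    [⟨⟨0, 0⟩, 10, [(⟨1, 0⟩, 3)], ⟨0, 0⟩, 0⟩,
      ⟨⟨1, 1⟩, 0, [(⟨1, 0⟩, 22)], ⟨-2, 0⟩, 0⟩,
      ⟨⟨0, 0⟩, 21, [(⟨1, 0⟩, 1)], ⟨7, -1⟩, 0⟩]⟩,
    ⟨⟨15, 1⟩, ⟨-100, 0⟩, ⟨3, -1⟩, ⟨-12, 7⟩, ⟨1872, 2592⟩, ⟨⟨6, -1⟩, 22, ⟨-2, 1⟩, 1⟩, ⟨⟨0, 0⟩, 21, ⟨0, 0⟩, 1⟩,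
    [⟨⟨0, 0⟩, 11, [(⟨6, -1⟩, 5)], ⟨-2, 1⟩, 0⟩,
      ⟨⟨0, 0⟩, 20, [(⟨6, -1⟩, 2)], ⟨2, 0⟩, 1⟩,
      ⟨⟨0, 1⟩, 0, [(⟨6, -1⟩, 19)], ⟨-3, -1⟩, 1⟩]⟩,
    ⟨⟨11, 1⟩, ⟨-32, 0⟩, ⟨3, -1⟩, ⟨-4, 3⟩, ⟨720, 2016⟩, ⟨⟨2, -1⟩, 21, ⟨-6, 1⟩, 1⟩, ⟨⟨0, 0⟩, 22, ⟨0, 0⟩, 1⟩,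
    [⟨⟨0, 0⟩, 2, [(⟨2, -1⟩, 20)], ⟨-2, 0⟩, 0⟩,
      ⟨⟨0, 0⟩, 5, [(⟨2, -1⟩, 11)], ⟨2, -1⟩, 1⟩,
      ⟨⟨0, 0⟩, 19, [(⟨2, 0⟩, 0)], ⟨3, 1⟩, 0⟩]⟩,
    ⟨⟨9, 0⟩, ⟨-4, -2⟩, ⟨3, -1⟩, ⟨-5, 0⟩, ⟨2592, 1296⟩, ⟨⟨0, 0⟩, 24, ⟨0, 0⟩, 1⟩, ⟨⟨0, 0⟩, 23, ⟨0, 0⟩, 1⟩,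
    [⟨⟨0, 0⟩, 7, [(⟨0, 0⟩, 15)], ⟨0, 0⟩, 0⟩,
      ⟨⟨0, 0⟩, 18, [(⟨1, 0⟩, 0)], ⟨0, 0⟩, 1⟩,
      ⟨⟨0, 0⟩, 2, [(⟨0, 0⟩, 17)], ⟨-2, 0⟩, 1⟩]⟩,
    ⟨⟨5, 0⟩, ⟨-4, -2⟩, ⟨3, -1⟩, ⟨-9, 0⟩, ⟨1440, 720⟩, ⟨⟨0, 0⟩, 23, ⟨0, 0⟩, 1⟩, ⟨⟨0, 0⟩, 24, ⟨0, 0⟩, 1⟩,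
    [⟨⟨1, 0⟩, 0, [(⟨0, 0⟩, 18)], ⟨0, 0⟩, 0⟩,
      ⟨⟨0, 0⟩, 15, [(⟨0, 0⟩, 7)], ⟨0, 0⟩, 1⟩,
      ⟨⟨0, 0⟩, 17, [(⟨0, 0⟩, 2)], ⟨2, 0⟩, 0⟩]⟩]
  L := 3312
  M := 1000000
  B := 3312
  Q := 1024
  cov := .cy 512 (.cy 256 (.cy 128 (.cx 512 (.leaf 0 0 0) (.leaf 0 1 0)) (.cx 512 (.cy 192 (.leaf 0 0 0) (.cx
    256 (.cy 224 (.leaf 0 0 0) (.cx 128 (.leaf 13 0 0) (.leaf 16 0 0))) (.cy 224 (.leaf 17 0 0) (.cx 384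
    (.leaf 16 0 0) (.leaf 15 0 0))))) (.cy 192 (.leaf 0 1 0) (.cx 768 (.cy 224 (.leaf 0 1 0) (.cx 640 (.leaf
    15 0 0) (.leaf 14 0 0))) (.cy 224 (.leaf 0 1 0) (.cx 896 (.leaf 14 0 0) (.leaf 13 1 0))))))) (.cy 384 (.cx
    512 (.cy 320 (.cx 256 (.cy 288 (.cx 128 (.leaf 13 0 0) (.leaf 16 0 0)) (.leaf 6 0 0)) (.cy 288 (.cx 384
    (.leaf 16 0 0) (.leaf 15 0 0)) (.leaf 8 0 0))) (.cx 256 (.leaf 6 0 0) (.leaf 8 0 0))) (.cy 320 (.cx 768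
    (.cy 288 (.cx 640 (.leaf 15 0 0) (.leaf 14 0 0)) (.leaf 7 0 0)) (.cy 288 (.cx 896 (.leaf 14 0 0) (.leaf 13
    1 0)) (.cx 896 (.leaf 7 0 0) (.leaf 6 1 0)))) (.cx 768 (.leaf 7 0 0) (.leaf 6 1 0)))) (.cx 512 (.cy 448
    (.cx 256 (.cy 416 (.cx 128 (.cy 400 (.leaf 6 0 0) (.leaf 1 0 0)) (.cy 400 (.leaf 8 0 0) (.leaf 1 0 0)))
    (.leaf 1 0 0)) (.cy 416 (.cx 384 (.leaf 8 0 0) (.cy 400 (.leaf 8 0 0) (.leaf 2 0 0))) (.leaf 2 0 0))) (.cx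
    256 (.leaf 1 0 0) (.leaf 2 0 0))) (.cy 448 (.cx 768 (.cy 416 (.leaf 7 0 0) (.leaf 2 0 0)) (.cy 416 (.leaf
    18 0 0) (.leaf 1 1 0))) (.cx 768 (.leaf 2 0 0) (.leaf 1 1 0)))))) (.cy 768 (.cy 640 (.cx 512 (.cy 576 (.cx
    256 (.leaf 1 0 0) (.leaf 2 0 0)) (.cx 256 (.cy 608 (.leaf 1 0 0) (.leaf 19 0 0)) (.cy 608 (.leaf 2 0 0)
    (.leaf 5 0 0)))) (.cy 576 (.cx 768 (.leaf 2 0 0) (.leaf 1 1 0)) (.cx 768 (.cy 608 (.leaf 2 0 0) (.cx 640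
    (.cy 624 (.leaf 2 0 0) (.leaf 4 0 0)) (.leaf 4 0 0))) (.cy 608 (.leaf 1 1 0) (.cx 896 (.cy 624 (.leaf 1 1
    0) (.leaf 4 0 0)) (.cy 624 (.leaf 1 1 0) (.leaf 3 1 0))))))) (.cx 512 (.cy 704 (.cx 256 (.leaf 3 0 0)
    (.leaf 5 0 0)) (.cx 256 (.cy 736 (.cx 128 (.leaf 3 0 0) (.leaf 5 0 0)) (.cx 128 (.leaf 9 0 0) (.leaf 12 0
    0))) (.cy 736 (.leaf 5 0 0) (.cx 384 (.leaf 12 0 0) (.leaf 11 0 0))))) (.cy 704 (.cx 768 (.leaf 4 0 0)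
    (.leaf 3 1 0)) (.cx 768 (.cy 736 (.leaf 4 0 0) (.cx 640 (.leaf 11 0 0) (.leaf 10 0 0))) (.cy 736 (.leaf 3
    1 0) (.cx 896 (.leaf 10 0 0) (.leaf 9 1 0))))))) (.cy 896 (.cx 512 (.cy 832 (.cx 256 (.cy 800 (.cx 128
    (.leaf 9 0 0) (.leaf 12 0 0)) (.leaf 0 0 1)) (.cy 800 (.cx 384 (.leaf 12 0 0) (.leaf 11 0 0)) (.leaf 0 0
    1))) (.leaf 0 0 1)) (.cy 832 (.cx 768 (.cy 800 (.cx 640 (.leaf 11 0 0) (.leaf 10 0 0)) (.leaf 20 0 0))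
    (.cy 800 (.cx 896 (.leaf 10 0 0) (.leaf 9 1 0)) (.leaf 0 1 1))) (.leaf 0 1 1))) (.cx 512 (.leaf 0 0 1)
    (.leaf 0 1 1))))

lemma atlas67_ok : atlas67.ok = true := by decide +kernel

/-- The action of the generators on cosets for discriminant `-67`. -/
def action67 : List ℕ := [46554656868538934293434662287904998656, 14715725787088356399938216805593385216,
    20011376718272490338853433276725592320, 318244129672262132158517454992308700160,
    75989469251804625219516822111731778048, 56144381040318326961708558363683006208,
    286135455849738814716515186027559183360, 275791914359775002893572176695165203456,
    80802014413184505234311943084749518080, 167526321022256173576198454351315596800,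
    125240579915018093855177757385656362496, 199002659933032118627462356104143549184,
    33455145679668794718514513547894137344, 50786322399972884624676641886313722624,
    33455145679668794718514513547894137344, 77412674221849091646988344189784766208,
    54805221329827640929263641398406742528, 55978548266350665797799456246466152192,
    6828809081901786517617745885653566976, 50786322399972884624676641886313722624,
    111345771214155654682844301685612472064, 200315497413289599241895647434232214784,
    294266470559445907543468361278597426176, 203282396532765850163319855967541872128,
    325369236476440002987569564411609826048, 325369236476440002987569564411609826048,
    166799930200074454239880706809494954240, 166799930200074454239880706809494954240]

lemma action67_ok : tabOK (atlas67.geom atlas67_ok) action67 = true := by decide +kernel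

/-- A certificate for discriminant `-67`. -/
def cert67A : Cert where
  fr := [10, 21, 18, 19, 41, 310, 69, 121, 222, 89, 94, 209, 71, 199, 86, 53, 279, 308, 20, 153, 34, 35]
  sd := [37, 42, 47, 5, 15, 210, 87, 39, 317]
  W := [[0, 0, 0, 0, 0, 0, 0, 0, 0, 0, 0, 0, 0, 0, 0, 0, 0, 0, 0, 0, 0, 0], [0, 0, 0, 0, 0, 0, 0, 0, 0, 0, 0,
    0, 0, 0, 0, 0, 0, 0, 0, 0, 0, 0], [0, 0, 0, 0, 0, 0, 0, 0, 0, 0, 0, 0, 0, 0, 0, 0, 0, 0, 0, 0, 0, 0], [-5,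
    -1, 3, 0, -1, 1, 0, 0, 0, 0, -1, 1, 0, 0, 0, 0, 0, 0, 0, 0, 0, 0], [4, 1, -3, 0, 1, -1, 0, 0, 0, 0, 1, -1,
    0, 0, 0, 0, 0, 0, 0, 0, 0, 0], [6, 0, -2, -1, -1, -2, 1, 1, 0, 0, 1, -1, 0, 0, 0, 0, 0, 0, 0, 0, 0, 0],
    [20, 1, -10, -2, -2, -6, 2, 1, -2, 2, 4, -4, 0, 0, 0, 0, 0, 0, 0, 0, 0, 0], [14, 2, -8, -2, 0, -4, 1, 0,
    -1, 1, 3, -3, 0, 0, 0, 0, 0, 0, 0, 0, 0, 0], [27, 4, -17, -3, 3, -7, 2, 0, -2, 2, 6, -6, -1, 0, 0, 0, 0,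
    0, 0, 0, 0, 0]]
  ord := [(0, 1, 1), (30, 9, 0), (8, 13, 0), (2, 3, 1), (32, 7, 0), (6, 11, 0), (1, 2, 1), (31, 14, 0), (5, 6,
    1), (15, 17, 1), (45, 25, 0), (23, 29, 0), (16, 26, 0), (46, 30, 0), (20, 22, 1), (17, 31, 0), (47, 23,
    0), (21, 27, 0), (96, 45, 0), (95, 38, 0), (215, 46, 1), (100, 43, 0), (2195, 335, 0), (230, 429, 0),
    (2654, 415, 0), (2202, 330, 0), (237, 427, 0), (2649, 410, 0), (554, 79, 0), (331, 50, 0), (332, 51, 0),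
    (544, 405, 1), (2644, 422, 0), (235, 315, 1), (2200, 325, 0), (549, 74, 0), (330, 49, 0), (636, 149, 0),
    (2674, 278, 0), (1450, 203, 0), (878, 131, 0), (2255, 294, 1), (1568, 217, 0), (2060, 183, 0), (1356, 233,
    0), (1573, 299, 0), (1480, 107, 1), (760, 110, 0), (741, 129, 0), (883, 126, 0), (638, 154, 0), (2679,
    283, 0), (1052, 163, 1), (1232, 170, 0), (1452, 205, 0), (2065, 185, 0), (1358, 238, 0), (1401, 231, 1),
    (1363, 190, 0), (643, 159, 0), (2684, 285, 0), (1050, 161, 1), (1230, 175, 0), (1445, 198, 0), (1475, 102,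
    1), (755, 105, 0), (2067, 301, 1), (1482, 109, 1), (756, 103, 0), (743, 130, 0), (1051, 162, 1), (1231,
    165, 0), (876, 119, 0), (1566, 215, 0), (1560, 290, 0), (1036, 391, 0), (2161, 369, 0), (2391, 343, 0),
    (2346, 354, 0), (2406, 194, 0), (1441, 277, 0), (1561, 291, 0), (2177, 243, 1), (1772, 261, 0), (666, 55,
    1), (336, 73, 0), (426, 393, 0), (2162, 370, 0), (2393, 345, 0), (2348, 355, 0), (2408, 195, 0), (1442,
    282, 0), (343, 62, 0), (411, 57, 0), (338, 78, 0), (428, 398, 0), (433, 350, 1), (2353, 353, 0), (2413,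
    193, 0), (1440, 287, 0), (2176, 242, 1), (1771, 271, 0), (1845, 241, 0), (1770, 266, 0), (2175, 289, 0),
    (1562, 211, 0), (2160, 371, 0), (1446, 274, 0), (2187, 253, 1), (1782, 258, 0), (2056, 187, 0), (1360,
    225, 0), (1476, 298, 0), (1809, 250, 0), (1779, 267, 0), (1572, 221, 0), (1851, 247, 0), (1776, 265, 0),
    (2064, 191, 0), (1364, 237, 0), (1269, 275, 0), (1448, 201, 0), (2180, 246, 1), (1775, 259, 0), (2057,
    189, 0), (1362, 226, 0), (1396, 178, 0), (1351, 239, 0), (1478, 303, 0), (1805, 255, 0), (1784, 269, 0),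
    (1264, 293, 1), (1483, 206, 0), (1453, 273, 0), (2179, 245, 1), (1774, 262, 0), (1804, 251, 0), (1780,
    257, 0), (1565, 214, 0), (1570, 219, 0), (1849, 254, 0), (1783, 263, 0), (1850, 270, 1), (1778, 249, 0),
    (2055, 182, 0), (1355, 227, 0), (2059, 186, 0), (1359, 235, 0), (1395, 177, 0), (1350, 234, 0), (2069,
    181, 0), (1354, 230, 0), (1397, 179, 0), (1352, 229, 0), (635, 145, 0), (2025, 366, 0), (2428, 342, 0),
    (2670, 401, 0), (2640, 417, 0), (229, 309, 1), (2194, 321, 0), (1064, 143, 0), (204, 374, 1), (740, 133,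
    0), (1054, 91, 0), (640, 146, 0), (2026, 359, 0), (2421, 347, 0), (2671, 402, 0), (2641, 418, 0), (234,
    314, 1), (2199, 322, 0), (209, 379, 1), (745, 138, 0), (1059, 93, 0), (642, 147, 0), (2027, 361, 0),
    (2423, 349, 0), (2672, 403, 0), (2642, 419, 0), (239, 319, 1), (2204, 323, 0), (199, 381, 1), (875, 118,
    0), (880, 123, 0), (882, 125, 0), (2466, 395, 0), (2468, 397, 0), (2473, 390, 0), (334, 70, 0), (407, 67,
    1), (335, 54, 0), (542, 334, 0), (2192, 307, 0), (545, 406, 1), (2645, 421, 0), (2675, 150, 1), (639, 90,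
    0), (2409, 346, 0), (2349, 363, 0), (424, 341, 1), (2344, 358, 0), (2404, 85, 1), (634, 157, 0), (2682,
    413, 0), (2652, 431, 0), (552, 77, 0), (344, 63, 0), (406, 66, 1), (342, 61, 0), (541, 329, 0), (2191,
    306, 0), (425, 387, 0), (429, 58, 0), (339, 75, 0), (405, 65, 1), (340, 59, 0), (540, 327, 0), (2190, 305,
    0), (550, 411, 1), (2650, 426, 0), (2680, 155, 1), (644, 95, 0), (2414, 351, 0), (2354, 365, 0), (430,
    385, 0), (432, 386, 0), (2250, 139, 0), (872, 115, 0), (2251, 141, 0), (870, 113, 0), (2252, 134, 0),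
    (871, 114, 0), (2165, 377, 0), (2170, 382, 0), (2172, 375, 0), (1444, 197, 0), (2188, 302, 0), (1474, 101,
    1), (1564, 213, 0), (2061, 295, 1), (2181, 202, 0), (1449, 281, 0), (1479, 106, 1), (1569, 218, 0), (2063,
    297, 1), (2183, 207, 0), (1454, 286, 0), (1484, 111, 1), (1574, 223, 0), (2151, 167, 1), (2153, 169, 1),
    (396, 174, 0), (2193, 326, 0), (228, 36, 0), (90, 33, 0), (213, 4, 1), (225, 420, 0), (2646, 407, 0),
    (2399, 399, 1), (421, 338, 1), (2341, 356, 0), (2371, 372, 0), (633, 84, 0), (1058, 137, 0), (2403, 340,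
    0), (2343, 362, 0), (738, 100, 1), (750, 97, 0), (858, 116, 1), (1043, 388, 0), (2168, 383, 0), (91, 40,
    0), (217, 8, 1), (226, 424, 0), (2648, 409, 0), (2678, 280, 0), (232, 312, 1), (2197, 331, 0), (1443, 196,
    0), (1800, 248, 0), (1777, 260, 0), (2401, 82, 1), (631, 152, 0), (2677, 408, 0), (2647, 425, 0), (231,
    311, 1), (2196, 328, 0), (1055, 166, 1), (1102, 136, 0), (1057, 168, 1), (660, 81, 0), (630, 148, 0),
    (2673, 404, 0), (2643, 423, 0), (238, 318, 1), (2203, 324, 0), (543, 68, 0), (337, 56, 0), (1062, 173, 1),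
    (1098, 132, 0), (1053, 164, 1), (427, 344, 1), (2347, 367, 0), (2407, 88, 1), (637, 158, 0), (1063, 142,
    0), (742, 104, 1), (751, 98, 0), (1471, 292, 0), (862, 120, 1), (874, 117, 0), (1567, 216, 0), (383, 184,
    0), (1357, 228, 0), (1048, 392, 0), (2163, 376, 0), (2372, 339, 0), (2342, 360, 0), (2387, 24, 0), (422,
    389, 0), (879, 122, 0), (2173, 373, 0), (92, 44, 0), (221, 12, 1), (227, 428, 0), (2653, 414, 0), (2683,
    284, 0), (236, 316, 1), (2201, 333, 0), (1447, 200, 0), (1470, 300, 0), (1801, 252, 0), (1781, 264, 0),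
    (1802, 244, 0), (1773, 268, 0), (2402, 83, 1), (632, 156, 0), (2681, 412, 0), (2651, 430, 0), (233, 313,
    1), (2198, 332, 0), (547, 72, 0), (341, 60, 0), (408, 52, 0), (333, 76, 0), (1060, 171, 1), (1106, 140,
    0), (1061, 172, 1), (423, 396, 0), (431, 348, 1), (2351, 357, 0), (2411, 92, 1), (641, 151, 0), (2676,
    276, 0), (1056, 135, 0), (1451, 204, 0), (1481, 108, 1), (752, 99, 0), (1472, 296, 0), (2400, 337, 0),
    (2340, 364, 0), (866, 124, 1), (1571, 220, 0), (2058, 188, 0), (1361, 232, 0), (1398, 180, 0), (1353, 236,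
    0), (2167, 380, 0), (2385, 28, 0), (420, 394, 0), (884, 127, 0), (1563, 212, 0), (2166, 378, 0)]
  ex := [94, 99, 661, 216, 151, 553, 1282, 744, 399]
  Y := [[1, 0, 0, 0, 0, 0, 0, 0, 0], [0, 1, 0, 0, 0, 0, 0, 0, 0], [1, 1, -2, 0, 0, 0, 0, 0, 0], [0, 0, 2, 1,
    -2, 0, 0, 0, 0], [0, 0, -2, -2, 2, 0, 0, 0, 0], [2, 2, -2, -3, 2, 2, 0, 0, 0], [-2, 2, -2, -6, 4, 6, 2, 4,
    0], [-2, 0, -4, -4, 4, 2, 0, 2, 0], [2, 2, -8, -11, 10, 4, 2, 2, -2]]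
  DY := 2

lemma cert67A_ok : certOK (atlas67.geom atlas67_ok) action67 (0, 0) (0, 0) cert67A = true := by
  decide +kernel

/-- A certificate for discriminant `-67`. -/
def cert67B : Cert where
  fr := [69, 121, 94, 209, 199, 47, 86, 53, 308, 20, 153, 34, 35]
  sd := [10, 15, 18, 19, 5, 21, 37, 42, 41, 310, 71, 89, 87, 210, 317, 39, 279, 222]
  W := [[0, 0, 0, 0, 0, 0, 0, 0, 0, 0, 0, 0, 0], [0, 0, 0, 0, 0, 0, 0, 0, 0, 0, 0, 0, 0], [0, 0, 0, 0, 0, 0,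
    0, 0, 0, 0, 0, 0, 0], [0, 0, 0, 0, 0, 0, 0, 0, 0, 0, 0, 0, 0], [0, 0, 0, 0, 0, 0, 0, 0, 0, 0, 0, 0, 0],
    [0, 0, 0, 0, 0, 0, 0, 0, 0, 0, 0, 0, 0], [0, 0, 0, 0, 0, 0, 0, 0, 0, 0, 0, 0, 0], [0, 0, 0, 0, 0, -1, 0,
    0, 0, 0, 0, 0, 0], [0, 0, 1, 1, 0, 0, -1, -1, 0, 0, 0, 0, 0], [0, 0, 0, 0, 0, 0, -1, -1, 0, 0, 0, 0, 0],
    [0, 0, 0, 0, 0, 0, 0, 0, 0, 0, 0, 0, 0], [0, 1, 0, 0, 0, 0, 0, 0, 0, 0, 0, 0, 0], [0, -1, 0, 0, 0, 0, 0,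
    0, 0, 0, 0, 0, 0], [1, -1, 0, 0, 0, 0, -1, -1, 0, 0, 0, 0, 0], [0, 0, 1, 1, 0, 0, 0, 0, 0, 0, 0, 0, 0],
    [0, 0, -1, -1, 0, 0, 1, 1, 0, 0, 0, 0, 0], [0, 0, -1, -1, 0, 0, 0, 0, 0, 0, 0, 0, 0], [-1, 1, 0, 0, 0, 0,
    1, 1, 0, 0, 0, 0, 0]]
  ord := [(0, 1, 1), (30, 9, 0), (8, 13, 0), (2, 3, 1), (32, 7, 0), (6, 11, 0), (1, 2, 1), (31, 14, 0), (5, 6,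
    1), (15, 17, 1), (45, 25, 0), (23, 29, 0), (16, 26, 0), (46, 30, 0), (20, 22, 1), (17, 31, 0), (47, 23,
    0), (21, 27, 0), (96, 45, 0), (95, 38, 0), (215, 46, 0), (100, 43, 0), (2195, 335, 0), (230, 429, 1),
    (2654, 415, 0), (2202, 330, 1), (237, 427, 1), (2649, 410, 0), (554, 79, 0), (331, 50, 0), (332, 51, 0),
    (544, 405, 1), (2644, 422, 1), (235, 315, 1), (2200, 325, 1), (549, 74, 0), (330, 49, 0), (636, 149, 0),
    (2674, 278, 1), (1450, 203, 0), (878, 131, 0), (2255, 294, 1), (1568, 217, 0), (2060, 183, 1), (1356, 233,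
    0), (1573, 299, 0), (1480, 107, 1), (760, 110, 0), (741, 129, 0), (883, 126, 0), (638, 154, 1), (2679,
    283, 0), (1052, 163, 1), (1232, 170, 1), (1452, 205, 0), (2065, 185, 1), (1358, 238, 1), (1401, 231, 1),
    (1363, 190, 0), (643, 159, 1), (2684, 285, 1), (1050, 161, 1), (1230, 175, 0), (1445, 198, 0), (1475, 102,
    1), (755, 105, 1), (2067, 301, 1), (1482, 109, 1), (756, 103, 0), (743, 130, 0), (1051, 162, 1), (1231,
    165, 1), (876, 119, 0), (1566, 215, 0), (1560, 290, 1), (1036, 391, 1), (2161, 369, 1), (2391, 343, 0),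
    (2346, 354, 1), (2406, 194, 1), (1441, 277, 1), (1561, 291, 1), (2177, 243, 1), (1772, 261, 0), (666, 55,
    1), (336, 73, 0), (426, 393, 0), (2162, 370, 1), (2393, 345, 0), (2348, 355, 0), (2408, 195, 0), (1442,
    282, 1), (343, 62, 0), (411, 57, 0), (338, 78, 1), (428, 398, 1), (433, 350, 1), (2353, 353, 1), (2413,
    193, 1), (1440, 287, 0), (2176, 242, 1), (1771, 271, 1), (1845, 241, 0), (1770, 266, 1), (2175, 289, 0),
    (1562, 211, 0), (2160, 371, 0), (1446, 274, 1), (2187, 253, 1), (1782, 258, 0), (2056, 187, 1), (1360,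
    225, 0), (1476, 298, 0), (1809, 250, 0), (1779, 267, 0), (1572, 221, 0), (1851, 247, 0), (261, 265, 0),
    (2064, 191, 1), (1364, 237, 0), (1269, 275, 1), (1448, 201, 0), (2180, 246, 1), (1775, 259, 1), (2057,
    189, 0), (1362, 226, 1), (1396, 178, 0), (1351, 239, 1), (1478, 303, 1), (1805, 255, 0), (1784, 269, 1),
    (1565, 214, 0), (1850, 270, 1), (263, 249, 1), (2069, 181, 0), (1354, 230, 0), (1264, 293, 1), (1483, 206,
    0), (1453, 273, 1), (2179, 245, 1), (1774, 262, 1), (1804, 251, 1), (1780, 257, 1), (1570, 219, 0), (1849,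
    254, 0), (1783, 263, 1), (2055, 182, 1), (1355, 227, 1), (1397, 179, 0), (1352, 229, 1), (2059, 186, 1),
    (1359, 235, 0), (1395, 177, 0), (1350, 234, 0), (635, 145, 0), (2670, 401, 0), (2640, 417, 1), (229, 309,
    1), (2194, 321, 1), (1064, 143, 0), (1140, 342, 0), (2428, 366, 0), (204, 374, 1), (740, 133, 0), (1054,
    91, 0), (640, 146, 1), (2026, 359, 1), (2421, 347, 0), (2671, 402, 0), (2641, 418, 0), (234, 314, 1),
    (2199, 322, 1), (209, 379, 0), (745, 138, 1), (1059, 93, 0), (642, 147, 1), (2672, 403, 0), (2642, 419,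
    1), (239, 319, 1), (2204, 323, 0), (1142, 349, 1), (2423, 361, 0), (199, 381, 0), (875, 118, 0), (880,
    123, 0), (882, 125, 0), (2466, 395, 0), (1044, 397, 0), (1049, 390, 0), (334, 70, 0), (407, 67, 1), (335,
    54, 0), (542, 334, 0), (2192, 307, 0), (545, 406, 1), (2645, 421, 1), (2675, 150, 1), (639, 90, 0), (2409,
    346, 0), (2349, 363, 0), (424, 341, 1), (2344, 358, 0), (2404, 85, 1), (634, 157, 1), (2682, 413, 0),
    (2652, 431, 1), (552, 77, 0), (344, 63, 0), (406, 66, 1), (342, 61, 0), (541, 329, 0), (2191, 306, 0),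
    (425, 387, 0), (429, 58, 0), (339, 75, 1), (405, 65, 1), (340, 59, 0), (540, 327, 0), (2190, 305, 0),
    (550, 411, 1), (2650, 426, 0), (2680, 155, 1), (644, 95, 0), (2414, 351, 0), (2354, 365, 0), (430, 385,
    0), (432, 386, 0), (2250, 139, 1), (872, 115, 0), (2251, 141, 0), (870, 113, 0), (2252, 134, 1), (871,
    114, 0), (2165, 377, 1), (2170, 382, 0), (2172, 375, 1), (1444, 197, 0), (2188, 302, 0), (1474, 101, 1),
    (1564, 213, 0), (2061, 295, 1), (2181, 202, 0), (1449, 281, 1), (1479, 106, 1), (1569, 218, 0), (2063,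
    297, 1), (2183, 207, 1), (1454, 286, 1), (1484, 111, 1), (1574, 223, 0), (1519, 167, 0), (1529, 174, 1),
    (398, 169, 1), (2193, 326, 1), (228, 36, 0), (90, 33, 0), (213, 4, 1), (225, 420, 0), (2646, 407, 0),
    (2399, 399, 1), (421, 338, 1), (2341, 356, 0), (2371, 372, 0), (633, 84, 0), (1058, 137, 0), (2403, 340,
    0), (2343, 362, 1), (738, 100, 1), (750, 97, 0), (858, 116, 1), (1043, 388, 0), (2168, 383, 1), (91, 40,
    0), (219, 8, 0), (226, 424, 0), (2648, 409, 0), (2678, 280, 0), (232, 312, 1), (2197, 331, 1), (1443, 196,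
    0), (1800, 248, 0), (1777, 260, 0), (2401, 82, 1), (631, 152, 0), (2677, 408, 0), (2647, 425, 0), (231,
    311, 1), (2196, 328, 0), (1055, 166, 1), (1102, 136, 0), (1057, 168, 1), (660, 81, 0), (630, 148, 1),
    (2673, 404, 0), (2643, 423, 1), (238, 318, 1), (2203, 324, 0), (543, 68, 0), (337, 56, 0), (1062, 173, 1),
    (1098, 132, 0), (1053, 164, 1), (427, 344, 1), (2347, 367, 0), (2407, 88, 1), (637, 158, 1), (1063, 142,
    0), (742, 104, 1), (751, 98, 0), (1471, 292, 1), (862, 120, 1), (874, 117, 0), (1567, 216, 0), (383, 184,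
    0), (1357, 228, 0), (1048, 392, 0), (2163, 376, 0), (2372, 339, 0), (2342, 360, 1), (2387, 24, 1), (422,
    389, 0), (879, 122, 0), (2173, 373, 1), (92, 44, 0), (224, 12, 0), (227, 428, 0), (2653, 414, 0), (2683,
    284, 1), (236, 316, 1), (2201, 333, 0), (1447, 200, 0), (1470, 300, 1), (1801, 252, 0), (1781, 264, 0),
    (1802, 244, 0), (1773, 268, 0), (2402, 83, 1), (632, 156, 1), (2681, 412, 0), (2651, 430, 1), (233, 313,
    1), (2198, 332, 0), (547, 72, 0), (341, 60, 0), (408, 52, 0), (333, 76, 1), (1060, 171, 1), (1106, 140,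
    0), (1061, 172, 1), (423, 396, 1), (431, 348, 1), (2351, 357, 1), (2411, 92, 1), (641, 151, 1), (2676,
    276, 1), (1056, 135, 0), (1451, 204, 0), (1481, 108, 1), (752, 99, 0), (1472, 296, 0), (2400, 337, 0),
    (2340, 364, 1), (866, 124, 1), (1571, 220, 0), (2058, 188, 0), (1361, 232, 0), (1398, 180, 0), (1353, 236,
    0), (2167, 380, 0), (2385, 28, 1), (420, 394, 1), (884, 127, 0), (1563, 212, 0), (2166, 378, 0)]
  ex := [9, 10, 24, 25, 38, 53, 94, 468, 218, 804, 190, 440, 399, 674, 2483, 568, 570, 393]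
  Y := [[-2, 0, 0, 0, 0, 0, 0, 0, 0, 0, 0, 0, 0, 0, 0, 0, 0, 0], [0, -2, 0, 0, 0, 0, 0, 0, 0, 0, 0, 0, 0, 0,
    0, 0, 0, 0], [0, 0, -2, 0, 0, 0, 0, 0, 0, 0, 0, 0, 0, 0, 0, 0, 0, 0], [0, 0, 0, -2, 0, 0, 0, 0, 0, 0, 0,
    0, 0, 0, 0, 0, 0, 0], [0, 0, 0, 0, -2, 0, 0, 0, 0, 0, 0, 0, 0, 0, 0, 0, 0, 0], [0, 0, 0, 0, 0, -2, 0, 0,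
    0, 0, 0, 0, 0, 0, 0, 0, 0, 0], [0, 0, 0, 0, 0, 0, 2, 0, 0, 0, 0, 0, 0, 0, 0, 0, 0, 0], [0, 0, 0, 0, -4, 0,
    -2, 4, 0, 0, 0, 0, 0, 0, 0, 0, 0, 0], [16, -12, 3, 6, -3, 2, 1, 2, -2, -1, 1, 1, 2, 2, -1, 0, -1, -1], [8,
    -34, -7, -8, -1, 0, 3, -4, 4, 3, -1, -5, -6, 2, -3, 0, 1, 1], [4, 2, -1, -1, 4, 0, 2, -1, 1, -1, -2, 0, 0,
    0, 0, 0, 0, 0], [2, -21, -3, -3, 3, 0, 1, 1, 2, -2, -1, 2, 0, 0, 0, 0, 0, 0], [-30, 36, 12, 10, -10, 2,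
    -4, -2, -6, 8, 6, -8, -4, 2, 2, 2, -2, -2], [-34, 18, 13, 16, -7, 2, -5, -2, -6, 9, 7, -9, -6, 2, 1, 4,
    -3, -3], [8, 12, 9, 13, -6, 2, -2, 7, -5, -5, 2, 6, 8, 0, 2, 0, -2, -2], [-16, 10, -3, -6, 3, -2, -1, -2,
    4, 1, -1, -1, -2, -2, 1, 0, 1, 1], [-23, 55, 7, 5, -7, 0, -4, -1, -2, 4, 3, -3, -2, -1, 2, 1, -2, 0], [0,
    15, -2, -9, 4, -2, 0, 3, 4, -7, -4, 7, 6, -4, 1, -2, 1, 1]]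
  DY := 4

lemma cert67B_ok : certOK (atlas67.geom atlas67_ok) action67 (0, 1) (0, 0) cert67B = true := by
  decide +kernel

/-- A certificate for discriminant `-67`. -/
def cert67C : Cert where
  fr := [310, 317, 69, 222, 209, 86, 279, 308]
  sd := [10, 15, 18, 19, 5, 20, 21, 37, 42, 47, 34, 35, 41, 121, 89, 71, 87, 210, 94, 153, 53, 39, 199]
  W := [[0, 0, 0, 0, 0, 0, 0, 0], [0, 0, 0, 0, 0, 0, 0, 0], [0, 0, 0, 0, 0, 0, 0, 0], [0, 0, 0, 0, 0, 0, 0,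
    0], [0, 0, 0, 0, 0, 0, 0, 0], [0, 0, 0, 0, 0, 0, 0, 0], [0, 0, 0, 0, 0, 0, 0, 0], [0, 0, 0, 0, 0, 0, 0,
    0], [0, 0, 0, 0, 0, 0, 0, 0], [0, 0, 0, 0, 0, 0, 0, 0], [0, 0, 0, 0, 0, 0, 0, 0], [0, 0, 0, 0, 0, 0, 0,
    0], [-1, 1, 0, 0, 0, 0, 0, 0], [-1, 0, 1, -1, 0, 0, 0, 0], [-1, 0, 1, -1, 0, 0, 0, 0], [0, 0, 0, 0, 0, 0,
    0, 0], [-1, 0, 1, -1, 0, 0, 0, 0], [0, 0, 0, -1, 0, 0, 0, 0], [0, 1, 0, 0, -1, 0, 0, 0], [0, 0, 0, 0, 0,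
    0, 0, 0], [0, 0, 0, 0, 0, 0, 0, 1], [-1, 1, 0, 0, 0, 0, 0, 0], [1, -1, -1, 1, 1, 1, 0, 0]]
  ord := [(0, 1, 1), (30, 9, 0), (8, 13, 0), (2, 3, 1), (32, 7, 0), (6, 11, 0), (1, 2, 1), (31, 14, 0), (5, 6,
    1), (15, 17, 1), (45, 25, 0), (23, 29, 0), (16, 26, 0), (46, 30, 0), (20, 22, 1), (17, 31, 0), (47, 23,
    0), (21, 27, 0), (96, 45, 1), (95, 38, 0), (215, 46, 0), (100, 43, 0), (2195, 335, 1), (230, 429, 0),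
    (2654, 415, 0), (2202, 330, 1), (237, 427, 0), (2649, 410, 0), (554, 79, 0), (331, 50, 0), (332, 51, 0),
    (544, 405, 1), (2644, 422, 0), (235, 315, 1), (2200, 325, 0), (549, 74, 0), (330, 49, 0), (636, 149, 1),
    (2674, 278, 0), (1450, 203, 0), (878, 131, 1), (2255, 294, 1), (1568, 217, 0), (2060, 183, 1), (1356, 233,
    0), (1573, 299, 0), (1480, 107, 1), (760, 110, 0), (741, 129, 1), (883, 126, 0), (638, 154, 0), (2679,
    283, 1), (1052, 163, 1), (1232, 170, 1), (1452, 205, 0), (2065, 185, 1), (1358, 238, 1), (1401, 231, 1),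
    (1363, 190, 0), (643, 159, 1), (2684, 285, 1), (1050, 161, 1), (1230, 175, 1), (1445, 198, 0), (1475, 102,
    1), (755, 105, 0), (2067, 301, 1), (1482, 109, 1), (756, 103, 0), (743, 130, 1), (1051, 162, 1), (1231,
    165, 0), (876, 119, 0), (1566, 215, 0), (1560, 290, 1), (1036, 391, 1), (2161, 369, 1), (2391, 343, 0),
    (2346, 354, 0), (2406, 194, 0), (1441, 277, 1), (1561, 291, 1), (2177, 243, 1), (1772, 261, 0), (666, 55,
    1), (336, 73, 0), (426, 393, 0), (2162, 370, 1), (2393, 345, 0), (2348, 355, 1), (2408, 195, 1), (1442,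
    282, 1), (343, 62, 0), (411, 57, 0), (338, 78, 1), (428, 398, 1), (433, 350, 1), (2353, 353, 1), (2413,
    193, 1), (1440, 287, 0), (2176, 242, 1), (1771, 271, 1), (1845, 241, 0), (1770, 266, 1), (2175, 289, 0),
    (1562, 211, 0), (2160, 371, 0), (1446, 274, 1), (2187, 253, 1), (1782, 258, 0), (2056, 187, 1), (1360,
    225, 0), (1476, 298, 1), (1809, 250, 0), (1779, 267, 0), (1572, 221, 0), (1851, 247, 0), (1776, 265, 1),
    (2064, 191, 1), (1364, 237, 0), (1269, 275, 1), (1448, 201, 0), (2180, 246, 1), (1775, 259, 1), (2057,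
    189, 0), (1362, 226, 1), (1396, 178, 0), (1351, 239, 1), (1478, 303, 0), (1805, 255, 1), (1784, 269, 1),
    (1264, 293, 1), (1483, 206, 0), (1453, 273, 1), (2179, 245, 1), (1774, 262, 1), (1804, 251, 1), (1780,
    257, 1), (1565, 214, 0), (1570, 219, 0), (1849, 254, 0), (1783, 263, 1), (1850, 270, 1), (1778, 249, 0),
    (2055, 182, 1), (1355, 227, 1), (2059, 186, 1), (1359, 235, 0), (1395, 177, 0), (1350, 234, 0), (2069,
    181, 0), (1354, 230, 0), (1397, 179, 0), (1352, 229, 1), (635, 145, 1), (2025, 366, 1), (2428, 342, 0),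
    (2670, 401, 0), (2640, 417, 0), (229, 309, 1), (2194, 321, 0), (1064, 143, 0), (204, 374, 1), (740, 133,
    1), (1054, 91, 1), (640, 146, 1), (2026, 359, 1), (2421, 347, 0), (2671, 402, 0), (2641, 418, 0), (234,
    314, 1), (2199, 322, 0), (209, 379, 0), (745, 138, 1), (1059, 93, 1), (642, 147, 0), (2027, 361, 0),
    (2423, 349, 0), (2672, 403, 0), (2642, 419, 0), (239, 319, 1), (2204, 323, 0), (199, 381, 0), (875, 118,
    0), (880, 123, 0), (882, 125, 0), (2466, 395, 0), (2468, 397, 0), (2473, 390, 0), (334, 70, 0), (407, 67,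
    1), (335, 54, 0), (542, 334, 0), (2192, 307, 0), (545, 406, 1), (2645, 421, 0), (2675, 150, 1), (639, 90,
    0), (2409, 346, 0), (2349, 363, 1), (424, 341, 1), (2344, 358, 0), (2404, 85, 1), (634, 157, 1), (2682,
    413, 0), (2652, 431, 1), (552, 77, 0), (344, 63, 0), (406, 66, 1), (342, 61, 0), (541, 329, 0), (2191,
    306, 0), (425, 387, 0), (429, 58, 0), (339, 75, 1), (405, 65, 1), (340, 59, 0), (540, 327, 0), (2190, 305,
    0), (550, 411, 1), (2650, 426, 1), (2680, 155, 1), (644, 95, 0), (2414, 351, 0), (2354, 365, 1), (430,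
    385, 0), (432, 386, 0), (2250, 139, 0), (872, 115, 0), (2251, 141, 0), (870, 113, 0), (2252, 134, 0),
    (871, 114, 0), (2165, 377, 1), (2170, 382, 0), (2172, 375, 1), (1444, 197, 0), (2188, 302, 0), (1474, 101,
    1), (1564, 213, 0), (2061, 295, 1), (2181, 202, 0), (1449, 281, 1), (1479, 106, 1), (1569, 218, 0), (2063,
    297, 1), (2183, 207, 1), (1454, 286, 1), (1484, 111, 1), (1574, 223, 0), (2151, 167, 1), (2153, 169, 1),
    (396, 174, 1), (2193, 326, 0), (228, 36, 0), (90, 33, 0), (213, 4, 1), (225, 420, 0), (2646, 407, 0),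
    (2399, 399, 1), (421, 338, 1), (2341, 356, 0), (2371, 372, 0), (633, 84, 0), (1058, 137, 0), (2403, 340,
    0), (2343, 362, 1), (738, 100, 1), (750, 97, 0), (858, 116, 1), (1043, 388, 0), (2168, 383, 1), (91, 40,
    0), (217, 8, 1), (226, 424, 1), (2648, 409, 0), (2678, 280, 1), (232, 312, 1), (2197, 331, 0), (1443, 196,
    0), (1800, 248, 0), (1777, 260, 0), (2401, 82, 1), (631, 152, 1), (2677, 408, 0), (2647, 425, 1), (231,
    311, 1), (2196, 328, 0), (1055, 166, 1), (1235, 168, 0), (1057, 136, 0), (660, 81, 0), (630, 148, 0),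
    (2673, 404, 0), (2643, 423, 0), (238, 318, 1), (2203, 324, 1), (543, 68, 0), (337, 56, 0), (1062, 173, 1),
    (1098, 132, 0), (1053, 164, 1), (427, 344, 1), (2347, 367, 0), (2407, 88, 1), (637, 158, 1), (1063, 142,
    0), (742, 104, 0), (751, 98, 0), (1471, 292, 1), (862, 120, 1), (874, 117, 0), (1567, 216, 0), (383, 184,
    0), (1357, 228, 0), (1048, 392, 1), (2163, 376, 0), (2372, 339, 0), (2342, 360, 0), (2387, 24, 0), (422,
    389, 0), (879, 122, 0), (2173, 373, 1), (92, 44, 0), (221, 12, 1), (227, 428, 1), (2653, 414, 0), (2683,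
    284, 1), (236, 316, 1), (2201, 333, 0), (1447, 200, 0), (1470, 300, 1), (1801, 252, 0), (1781, 264, 1),
    (1802, 244, 0), (1773, 268, 1), (2402, 83, 1), (632, 156, 1), (2681, 412, 0), (2651, 430, 1), (233, 313,
    1), (2198, 332, 1), (547, 72, 0), (341, 60, 0), (408, 52, 0), (333, 76, 0), (1060, 171, 1), (1240, 172,
    1), (1061, 140, 0), (423, 396, 0), (431, 348, 1), (2351, 357, 1), (2411, 92, 1), (641, 151, 1), (2676,
    276, 0), (1056, 135, 0), (1451, 204, 0), (1481, 108, 1), (752, 99, 0), (1472, 296, 0), (2400, 337, 0),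
    (2340, 364, 0), (866, 124, 1), (1571, 220, 0), (2058, 188, 1), (1361, 232, 1), (1398, 180, 0), (1353, 236,
    1), (2167, 380, 0), (2385, 28, 0), (420, 394, 1), (884, 127, 0), (1563, 212, 0), (2166, 378, 0)]
  ex := [9, 10, 24, 25, 38, 48, 53, 94, 99, 451, 322, 326, 218, 2607, 1233, 553, 747, 1417, 157, 26, 819,
    1503, 2483]
  Y := [[-4, 0, 0, 0, 0, 0, 0, 0, 0, 0, 0, 0, 0, 0, 0, 0, 0, 0, 0, 0, 0, 0, 0], [0, -4, 0, 0, 0, 0, 0, 0, 0,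
    0, 0, 0, 0, 0, 0, 0, 0, 0, 0, 0, 0, 0, 0], [0, 0, -4, 0, 0, 0, 0, 0, 0, 0, 0, 0, 0, 0, 0, 0, 0, 0, 0, 0,
    0, 0, 0], [0, 0, 0, -4, 0, 0, 0, 0, 0, 0, 0, 0, 0, 0, 0, 0, 0, 0, 0, 0, 0, 0, 0], [0, 0, 0, 0, -4, 0, 0,
    0, 0, 0, 0, 0, 0, 0, 0, 0, 0, 0, 0, 0, 0, 0, 0], [0, 0, 0, 0, 0, -4, 0, 0, 0, 0, 0, 0, 0, 0, 0, 0, 0, 0,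
    0, 0, 0, 0, 0], [0, 0, 0, 0, 0, 0, -4, 0, 0, 0, 0, 0, 0, 0, 0, 0, 0, 0, 0, 0, 0, 0, 0], [0, 0, 0, 0, 0, 0,
    0, 4, 0, 0, 0, 0, 0, 0, 0, 0, 0, 0, 0, 0, 0, 0, 0], [0, 0, 0, 0, 0, 0, 0, 0, 4, 0, 0, 0, 0, 0, 0, 0, 0, 0,
    0, 0, 0, 0, 0], [8, 0, 0, 0, 0, 0, 0, 4, 4, -8, 0, 0, 0, 0, 0, 0, 0, 0, 0, 0, 0, 0, 0], [0, 0, 0, 0, 0, 0,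
    0, 0, 0, 0, -2, 0, 0, 0, 0, 0, 0, 0, 0, 0, 0, 0, 0], [0, 0, 0, 0, 0, 0, 0, 0, 0, 0, 0, -2, 0, 0, 0, 0, 0,
    0, 0, 0, 0, 0, 0], [-36, -16, 10, 0, -8, 0, -2, -8, 0, -4, -6, -6, 4, -4, 2, -2, 0, 2, -2, -2, 0, -2, -4],
    [-122, 16, 18, -2, 20, 0, 2, -32, -42, 44, 18, 16, -8, 0, -4, 0, -2, -2, -2, 6, 0, 4, -8], [-106, -4, 20,
    -4, -8, 0, 6, -40, -30, 24, 10, 0, -4, 0, -4, 0, 0, 2, -2, 2, 0, 0, -8], [36, -28, -6, -12, -44, 0, 10,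
    -8, 16, -28, -10, -26, 4, 4, 6, 2, 0, 6, 2, -6, 0, -6, 4], [0, -4, 2, -14, -20, 0, 4, -8, 12, -20, -8,
    -16, 0, 0, 0, 0, -2, 4, 0, -4, 0, -4, 0], [-14, 40, 2, 10, -16, 0, 2, 0, -10, -12, 14, -4, 0, 0, 0, 4, -2,
    2, 2, 2, 0, 0, 0], [4, 4, 2, 0, -40, 0, -6, -4, 24, -44, -14, -26, 12, -8, -2, 2, 0, 6, -2, -6, 0, -6,
    -4], [9, -2, -4, 2, 12, 2, 3, 2, -3, 12, -5, 0, 0, 0, 2, 0, 0, 3, 1, 1, 0, 0, 0], [-4, -16, -12, -4, 8, 2,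
    -6, 24, 10, -20, 10, 0, 0, -2, -4, 0, 0, 0, 2, -2, -4, 0, 0], [-36, -20, 10, 0, -8, 0, -2, -8, 0, -4, -6,
    -6, 0, -4, 2, -2, 0, 2, -2, -2, 0, -2, -4], [-12, -12, 2, 8, 44, 0, 4, 2, -24, 48, 12, 26, -8, 6, 2, -2,
    4, -6, 0, 6, 0, 6, 4]]
  DY := 8

lemma cert67C_ok : certOK (atlas67.geom atlas67_ok) action67 (0, 1) (0, 1) cert67C = true := by
  decide +kernel

/-- A certificate for discriminant `-67`. -/
def cert67D : Cert where
  fr := []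
  sd := [10, 15, 20, 18, 19, 42, 5, 21, 47, 35, 41, 89, 310, 121, 94, 317, 69, 199, 37, 71, 222, 53, 209, 39,
    279, 87, 86, 308, 153, 210, 34]
  W := [[], [], [], [], [], [], [], [], [], [], [], [], [], [], [], [], [], [], [], [], [], [], [], [], [],
    [], [], [], [], [], []]
  ord := [(0, 1, 1), (30, 9, 0), (8, 13, 0), (2, 3, 1), (32, 7, 0), (6, 11, 0), (1, 2, 1), (31, 14, 0), (5, 6,
    1), (15, 17, 1), (45, 25, 0), (23, 29, 0), (16, 26, 0), (46, 30, 0), (20, 22, 1), (17, 31, 0), (47, 23,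
    0), (21, 27, 0), (96, 45, 0), (95, 38, 0), (215, 46, 0), (100, 43, 0), (2195, 335, 0), (230, 429, 0),
    (2654, 415, 0), (2202, 330, 0), (237, 427, 1), (2649, 410, 0), (554, 79, 0), (331, 50, 0), (332, 51, 0),
    (544, 405, 1), (2644, 422, 1), (235, 315, 1), (2200, 325, 0), (549, 74, 0), (330, 49, 0), (636, 149, 0),
    (2674, 278, 1), (1450, 203, 0), (878, 131, 0), (2255, 294, 1), (1568, 217, 0), (2060, 183, 1), (1356, 233,
    0), (1573, 299, 0), (1480, 107, 1), (760, 110, 1), (741, 129, 0), (883, 126, 0), (638, 154, 0), (2679,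
    283, 1), (1052, 163, 1), (1232, 170, 0), (1452, 205, 0), (2065, 185, 1), (1358, 238, 1), (1401, 231, 1),
    (1363, 190, 0), (643, 159, 0), (2684, 285, 0), (1050, 161, 1), (1230, 175, 0), (1445, 198, 0), (1475, 102,
    1), (755, 105, 0), (2067, 301, 1), (1482, 109, 1), (756, 103, 0), (743, 130, 1), (1051, 162, 1), (1231,
    165, 0), (876, 119, 0), (1566, 215, 0), (1560, 290, 1), (1036, 391, 0), (2161, 369, 1), (2391, 343, 0),
    (2346, 354, 1), (2406, 194, 1), (1441, 277, 1), (1561, 291, 1), (2177, 243, 1), (1772, 261, 0), (666, 55,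
    1), (336, 73, 0), (426, 393, 0), (2162, 370, 1), (2393, 345, 0), (2348, 355, 1), (2408, 195, 1), (1442,
    282, 1), (343, 62, 0), (411, 57, 0), (338, 78, 1), (428, 398, 1), (433, 350, 1), (2353, 353, 0), (2413,
    193, 0), (1440, 287, 0), (2176, 242, 1), (1771, 271, 1), (1845, 241, 0), (1770, 266, 1), (2175, 289, 0),
    (1562, 211, 0), (2160, 371, 0), (1446, 274, 1), (2187, 253, 1), (1782, 258, 0), (2056, 187, 1), (1360,
    225, 0), (1476, 298, 0), (1809, 250, 0), (1779, 267, 0), (1572, 221, 0), (1851, 247, 0), (261, 265, 0),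
    (2064, 191, 1), (1364, 237, 0), (1269, 275, 0), (1448, 201, 0), (2180, 246, 1), (1775, 259, 1), (2057,
    189, 0), (1362, 226, 1), (1396, 178, 0), (1351, 239, 1), (1478, 303, 0), (1805, 255, 1), (1784, 269, 1),
    (1264, 293, 1), (1483, 206, 0), (1453, 273, 1), (2179, 245, 1), (1774, 262, 1), (1804, 251, 0), (1780,
    257, 1), (1565, 214, 0), (1570, 219, 0), (1849, 254, 0), (268, 263, 0), (1850, 270, 1), (1778, 249, 0),
    (2055, 182, 1), (1355, 227, 1), (2059, 186, 1), (1359, 235, 0), (1395, 177, 0), (1350, 234, 0), (2069,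
    181, 0), (1354, 230, 0), (1397, 179, 0), (1352, 229, 1), (635, 145, 1), (2025, 366, 1), (2428, 342, 0),
    (2670, 401, 0), (2640, 417, 0), (229, 309, 1), (2194, 321, 1), (1064, 143, 0), (204, 374, 1), (740, 133,
    1), (1054, 91, 0), (640, 146, 0), (2671, 402, 0), (2641, 418, 1), (234, 314, 1), (2199, 322, 0), (1141,
    347, 0), (2421, 359, 0), (209, 379, 0), (745, 138, 0), (1059, 93, 1), (642, 147, 1), (2672, 403, 0),
    (2642, 419, 1), (239, 319, 1), (2204, 323, 1), (1142, 349, 1), (2423, 361, 0), (199, 381, 0), (875, 118,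
    0), (880, 123, 0), (882, 125, 0), (2473, 390, 0), (1039, 395, 0), (1044, 397, 1), (334, 70, 0), (407, 67,
    1), (335, 54, 0), (542, 334, 0), (2192, 307, 0), (545, 406, 1), (2645, 421, 1), (2675, 150, 1), (639, 90,
    0), (2409, 346, 0), (2349, 363, 0), (424, 341, 1), (2344, 358, 1), (2404, 85, 1), (634, 157, 0), (2682,
    413, 0), (2652, 431, 0), (552, 77, 0), (344, 63, 0), (406, 66, 1), (342, 61, 0), (541, 329, 0), (2191,
    306, 0), (425, 387, 0), (429, 58, 0), (339, 75, 1), (405, 65, 1), (340, 59, 0), (540, 327, 0), (2190, 305,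
    0), (550, 411, 1), (2650, 426, 1), (2680, 155, 1), (644, 95, 0), (2414, 351, 0), (2354, 365, 1), (430,
    385, 0), (432, 386, 0), (2250, 139, 0), (872, 115, 0), (2251, 141, 1), (870, 113, 0), (2252, 134, 1),
    (871, 114, 0), (2165, 377, 1), (2170, 382, 0), (2172, 375, 1), (1444, 197, 0), (2188, 302, 0), (1474, 101,
    1), (1564, 213, 0), (2061, 295, 1), (2181, 202, 0), (1449, 281, 1), (1479, 106, 1), (1569, 218, 0), (2063,
    297, 1), (2183, 207, 1), (1454, 286, 1), (1484, 111, 1), (1574, 223, 0), (1524, 169, 1), (1529, 174, 1),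
    (396, 167, 1), (2193, 326, 1), (228, 36, 0), (90, 33, 0), (213, 4, 1), (225, 420, 1), (2646, 407, 0),
    (2399, 399, 1), (421, 338, 1), (2341, 356, 1), (2371, 372, 1), (633, 84, 0), (1058, 137, 0), (2403, 340,
    0), (2343, 362, 1), (738, 100, 0), (750, 97, 0), (858, 116, 1), (1043, 388, 1), (2168, 383, 1), (91, 40,
    0), (219, 8, 0), (226, 424, 0), (2648, 409, 0), (2678, 280, 1), (232, 312, 1), (2197, 331, 0), (1443, 196,
    0), (1800, 248, 0), (1777, 260, 1), (2401, 82, 1), (631, 152, 1), (2677, 408, 0), (2647, 425, 1), (231,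
    311, 1), (2196, 328, 1), (1055, 166, 1), (1102, 136, 0), (1057, 168, 1), (660, 81, 0), (630, 148, 1),
    (2673, 404, 0), (2643, 423, 1), (238, 318, 1), (2203, 324, 1), (543, 68, 0), (337, 56, 0), (1062, 173, 1),
    (1233, 164, 0), (1053, 132, 0), (427, 344, 1), (2347, 367, 0), (2407, 88, 1), (637, 158, 1), (1063, 142,
    0), (742, 104, 1), (751, 98, 0), (1471, 292, 1), (862, 120, 1), (874, 117, 0), (1567, 216, 0), (383, 184,
    0), (1357, 228, 1), (1048, 392, 0), (2163, 376, 0), (2372, 339, 0), (2342, 360, 1), (2387, 24, 1), (422,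
    389, 0), (879, 122, 0), (2173, 373, 1), (92, 44, 0), (221, 12, 1), (227, 428, 1), (2653, 414, 0), (2683,
    284, 0), (236, 316, 1), (2201, 333, 1), (1447, 200, 0), (1470, 300, 1), (1801, 252, 0), (1781, 264, 0),
    (1802, 244, 0), (1773, 268, 1), (2402, 83, 1), (632, 156, 0), (2681, 412, 0), (2651, 430, 0), (233, 313,
    1), (2198, 332, 0), (547, 72, 0), (341, 60, 0), (408, 52, 0), (333, 76, 0), (1060, 171, 1), (1240, 172,
    0), (1061, 140, 0), (423, 396, 0), (431, 348, 1), (2351, 357, 1), (2411, 92, 1), (641, 151, 1), (2676,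
    276, 1), (1056, 135, 0), (1451, 204, 0), (1481, 108, 1), (752, 99, 0), (1472, 296, 0), (2400, 337, 0),
    (2340, 364, 0), (866, 124, 1), (1571, 220, 0), (2058, 188, 0), (1361, 232, 0), (1398, 180, 0), (1353, 236,
    1), (2167, 380, 0), (2385, 28, 0), (420, 394, 1), (884, 127, 0), (1563, 212, 0), (2166, 378, 0)]
  ex := [9, 10, 18, 24, 25, 37, 38, 53, 104, 326, 218, 1212, 1427, 905, 2578, 555, 445, 2782, 447, 567, 1029,
    580, 402, 1162, 1071, 1281, 809, 2469, 150, 1211, 1520]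
  Y := [[-4, 0, 0, 0, 0, 0, 0, 0, 0, 0, 0, 0, 0, 0, 0, 0, 0, 0, 0, 0, 0, 0, 0, 0, 0, 0, 0, 0, 0, 0, 0], [0,
    -4, 0, 0, 0, 0, 0, 0, 0, 0, 0, 0, 0, 0, 0, 0, 0, 0, 0, 0, 0, 0, 0, 0, 0, 0, 0, 0, 0, 0, 0], [0, 0, -4, 0,
    0, 0, 0, 0, 0, 0, 0, 0, 0, 0, 0, 0, 0, 0, 0, 0, 0, 0, 0, 0, 0, 0, 0, 0, 0, 0, 0], [0, 0, 0, -4, 0, 0, 0,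
    0, 0, 0, 0, 0, 0, 0, 0, 0, 0, 0, 0, 0, 0, 0, 0, 0, 0, 0, 0, 0, 0, 0, 0], [0, 0, 0, 0, -4, 0, 0, 0, 0, 0,
    0, 0, 0, 0, 0, 0, 0, 0, 0, 0, 0, 0, 0, 0, 0, 0, 0, 0, 0, 0, 0], [0, 0, 0, 0, 0, 4, 0, 0, 0, 0, 0, 0, 0, 0,
    0, 0, 0, 0, 0, 0, 0, 0, 0, 0, 0, 0, 0, 0, 0, 0, 0], [0, 0, 0, 0, 0, 0, -4, 0, 0, 0, 0, 0, 0, 0, 0, 0, 0,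
    0, 0, 0, 0, 0, 0, 0, 0, 0, 0, 0, 0, 0, 0], [0, 0, 0, 0, 0, 0, 0, -4, 0, 0, 0, 0, 0, 0, 0, 0, 0, 0, 0, 0,
    0, 0, 0, 0, 0, 0, 0, 0, 0, 0, 0], [0, 0, 0, 0, 0, 0, 0, 0, 4, 0, 0, 0, 0, 0, 0, 0, 0, 0, 0, 0, 0, 0, 0, 0,
    0, 0, 0, 0, 0, 0, 0], [0, 0, 0, 0, 0, 0, 0, 0, 0, -2, 0, 0, 0, 0, 0, 0, 0, 0, 0, 0, 0, 0, 0, 0, 0, 0, 0,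
    0, 0, 0, 0], [42, -20, 0, 0, 6, -2, 0, 0, 0, 0, 0, 4, -2, -2, 4, 0, 4, 0, 0, 4, 0, 0, -2, 2, 0, 0, 0, 0,
    0, 0, 0], [15, 7, 0, 2, -3, 0, -8, 0, -3, -1, 2, -5, 2, 1, -3, 0, 1, -3, 3, 1, 1, -1, 1, -1, -1, -2, 2, 0,
    0, 0, 0], [11, -1, 0, -9, 3, 0, 4, -2, -2, 3, -4, -2, 1, 1, 3, -4, -3, -1, 1, -1, 1, -3, -1, 1, -5, 2, 0,
    4, -2, 2, 0], [-1, 5, 0, 6, 1, -2, -12, 0, -3, 1, 4, -5, 2, 1, -5, 0, 3, -3, 5, 1, 3, 1, -1, -1, -1, -2,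
    2, 0, 0, 0, 0], [35, -19, 0, -4, 7, -2, 4, -2, -1, 5, -2, 3, 0, -3, 3, 0, -1, 1, -3, -1, -1, -1, -1, 3,
    -1, 2, 0, 4, -2, 2, 0], [43, -21, 0, -11, 11, -2, 4, -2, 0, 3, -4, 4, -1, -1, 9, -6, 1, -1, -1, 5, 1, -3,
    -3, 3, -5, 2, 0, 4, -2, 2, 0], [16, -38, 0, -6, 6, -2, 8, -4, 8, 0, -2, 8, -2, -4, 6, -4, -2, 2, -4, 2, 0,
    0, 0, 0, 0, 2, -2, 0, 0, 0, 0], [4, -15, 0, -5, 5, 2, 4, 0, 3, -1, -1, 4, -1, -1, 4, -2, -1, 3, -3, 3, 1,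
    -1, -2, 0, 1, -1, -1, 0, 0, 0, 0], [-32, 0, 0, -16, 12, 0, 24, -8, 16, 0, -4, 16, -4, -4, 12, -8, -8, 8,
    -8, 0, 0, 0, 0, 0, 0, 4, -4, 0, 0, 0, 0], [-6, -4, 0, -2, 2, 0, 4, 0, 2, 0, 0, 2, 0, 0, 2, 2, 0, 4, -2,
    -2, 0, 0, 0, 0, 0, 0, 0, 0, 0, 0, 0], [0, -6, 0, -9, 0, -2, 4, -2, 1, 4, 0, 3, 1, 0, 4, -4, -2, 0, -2, 0,
    0, -2, -2, 2, -4, 2, 0, 4, -2, 2, 0], [7, -14, 0, -4, 4, -2, 12, -4, 5, 0, -1, 6, -2, -2, 5, -6, -2, 2,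
    -2, -2, 0, 0, 1, 1, -2, 3, -1, 0, 0, 0, 0], [54, -18, 0, -13, 2, 4, 0, -4, 3, -2, 2, 3, -1, -2, 4, 0, 2,
    2, 0, 4, 2, -2, 2, 0, 0, 0, 0, 0, 0, 0, 0], [-42, 16, 0, 0, -6, 2, 0, 0, 0, 0, 4, -4, 2, 2, -4, 0, -4, 0,
    0, -4, 0, 0, 2, -2, 0, 0, 0, 0, 0, 0, 0], [-41, 41, 0, 7, -9, 2, -12, 4, -8, 1, 2, -8, 3, 5, -7, 2, -1,
    -3, 3, -5, -1, 1, 3, -1, -1, 0, 0, 0, 0, 0, 0], [-27, 11, 0, 10, -5, -2, -12, 4, -9, 3, 4, -7, 2, 3, -7,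
    4, 5, -1, 3, -1, 1, 3, -3, 1, 1, -2, 2, 0, 0, 0, 0], [18, -7, 0, -9, 5, 2, 12, -4, 9, -3, -3, 8, -1, -1,
    6, -4, -5, 1, -3, -1, -1, -3, 4, 0, -3, 3, -1, 0, 0, 0, 0], [-15, 4, 0, 0, -2, 4, -4, 2, 7, -8, -1, 0, 0,
    0, -1, 4, 0, 0, 0, 4, 0, -2, 1, -3, 2, -3, -1, -2, 2, -2, 0], [52, 8, 0, 0, -2, -4, -12, -4, 0, -4, 2, -2,
    2, 0, 0, -6, 2, -2, 2, 4, 0, -4, -2, -2, -8, 2, 2, -2, -4, 0, 0], [-8, -28, 0, 3, 0, 4, -4, 2, 1, -6, 2,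
    -1, 1, 0, -2, 4, 0, 0, 0, 0, -2, 0, 4, -2, 4, -2, 0, -4, 2, -2, 0], [-6, -24, -2, -4, 8, -2, 4, 0, -12,
    16, 2, -4, 2, 2, 2, 0, 0, 0, 0, -4, 0, 4, -8, 8, 0, 2, 2, 10, 0, 4, 2]]
  DY := 8

lemma cert67D_ok : certOK (atlas67.geom atlas67_ok) action67 (0, 1) (1, 0) cert67D = true := by
  decide +kernel

end Bianchi

/-- For `d ∈ {3, 11, 19, 43, 67}`, `K = ℚ(√−d)` and `N = 16𝓞_K = (2𝓞_K)⁴`,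
for every prime `l ≥ 5` the abelianization of `Γ₀(N)` has no element of order `l`. -/
theorem abelianization_of_Gamma0_no_large_prime_torsion
    (d : ℕ) (hd : d = 3 ∨ d = 11 ∨ d = 19 ∨ d = 43 ∨ d = 67)
    (K : Type*) [Field K] [NumberField K] (hdeg : Module.finrank ℚ K = 2)
    (sqd : K) (hsqd : sqd ^ 2 = -(d : K)) :
    ∀ l : ℕ, l.Prime → 5 ≤ l →
      ¬ ∃ x : Abelianization (Gamma0 (Ideal.span {(16 : 𝓞 K)})), orderOf x = l := by
  intro l hl hl5
  rcases hd with rfl | rfl | rfl | rfl | rfl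
  · exact Bianchi.no_order_of_certs (m := 1) (by norm_num) (by norm_num) (by norm_num)
      Bianchi.action3_ok Bianchi.cert3A_ok Bianchi.cert3B_ok Bianchi.cert3C_ok Bianchi.cert3D_ok
      K hdeg sqd hsqd hl hl5
  · exact Bianchi.no_order_of_certs (m := 3) (by norm_num) (by norm_num) (by norm_num)
      Bianchi.action11_ok Bianchi.cert11A_ok Bianchi.cert11B_ok Bianchi.cert11C_ok Bianchi.cert11D_ok
      K hdeg sqd hsqd hl hl5
  · exact Bianchi.no_order_of_certs (m := 5) (by norm_num) (by norm_num) (by norm_num)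
      Bianchi.action19_ok Bianchi.cert19A_ok Bianchi.cert19B_ok Bianchi.cert19C_ok Bianchi.cert19D_ok
      K hdeg sqd hsqd hl hl5
  · exact Bianchi.no_order_of_certs (m := 11) (by norm_num) (by norm_num) (by norm_num)
      Bianchi.action43_ok Bianchi.cert43A_ok Bianchi.cert43B_ok Bianchi.cert43C_ok Bianchi.cert43D_ok
      K hdeg sqd hsqd hl hl5
  · exact Bianchi.no_order_of_certs (m := 17) (by norm_num) (by norm_num) (by norm_num)
      Bianchi.action67_ok Bianchi.cert67A_ok Bianchi.cert67B_ok Bianchi.cert67C_ok Bianchi.cert67D_ok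
      K hdeg sqd hsqd hl hl5
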